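/- Let either n ≥ 2 and (n−2)/n < m < n/(n+2), or n = 1 and 0 < m < 1/3; set p := 2/(1−m) − n (so 0 < p < 2), δ := (p/2 − 1)/(p+n) (note δ < 0) and γ := (p/2+1)²/(2p). Suppose ρ is a solution of the fast diffusion equation with ∫_{ℝⁿ} ρ(0,y) dy = 1, and if n = 1 additionally ∫_ℝ y·ρ(0,y) dy = 0; let B > 0 be chosen so that ∫_{ℝⁿ} u_B(y) dy = 1. If sup_{y∈ℝⁿ} ρ_B(0,y)^δ · |1 − ρ(0,y)/ρ_B(0,y)| < ∞, then for every ε > 0, limsup_{τ→∞} sup_{y∈ℝⁿ} τ^{γ−ε} · (ρ_B(τ,y)/ρ_B(τ,0))^δ · |ρ(τ,y)/ρ_B(τ,y) − 1| < ∞. If moreover ∫_{ℝⁿ} (ρ_B(0,y)^δ · |1 − ρ(0,y)/ρ_B(0,y)|)² (1+|y|²)^{−n/2} dy < ∞, then the same conclusion holds with ε = 0. -/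

import Mathlib

open MeasureTheory Filter
open scoped BigOperators ENNReal Topology

noncomputable section

/-- The `i`-th standard basis vector of `ℝⁿ`. -/
def stdBasis (n : ℕ) (i : Fin n) : EuclideanSpace ℝ (Fin n) :=
  EuclideanSpace.single i 1

/-- The Laplacian (sum of second partial derivatives) of `f : ℝⁿ → ℝ`. -/
def lap (n : ℕ) (f : EuclideanSpace ℝ (Fin n) → ℝ) (x : EuclideanSpace ℝ (Fin n)) : ℝ :=
  ∑ i : Fin n, fderiv ℝ (fun y => fderiv ℝ f y (stdBasis n i)) x (stdBasis n i)

/-- `x · ∇f x`. -/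
def gradDot (n : ℕ) (f : EuclideanSpace ℝ (Fin n) → ℝ) (x : EuclideanSpace ℝ (Fin n)) : ℝ :=
  ∑ i : Fin n, x i * fderiv ℝ f x (stdBasis n i)

/-- The moment parameter `p = 2/(1-m) - n`. -/
def pPar (n : ℕ) (m : ℝ) : ℝ := 2 / (1 - m) - n

/-- The scaling exponent `β = (1 + n/p)/2`. -/
def betaPar (n : ℕ) (m : ℝ) : ℝ := (1 + n / pPar n m) / 2

/-- The Barenblatt profile `u_B(x) = (B + |x|²)^{-1/(1-m)}`. -/
def uB (n : ℕ) (m B : ℝ) (x : EuclideanSpace ℝ (Fin n)) : ℝ :=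
  (B + ‖x‖ ^ 2) ^ (-(1 / (1 - m)))

/-- The Barenblatt solution `ρ_B(τ,y) = (1+2pτ)^{-nβ} u_B((1+2pτ)^{-β} y)`. -/
def rhoB (n : ℕ) (m B : ℝ) (τ : ℝ) (y : EuclideanSpace ℝ (Fin n)) : ℝ :=
  (1 + 2 * pPar n m * τ) ^ (-(n : ℝ) * betaPar n m) *
    uB n m B ((1 + 2 * pPar n m * τ) ^ (-betaPar n m) • y)

/-- A (positive, continuous up to time 0, smooth for positive times) solution of the
fast diffusion equation `∂_τ ρ = (1/m) Δ (ρ^m)` on `[0,∞) × ℝⁿ`. -/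
def IsFDESol (n : ℕ) (m : ℝ) (ρ : ℝ → EuclideanSpace ℝ (Fin n) → ℝ) : Prop :=
  (∀ τ ∈ Set.Ici (0 : ℝ), ∀ y, 0 < ρ τ y) ∧
  ContinuousOn (fun q : ℝ × EuclideanSpace ℝ (Fin n) => ρ q.1 q.2)
    (Set.Ici 0 ×ˢ Set.univ) ∧
  ContDiffOn ℝ (⊤ : ℕ∞) (fun q : ℝ × EuclideanSpace ℝ (Fin n) => ρ q.1 q.2)
    (Set.Ioi 0 ×ˢ Set.univ) ∧
  ∀ τ ∈ Set.Ioi (0 : ℝ), ∀ y,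
    deriv (fun s => ρ s y) τ = (1 / m) * lap n (fun x => ρ τ x ^ m) y

open scoped ContDiff

/-- Euclidean space, as used throughout. -/
abbrev Eu (n : ℕ) := EuclideanSpace ℝ (Fin n)

/-- The `i`-th partial derivative. -/
def pd (n : ℕ) (i : Fin n) (f : Eu n → ℝ) (x : Eu n) : ℝ := fderiv ℝ f x (stdBasis n i)

section Calculus

variable {n : ℕ} {i : Fin n} {f g : Eu n → ℝ} {x : Eu n}

lemma lap_eq_sum_pd (f : Eu n → ℝ) (x : Eu n) : lap n f x = ∑ i, pd n i (pd n i f) x := rfl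

lemma contDiff_pd (hf : ContDiff ℝ ∞ f) (i : Fin n) : ContDiff ℝ ∞ (pd n i f) := by
  unfold pd
  exact (hf.fderiv_right (m := ∞) (by simp)).clm_apply contDiff_const

lemma contDiff_lap (hf : ContDiff ℝ ∞ f) : ContDiff ℝ ∞ (lap n f) := by
  have : lap n f = fun x => ∑ i, pd n i (pd n i f) x := rfl
  rw [this]
  exact ContDiff.sum fun i _ => contDiff_pd (contDiff_pd hf i) i

lemma ContDiff.diffAt (hf : ContDiff ℝ ∞ f) (x : Eu n) : DifferentiableAt ℝ f x :=
  (hf.differentiable (by simp)) x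

lemma pd_const (c : ℝ) : pd n i (fun _ => c) = fun _ => 0 := by
  ext x; simp [pd]

lemma pd_add (hf : ContDiff ℝ ∞ f) (hg : ContDiff ℝ ∞ g) :
    pd n i (fun y => f y + g y) = fun y => pd n i f y + pd n i g y := by
  ext x
  simp only [pd]
  rw [fderiv_fun_add (hf.diffAt x) (hg.diffAt x)]; rfl

lemma pd_sub (hf : ContDiff ℝ ∞ f) (hg : ContDiff ℝ ∞ g) :
    pd n i (fun y => f y - g y) = fun y => pd n i f y - pd n i g y := by
  ext x
  simp only [pd]
  rw [fderiv_fun_sub (hf.diffAt x) (hg.diffAt x)]; rfl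

lemma pd_const_mul (c : ℝ) (f : Eu n → ℝ) :
    pd n i (fun y => c * f y) = fun y => c * pd n i f y := by
  ext x
  simp only [pd]
  have : (fun y => c * f y) = c • f := rfl
  rw [this, fderiv_const_smul_field]; rfl

lemma pd_mul (hf : ContDiff ℝ ∞ f) (hg : ContDiff ℝ ∞ g) :
    pd n i (fun y => f y * g y) = fun y => f y * pd n i g y + g y * pd n i f y := by
  ext x
  simp only [pd]
  rw [fderiv_fun_mul (hf.diffAt x) (hg.diffAt x)]; rfl

lemma pd_sum {ι : Type*} (t : Finset ι) {F : ι → Eu n → ℝ} (hF : ∀ j, ContDiff ℝ ∞ (F j)) :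
    pd n i (fun y => ∑ j ∈ t, F j y) = fun y => ∑ j ∈ t, pd n i (F j) y := by
  ext x
  simp only [pd]
  rw [fderiv_fun_sum (fun j _ => (hF j).diffAt x)]; simp

lemma pd_comp {h h' : ℝ → ℝ} (hf : ContDiff ℝ ∞ f) (hh : ∀ y, HasDerivAt h (h' (f y)) (f y)) :
    pd n i (fun y => h (f y)) = fun y => h' (f y) * pd n i f y := by
  ext x
  simp only [pd]
  have := (hh x).comp_hasFDerivAt x (hf.diffAt x).hasFDerivAt
  have e : fderiv ℝ (fun y => h (f y)) x = h' (f x) • fderiv ℝ f x := this.fderiv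
  rw [e]; rfl

lemma lap_const (c : ℝ) : lap n (fun _ => c) x = 0 := by
  simp [lap_eq_sum_pd, pd_const]

lemma lap_add (hf : ContDiff ℝ ∞ f) (hg : ContDiff ℝ ∞ g) :
    lap n (fun y => f y + g y) x = lap n f x + lap n g x := by
  simp only [lap_eq_sum_pd, pd_add hf hg, pd_add (contDiff_pd hf _) (contDiff_pd hg _),
    Finset.sum_add_distrib]

lemma lap_sub (hf : ContDiff ℝ ∞ f) (hg : ContDiff ℝ ∞ g) :
    lap n (fun y => f y - g y) x = lap n f x - lap n g x := by
  simp only [lap_eq_sum_pd, pd_sub hf hg, pd_sub (contDiff_pd hf _) (contDiff_pd hg _),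
    Finset.sum_sub_distrib]

lemma lap_const_mul (c : ℝ) (f : Eu n → ℝ) :
    lap n (fun y => c * f y) x = c * lap n f x := by
  simp only [lap_eq_sum_pd, pd_const_mul, Finset.mul_sum]

lemma lap_mul (hf : ContDiff ℝ ∞ f) (hg : ContDiff ℝ ∞ g) :
    lap n (fun y => f y * g y) x =
      f x * lap n g x + g x * lap n f x + 2 * ∑ i, pd n i f x * pd n i g x := by
  simp only [lap_eq_sum_pd, Finset.mul_sum, ← Finset.sum_add_distrib]
  refine Finset.sum_congr rfl fun i _ => ?_
  rw [pd_mul hf hg, pd_add (hf.mul (contDiff_pd hg i)) (hg.mul (contDiff_pd hf i)),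
    pd_mul hf (contDiff_pd hg i), pd_mul hg (contDiff_pd hf i)]
  ring

lemma lap_sum {ι : Type*} (t : Finset ι) {F : ι → Eu n → ℝ} (hF : ∀ j, ContDiff ℝ ∞ (F j)) :
    lap n (fun y => ∑ j ∈ t, F j y) x = ∑ j ∈ t, lap n (F j) x := by
  simp only [lap_eq_sum_pd]
  rw [Finset.sum_comm]
  refine Finset.sum_congr rfl fun i _ => ?_
  rw [pd_sum t hF, pd_sum t fun j => contDiff_pd (hF j) i]

lemma lap_sq (hf : ContDiff ℝ ∞ f) :
    lap n (fun y => f y ^ 2) x = 2 * f x * lap n f x + 2 * ∑ i, pd n i f x ^ 2 := by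
  have := lap_mul hf hf (x := x)
  simp only [pow_two]
  rw [this]; ring

lemma pd_sq (hf : ContDiff ℝ ∞ f) :
    pd n i (fun y => f y ^ 2) = fun y => 2 * f y * pd n i f y := by
  have := pd_mul hf hf (i := i)
  simp only [pow_two]
  rw [this]; ext; ring

lemma contDiff_rpow (hf : ContDiff ℝ ∞ f) (hpos : ∀ y, 0 < f y) (r : ℝ) :
    ContDiff ℝ ∞ (fun y => f y ^ r) :=
  hf.rpow_const_of_ne fun y => (hpos y).ne'

lemma pd_rpow (hf : ContDiff ℝ ∞ f) (hpos : ∀ y, 0 < f y) (r : ℝ) :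
    pd n i (fun y => f y ^ r) = fun y => r * f y ^ (r - 1) * pd n i f y :=
  pd_comp (h := fun u => u ^ r) (h' := fun u => r * u ^ (r - 1)) hf
    fun y => Real.hasDerivAt_rpow_const (Or.inl (hpos y).ne')

lemma lap_rpow (hf : ContDiff ℝ ∞ f) (hpos : ∀ y, 0 < f y) (r : ℝ) :
    lap n (fun y => f y ^ r) x = r * f x ^ (r - 1) * lap n f x +
      r * (r - 1) * f x ^ (r - 2) * ∑ i, pd n i f x ^ 2 := by
  simp only [lap_eq_sum_pd, Finset.mul_sum, ← Finset.sum_add_distrib]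
  refine Finset.sum_congr rfl fun i _ => ?_
  rw [pd_rpow hf hpos, pd_mul (contDiff_const.mul (contDiff_rpow hf hpos _)) (contDiff_pd hf i),
    pd_const_mul, pd_rpow hf hpos, show r - 1 - 1 = r - 2 by ring]
  ring

lemma contDiff_normSq : ContDiff ℝ ∞ (fun y : Eu n => ‖y‖ ^ 2) := contDiff_norm_sq ℝ

lemma inner_stdBasis (y : Eu n) (i : Fin n) : inner ℝ y (stdBasis n i) = y i := by
  simp [stdBasis, EuclideanSpace.inner_single_right]

lemma pd_normSq : pd n i (fun y : Eu n => ‖y‖ ^ 2) = fun y => 2 * y i := by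
  ext x
  have h := (hasStrictFDerivAt_norm_sq x).hasFDerivAt.fderiv
  simp only [pd]
  rw [h]
  simp [inner_stdBasis]

lemma contDiff_coord (i : Fin n) : ContDiff ℝ ∞ (fun y : Eu n => y i) :=
  (EuclideanSpace.proj (𝕜 := ℝ) i).contDiff

lemma pd_coord : pd n i (fun y : Eu n => y i) = fun _ => 1 := by
  ext x
  simp only [pd]
  have := (EuclideanSpace.proj (𝕜 := ℝ) i : Eu n →L[ℝ] ℝ).fderiv (x := x)
  have e : (fun y : Eu n => y i) = (EuclideanSpace.proj (𝕜 := ℝ) i : Eu n →L[ℝ] ℝ) := rfl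
  rw [e, this]; simp [stdBasis]

lemma lap_normSq : lap n (fun y : Eu n => ‖y‖ ^ 2) x = 2 * n := by
  simp only [lap_eq_sum_pd, pd_normSq, pd_const_mul, pd_coord]
  simp; ring

lemma sum_coord_sq (y : Eu n) : ∑ i, y i ^ 2 = ‖y‖ ^ 2 := by
  rw [EuclideanSpace.norm_sq_eq]; simp

lemma pd_translate (f : Eu n → ℝ) (a : Eu n) :
    pd n i (fun y => f (y + a)) = fun y => pd n i f (y + a) := by
  ext x
  simp only [pd]
  rw [fderiv_comp_add_right]

lemma lap_translate (f : Eu n → ℝ) (a : Eu n) :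
    lap n (fun y => f (y + a)) x = lap n f (x + a) := by
  simp only [lap_eq_sum_pd, pd_translate]

lemma pd_rescale (hf : ContDiff ℝ ∞ f) (a : Eu n) (R : ℝ) :
    pd n i (fun z => f (a + R • z)) = fun z => R * pd n i f (a + R • z) := by
  ext x
  simp only [pd]
  have h1 : HasFDerivAt (fun z : Eu n => a + R • z) (R • ContinuousLinearMap.id ℝ (Eu n)) x :=
    ((hasFDerivAt_id x).const_smul R).const_add a
  have := (hf.diffAt (a + R • x)).hasFDerivAt.comp x h1
  have e : fderiv ℝ (fun z => f (a + R • z)) x = _ := this.fderiv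
  rw [e]; simp

lemma contDiff_rescale (hf : ContDiff ℝ ∞ f) (a : Eu n) (R : ℝ) :
    ContDiff ℝ ∞ (fun z => f (a + R • z)) :=
  hf.comp (contDiff_const.add (contDiff_id.const_smul R))

lemma lap_rescale (hf : ContDiff ℝ ∞ f) (a : Eu n) (R : ℝ) :
    lap n (fun z => f (a + R • z)) x = R ^ 2 * lap n f (a + R • x) := by
  simp only [lap_eq_sum_pd, pd_rescale hf, pd_const_mul, pd_rescale (contDiff_pd hf _),
    Finset.mul_sum]
  exact Finset.sum_congr rfl fun i _ => by ring

lemma hasDerivAt_line (hf : ContDiff ℝ ∞ f) (x : Eu n) (i : Fin n) (t : ℝ) :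
    HasDerivAt (fun t : ℝ => f (x + t • stdBasis n i)) (pd n i f (x + t • stdBasis n i)) t := by
  have h1 : HasDerivAt (fun t : ℝ => x + t • stdBasis n i) (stdBasis n i) t := by
    simpa using ((hasDerivAt_id t).smul_const (stdBasis n i)).const_add x
  exact (hf.diffAt _).hasFDerivAt.comp_hasDerivAt t h1

lemma pd_eq_zero_of_isLocalMax (h : IsLocalMax f x) : pd n i f x = 0 := by
  simp [pd, h.fderiv_eq_zero]

lemma pd_pd_nonpos_of_isLocalMax (hf : ContDiff ℝ ∞ f) (h : IsLocalMax f x) :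
    pd n i (pd n i f) x ≤ 0 := by
  by_contra! hc
  set u : ℝ → ℝ := fun t => f (x + t • stdBasis n i)
  have hu : deriv u = fun t => pd n i f (x + t • stdBasis n i) :=
    funext fun t => (hasDerivAt_line hf x i t).deriv
  have hu2 : deriv (deriv u) 0 = pd n i (pd n i f) x := by
    rw [hu, (hasDerivAt_line (contDiff_pd hf i) x i 0).deriv]; simp
  have hmin : IsLocalMin u 0 := isLocalMin_of_deriv_deriv_pos (by rw [hu2]; exact hc)
    (by rw [hu]; simpa using pd_eq_zero_of_isLocalMax h) (hasDerivAt_line hf x i 0).continuousAt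
  have hcont : Tendsto (fun t : ℝ => x + t • stdBasis n i) (𝓝 0) (𝓝 x) := by
    have : Continuous (fun t : ℝ => x + t • stdBasis n i) := by fun_prop
    simpa using this.tendsto 0
  have hmax : ∀ᶠ t in 𝓝 (0 : ℝ), u t ≤ u 0 := by
    have := hcont.eventually h
    simpa [u] using this
  have hconst : u =ᶠ[𝓝 0] fun _ => u 0 := by
    filter_upwards [hmin, hmax] with t h1 h2 using le_antisymm h2 h1
  have : deriv (deriv u) 0 = 0 := by
    rw [(hconst.deriv).deriv_eq]; simp
  linarith [hu2]

lemma lap_nonpos_of_isLocalMax (hf : ContDiff ℝ ∞ f) (h : IsLocalMax f x) : lap n f x ≤ 0 := by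
  rw [lap_eq_sum_pd]
  exact Finset.sum_nonpos fun i _ => pd_pd_nonpos_of_isLocalMax hf h

lemma deriv_nonneg_of_max_left {u : ℝ → ℝ} {u' t0 t : ℝ} (hu : HasDerivAt u u' t) (ht : t0 < t)
    (h : ∀ s ∈ Set.Icc t0 t, u s ≤ u t) : 0 ≤ u' := by
  have h1 := hu.hasDerivWithinAt (s := Set.Iio t)
  rw [hasDerivWithinAt_iff_tendsto_slope' (by simp)] at h1
  have : (𝓝[<] t).NeBot := inferInstance
  refine ge_of_tendsto h1 ?_
  filter_upwards [Ioo_mem_nhdsLT ht] with s hs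
  rw [slope_def_field]
  exact div_nonneg_of_nonpos (by linarith [h s ⟨hs.1.le, hs.2.le⟩]) (by linarith [hs.2])

/-- Location of a maximum of a continuous function on a compact parabolic cylinder. -/
lemma parabolic_max {u : ℝ → Eu n → ℝ} {t0 T R k : ℝ} {x0 : Eu n}
    (hc : ContinuousOn (fun q : ℝ × Eu n => u q.1 q.2)
      (Set.Icc t0 T ×ˢ Metric.closedBall x0 R))
    (h0 : ∀ x ∈ Metric.closedBall x0 R, u t0 x ≤ k)
    (hb : ∀ t ∈ Set.Icc t0 T, ∀ x, dist x x0 = R → u t x ≤ k)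
    (hex : ∃ t ∈ Set.Icc t0 T, ∃ x ∈ Metric.closedBall x0 R, k < u t x) :
    ∃ t x, t0 < t ∧ t ≤ T ∧ dist x x0 < R ∧ k < u t x ∧
      (∀ t' ∈ Set.Icc t0 t, u t' x ≤ u t x) ∧ IsLocalMax (u t) x := by
  obtain ⟨t1, ht1, x1, hx1, h1⟩ := hex
  have hK : IsCompact (Set.Icc t0 T ×ˢ Metric.closedBall x0 R) :=
    isCompact_Icc.prod (isCompact_closedBall x0 R)
  obtain ⟨⟨t, x⟩, ⟨ht, hx⟩, hm⟩ := hK.exists_isMaxOn ⟨(t1, x1), ht1, hx1⟩ hc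
  have hk : k < u t x := lt_of_lt_of_le h1 (hm (show (t1, x1) ∈ _ from ⟨ht1, hx1⟩))
  simp only at ht hx
  have htt : t0 < t := by
    rcases eq_or_lt_of_le ht.1 with h | h
    · subst h; exact absurd (h0 x hx) (not_le.2 hk)
    · exact h
  have hxx : dist x x0 < R := by
    rcases eq_or_lt_of_le (Metric.mem_closedBall.1 hx) with h | h
    · exact absurd (hb t ht x h) (not_le.2 hk)
    · exact h
  refine ⟨t, x, htt, ht.2, hxx, hk, fun t' ht' => ?_, ?_⟩
  · exact hm (show (t', x) ∈ _ from ⟨⟨ht'.1, ht'.2.trans ht.2⟩, hx⟩)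
  · filter_upwards [Metric.isOpen_ball.mem_nhds (Metric.mem_ball.2 hxx)] with z hz
    exact hm (show (t, z) ∈ _ from ⟨ht, Metric.ball_subset_closedBall hz⟩)

end Calculus

section RpowTangent

/-- Tangent line inequality for a convex (nonpositive) power. -/
lemma rpow_tangent_of_nonpos {r x y : ℝ} (hr : r ≤ 0) (hx : 0 < x) (hy : 0 < y) :
    x ^ r + r * x ^ (r - 1) * (y - x) ≤ y ^ r := by
  have ht : 0 < y / x := div_pos hy hx
  have h1 : 1 + r * (y / x - 1) ≤ (y / x) ^ r := by
    rw [Real.rpow_def_of_pos ht]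
    have h2 := Real.add_one_le_exp (Real.log (y / x) * r)
    have h3 := Real.log_le_sub_one_of_pos ht
    nlinarith
  have hxr : 0 < x ^ r := Real.rpow_pos_of_pos hx r
  have h4 := mul_le_mul_of_nonneg_left h1 hxr.le
  rw [Real.div_rpow hy.le hx.le, mul_div_cancel₀ _ hxr.ne'] at h4
  refine le_trans (le_of_eq ?_) h4
  rw [Real.rpow_sub_one hx.ne']
  field_simp

/-- Tangent line inequality for a concave power. -/
lemma rpow_tangent_of_mem {r x y : ℝ} (hr : 0 ≤ r) (hr1 : r ≤ 1) (hx : 0 < x) (hy : 0 < y) :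
    y ^ r ≤ x ^ r + r * x ^ (r - 1) * (y - x) := by
  have ht : 0 < y / x := div_pos hy hx
  have h1 := rpow_one_add_le_one_add_mul_self (s := y / x - 1) (by linarith) hr hr1
  rw [add_sub_cancel] at h1
  have hxr : 0 < x ^ r := Real.rpow_pos_of_pos hx r
  have h4 := mul_le_mul_of_nonneg_left h1 hxr.le
  rw [Real.div_rpow hy.le hx.le, mul_div_cancel₀ _ hxr.ne'] at h4
  refine le_trans h4 (le_of_eq ?_)
  rw [Real.rpow_sub_one hx.ne']
  field_simp

end RpowTangent

/-- `P` is a pressure solution: `∂_τ P = P ΔP - s |∇P|²`. -/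
structure IsPress (n : ℕ) (s : ℝ) (P : ℝ → Eu n → ℝ) : Prop where
  pos : ∀ τ, 0 ≤ τ → ∀ y, 0 < P τ y
  cont : ContinuousOn (fun q : ℝ × Eu n => P q.1 q.2) (Set.Ici 0 ×ˢ Set.univ)
  smooth : ContDiffOn ℝ ∞ (fun q : ℝ × Eu n => P q.1 q.2) (Set.Ioi 0 ×ˢ Set.univ)
  eqn : ∀ τ, 0 < τ → ∀ y, HasDerivAt (fun t => P t y)
    (P τ y * lap n (P τ) y - s * ∑ i, pd n i (P τ) y ^ 2) τ

/-- The explicit Barenblatt pressures. -/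
def Pr (n : ℕ) (p b c : ℝ) (τ : ℝ) (y : Eu n) : ℝ :=
  ‖y‖ ^ 2 / (c + 2 * p * τ) + b * (c + 2 * p * τ) ^ ((n : ℝ) / p)

section Press

variable {n : ℕ} {s : ℝ} {P : ℝ → Eu n → ℝ}

lemma ContDiffOn.slice {F : ℝ → Eu n → ℝ}
    (h : ContDiffOn ℝ ∞ (fun q : ℝ × Eu n => F q.1 q.2) (Set.Ioi 0 ×ˢ Set.univ))
    {τ : ℝ} (hτ : 0 < τ) : ContDiff ℝ ∞ (F τ) := by
  rw [contDiff_iff_contDiffAt]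
  intro y
  have h1 := h.contDiffAt (x := (τ, y))
    ((isOpen_Ioi.prod isOpen_univ).mem_nhds ⟨hτ, trivial⟩)
  exact h1.comp y (contDiffAt_const.prodMk contDiffAt_id)

lemma IsPress.slice (h : IsPress n s P) {τ : ℝ} (hτ : 0 < τ) : ContDiff ℝ ∞ (P τ) :=
  h.smooth.slice hτ

lemma IsPress.hasDerivAt_rpow (h : IsPress n s P) {τ : ℝ} (hτ : 0 < τ) (y : Eu n) :
    HasDerivAt (fun t => P t y ^ (1 - s)) (P τ y * lap n (fun x => P τ x ^ (1 - s)) y) τ := by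
  have hp := h.pos τ hτ.le
  have h1 := (h.eqn τ hτ y).rpow_const (p := 1 - s) (Or.inl (hp y).ne')
  convert h1 using 1
  rw [lap_rpow (h.slice hτ) hp]
  have e1 : P τ y ^ (1 - s - 1) = P τ y * P τ y ^ (1 - s - 2) := by
    rw [show 1 - s - 1 = 1 + (1 - s - 2) by ring, Real.rpow_add (hp y), Real.rpow_one]
  rw [e1]; ring

lemma lap_Pr_aux (a b : ℝ) (y : Eu n) :
    lap n (fun y => ‖y‖ ^ 2 / a + b) y = 2 * n / a := by
  have : (fun y : Eu n => ‖y‖ ^ 2 / a + b) = fun y => a⁻¹ * ‖y‖ ^ 2 + b := by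
    ext y; ring
  rw [this, lap_add (contDiff_const.mul contDiff_normSq) contDiff_const, lap_const_mul,
    lap_normSq, lap_const]
  ring

lemma pd_Pr_aux (a b : ℝ) (i : Fin n) :
    pd n i (fun y => ‖y‖ ^ 2 / a + b) = fun y => 2 * y i / a := by
  have : (fun y : Eu n => ‖y‖ ^ 2 / a + b) = fun y => a⁻¹ * ‖y‖ ^ 2 + b := by
    ext y; ring
  rw [this, pd_add (contDiff_const.mul contDiff_normSq) contDiff_const, pd_const_mul,
    pd_normSq, pd_const]
  ext; ring

lemma Pr_isPress {p b c : ℝ} (hp : 0 < p) (hb : 0 < b) (hc : 0 < c) :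
    IsPress n ((p + n) / 2) (Pr n p b c) := by
  have hθ : ∀ τ : ℝ, 0 ≤ τ → 0 < c + 2 * p * τ := fun τ hτ => by positivity
  refine ⟨fun τ hτ y => ?_, ?_, ?_, fun τ hτ y => ?_⟩
  · have := hθ τ hτ
    unfold Pr; positivity
  · unfold Pr
    refine ContinuousOn.add (ContinuousOn.div (by fun_prop) (by fun_prop) ?_)
      (continuousOn_const.mul (ContinuousOn.rpow_const (by fun_prop) ?_))
    · exact fun q hq => (hθ q.1 hq.1).ne'
    · exact fun q hq => Or.inl (hθ q.1 hq.1).ne'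
  · unfold Pr
    have h1 : ContDiff ℝ ∞ (fun q : ℝ × Eu n => ‖q.2‖ ^ 2) := contDiff_normSq.comp contDiff_snd
    have h2 : ContDiff ℝ ∞ (fun q : ℝ × Eu n => c + 2 * p * q.1) :=
      contDiff_const.add (contDiff_const.mul contDiff_fst)
    refine ContDiffOn.add (h1.contDiffOn.div h2.contDiffOn ?_)
      (contDiffOn_const.mul (h2.contDiffOn.rpow_const_of_ne ?_))
    · exact fun q hq => (hθ q.1 (le_of_lt hq.1)).ne'
    · exact fun q hq => (hθ q.1 (le_of_lt hq.1)).ne'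
  · have h0 := hθ τ hτ.le
    have hd : HasDerivAt (fun t : ℝ => c + 2 * p * t) (2 * p) τ := by
      simpa using ((hasDerivAt_id τ).const_mul (2 * p)).const_add c
    have h1 := ((hasDerivAt_const τ (‖y‖ ^ 2)).div hd h0.ne').add
      ((hd.rpow_const (p := (n : ℝ) / p) (Or.inl h0.ne')).const_mul b)
    refine h1.congr_deriv ?_
    have e1 : lap n (Pr n p b c τ) y = 2 * n / (c + 2 * p * τ) := lap_Pr_aux _ _ _
    have e2 : ∀ i, pd n i (Pr n p b c τ) y = 2 * y i / (c + 2 * p * τ) :=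
      fun i => congrFun (pd_Pr_aux _ _ _) y
    simp only [e1, e2, div_pow, mul_pow, ← Finset.sum_div, ← Finset.mul_sum, sum_coord_sq]
    unfold Pr
    rw [Real.rpow_sub_one h0.ne']
    field_simp
    ring

end Press

section Comparison

variable {n : ℕ}

lemma contDiff_one_add_normSq : ContDiff ℝ ∞ (fun y : Eu n => 1 + ‖y‖ ^ 2) :=
  contDiff_const.add contDiff_normSq

lemma pd_one_add_normSq (i : Fin n) : pd n i (fun y : Eu n => 1 + ‖y‖ ^ 2) = fun y => 2 * y i := by
  rw [pd_add contDiff_const contDiff_normSq, pd_const, pd_normSq]; simp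

lemma lap_one_add_normSq (x : Eu n) : lap n (fun y : Eu n => 1 + ‖y‖ ^ 2) x = 2 * n := by
  rw [lap_add contDiff_const contDiff_normSq, lap_const, lap_normSq]; simp

lemma isLocalMax_of_mul {f : Eu n → ℝ} {x : Eu n} {k : ℝ} (hk : 0 < k)
    (h : IsLocalMax (fun y => f y * k) x) : IsLocalMax f x := by
  filter_upwards [h] with y hy
  exact le_of_mul_le_mul_right hy hk

lemma Pr_bound {p b c T : ℝ} (hp : 0 < p) (hb : 0 < b) (hc : 0 < c) :
    ∃ C, 0 < C ∧ ∀ τ, 0 ≤ τ → τ ≤ T → ∀ y : Eu n, Pr n p b c τ y ≤ C * (1 + ‖y‖ ^ 2) := by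
  refine ⟨1 / c + b * (c + 2 * p * |T|) ^ ((n : ℝ) / p), by positivity, fun τ h0 hT y => ?_⟩
  have h1 : ‖y‖ ^ 2 / (c + 2 * p * τ) ≤ ‖y‖ ^ 2 / c :=
    div_le_div_of_nonneg_left (by positivity) hc (by nlinarith)
  have h2 : (c + 2 * p * τ) ^ ((n : ℝ) / p) ≤ (c + 2 * p * |T|) ^ ((n : ℝ) / p) :=
    Real.rpow_le_rpow (by positivity) (by nlinarith [le_abs_self T]) (by positivity)
  have h3 : 0 ≤ b * (c + 2 * p * |T|) ^ ((n : ℝ) / p) * ‖y‖ ^ 2 := by positivity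
  have h4 := mul_le_mul_of_nonneg_left h2 hb.le
  have h5 : ‖y‖ ^ 2 / c = 1 / c * ‖y‖ ^ 2 := by ring
  have h6 : 0 < 1 / c := by positivity
  unfold Pr
  linarith

/-- First and second order conditions at a maximum of `quadratic - quartic - Q`. -/
lemma max_quadratic_sub {Q : Eu n → ℝ} (sQ : ContDiff ℝ ∞ Q) (a e ε E : ℝ) {x : Eu n}
    (hmax : IsLocalMax (fun y : Eu n =>
      ‖y‖ ^ 2 / a + e - ε * (E * (1 + ‖y‖ ^ 2) ^ 2) - Q y) x) :
    (∀ i, pd n i Q x = (2 / a - 4 * ε * E * (1 + ‖x‖ ^ 2)) * x i) ∧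
    n * (2 / a) - ε * (E * (4 * n * (1 + ‖x‖ ^ 2) + 8 * ‖x‖ ^ 2)) ≤ lap n Q x := by
  have sP : ContDiff ℝ ∞ (fun y : Eu n => ‖y‖ ^ 2 / a + e) :=
    (contDiff_normSq.div_const a).add contDiff_const
  have sh : ContDiff ℝ ∞ (fun y : Eu n => E * (1 + ‖y‖ ^ 2) ^ 2) :=
    contDiff_const.mul (contDiff_one_add_normSq.pow 2)
  have seh : ContDiff ℝ ∞ (fun y : Eu n => ε * (E * (1 + ‖y‖ ^ 2) ^ 2)) := contDiff_const.mul sh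
  have hlaph : lap n (fun y : Eu n => ε * (E * (1 + ‖y‖ ^ 2) ^ 2)) x =
      ε * (E * (4 * n * (1 + ‖x‖ ^ 2) + 8 * ‖x‖ ^ 2)) := by
    rw [lap_const_mul, lap_const_mul, lap_sq contDiff_one_add_normSq, lap_one_add_normSq]
    simp only [pd_one_add_normSq, mul_pow, ← Finset.mul_sum, sum_coord_sq]
    ring
  have hpdh : ∀ i, pd n i (fun y : Eu n => ε * (E * (1 + ‖y‖ ^ 2) ^ 2)) x =
      ε * (E * (4 * (1 + ‖x‖ ^ 2))) * x i := by
    intro i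
    rw [pd_const_mul, pd_const_mul, pd_sq contDiff_one_add_normSq, pd_one_add_normSq]
    ring
  constructor
  · intro i
    have := pd_eq_zero_of_isLocalMax (i := i) hmax
    rw [pd_sub (sP.sub seh) sQ, pd_sub sP seh] at this
    simp only [pd_Pr_aux, hpdh] at this
    linear_combination -this
  · have := lap_nonpos_of_isLocalMax ((sP.sub seh).sub sQ) hmax
    rw [lap_sub (sP.sub seh) sQ, lap_sub sP seh, hlaph, lap_Pr_aux] at this
    have e : (n : ℝ) * (2 / a) = 2 * n / a := by ring
    linarith

/-- The algebra behind `Pr_le_press`. -/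
lemma Pr_le_press_algebra {A q L r z s C N ε E k : ℝ} (hr : 0 ≤ r) (hs : 0 < s)
    (hN : 0 ≤ N) (hε : 0 < ε) (hE : 0 < E) (hz : 0 < z) (hq : 0 < q)
    (hg : 0 < A - ε * (E * (1 + r) ^ 2) - q) (hAC : A ≤ C * (1 + r)) (hk : N * z ≤ k)
    (hL : N * z - ε * (E * (4 * N * (1 + r) + 8 * r)) ≤ L) :
    A * (N * z) - s * (z ^ 2 * r) -
        ε * ((k + C * (8 + 4 * N) + 16 * s * C) * E * (1 + r) ^ 2) -
        (q * L - s * ((z - 4 * ε * E * (1 + r)) ^ 2 * r)) ≤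
      k * (A - ε * (E * (1 + r) ^ 2) - q) := by
  have hεE : 0 < ε * E := mul_pos hε hE
  have h1 : q * (N * z - ε * (E * (4 * N * (1 + r) + 8 * r))) ≤ q * L :=
    mul_le_mul_of_nonneg_left hL hq.le
  have hqC : q ≤ C * (1 + r) := by nlinarith [mul_pos hεE (by positivity : 0 < (1 + r) ^ 2)]
  have h2 : q * (ε * (E * (4 * N * (1 + r) + 8 * r))) ≤
      C * (1 + r) * (ε * E * ((4 * N + 8) * (1 + r))) := by
    rw [← mul_assoc ε E]
    refine mul_le_mul hqC (mul_le_mul_of_nonneg_left (by nlinarith) hεE.le) (by positivity)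
      (by nlinarith)
  have hw : ε * E * (1 + r) ≤ C := by
    have : ε * E * (1 + r) * (1 + r) ≤ C * (1 + r) := by nlinarith
    exact le_of_mul_le_mul_right this (by linarith)
  have h3 : r * (ε * E) ≤ C := by nlinarith
  have h4 : s * ((z - 4 * ε * E * (1 + r)) ^ 2 * r) - s * (z ^ 2 * r) ≤
      s * (16 * (ε * E * (1 + r) ^ 2) * (r * (ε * E))) := by
    have : 0 ≤ s * (8 * z * (ε * E) * (1 + r) * r) := by positivity
    nlinarith
  have h5 : s * (16 * (ε * E * (1 + r) ^ 2) * (r * (ε * E))) ≤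
      s * (16 * (ε * E * (1 + r) ^ 2) * C) := by gcongr
  have h6 : 0 ≤ (k - N * z) * (A - q) := by
    have : 0 ≤ ε * (E * (1 + r) ^ 2) := by positivity
    exact mul_nonneg (by linarith) (by linarith)
  nlinarith

/-- An explicit pressure lying initially below a pressure solution stays below. -/
lemma Pr_le_press {p b c : ℝ} {Q : ℝ → Eu n → ℝ} (hp : 0 < p) (hb : 0 < b) (hc : 0 < c)
    (hQ : IsPress n ((p + n) / 2) Q) (h0 : ∀ y, Pr n p b c 0 y ≤ Q 0 y) {τ : ℝ} (hτ : 0 ≤ τ)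
    (y : Eu n) : Pr n p b c τ y ≤ Q τ y := by
  have hP : IsPress n ((p + n) / 2) (Pr n p b c) := Pr_isPress hp hb hc
  obtain ⟨C, hC, hPC⟩ := Pr_bound (n := n) (T := τ) hp hb hc
  set s := (p + (n : ℝ)) / 2 with hs
  have hspos : 0 < s := by positivity
  set K : ℝ := 2 * n / c + C * (8 + 4 * n) + 16 * s * C with hK
  set K' : ℝ := 2 * n / c + 1 with hK'
  suffices H : ∀ ε : ℝ, 0 < ε →
      Pr n p b c τ y ≤ Q τ y + ε * (Real.exp (K * τ) * (1 + ‖y‖ ^ 2) ^ 2) by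
    by_contra! hlt
    have hh : 0 < Real.exp (K * τ) * (1 + ‖y‖ ^ 2) ^ 2 := by positivity
    have := H ((Pr n p b c τ y - Q τ y) / (Real.exp (K * τ) * (1 + ‖y‖ ^ 2) ^ 2) / 2)
      (div_pos (div_pos (by linarith) hh) two_pos)
    rw [div_div, mul_comm _ (2 : ℝ), ← div_div, div_mul_cancel₀ _ hh.ne'] at this
    linarith
  intro ε hε
  by_contra! hlt
  set d : ℝ → Eu n → ℝ :=
    fun t x => Pr n p b c t x - ε * (Real.exp (K * t) * (1 + ‖x‖ ^ 2) ^ 2) - Q t x with hd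
  set u : ℝ → Eu n → ℝ := fun t x => d t x * Real.exp (-(K' * t)) with hu
  have hKnn : 0 ≤ K := by positivity
  set R : ℝ := max ‖y‖ (C / ε) + 1 with hR
  have hR1 : 1 ≤ R := by
    have := norm_nonneg y
    have := le_max_left ‖y‖ (C / ε)
    linarith
  have hRC : C ≤ ε * (1 + R ^ 2) := by
    have h1 : C / ε ≤ R := by linarith [le_max_right ‖y‖ (C / ε)]
    rw [div_le_iff₀ hε] at h1
    have h2 : R ≤ 1 + R ^ 2 := by nlinarith
    have := mul_le_mul_of_nonneg_left h2 hε.le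
    linarith
  obtain ⟨t, x, ht0, htτ, -, hpos, hleft, hmax⟩ := parabolic_max (u := u) (t0 := 0) (T := τ)
    (R := R) (k := 0) (x0 := 0) (by
      have hsub : Set.Icc (0 : ℝ) τ ×ˢ Metric.closedBall (0 : Eu n) R ⊆ Set.Ici 0 ×ˢ Set.univ :=
        fun q hq => ⟨hq.1.1, trivial⟩
      have e1 := hP.cont.mono hsub
      have e2 := hQ.cont.mono hsub
      refine ContinuousOn.mul ((e1.sub ?_).sub e2) ?_
      · exact Continuous.continuousOn (by fun_prop)
      · exact Continuous.continuousOn (by fun_prop)) (by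
      intro x _
      have h1 := h0 x
      have : d 0 x ≤ 0 := by
        have : 0 ≤ ε * (Real.exp (K * 0) * (1 + ‖x‖ ^ 2) ^ 2) := by positivity
        simp only [hd]; linarith
      exact mul_nonpos_of_nonpos_of_nonneg this (Real.exp_nonneg _)) (by
      intro t ht x hx
      rw [dist_zero_right] at hx
      have h1 := hPC t ht.1 ht.2 x
      have h2 := hQ.pos t ht.1 x
      have h3 : (1 : ℝ) ≤ Real.exp (K * t) := Real.one_le_exp (mul_nonneg hKnn ht.1)
      have h4 : ε * (1 + R ^ 2) ^ 2 ≤ ε * (Real.exp (K * t) * (1 + R ^ 2) ^ 2) := by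
        have : 0 ≤ ε * (1 + R ^ 2) ^ 2 := by positivity
        nlinarith
      have : d t x ≤ 0 := by
        simp only [hd, hx] at h1 ⊢
        have h5 : C * (1 + R ^ 2) ≤ ε * (1 + R ^ 2) * (1 + R ^ 2) :=
          mul_le_mul_of_nonneg_right hRC (by positivity)
        linarith
      exact mul_nonpos_of_nonpos_of_nonneg this (Real.exp_nonneg _))
    ⟨τ, ⟨hτ, le_rfl⟩, y, by
      rw [Metric.mem_closedBall, dist_zero_right]; linarith [le_max_left ‖y‖ (C / ε)], by
      refine mul_pos ?_ (Real.exp_pos _)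
      simp only [hd]; linarith⟩
  have hdpos : 0 < d t x := pos_of_mul_pos_left hpos (Real.exp_nonneg _)
  have hdmax : IsLocalMax (d t) x := isLocalMax_of_mul (Real.exp_pos _) hmax
  set E := Real.exp (K * t) with hE
  have hEpos : 0 < E := Real.exp_pos _
  have hct : 0 < c + 2 * p * t := by positivity
  obtain ⟨hpdQ, hlapQ⟩ := max_quadratic_sub (hQ.slice ht0) _ _ ε E hdmax
  have hdt : HasDerivAt (fun r => d r x)
      (Pr n p b c t x * lap n (Pr n p b c t) x - s * ∑ i, pd n i (Pr n p b c t) x ^ 2 -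
        ε * (K * E * (1 + ‖x‖ ^ 2) ^ 2) -
        (Q t x * lap n (Q t) x - s * ∑ i, pd n i (Q t) x ^ 2)) t := by
    have h1 : HasDerivAt (fun r => Real.exp (K * r)) (E * K) t := by
      simpa using ((hasDerivAt_id t).const_mul K).exp
    have := ((hP.eqn t ht0 x).sub ((h1.mul_const ((1 + ‖x‖ ^ 2) ^ 2)).const_mul ε)).sub
      (hQ.eqn t ht0 x)
    refine this.congr_deriv ?_
    ring
  have hG : HasDerivAt (fun r => Real.exp (-(K' * r))) (Real.exp (-(K' * t)) * -K') t := by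
    simpa using ((hasDerivAt_id t).const_mul K').neg.exp
  have hnn := deriv_nonneg_of_max_left (hdt.mul hG) ht0 hleft
  have hsumP : ∑ i, pd n i (Pr n p b c t) x ^ 2 = (2 / (c + 2 * p * t)) ^ 2 * ‖x‖ ^ 2 := by
    rw [← sum_coord_sq x, Finset.mul_sum]
    refine Finset.sum_congr rfl fun i _ => ?_
    rw [show pd n i (Pr n p b c t) x = 2 * x i / (c + 2 * p * t) from
      congrFun (pd_Pr_aux _ _ _) x]
    ring
  have hsumQ : ∑ i, pd n i (Q t) x ^ 2 =
      (2 / (c + 2 * p * t) - 4 * ε * E * (1 + ‖x‖ ^ 2)) ^ 2 * ‖x‖ ^ 2 := by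
    rw [← sum_coord_sq x, Finset.mul_sum]
    refine Finset.sum_congr rfl fun i _ => ?_
    rw [hpdQ i, mul_pow, sum_coord_sq]
  have hlapP : lap n (Pr n p b c t) x = n * (2 / (c + 2 * p * t)) := by
    rw [show lap n (Pr n p b c t) x = 2 * n / (c + 2 * p * t) from lap_Pr_aux _ _ _]
    ring
  rw [hsumP, hsumQ, hlapP] at hnn
  have hinv : n * (2 / (c + 2 * p * t)) ≤ 2 * n / c := by
    have := div_le_div_of_nonneg_left (a := 2 * (n : ℝ)) (by positivity) hc
      (show c ≤ c + 2 * p * t by linarith [mul_pos hp ht0])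
    refine le_trans (le_of_eq ?_) this
    ring
  have key := Pr_le_press_algebra (A := Pr n p b c t x) (q := Q t x) (by positivity) hspos
    n.cast_nonneg hε hEpos (by positivity) (hQ.pos t ht0.le x) hdpos (hPC t ht0.le htτ x) hinv
    hlapQ
  have hdx : d t x = Pr n p b c t x - ε * (E * (1 + ‖x‖ ^ 2) ^ 2) - Q t x := rfl
  rw [← hdx] at key
  have hGpos := Real.exp_pos (-(K' * t))
  rw [← hK] at key
  have h1 := mul_le_mul_of_nonneg_right key hGpos.le
  have h2 := mul_pos hdpos hGpos
  rw [hK'] at hnn h1 h2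
  linarith

end Comparison

section Comparison

variable {n : ℕ}

/-- Uniform decay of negative powers of the explicit pressures. -/
lemma Pr_rpow_small {p b c T r k : ℝ} (hp : 0 < p) (hb : 0 < b) (hc : 0 < c) (hr : r < 0)
    (hk : 0 < k) : ∃ R0 : ℝ, ∀ R, R0 ≤ R → ∀ τ, 0 ≤ τ → τ ≤ T → ∀ y : Eu n, ‖y‖ = R →
      Pr n p b c τ y ^ r ≤ k := by
  have h1 : Tendsto (fun R : ℝ => (R ^ 2 / (c + 2 * p * |T|)) ^ r) atTop (𝓝 0) := by
    have h2 : Tendsto (fun R : ℝ => R ^ 2 / (c + 2 * p * |T|)) atTop atTop :=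
      (tendsto_pow_atTop two_ne_zero).atTop_div_const (by positivity)
    have := (tendsto_rpow_neg_atTop (neg_pos.2 hr)).comp h2
    simpa [Function.comp_def] using this
  obtain ⟨R0, hR0⟩ := eventually_atTop.1 ((h1.eventually_le_const hk).and (eventually_gt_atTop 0))
  refine ⟨R0, fun R hR τ hτ hT y hy => le_trans ?_ (hR0 R hR).1⟩
  have hRpos := (hR0 R hR).2
  refine Real.rpow_le_rpow_of_nonpos (by positivity) ?_ hr.le
  have h3 : R ^ 2 / (c + 2 * p * |T|) ≤ R ^ 2 / (c + 2 * p * τ) :=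
    div_le_div_of_nonneg_left (by positivity) (by positivity)
      (by nlinarith [hT.trans (le_abs_self T)])
  have h4 : 0 < b * (c + 2 * p * τ) ^ ((n : ℝ) / p) := by positivity
  unfold Pr
  rw [hy]; linarith

/-- Where the power `P^(1-s)` of an explicit pressure is superharmonic, `y` is bounded and
its Laplacian is bounded below. -/
lemma lap_Pr_rpow {p b c T : ℝ} (hp : 0 < p) (hb : 0 < b) (hc : 0 < c)
    (hs : 1 < (p + (n : ℝ)) / 2) :
    ∃ R1 M : ℝ, ∀ τ, 0 ≤ τ → τ ≤ T → ∀ y : Eu n,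
      lap n (fun x => Pr n p b c τ x ^ (1 - (p + (n : ℝ)) / 2)) y < 0 →
      ‖y‖ ≤ R1 ∧ -M ≤ lap n (fun x => Pr n p b c τ x ^ (1 - (p + (n : ℝ)) / 2)) y := by
  set s := (p + (n : ℝ)) / 2 with hs'
  set b' := b * (c + 2 * p * |T|) ^ ((n : ℝ) / p) with hb'
  have hb'0 : 0 < b' := by positivity
  set b0 := b * c ^ ((n : ℝ) / p) with hb0
  have hb00 : 0 < b0 := by positivity
  refine ⟨n * b' * (c + 2 * p * |T|) / p + 1, (s - 1) * b0 ^ (-s) * (2 * n / c),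
    fun τ hτ hT y hneg => ?_⟩
  have hct : 0 < c + 2 * p * τ := by positivity
  have hPp : ∀ x, 0 < Pr n p b c τ x := by
    intro x; unfold Pr; positivity
  have sP : ContDiff ℝ ∞ (Pr n p b c τ) := by
    have := (contDiff_normSq (n := n)).div_const (c + 2 * p * τ)
    exact this.add contDiff_const
  have hlapP : lap n (Pr n p b c τ) y = 2 * n / (c + 2 * p * τ) := lap_Pr_aux _ _ _
  have hpdP : ∑ i, pd n i (Pr n p b c τ) y ^ 2 = 4 * ‖y‖ ^ 2 / (c + 2 * p * τ) ^ 2 := by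
    rw [← sum_coord_sq y, Finset.mul_sum, Finset.sum_div]
    refine Finset.sum_congr rfl fun i _ => ?_
    rw [show pd n i (Pr n p b c τ) y = 2 * y i / (c + 2 * p * τ) from
      congrFun (pd_Pr_aux _ _ _) y, div_pow, mul_pow]
    norm_num
  rw [lap_rpow sP hPp, hlapP, hpdP] at hneg ⊢
  have e1 : Pr n p b c τ y ^ (1 - s - 1) = Pr n p b c τ y * Pr n p b c τ y ^ (1 - s - 2) := by
    rw [show 1 - s - 1 = 1 + (1 - s - 2) by ring, Real.rpow_add (hPp y), Real.rpow_one]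
  have hX : 0 < Pr n p b c τ y ^ (1 - s - 2) := Real.rpow_pos_of_pos (hPp y) _
  have hle : (c + 2 * p * τ) ≤ c + 2 * p * |T| := by nlinarith [hT.trans (le_abs_self T)]
  constructor
  · rw [e1] at hneg
    have h1 : (s - 1) * Pr n p b c τ y ^ (1 - s - 2) *
        (s * (4 * ‖y‖ ^ 2 / (c + 2 * p * τ) ^ 2) -
          Pr n p b c τ y * (2 * n / (c + 2 * p * τ))) < 0 := by
      refine lt_of_eq_of_lt ?_ hneg; ring
    have h2 : s * (4 * ‖y‖ ^ 2 / (c + 2 * p * τ) ^ 2) -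
          Pr n p b c τ y * (2 * n / (c + 2 * p * τ)) < 0 := by
      by_contra! h
      have : 0 ≤ (s - 1) * Pr n p b c τ y ^ (1 - s - 2) := mul_nonneg (by linarith) hX.le
      nlinarith [mul_nonneg this h]
    have h3 : s * (4 * ‖y‖ ^ 2 / (c + 2 * p * τ) ^ 2) -
          Pr n p b c τ y * (2 * n / (c + 2 * p * τ)) =
        (2 * p * ‖y‖ ^ 2 - 2 * n * (b * (c + 2 * p * τ) ^ ((n : ℝ) / p)) * (c + 2 * p * τ)) /
          (c + 2 * p * τ) ^ 2 := by
      unfold Pr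
      rw [hs']; field_simp; ring
    rw [h3, div_neg_iff] at h2
    have h4 : p * ‖y‖ ^ 2 < n * (b * (c + 2 * p * τ) ^ ((n : ℝ) / p)) * (c + 2 * p * τ) := by
      rcases h2 with h2 | h2
      · nlinarith [h2.2, sq_nonneg (c + 2 * p * τ)]
      · linarith [h2.1]
    have h5 : b * (c + 2 * p * τ) ^ ((n : ℝ) / p) ≤ b' :=
      mul_le_mul_of_nonneg_left (Real.rpow_le_rpow hct.le hle (by positivity)) hb.le
    have h6 : n * (b * (c + 2 * p * τ) ^ ((n : ℝ) / p)) * (c + 2 * p * τ) ≤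
        n * b' * (c + 2 * p * |T|) := by gcongr
    have h7 : ‖y‖ ^ 2 ≤ n * b' * (c + 2 * p * |T|) / p := by
      rw [le_div_iff₀ hp]; linarith
    nlinarith [sq_nonneg (‖y‖ - 1)]
  · have h1 : b0 ≤ Pr n p b c τ y := by
      have h2 : c ^ ((n : ℝ) / p) ≤ (c + 2 * p * τ) ^ ((n : ℝ) / p) :=
        Real.rpow_le_rpow hc.le (by nlinarith) (by positivity)
      have h3 := mul_le_mul_of_nonneg_left h2 hb.le
      have h4 : 0 ≤ ‖y‖ ^ 2 / (c + 2 * p * τ) := by positivity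
      unfold Pr; linarith
    have h2 : Pr n p b c τ y ^ (-s) ≤ b0 ^ (-s) :=
      Real.rpow_le_rpow_of_nonpos hb00 h1 (by linarith)
    have h3 : 2 * (n : ℝ) / (c + 2 * p * τ) ≤ 2 * n / c :=
      div_le_div_of_nonneg_left (by positivity) hc (by nlinarith)
    have h4 : 0 ≤ (1 - s) * (1 - s - 1) * Pr n p b c τ y ^ (1 - s - 2) *
        (4 * ‖y‖ ^ 2 / (c + 2 * p * τ) ^ 2) := by
      have : 0 ≤ (1 - s) * (1 - s - 1) := by nlinarith
      positivity
    rw [show 1 - s - 1 = -s by ring] at h4 ⊢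
    have h5 : Pr n p b c τ y ^ (-s) * (2 * (n : ℝ) / (c + 2 * p * τ)) ≤
        b0 ^ (-s) * (2 * n / c) := by
      have := hPp y
      gcongr
    have h6 := mul_le_mul_of_nonneg_left h5 (by linarith : 0 ≤ s - 1)
    linarith

/-- An explicit pressure lying initially above a pressure solution stays above. -/
lemma press_le_Pr {p b c : ℝ} {Q : ℝ → Eu n → ℝ} (hp : 0 < p) (hb : 0 < b) (hc : 0 < c)
    (hs : 1 < (p + (n : ℝ)) / 2)
    (hQ : IsPress n ((p + n) / 2) Q) (h0 : ∀ y, Q 0 y ≤ Pr n p b c 0 y) {τ : ℝ} (hτ : 0 ≤ τ)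
    (y : Eu n) : Q τ y ≤ Pr n p b c τ y := by
  have hP : IsPress n ((p + n) / 2) (Pr n p b c) := Pr_isPress hp hb hc
  obtain ⟨R1, M, hRM⟩ := lap_Pr_rpow (n := n) (T := τ) hp hb hc hs
  set s := (p + (n : ℝ)) / 2 with hs'
  obtain ⟨M1, hM1⟩ : ∃ M1, ∀ q ∈ Set.Icc (0 : ℝ) τ ×ˢ Metric.closedBall (0 : Eu n) R1,
      Q q.1 q.2 ≤ M1 := by
    have hK : IsCompact (Set.Icc (0 : ℝ) τ ×ˢ Metric.closedBall (0 : Eu n) R1) :=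
      isCompact_Icc.prod (isCompact_closedBall _ _)
    obtain ⟨M1, h⟩ := hK.bddAbove_image (hQ.cont.mono fun q hq => ⟨hq.1.1, trivial⟩)
    exact ⟨M1, fun q hq => h ⟨q, hq, rfl⟩⟩
  by_contra! hlt
  set K : ℝ := |M| * |M1| ^ s / (s - 1) + 1 with hK
  set d : ℝ → Eu n → ℝ := fun t x => Pr n p b c t x ^ (1 - s) - Q t x ^ (1 - s) with hd
  have hd1 : 0 < d τ y := by
    have := Real.rpow_lt_rpow_of_neg (hP.pos τ hτ y) hlt (by linarith : 1 - s < 0)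
    simp only [hd]; linarith
  set k : ℝ := d τ y * Real.exp (-(K * τ)) / 2 with hk
  have hk0 : 0 < k := by positivity
  obtain ⟨R0, hR0⟩ := Pr_rpow_small (n := n) (T := τ) hp hb hc (by linarith : 1 - s < 0) hk0
  set R := max R0 ‖y‖
  have hKnn : 0 ≤ K := by
    have : 0 ≤ s - 1 := by linarith
    positivity
  obtain ⟨t, x, ht0, htτ, -, hpos, hleft, hmax⟩ := parabolic_max
    (u := fun t x => d t x * Real.exp (-(K * t))) (t0 := 0) (T := τ)
    (R := R) (k := k) (x0 := 0) (by
      have hsub : Set.Icc (0 : ℝ) τ ×ˢ Metric.closedBall (0 : Eu n) R ⊆ Set.Ici 0 ×ˢ Set.univ :=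
        fun q hq => ⟨hq.1.1, trivial⟩
      have e1 := (hP.cont.mono hsub).rpow_const (p := 1 - s)
        fun q hq => Or.inl (hP.pos _ hq.1.1 _).ne'
      have e2 := (hQ.cont.mono hsub).rpow_const (p := 1 - s)
        fun q hq => Or.inl (hQ.pos _ hq.1.1 _).ne'
      exact (e1.sub e2).mul (Continuous.continuousOn (by fun_prop))) (by
      intro x _
      have h1 := Real.rpow_le_rpow_of_nonpos (hQ.pos 0 le_rfl x) (h0 x)
        (by linarith : 1 - s ≤ 0)
      have h2 : d 0 x ≤ 0 := by simp only [hd]; linarith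
      exact (mul_nonpos_of_nonpos_of_nonneg h2 (Real.exp_nonneg _)).trans hk0.le) (by
      intro t ht x hx
      rw [dist_zero_right] at hx
      have h1 := hR0 R (le_max_left _ _) t ht.1 ht.2 x hx
      have h2 : d t x ≤ k := by
        have := Real.rpow_nonneg (hQ.pos t ht.1 x).le (1 - s)
        simp only [hd]; linarith
      have h3 : Real.exp (-(K * t)) ≤ 1 :=
        Real.exp_le_one_iff.2 (neg_nonpos.2 (mul_nonneg hKnn ht.1))
      calc d t x * Real.exp (-(K * t)) ≤ k * Real.exp (-(K * t)) :=
            mul_le_mul_of_nonneg_right h2 (Real.exp_nonneg _)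
        _ ≤ k * 1 := mul_le_mul_of_nonneg_left h3 hk0.le
        _ = k := mul_one k)
    ⟨τ, ⟨hτ, le_rfl⟩, y, by
      rw [Metric.mem_closedBall, dist_zero_right]; exact le_max_right _ _, by
      have : 0 < d τ y * Real.exp (-(K * τ)) := by positivity
      rw [hk]; linarith⟩
  have hE : 0 < Real.exp (-(K * t)) := Real.exp_pos _
  have hdpos : 0 < d t x := pos_of_mul_pos_left (hk0.trans hpos) hE.le
  have hdmax : IsLocalMax (d t) x := isLocalMax_of_mul hE hmax
  have hPx := hP.pos t ht0.le x
  have hQx := hQ.pos t ht0.le x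
  have hdt := (hP.hasDerivAt_rpow ht0 x).sub (hQ.hasDerivAt_rpow ht0 x)
  have hG : HasDerivAt (fun r => Real.exp (-(K * r))) (Real.exp (-(K * t)) * -K) t := by
    simpa using ((hasDerivAt_id t).const_mul K).neg.exp
  have hnn := deriv_nonneg_of_max_left (hdt.mul hG) ht0 hleft
  have hlap := lap_nonpos_of_isLocalMax
    ((contDiff_rpow (hP.slice ht0) (hP.pos t ht0.le) (1 - s)).sub
      (contDiff_rpow (hQ.slice ht0) (hQ.pos t ht0.le) (1 - s))) hdmax
  rw [lap_sub (contDiff_rpow (hP.slice ht0) (hP.pos t ht0.le) (1 - s))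
    (contDiff_rpow (hQ.slice ht0) (hQ.pos t ht0.le) (1 - s))] at hlap
  set LP := lap n (fun x => Pr n p b c t x ^ (1 - s)) x with hLP
  set LQ := lap n (fun x => Q t x ^ (1 - s)) x with hLQ
  change 0 ≤ (Pr n p b c t x * LP - Q t x * LQ) * Real.exp (-(K * t)) +
    d t x * (Real.exp (-(K * t)) * -K) at hnn
  have h1 : 0 ≤ Pr n p b c t x * LP - Q t x * LQ - K * d t x := by
    by_contra! h
    nlinarith [mul_neg_of_neg_of_pos h hE]
  have hPQ : Pr n p b c t x < Q t x := by
    by_contra! h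
    have := Real.rpow_le_rpow_of_nonpos hQx h (by linarith : 1 - s ≤ 0)
    simp only [hd] at hdpos; linarith
  have h2 : K * d t x ≤ (Pr n p b c t x - Q t x) * LP := by
    nlinarith [mul_nonneg hQx.le (sub_nonneg.2 hlap)]
  have hK1 : 1 ≤ K := by
    have : 0 ≤ s - 1 := by linarith
    have : 0 ≤ |M| * |M1| ^ s / (s - 1) := by positivity
    linarith
  rcases le_or_gt 0 LP with hL | hL
  · nlinarith [mul_nonneg (sub_nonneg.2 hPQ.le) hL]
  · obtain ⟨hxR, hML⟩ := hRM t ht0.le htτ x hL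
    have hQM : Q t x ≤ |M1| :=
      (hM1 (t, x) ⟨⟨ht0.le, htτ⟩, by simpa using hxR⟩).trans (le_abs_self _)
    have hconv := rpow_tangent_of_nonpos (by linarith : 1 - s ≤ 0) hQx hPx
    rw [show 1 - s - 1 = -s by ring] at hconv
    have h3 : (s - 1) * Q t x ^ (-s) * (Q t x - Pr n p b c t x) ≤ d t x := by
      simp only [hd]; linarith
    have hQs : Q t x ^ s ≤ |M1| ^ s := Real.rpow_le_rpow hQx.le hQM (by linarith)
    have hQs0 : 0 < Q t x ^ s := Real.rpow_pos_of_pos hQx s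
    have h4 : (s - 1) * (Q t x - Pr n p b c t x) ≤ |M1| ^ s * d t x := by
      have := mul_le_mul_of_nonneg_left h3 hQs0.le
      rw [Real.rpow_neg hQx.le] at this
      have e : Q t x ^ s * ((s - 1) * (Q t x ^ s)⁻¹ * (Q t x - Pr n p b c t x)) =
          (s - 1) * (Q t x - Pr n p b c t x) := by field_simp
      rw [e] at this
      exact this.trans (mul_le_mul_of_nonneg_right hQs hdpos.le)
    have hs1 : 0 < s - 1 := by linarith
    have h5 : (Q t x - Pr n p b c t x) ≤ |M1| ^ s * d t x / (s - 1) := by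
      rw [le_div_iff₀ hs1]; linarith
    have h6 : (Pr n p b c t x - Q t x) * LP ≤ (Q t x - Pr n p b c t x) * |M| := by
      have := le_abs_self M
      nlinarith
    have h7 := mul_le_mul_of_nonneg_right h5 (abs_nonneg M)
    have h8 : K * d t x = |M1| ^ s * d t x / (s - 1) * |M| + d t x := by
      rw [hK]; ring
    linarith

end Comparison

section Radial

variable {n : ℕ}

/-- Area of the unit sphere. -/
def sphArea (n : ℕ) : ℝ := n * volume.real (Metric.ball (0 : Eu n) 1)

lemma nontrivial_Eu (hn : 1 ≤ n) : Nontrivial (Eu n) := by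
  have : Nonempty (Fin n) := ⟨⟨0, hn⟩⟩
  infer_instance

lemma sphArea_nonneg (n : ℕ) : 0 ≤ sphArea n := by
  unfold sphArea; positivity

lemma pow_mul_rpow_radial (hn : 1 ≤ n) {y : ℝ} (hy : 0 < y) (a : ℝ) :
    y ^ (n - 1) * y ^ a = y ^ (a + n - 1) := by
  rw [← Real.rpow_natCast, ← Real.rpow_add hy]
  congr 1
  rw [Nat.cast_sub hn]; push_cast; ring

lemma radial_inside (hn : 1 ≤ n) {a R : ℝ} (ha : 0 < a + n) (hR : 0 < R) :
    Integrable (fun x : Eu n => if ‖x‖ ≤ R then ‖x‖ ^ a else 0) ∧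
      ∫ x : Eu n, (if ‖x‖ ≤ R then ‖x‖ ^ a else 0) = sphArea n * (R ^ (a + n) / (a + n)) := by
  have := nontrivial_Eu hn
  have hdim : Module.finrank ℝ (Eu n) = n := by simp
  have hEq : Set.EqOn (fun y : ℝ => y ^ (n - 1) • (if y ≤ R then y ^ a else 0))
      ((Set.Ioc 0 R).indicator fun y => y ^ (a + n - 1)) (Set.Ioi 0) := by
    intro y hy
    have hy' : 0 < y := hy
    by_cases h : y ≤ R
    · simp [h, hy', pow_mul_rpow_radial hn hy']
    · simp [h]
  have hint : IntervalIntegrable (fun y : ℝ => y ^ (a + n - 1)) volume 0 R :=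
    intervalIntegral.intervalIntegrable_rpow' (by linarith)
  constructor
  · rw [integrable_fun_norm_addHaar volume (f := fun r => if r ≤ R then r ^ a else 0), hdim,
      integrableOn_congr_fun hEq measurableSet_Ioi]
    exact (((intervalIntegrable_iff_integrableOn_Ioc_of_le hR.le).1 hint).integrable_indicator
      measurableSet_Ioc).integrableOn
  · rw [integral_fun_norm_addHaar volume (fun r => if r ≤ R then r ^ a else 0), hdim,
      setIntegral_congr_fun measurableSet_Ioi hEq, setIntegral_indicator measurableSet_Ioc,
      Set.inter_eq_self_of_subset_right (fun x hx => hx.1),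
      ← intervalIntegral.integral_of_le hR.le, integral_rpow (Or.inl (by linarith))]
    rw [sub_add_cancel, Real.zero_rpow ha.ne', sub_zero, sphArea, nsmul_eq_mul, smul_eq_mul]
    ring

lemma radial_outside (hn : 1 ≤ n) {a R : ℝ} (ha : a + n < 0) (hR : 0 < R) :
    Integrable (fun x : Eu n => if R < ‖x‖ then ‖x‖ ^ a else 0) ∧
      ∫ x : Eu n, (if R < ‖x‖ then ‖x‖ ^ a else 0) = sphArea n * (R ^ (a + n) / -(a + n)) := by
  have := nontrivial_Eu hn
  have hdim : Module.finrank ℝ (Eu n) = n := by simp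
  have hEq : Set.EqOn (fun y : ℝ => y ^ (n - 1) • (if R < y then y ^ a else 0))
      ((Set.Ioi R).indicator fun y => y ^ (a + n - 1)) (Set.Ioi 0) := by
    intro y hy
    have hy' : 0 < y := hy
    by_cases h : R < y
    · simp [h, pow_mul_rpow_radial hn hy']
    · simp [h]
  have hint : IntegrableOn (fun y : ℝ => y ^ (a + n - 1)) (Set.Ioi R) :=
    integrableOn_Ioi_rpow_of_lt (by linarith) hR
  constructor
  · rw [integrable_fun_norm_addHaar volume (f := fun r => if R < r then r ^ a else 0), hdim,
      integrableOn_congr_fun hEq measurableSet_Ioi]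
    exact (hint.integrable_indicator measurableSet_Ioi).integrableOn
  · rw [integral_fun_norm_addHaar volume (fun r => if R < r then r ^ a else 0), hdim,
      setIntegral_congr_fun measurableSet_Ioi hEq, setIntegral_indicator measurableSet_Ioi,
      Set.inter_eq_self_of_subset_right (Set.Ioi_subset_Ioi hR.le),
      integral_Ioi_rpow_of_lt (by linarith) hR]
    rw [sub_add_cancel, sphArea, nsmul_eq_mul, smul_eq_mul, div_neg]
    ring

/-- Integrability of `(b+|x|²)^(-k)`. -/
lemma integrable_add_normSq_rpow {b k : ℝ} (hb : 0 < b) (hk : (n : ℝ) < 2 * k) :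
    Integrable (fun x : Eu n => (‖x‖ ^ 2 + b) ^ (-k)) := by
  have hk0 : 0 < k := by
    have : (0 : ℝ) ≤ n := n.cast_nonneg
    linarith
  have h1 : Integrable (fun x : Eu n => (1 + ‖x‖ ^ 2) ^ (-(2 * k) / 2)) :=
    integrable_rpow_neg_one_add_norm_sq (by simpa using hk)
  set c := min b 1
  have hc : 0 < c := lt_min hb one_pos
  refine (h1.const_mul (c ^ (-k))).mono' ?_ (ae_of_all _ fun x => ?_)
  · refine Continuous.aestronglyMeasurable (Continuous.rpow_const (by fun_prop) fun x => ?_)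
    left; positivity
  · rw [Real.norm_of_nonneg (by positivity), show -(2 * k) / 2 = -k by ring,
      ← Real.mul_rpow hc.le (by positivity)]
    refine Real.rpow_le_rpow_of_nonpos (by positivity) ?_ (by linarith)
    have h1 : c ≤ b := min_le_left _ _
    have h2 : c ≤ 1 := min_le_right _ _
    nlinarith [sq_nonneg ‖x‖]

end Radial

/-- Convolution of real functions on `ℝⁿ`. -/
def mol {n : ℕ} (ψ g : Eu n → ℝ) (y : Eu n) : ℝ := ∫ z, ψ z * g (y - z)

/-- Smooth compactly supported functions. -/
structure IsTest {n : ℕ} (ψ : Eu n → ℝ) : Prop where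
  smooth : ContDiff ℝ ∞ ψ
  supp : HasCompactSupport ψ

section Mollify

variable {n : ℕ} {ψ g : Eu n → ℝ}

lemma mol_eq_convolution (ψ g : Eu n → ℝ) :
    mol ψ g = convolution ψ g (ContinuousLinearMap.mul ℝ ℝ) volume := rfl

lemma mol_eq_swap (ψ g : Eu n → ℝ) (y : Eu n) : mol ψ g y = ∫ z, ψ (y - z) * g z := by
  unfold mol
  rw [← integral_sub_left_eq_self _ volume y]
  simp

lemma HasCompactSupport.pd (h : HasCompactSupport ψ) (i : Fin n) :
    HasCompactSupport (_root_.pd n i ψ) := by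
  have := h.fderiv_apply (𝕜 := ℝ) (v := stdBasis n i)
  exact this

lemma IsTest.pd (h : IsTest ψ) (i : Fin n) : IsTest (_root_.pd n i ψ) :=
  ⟨contDiff_pd h.smooth i, h.supp.pd i⟩

lemma IsTest.lap (h : IsTest ψ) : IsTest (_root_.lap n ψ) := by
  refine ⟨contDiff_lap h.smooth, ?_⟩
  have : _root_.lap n ψ = fun x => ∑ i, _root_.pd n i (_root_.pd n i ψ) x := rfl
  rw [this]
  refine HasCompactSupport.intro (K := tsupport ψ) h.supp fun x hx => ?_
  refine Finset.sum_eq_zero fun i _ => ?_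
  have h1 : tsupport (_root_.pd n i (_root_.pd n i ψ)) ⊆ tsupport ψ := by
    refine (?_ : _ ⊆ tsupport (_root_.pd n i ψ)).trans ?_
    · exact tsupport_fderiv_apply_subset ℝ _
    · exact tsupport_fderiv_apply_subset ℝ _
  exact image_eq_zero_of_notMem_tsupport fun h' => hx (h1 h')

lemma IsTest.reflect (h : IsTest ψ) (y : Eu n) : IsTest (fun z => ψ (y - z)) := by
  refine ⟨h.smooth.comp (contDiff_const.sub contDiff_id), ?_⟩
  exact h.supp.comp_homeomorph (Homeomorph.subLeft y)

lemma IsTest.integrable_mul (h : IsTest ψ) (hg : Continuous g) :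
    Integrable (fun z => ψ z * g z) :=
  (h.smooth.continuous.mul hg).integrable_of_hasCompactSupport h.supp.mul_right

lemma contDiff_mol (hψ : IsTest ψ) (hg : Continuous g) : ContDiff ℝ ∞ (mol ψ g) := by
  rw [mol_eq_convolution]
  exact hψ.supp.contDiff_convolution_left _ hψ.smooth hg.locallyIntegrable

lemma pd_mol (hψ : IsTest ψ) (hg : Continuous g) (i : Fin n) :
    pd n i (mol ψ g) = mol (pd n i ψ) g := by
  ext y
  have h := hψ.supp.hasFDerivAt_convolution_left (ContinuousLinearMap.mul ℝ ℝ)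
    (hψ.smooth.of_le (by simp)) hg.locallyIntegrable (μ := volume) y
  rw [← mol_eq_convolution] at h
  rw [pd, h.fderiv, convolution, ContinuousLinearMap.integral_apply]
  · rfl
  · have hc : HasCompactSupport (fderiv ℝ ψ) := hψ.supp.fderiv (𝕜 := ℝ)
    exact hc.convolutionExists_left ((ContinuousLinearMap.mul ℝ ℝ).precompL (Eu n))
      (hψ.smooth.continuous_fderiv (by simp)) hg.locallyIntegrable y

lemma mol_sum {ι : Type*} (t : Finset ι) {F : ι → Eu n → ℝ} (hF : ∀ j, IsTest (F j))
    (hg : Continuous g) (y : Eu n) :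
    mol (fun x => ∑ j ∈ t, F j x) g y = ∑ j ∈ t, mol (F j) g y := by
  unfold mol
  simp only [Finset.sum_mul]
  exact integral_finsetSum _ fun j _ =>
    (hF j).integrable_mul (hg.comp (continuous_const.sub continuous_id))

lemma lap_mol (hψ : IsTest ψ) (hg : Continuous g) :
    lap n (mol ψ g) = mol (lap n ψ) g := by
  ext y
  have : lap n ψ = fun x => ∑ i, pd n i (pd n i ψ) x := rfl
  rw [this, mol_sum _ (fun i => (hψ.pd i).pd i) hg, lap_eq_sum_pd]
  exact Finset.sum_congr rfl fun i _ => by rw [pd_mol hψ hg, pd_mol (hψ.pd i) hg]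

lemma mol_continuousOn {s : Set ℝ} {g : ℝ → Eu n → ℝ} (hψ : IsTest ψ)
    (hg : ContinuousOn (fun q : ℝ × Eu n => g q.1 q.2) (s ×ˢ Set.univ)) :
    ContinuousOn (fun q : ℝ × Eu n => mol ψ (g q.1) q.2) (s ×ˢ Set.univ) := by
  unfold mol
  refine continuousOn_integral_of_compact_support hψ.supp
    (f := fun (q : ℝ × Eu n) z => ψ z * g q.1 (q.2 - z)) ?_ ?_
  · refine (hψ.smooth.continuous.comp continuous_snd).continuousOn.mul ?_
    exact hg.comp (f := fun q : (ℝ × Eu n) × Eu n => (q.1.1, q.1.2 - q.2)) (by fun_prop)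
      fun q hq => ⟨hq.1.1, trivial⟩
  · intro q z _ hz
    simp [image_eq_zero_of_notMem_tsupport hz]

lemma hasDerivAt_integral_test {U : Set ℝ} (hU : IsOpen U) {g g' : ℝ → Eu n → ℝ} (hψ : IsTest ψ)
    (hg : ContinuousOn (fun q : ℝ × Eu n => g q.1 q.2) (U ×ˢ Set.univ))
    (hg' : ContinuousOn (fun q : ℝ × Eu n => g' q.1 q.2) (U ×ˢ Set.univ))
    (hd : ∀ t ∈ U, ∀ y, HasDerivAt (fun t => g t y) (g' t y) t) {t : ℝ} (ht : t ∈ U) :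
    HasDerivAt (fun t => ∫ z, ψ z * g t z) (∫ z, ψ z * g' t z) t := by
  obtain ⟨ε, hε, hεU⟩ := Metric.isOpen_iff.1 hU t ht
  have hsub : Metric.closedBall t (ε / 2) ⊆ U :=
    (Metric.closedBall_subset_ball (by linarith)).trans hεU
  have cs : ∀ {G : ℝ → Eu n → ℝ},
      ContinuousOn (fun q : ℝ × Eu n => G q.1 q.2) (U ×ˢ Set.univ) →
      ∀ {t}, t ∈ U → Continuous (G t) := fun hG t ht => by
    rw [← continuousOn_univ]
    exact hG.comp (f := fun z => (t, z)) (by fun_prop) fun z _ => ⟨ht, trivial⟩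
  have hK : IsCompact (Metric.closedBall t (ε / 2) ×ˢ tsupport ψ) :=
    (isCompact_closedBall _ _).prod hψ.supp
  obtain ⟨C, hC⟩ := hK.exists_bound_of_continuousOn
    (hg'.mono (Set.prod_mono hsub (Set.subset_univ _)))
  refine (hasDerivAt_integral_of_dominated_loc_of_deriv_le (F := fun t z => ψ z * g t z)
    (F' := fun t z => ψ z * g' t z) (bound := fun z => ‖ψ z‖ * C)
    (Metric.closedBall_mem_nhds t (half_pos hε)) ?_ ?_ ?_ ?_ ?_ ?_).2
  · filter_upwards [hU.mem_nhds ht] with t ht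
    exact (hψ.integrable_mul (cs hg ht)).aestronglyMeasurable
  · exact hψ.integrable_mul (cs hg ht)
  · exact (hψ.integrable_mul (cs hg' ht)).aestronglyMeasurable
  · refine ae_of_all _ fun z t' ht' => ?_
    rw [norm_mul]
    by_cases hz : z ∈ tsupport ψ
    · exact mul_le_mul_of_nonneg_left (hC (t', z) ⟨ht', hz⟩) (norm_nonneg _)
    · simp [image_eq_zero_of_notMem_tsupport hz]
  · exact ((hψ.smooth.continuous.integrable_of_hasCompactSupport hψ.supp).norm).mul_const _
  · exact ae_of_all _ fun z t' ht' => (hd t' (hsub ht') z).const_mul _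

lemma mol_hasDerivAt {U : Set ℝ} (hU : IsOpen U) {g g' : ℝ → Eu n → ℝ} (hψ : IsTest ψ)
    (hg : ContinuousOn (fun q : ℝ × Eu n => g q.1 q.2) (U ×ˢ Set.univ))
    (hg' : ContinuousOn (fun q : ℝ × Eu n => g' q.1 q.2) (U ×ˢ Set.univ))
    (hd : ∀ t ∈ U, ∀ y, HasDerivAt (fun t => g t y) (g' t y) t) {t : ℝ} (ht : t ∈ U) (y : Eu n) :
    HasDerivAt (fun t => mol ψ (g t) y) (mol ψ (g' t) y) t := by
  simp only [mol_eq_swap]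
  exact hasDerivAt_integral_test hU (hψ.reflect y) hg hg' hd ht

lemma pd_mol_right (hψ : IsTest ψ) (hg : ContDiff ℝ ∞ g) (i : Fin n) :
    pd n i (mol ψ g) = mol ψ (pd n i g) := by
  ext y
  have h1 := hasDerivAt_line (contDiff_mol hψ hg.continuous) y i 0
  have h2 : HasDerivAt (fun t : ℝ => mol ψ g (y + t • stdBasis n i)) (mol ψ (pd n i g) y) 0 := by
    have := hasDerivAt_integral_test (U := Set.univ) isOpen_univ (ψ := ψ)
      (g := fun t z => g (y - z + t • stdBasis n i))
      (g' := fun t z => pd n i g (y - z + t • stdBasis n i)) hψ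
      (hg.continuous.comp (by fun_prop)).continuousOn
      ((contDiff_pd hg i).continuous.comp (by fun_prop)).continuousOn
      (fun t _ z => hasDerivAt_line hg _ i t) (Set.mem_univ (0 : ℝ))
    simp only [zero_smul, add_zero] at this
    convert this using 1
    · ext t
      simp only [mol]
      congr 1; ext z; congr 2; abel
    · rfl
  simp only [zero_smul, add_zero] at h1
  exact h1.unique h2

/-- A normalized bump function of radius `ε`. -/
lemma exists_bump (n : ℕ) {ε : ℝ} (hε : 0 < ε) : ∃ η : Eu n → ℝ, IsTest η ∧ (∀ x, 0 ≤ η x) ∧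
    ∀ (g : Eu n → ℝ) (x : Eu n) (σ : ℝ), Continuous g →
      (∀ z, dist z x < ε → |g z - g x| ≤ σ) → |mol η g x - g x| ≤ σ := by
  let φ : ContDiffBump (0 : Eu n) := ⟨ε / 2, ε, half_pos hε, by linarith⟩
  refine ⟨φ.normed volume, ⟨φ.contDiff_normed, φ.hasCompactSupport_normed⟩, φ.nonneg_normed,
    fun g x σ hg h => ?_⟩
  have := φ.dist_normed_convolution_le (μ := volume) (x₀ := x) (ε := σ)
    hg.aestronglyMeasurable fun z hz => by
      rw [Real.dist_eq]; exact h z hz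
  rw [Real.dist_eq] at this
  exact this

/-- Finitely many functions continuous on a cylinder are simultaneously approximated by
mollification. -/
lemma exists_bump_approx {ι : Type*} [Finite ι] {t0 T R σ : ℝ} (hσ : 0 < σ)
    {G : ι → ℝ → Eu n → ℝ}
    (hG : ∀ j, ContinuousOn (fun q : ℝ × Eu n => G j q.1 q.2) (Set.Icc t0 T ×ˢ Set.univ)) :
    ∃ η : Eu n → ℝ, IsTest η ∧ (∀ x, 0 ≤ η x) ∧ ∀ j, ∀ t ∈ Set.Icc t0 T, ∀ y : Eu n, ‖y‖ ≤ R →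
      |mol η (G j t) y - G j t y| ≤ σ := by
  have hK : IsCompact (Set.Icc t0 T ×ˢ Metric.closedBall (0 : Eu n) (R + 1)) :=
    isCompact_Icc.prod (isCompact_closedBall _ _)
  have h1 : ∀ j, ∃ δ > 0, δ ≤ 1 ∧ ∀ t ∈ Set.Icc t0 T, ∀ y : Eu n, ‖y‖ ≤ R → ∀ z, dist z y < δ →
      |G j t z - G j t y| ≤ σ := by
    intro j
    have hu := hK.uniformContinuousOn_of_continuous
      ((hG j).mono (Set.prod_mono subset_rfl (Set.subset_univ _)))
    obtain ⟨δ, hδ, h⟩ := Metric.uniformContinuousOn_iff.1 hu σ hσ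
    refine ⟨min δ 1, lt_min hδ one_pos, min_le_right _ _, fun t ht y hy z hz => ?_⟩
    have hz1 : dist z y < 1 := hz.trans_le (min_le_right _ _)
    have := h (t, z) ⟨ht, ?_⟩ (t, y) ⟨ht, ?_⟩ ?_
    · rw [Real.dist_eq] at this; exact this.le
    · rw [mem_closedBall_zero_iff]
      rw [dist_eq_norm] at hz1
      calc ‖z‖ = ‖(z - y) + y‖ := by simp
        _ ≤ ‖z - y‖ + ‖y‖ := norm_add_le _ _
        _ ≤ R + 1 := by linarith
    · rw [mem_closedBall_zero_iff]; linarith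
    · simp only [Prod.dist_eq, dist_self]
      exact max_lt hδ (hz.trans_le (min_le_left _ _))
  choose δ hδ0 hδ1 hδ using h1
  obtain ⟨ε, hε, hεδ⟩ : ∃ ε > 0, ∀ j, ε ≤ δ j := by
    have := Fintype.ofFinite ι
    rcases isEmpty_or_nonempty ι with h | h
    · exact ⟨1, one_pos, fun j => h.elim j⟩
    · exact ⟨Finset.univ.inf' Finset.univ_nonempty δ, by
        rw [gt_iff_lt, Finset.lt_inf'_iff]; exact fun j _ => hδ0 j,
        fun j => Finset.inf'_le _ (Finset.mem_univ j)⟩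
  obtain ⟨η, hη, hη0, h⟩ := exists_bump n hε
  refine ⟨η, hη, hη0, fun j t ht y hy => h _ y σ ?_ fun z hz =>
    hδ j t ht y hy z (hz.trans_le (hεδ j))⟩
  rw [← continuousOn_univ]
  exact (hG j).comp (f := fun z => (t, z)) (by fun_prop) fun z _ => ⟨ht, trivial⟩

end Mollify

/-- Radial profile of the Newtonian potential, as a function of the squared radius. -/
def kap (n : ℕ) (u : ℝ) : ℝ :=
  if n = 2 then Real.log u / 2 else u ^ (1 - (n : ℝ) / 2) / (2 - n)

/-- Regularised Newtonian potential, normalised to vanish on the unit sphere. -/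
def pot (n : ℕ) (δ : ℝ) (x : Eu n) : ℝ := kap n (δ ^ 2 + ‖x‖ ^ 2) - kap n (δ ^ 2 + 1)

section Potential

variable {n : ℕ}

lemma two_sub_ne (h : n ≠ 2) : (2 : ℝ) - n ≠ 0 := by
  rw [sub_ne_zero]; exact_mod_cast (Ne.symm h)

lemma hasDerivAt_kap (n : ℕ) {u : ℝ} (hu : 0 < u) :
    HasDerivAt (kap n) (u ^ (-(n : ℝ) / 2) / 2) u := by
  by_cases h : n = 2
  · subst h
    have h1 : kap 2 = fun u => Real.log u / 2 := by ext u; simp [kap]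
    rw [h1]
    have h2 := (Real.hasDerivAt_log hu.ne').div_const 2
    rwa [← Real.rpow_neg_one, show (-1 : ℝ) = -((2 : ℕ) : ℝ) / 2 by norm_num] at h2
  · have h1 : kap n = fun u : ℝ => u ^ (1 - (n : ℝ) / 2) / (2 - n) := by ext u; simp [kap, h]
    rw [h1]
    have h2 := (Real.hasDerivAt_rpow_const (p := 1 - (n : ℝ) / 2) (Or.inl hu.ne')).div_const
      (2 - (n : ℝ))
    have := two_sub_ne h
    rw [show 1 - (n : ℝ) / 2 - 1 = -(n : ℝ) / 2 by ring] at h2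
    have e : (1 - (n : ℝ) / 2) * u ^ (-(n : ℝ) / 2) / (2 - n) = u ^ (-(n : ℝ) / 2) / 2 := by
      field_simp
    rwa [e] at h2

lemma measurable_kap (n : ℕ) : Measurable (kap n) := by
  unfold kap
  split_ifs
  · exact Real.measurable_log.div_const 2
  · exact (measurable_id.pow_const _).div_const _

lemma contDiffAt_kap (n : ℕ) {u : ℝ} (hu : 0 < u) : ContDiffAt ℝ ∞ (kap n) u := by
  by_cases h : n = 2
  · have h1 : kap n = fun u => Real.log u / 2 := by ext u; simp [kap, h]
    rw [h1]
    exact (Real.contDiffAt_log.2 hu.ne').div_const 2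
  · have h1 : kap n = fun u : ℝ => u ^ (1 - (n : ℝ) / 2) / (2 - n) := by ext u; simp [kap, h]
    rw [h1]
    exact (Real.contDiffAt_rpow_const_of_ne hu.ne').div_const _

lemma kap_sq_diff (hn : 1 ≤ n) (δ : ℝ) {a b : ℝ} (ha : 0 < a) (hab : a ≤ b) :
    |kap n (δ ^ 2 + b ^ 2) - kap n (δ ^ 2 + a ^ 2)| ≤ a ^ (1 - (n : ℝ)) * (b - a) := by
  have hn' : (1 : ℝ) ≤ n := by exact_mod_cast hn
  have hd : ∀ t ∈ Set.Icc a b, HasDerivWithinAt (fun t => kap n (δ ^ 2 + t ^ 2))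
      ((δ ^ 2 + t ^ 2) ^ (-(n : ℝ) / 2) / 2 * (2 * t)) (Set.Icc a b) t := by
    intro t ht
    have ht0 : 0 < t := ha.trans_le ht.1
    have h1 : HasDerivAt (fun t : ℝ => δ ^ 2 + t ^ 2) (2 * t) t := by
      simpa using ((hasDerivAt_id t).pow 2).const_add (δ ^ 2)
    exact ((hasDerivAt_kap n (by positivity : 0 < δ ^ 2 + t ^ 2)).comp t h1).hasDerivWithinAt
  have := (convex_Icc a b).norm_image_sub_le_of_norm_hasDerivWithin_le (C := a ^ (1 - (n : ℝ)))
    hd ?_ (Set.left_mem_Icc.2 hab) (Set.right_mem_Icc.2 hab)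
  · rwa [Real.norm_eq_abs, Real.norm_of_nonneg (sub_nonneg.2 hab)] at this
  · intro t ht
    have ht0 : 0 < t := ha.trans_le ht.1
    rw [Real.norm_of_nonneg (by positivity)]
    calc (δ ^ 2 + t ^ 2) ^ (-(n : ℝ) / 2) / 2 * (2 * t)
        = (δ ^ 2 + t ^ 2) ^ (-(n : ℝ) / 2) * t := by ring
      _ ≤ (t ^ 2) ^ (-(n : ℝ) / 2) * t := by
          refine mul_le_mul_of_nonneg_right ?_ ht0.le
          exact Real.rpow_le_rpow_of_nonpos (by positivity) (by nlinarith [sq_nonneg δ])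
            (by linarith)
      _ = t ^ (1 - (n : ℝ)) := by
          rw [← Real.rpow_natCast, ← Real.rpow_mul ht0.le]
          nth_rewrite 2 [← Real.rpow_one t]
          rw [← Real.rpow_add ht0]
          congr 1; push_cast; ring
      _ ≤ a ^ (1 - (n : ℝ)) := Real.rpow_le_rpow_of_nonpos ha ht.1 (by linarith)

/-- Integrable majorant of the singular part of the potential. -/
def sing (n : ℕ) (x : Eu n) : ℝ := if ‖x‖ ≤ 1 then ‖x‖ ^ (1 - (n : ℝ)) else 0

lemma sing_nonneg (x : Eu n) : 0 ≤ sing n x := by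
  unfold sing; split_ifs <;> positivity

lemma integrable_sing (hn : 1 ≤ n) : Integrable (sing n) :=
  (radial_inside hn (by linarith) one_pos).1

lemma pot_bound (hn : 1 ≤ n) (δ : ℝ) {x : Eu n} (hx : x ≠ 0) :
    |pot n δ x| ≤ sing n x + ‖x‖ := by
  have hx0 : 0 < ‖x‖ := norm_pos_iff.2 hx
  unfold pot sing
  split_ifs with h
  · have h1 := kap_sq_diff hn δ hx0 h
    rw [one_pow, abs_sub_comm] at h1
    have : 0 ≤ ‖x‖ ^ (1 - (n : ℝ)) := by positivity
    nlinarith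
  · have h1 := kap_sq_diff hn δ one_pos (not_le.1 h).le
    rw [one_pow, Real.one_rpow] at h1
    linarith

lemma measurable_pot (δ : ℝ) : Measurable (pot n δ) := by
  unfold pot
  exact ((measurable_kap n).comp (by fun_prop)).sub_const _

lemma contDiff_pot {δ : ℝ} (hδ : 0 < δ) : ContDiff ℝ ∞ (pot n δ) := by
  refine ContDiff.sub ?_ contDiff_const
  rw [contDiff_iff_contDiffAt]
  intro x
  exact (contDiffAt_kap n (by positivity : 0 < δ ^ 2 + ‖x‖ ^ 2)).comp x
    (contDiff_const.add contDiff_normSq).contDiffAt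

lemma lap_pot {δ : ℝ} (hδ : 0 < δ) (x : Eu n) :
    lap n (pot n δ) x = n * δ ^ 2 * (δ ^ 2 + ‖x‖ ^ 2) ^ (-(n : ℝ) / 2 - 1) := by
  have hq : ∀ x : Eu n, 0 < δ ^ 2 + ‖x‖ ^ 2 := fun x => by positivity
  have sq : ContDiff ℝ ∞ (fun x : Eu n => δ ^ 2 + ‖x‖ ^ 2) := contDiff_const.add contDiff_normSq
  have pq : ∀ i : Fin n, pd n i (fun x : Eu n => δ ^ 2 + ‖x‖ ^ 2) = fun x => 2 * x i := fun i => by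
    rw [pd_add contDiff_const contDiff_normSq, pd_const, pd_normSq]; simp
  have h1 : ∀ i : Fin n, pd n i (pot n δ) = fun x => (δ ^ 2 + ‖x‖ ^ 2) ^ (-(n : ℝ) / 2) * x i := by
    intro i
    unfold pot
    have sk : ContDiff ℝ ∞ (fun x : Eu n => kap n (δ ^ 2 + ‖x‖ ^ 2)) := by
      rw [contDiff_iff_contDiffAt]
      intro x
      exact (contDiffAt_kap n (hq x)).comp x sq.contDiffAt
    rw [pd_sub sk contDiff_const, pd_const, pd_comp (h' := fun u => u ^ (-(n : ℝ) / 2) / 2) sq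
      fun y => hasDerivAt_kap n (hq y), pq]
    ext x; ring
  have h2 : ∀ i : Fin n, pd n i (pd n i (pot n δ)) x = (δ ^ 2 + ‖x‖ ^ 2) ^ (-(n : ℝ) / 2) -
      n * (δ ^ 2 + ‖x‖ ^ 2) ^ (-(n : ℝ) / 2 - 1) * x i ^ 2 := by
    intro i
    rw [h1, pd_mul (contDiff_rpow sq hq _) (contDiff_coord i), pd_coord, pd_rpow sq hq, pq]
    ring
  rw [lap_eq_sum_pd]
  simp only [h2]
  rw [Finset.sum_sub_distrib, ← Finset.mul_sum, sum_coord_sq]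
  simp only [Finset.sum_const, Finset.card_univ, Fintype.card_fin, nsmul_eq_mul]
  have h3 : (δ ^ 2 + ‖x‖ ^ 2) ^ (-(n : ℝ) / 2) =
      (δ ^ 2 + ‖x‖ ^ 2) ^ (-(n : ℝ) / 2 - 1) * (δ ^ 2 + ‖x‖ ^ 2) := by
    rw [← Real.rpow_add_one (hq x).ne']; congr 1; ring
  rw [h3]; ring

/-- Normalisation constant of the potential. -/
def potMass (n : ℕ) : ℝ := ∫ x : Eu n, n * (1 + ‖x‖ ^ 2) ^ (-(n : ℝ) / 2 - 1)

lemma integrable_potMass : Integrable fun x : Eu n => n * (1 + ‖x‖ ^ 2) ^ (-(n : ℝ) / 2 - 1) := by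
  have := integrable_add_normSq_rpow (n := n) (b := 1) (k := (n : ℝ) / 2 + 1) one_pos (by linarith)
  convert this.const_mul (n : ℝ) using 3 with x
  rw [add_comm]; congr 1; ring

lemma potMass_pos (hn : 1 ≤ n) : 0 < potMass n := by
  have hn' : (0 : ℝ) < n := by exact_mod_cast hn
  have hpos : ∀ x : Eu n, 0 < n * (1 + ‖x‖ ^ 2) ^ (-(n : ℝ) / 2 - 1) := fun x => by positivity
  unfold potMass
  rw [integral_pos_iff_support_of_nonneg (fun x => (hpos x).le) integrable_potMass]
  have : Function.support (fun x : Eu n => n * (1 + ‖x‖ ^ 2) ^ (-(n : ℝ) / 2 - 1)) = Set.univ :=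
    Set.eq_univ_of_forall fun x => (hpos x).ne'
  rw [this]
  exact NeZero.pos _

lemma IsTest.integrable_abs_mul_sing (hn : 1 ≤ n) {φ : Eu n → ℝ} (hφ : IsTest φ) :
    Integrable fun x => |φ x| * (sing n x + ‖x‖) := by
  simp only [mul_add]
  refine Integrable.add ?_ ?_
  · obtain ⟨C, hC⟩ := hφ.supp.exists_bound_of_continuous hφ.smooth.continuous
    exact (integrable_sing hn).bdd_mul (c := C)
      hφ.smooth.continuous.abs.aestronglyMeasurable (ae_of_all _ fun x => by simpa using hC x)
  · refine (hφ.smooth.continuous.abs.mul continuous_norm).integrable_of_hasCompactSupport ?_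
    exact (hφ.supp.comp_left (g := fun x : ℝ => |x|) abs_zero).mul_right

lemma tendsto_pot {x : Eu n} (hx : x ≠ 0) :
    Tendsto (fun j : ℕ => pot n (1 / ((j : ℝ) + 1)) x) atTop (𝓝 (pot n 0 x)) := by
  have hx0 : 0 < ‖x‖ := norm_pos_iff.2 hx
  have h1 : Tendsto (fun δ : ℝ => pot n δ x) (𝓝 0) (𝓝 (pot n 0 x)) := by
    have hc : ∀ r : ℝ, 0 < r → Tendsto (fun δ : ℝ => kap n (δ ^ 2 + r)) (𝓝 0)
        (𝓝 (kap n (0 ^ 2 + r))) := fun r hr => by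
      have h2 := (hasDerivAt_kap n (u := 0 ^ 2 + r) (by simpa using hr)).continuousAt
      exact h2.tendsto.comp (Continuous.tendsto (by fun_prop) 0)
    exact (hc _ (by positivity)).sub (hc 1 one_pos)
  exact h1.comp tendsto_one_div_add_atTop_nhds_zero_nat

/-- The potential is, up to normalisation, a fundamental solution. -/
lemma mol_lap_pot (hn : 1 ≤ n) {φ : Eu n → ℝ} (hφ : IsTest φ) (z : Eu n) :
    mol (lap n φ) (pot n 0) z = potMass n * φ z := by
  have := nontrivial_Eu hn
  have hM := potMass_pos hn
  have hlap := hφ.lap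
  have h1 : ∀ δ : ℝ, 0 < δ → mol (lap n φ) (pot n δ) z =
      ∫ x, φ x * (n * δ ^ 2 * (δ ^ 2 + ‖z - x‖ ^ 2) ^ (-(n : ℝ) / 2 - 1)) := by
    intro δ hδ
    have hs := contDiff_pot (n := n) hδ
    have : lap n (mol φ (pot n δ)) z = mol φ (lap n (pot n δ)) z := by
      rw [lap_eq_sum_pd]
      simp only [pd_mol_right hφ hs, pd_mol_right hφ (contDiff_pd hs _)]
      unfold mol
      simp only [lap_eq_sum_pd, Finset.mul_sum]
      rw [integral_finsetSum]
      exact fun i _ => hφ.integrable_mul (g := fun x => pd n i (pd n i (pot n δ)) (z - x))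
        (((contDiff_pd (contDiff_pd hs i) i).continuous).comp (continuous_const.sub continuous_id))
    rw [← lap_mol hφ hs.continuous, this]
    simp only [mol, lap_pot hδ]
  have h2 : Tendsto (fun j : ℕ => mol (lap n φ) (pot n (1 / ((j : ℝ) + 1))) z) atTop
      (𝓝 (mol (lap n φ) (pot n 0) z)) := by
    simp only [mol_eq_swap]
    refine tendsto_integral_of_dominated_convergence
      (fun x => |lap n φ (z - x)| * (sing n x + ‖x‖)) (fun j => ?_) ?_ (fun j => ?_) ?_
    · exact ((hlap.reflect z).smooth.continuous.aestronglyMeasurable).mul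
        (measurable_pot _).aestronglyMeasurable
    · exact (hlap.reflect z).integrable_abs_mul_sing hn
    · filter_upwards [compl_mem_ae_iff.2 (measure_singleton (0 : Eu n))] with x hx
      rw [norm_mul, Real.norm_eq_abs, Real.norm_eq_abs]
      exact mul_le_mul_of_nonneg_left (pot_bound hn _ hx) (abs_nonneg _)
    · filter_upwards [compl_mem_ae_iff.2 (measure_singleton (0 : Eu n))] with x hx
      exact (tendsto_pot (by simpa using hx)).const_mul _
  have h3 : Tendsto (fun c : ℝ => ∫ x, (c ^ n * (n * (1 + ‖c • (z - x)‖ ^ 2) ^ (-(n : ℝ) / 2 - 1) /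
      potMass n)) • φ x) atTop (𝓝 (φ z)) := by
    have := tendsto_integral_comp_smul_smul_of_integrable' (μ := (volume : Measure (Eu n)))
      (φ := fun x : Eu n => n * (1 + ‖x‖ ^ 2) ^ (-(n : ℝ) / 2 - 1) / potMass n) (g := φ) (x₀ := z)
      (fun x => by positivity) ?_ ?_
      (hφ.smooth.continuous.integrable_of_hasCompactSupport hφ.supp) hφ.smooth.continuous.continuousAt
    · simpa using this
    · rw [integral_div]; exact div_self hM.ne'
    · have : Tendsto (fun x : Eu n => n / potMass n * (‖x‖ ^ 2)⁻¹) (Bornology.cobounded (Eu n))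
          (𝓝 (n / potMass n * 0)) := by
        refine Tendsto.const_mul _ (tendsto_inv_atTop_zero.comp ?_)
        exact (tendsto_pow_atTop two_ne_zero).comp tendsto_norm_cobounded_atTop
      rw [mul_zero] at this
      refine squeeze_zero (fun x => by positivity) (fun x => ?_) this
      rcases eq_or_ne x 0 with rfl | hx
      · simp [show n ≠ 0 by lia]
      have hx0 : 0 < ‖x‖ := norm_pos_iff.2 hx
      have e1 : (1 + ‖x‖ ^ 2) ^ (-(n : ℝ) / 2 - 1) ≤ (‖x‖ ^ 2) ^ (-(n : ℝ) / 2 - 1) :=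
        Real.rpow_le_rpow_of_nonpos (by positivity) (by linarith)
          (by have : (0 : ℝ) ≤ n := n.cast_nonneg
              linarith)
      have e2 : ‖x‖ ^ n * (‖x‖ ^ 2) ^ (-(n : ℝ) / 2 - 1) = (‖x‖ ^ 2)⁻¹ := by
        rw [← Real.rpow_natCast ‖x‖ n, ← Real.rpow_natCast ‖x‖ 2, ← Real.rpow_mul hx0.le,
          ← Real.rpow_add hx0, ← Real.rpow_neg hx0.le]
        congr 1; push_cast; ring
      have e3 : Module.finrank ℝ (Eu n) = n := by simp
      rw [e3]
      calc ‖x‖ ^ n * (n * (1 + ‖x‖ ^ 2) ^ (-(n : ℝ) / 2 - 1) / potMass n)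
          = n / potMass n * (‖x‖ ^ n * (1 + ‖x‖ ^ 2) ^ (-(n : ℝ) / 2 - 1)) := by ring
        _ ≤ n / potMass n * (‖x‖ ^ n * (‖x‖ ^ 2) ^ (-(n : ℝ) / 2 - 1)) := by gcongr
        _ = _ := by rw [e2]
  have h4 : Tendsto (fun j : ℕ => mol (lap n φ) (pot n (1 / ((j : ℝ) + 1))) z) atTop
      (𝓝 (potMass n * φ z)) := by
    have hc : Tendsto (fun j : ℕ => (j : ℝ) + 1) atTop atTop :=
      tendsto_atTop_add_const_right _ _ tendsto_natCast_atTop_atTop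
    refine ((h3.comp hc).const_mul (potMass n)).congr fun j => ?_
    have hj : (0 : ℝ) < j + 1 := by positivity
    rw [h1 _ (by positivity), Function.comp, ← integral_const_mul]
    congr 1; ext x
    rw [norm_smul, Real.norm_of_nonneg hj.le, smul_eq_mul]
    set c := (j : ℝ) + 1
    have e : (1 / c) ^ 2 + ‖z - x‖ ^ 2 = (c ^ 2)⁻¹ * (1 + (c * ‖z - x‖) ^ 2) := by
      field_simp
    have e2 : ((c ^ 2)⁻¹ : ℝ) ^ (-(n : ℝ) / 2 - 1) = c ^ n * c ^ 2 := by
      rw [Real.inv_rpow (by positivity), ← Real.rpow_neg (by positivity), ← Real.rpow_natCast c 2,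
        ← Real.rpow_natCast c n, ← Real.rpow_mul hj.le, ← Real.rpow_add hj]
      congr 1; push_cast; ring
    rw [e, Real.mul_rpow (by positivity) (by positivity), e2]
    field_simp
  exact tendsto_nhds_unique h2 h4

end Potential

section PoissonSolution

variable {n : ℕ}

lemma add_normSq_le_mul {B R : ℝ} (hB : 0 < B) {x y : Eu n} (hy : ‖y‖ ≤ R) :
    ‖x‖ ^ 2 + B ≤ (2 + 2 * R ^ 2 / B) * (‖y - x‖ ^ 2 + B) := by
  have hR : 0 ≤ R := (norm_nonneg y).trans hy
  have h1 : ‖x‖ ≤ ‖y - x‖ + ‖y‖ := by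
    have := norm_sub_le (y - (y - x)) 0
    calc ‖x‖ = ‖y - (y - x)‖ := by simp
      _ ≤ ‖y‖ + ‖y - x‖ := norm_sub_le _ _
      _ = _ := add_comm _ _
  have h2 : ‖x‖ ^ 2 ≤ 2 * ‖y - x‖ ^ 2 + 2 * R ^ 2 := by
    have : ‖x‖ ≤ ‖y - x‖ + R := by linarith
    nlinarith [norm_nonneg x, norm_nonneg (y - x), sq_nonneg (‖y - x‖ - R)]
  have h3 : 0 ≤ 2 * R ^ 2 / B * ‖y - x‖ ^ 2 := by positivity
  have h4 : 2 * R ^ 2 / B * B = 2 * R ^ 2 := by field_simp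
  nlinarith

/-- Decay of `f` gives local-in-`y` uniform decay of its translates. -/
lemma translate_decay {B K k R : ℝ} (hB : 0 < B) (hK : 0 ≤ K) (hk : 0 ≤ k) {f : Eu n → ℝ}
    (hf : ∀ z, |f z| ≤ K * (‖z‖ ^ 2 + B) ^ (-k)) {x y : Eu n} (hy : ‖y‖ ≤ R) :
    |f (y - x)| ≤ K * (2 + 2 * R ^ 2 / B) ^ k * (‖x‖ ^ 2 + B) ^ (-k) := by
  refine (hf _).trans ?_
  rw [mul_assoc]
  refine mul_le_mul_of_nonneg_left ?_ hK
  have h1 : ((2 + 2 * R ^ 2 / B) * (‖y - x‖ ^ 2 + B)) ^ (-k) ≤ (‖x‖ ^ 2 + B) ^ (-k) :=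
    Real.rpow_le_rpow_of_nonpos (by positivity) (add_normSq_le_mul hB hy) (by linarith)
  rw [Real.mul_rpow (by positivity) (by positivity), Real.rpow_neg (by positivity)] at h1
  rw [← inv_mul_le_iff₀ (by positivity)]
  exact h1

lemma norm_mul_decay {B k : ℝ} (hB : 0 < B) (x : Eu n) :
    ‖x‖ * (‖x‖ ^ 2 + B) ^ (-k) ≤ (‖x‖ ^ 2 + B) ^ (-(k - 1 / 2)) := by
  have hX : 0 < ‖x‖ ^ 2 + B := by positivity
  have h1 : ‖x‖ ≤ (‖x‖ ^ 2 + B) ^ (1 / 2 : ℝ) := by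
    rw [← Real.sqrt_eq_rpow]
    exact Real.le_sqrt_of_sq_le (by linarith)
  calc ‖x‖ * (‖x‖ ^ 2 + B) ^ (-k) ≤ (‖x‖ ^ 2 + B) ^ (1 / 2 : ℝ) * (‖x‖ ^ 2 + B) ^ (-k) := by gcongr
    _ = _ := by rw [← Real.rpow_add hX]; congr 1; ring

lemma integrable_sing_mul_decay (hn : 1 ≤ n) {B k : ℝ} (hB : 0 < B) (hk : n + 1 < 2 * k) :
    Integrable fun x : Eu n => (sing n x + ‖x‖) * (‖x‖ ^ 2 + B) ^ (-k) := by
  have hn0 : (0 : ℝ) ≤ n := n.cast_nonneg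
  have hc : Continuous fun x : Eu n => (‖x‖ ^ 2 + B) ^ (-k) :=
    Continuous.rpow_const (by fun_prop) fun x => Or.inl (by positivity)
  simp only [add_mul]
  refine Integrable.add ?_ ?_
  · refine (integrable_sing hn).mul_bdd (c := B ^ (-k)) hc.aestronglyMeasurable
      (ae_of_all _ fun x => ?_)
    rw [Real.norm_of_nonneg (by positivity)]
    exact Real.rpow_le_rpow_of_nonpos hB (by linarith [sq_nonneg ‖x‖]) (by linarith)
  · refine (integrable_add_normSq_rpow (k := k - 1 / 2) hB (by linarith)).mono'
      (continuous_norm.mul hc).aestronglyMeasurable (ae_of_all _ fun x => ?_)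
    rw [Real.norm_of_nonneg (by positivity)]
    exact norm_mul_decay hB x

/-- The Newtonian potential of `f` (before normalisation). -/
def newt (f : Eu n → ℝ) (y : Eu n) : ℝ := ∫ x, pot n 0 x * f (y - x)

lemma newt_dominated (hn : 1 ≤ n) {B K k R : ℝ} (hB : 0 < B) (hK : 0 ≤ K) (hk : 0 ≤ k)
    {f : Eu n → ℝ} (hf : ∀ z, |f z| ≤ K * (‖z‖ ^ 2 + B) ^ (-k)) {y : Eu n} (hy : ‖y‖ ≤ R) :
    ∀ᵐ x : Eu n, ‖pot n 0 x * f (y - x)‖ ≤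
      K * (2 + 2 * R ^ 2 / B) ^ k * ((sing n x + ‖x‖) * (‖x‖ ^ 2 + B) ^ (-k)) := by
  have := nontrivial_Eu hn
  filter_upwards [compl_mem_ae_iff.2 (measure_singleton (0 : Eu n))] with x hx
  rw [norm_mul, Real.norm_eq_abs, Real.norm_eq_abs]
  calc |pot n 0 x| * |f (y - x)| ≤ (sing n x + ‖x‖) *
        (K * (2 + 2 * R ^ 2 / B) ^ k * (‖x‖ ^ 2 + B) ^ (-k)) := by
        have := sing_nonneg x
        exact mul_le_mul (pot_bound hn 0 hx) (translate_decay hB hK hk hf hy) (abs_nonneg _)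
          (by positivity)
    _ = _ := by ring

lemma integrable_newt (hn : 1 ≤ n) {B K k : ℝ} (hB : 0 < B) (hK : 0 ≤ K) (hk : n + 1 < 2 * k)
    {f : Eu n → ℝ} (hfc : Continuous f) (hf : ∀ z, |f z| ≤ K * (‖z‖ ^ 2 + B) ^ (-k)) (y : Eu n) :
    Integrable fun x => pot n 0 x * f (y - x) := by
  have hk0 : 0 ≤ k := by
    have : (0 : ℝ) ≤ n := n.cast_nonneg
    linarith
  exact ((integrable_sing_mul_decay hn hB hk).const_mul _).mono'
    ((measurable_pot 0).aestronglyMeasurable.mul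
      (hfc.comp (continuous_const.sub continuous_id)).aestronglyMeasurable)
    (newt_dominated hn hB hK hk0 hf le_rfl)

lemma newt_bound (hn : 1 ≤ n) {B K k : ℝ} (hB : 0 < B) (hK : 0 ≤ K) (hk : n + 1 < 2 * k) (R : ℝ)
    {f : Eu n → ℝ} (hf : ∀ z, |f z| ≤ K * (‖z‖ ^ 2 + B) ^ (-k)) :
    ∃ C, ∀ y : Eu n, ‖y‖ ≤ R → |newt f y| ≤ C := by
  have hk0 : 0 ≤ k := by
    have : (0 : ℝ) ≤ n := n.cast_nonneg
    linarith
  exact ⟨_, fun y hy => norm_integral_le_of_norm_le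
    ((integrable_sing_mul_decay hn hB hk).const_mul _) (newt_dominated hn hB hK hk0 hf hy)⟩

lemma continuous_newt (hn : 1 ≤ n) {B K k : ℝ} (hB : 0 < B) (hK : 0 ≤ K) (hk : n + 1 < 2 * k)
    {f : Eu n → ℝ} (hfc : Continuous f) (hf : ∀ z, |f z| ≤ K * (‖z‖ ^ 2 + B) ^ (-k)) :
    Continuous (newt f) := by
  have hk0 : 0 ≤ k := by
    have : (0 : ℝ) ≤ n := n.cast_nonneg
    linarith
  rw [continuous_iff_continuousAt]
  intro y0
  refine continuousAt_of_dominated (bound := fun x => K * (2 + 2 * (‖y0‖ + 1) ^ 2 / B) ^ k *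
    ((sing n x + ‖x‖) * (‖x‖ ^ 2 + B) ^ (-k))) ?_ ?_
    ((integrable_sing_mul_decay hn hB hk).const_mul _) ?_
  · exact Eventually.of_forall fun y => (integrable_newt hn hB hK hk hfc hf y).aestronglyMeasurable
  · filter_upwards [Metric.ball_mem_nhds y0 one_pos] with y hy
    refine newt_dominated hn hB hK hk0 hf ?_
    rw [Metric.mem_ball, dist_eq_norm] at hy
    calc ‖y‖ = ‖y0 + (y - y0)‖ := by simp
      _ ≤ ‖y0‖ + ‖y - y0‖ := norm_add_le _ _
      _ ≤ _ := by linarith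
  · exact ae_of_all _ fun x => by fun_prop

lemma newt_eq_swap (f : Eu n → ℝ) (y : Eu n) : newt f y = ∫ z, pot n 0 (y - z) * f z := by
  unfold newt
  rw [← integral_sub_left_eq_self _ volume y]
  simp

lemma pot_neg (δ : ℝ) (x : Eu n) : pot n δ (-x) = pot n δ x := by simp [pot]

/-- `newt f` solves Poisson's equation in the weak sense. -/
lemma integral_lap_mul_newt (hn : 1 ≤ n) {B K k : ℝ} (hB : 0 < B) (hK : 0 ≤ K)
    (hk : n + 1 < 2 * k) {f : Eu n → ℝ} (hfc : Continuous f)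
    (hf : ∀ z, |f z| ≤ K * (‖z‖ ^ 2 + B) ^ (-k)) {φ : Eu n → ℝ} (hφ : IsTest φ) :
    ∫ y, lap n φ y * newt f y = potMass n * ∫ z, φ z * f z := by
  have hnt := nontrivial_Eu hn
  have hlap := hφ.lap
  have hfi : Integrable f := by
    refine ((integrable_add_normSq_rpow (n := n) (k := k) hB (by linarith)).const_mul K).mono'
      hfc.aestronglyMeasurable (ae_of_all _ hf)
  have hfi1 : Integrable fun z : Eu n => ‖z‖ * f z := by
    refine ((integrable_add_normSq_rpow (n := n) (k := k - 1 / 2) hB (by linarith)).const_mul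
      K).mono' (continuous_norm.mul hfc).aestronglyMeasurable (ae_of_all _ fun z => ?_)
    rw [norm_mul, norm_norm, Real.norm_eq_abs]
    calc ‖z‖ * |f z| ≤ ‖z‖ * (K * (‖z‖ ^ 2 + B) ^ (-k)) := by gcongr; exact hf z
      _ = K * (‖z‖ * (‖z‖ ^ 2 + B) ^ (-k)) := by ring
      _ ≤ _ := by gcongr; exact norm_mul_decay hB z
  set c := |pot n 0 (0 : Eu n)|
  have hpot : ∀ x : Eu n, |pot n 0 x| ≤ sing n x + ‖x‖ + c := fun x => by
    rcases eq_or_ne x 0 with rfl | hx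
    · have := sing_nonneg (0 : Eu n)
      simp only [norm_zero]
      linarith
    · have := pot_bound hn 0 hx
      have : 0 ≤ c := abs_nonneg _
      linarith
  have hli : Integrable (fun y => |lap n φ y|) :=
    (hlap.smooth.continuous.integrable_of_hasCompactSupport hlap.supp).abs
  have hli1 : Integrable (fun y => |lap n φ y| * ‖y‖) :=
    (hlap.smooth.continuous.abs.mul continuous_norm).integrable_of_hasCompactSupport
      (hlap.supp.comp_left (g := fun x : ℝ => |x|) abs_zero).mul_right
  obtain ⟨C, hC⟩ := hlap.supp.exists_bound_of_continuous hlap.smooth.continuous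
  have i1 := (((hfi.abs.convolution_integrand (μ := volume) (ν := volume)
    (ContinuousLinearMap.mul ℝ ℝ) (integrable_sing hn))).bdd_mul (c := C)
    (f := fun q : Eu n × Eu n => |lap n φ q.1|)
    (hlap.smooth.continuous.comp continuous_fst).abs.aestronglyMeasurable
    (ae_of_all _ fun q => by simpa using hC q.1))
  have i2 := hli1.mul_prod hfi.abs
  have i3 := hli.mul_prod hfi1.abs
  have i4 := (hli.mul_prod hfi.abs).const_mul c
  have hint : Integrable (fun q : Eu n × Eu n => lap n φ q.1 * (pot n 0 (q.1 - q.2) * f q.2))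
      ((volume : Measure (Eu n)).prod volume) := by
    refine (((i1.add i2).add i3).add i4).mono' ?_ (ae_of_all _ fun q => ?_)
    · refine ((hlap.smooth.continuous.comp continuous_fst).aestronglyMeasurable).mul
        (AEStronglyMeasurable.mul ?_ (hfc.comp continuous_snd).aestronglyMeasurable)
      exact ((measurable_pot 0).comp (measurable_fst.sub measurable_snd)).aestronglyMeasurable
    · simp only [norm_mul, Real.norm_eq_abs, Pi.add_apply, ContinuousLinearMap.mul_apply', abs_mul,
        abs_norm]
      have h1 := hpot (q.1 - q.2)
      have h2 := norm_sub_le q.1 q.2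
      calc |lap n φ q.1| * (|pot n 0 (q.1 - q.2)| * |f q.2|)
          ≤ |lap n φ q.1| * ((sing n (q.1 - q.2) + (‖q.1‖ + ‖q.2‖) + c) * |f q.2|) := by
            gcongr; linarith
        _ = _ := by ring
  simp only [newt_eq_swap, ← integral_const_mul]
  rw [integral_integral_swap hint]
  congr 1; ext z
  have := mol_lap_pot hn hφ z
  unfold mol at this
  have e : ∫ y, lap n φ y * (pot n 0 (y - z) * f z) =
      (∫ y, lap n φ y * pot n 0 (z - y)) * f z := by
    rw [← integral_mul_const]
    congr 1; ext y
    rw [← pot_neg, neg_sub]; ring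
  rw [e, this]; ring

end PoissonSolution

section NewtonDecay

variable {n : ℕ}

lemma inner_eq_sum_coord (y z : Eu n) : inner ℝ y z = ∑ i, y i * z i := by
  simp [PiLp.inner_apply, mul_comm]

/-- Second-order Taylor bound for the Newtonian kernel away from the origin. -/
lemma pot_taylor (n : ℕ) {y z : Eu n} {r : ℝ} (hr : 0 < r) (hy : ‖y‖ = r) (hz : ‖z‖ ≤ r / 2) :
    |pot n 0 (y - z) - pot n 0 y + (r ^ 2) ^ (-(n : ℝ) / 2) * inner ℝ y z| ≤
      (n + 1) * (r / 2) ^ (-(n : ℝ)) * ‖z‖ ^ 2 := by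
  set A := inner ℝ y z
  set q : ℝ → ℝ := fun t => ‖y - t • z‖ ^ 2 with hq
  have hqe : ∀ t, q t = r ^ 2 - 2 * t * A + t ^ 2 * ‖z‖ ^ 2 := fun t => by
    simp only [hq, norm_sub_sq_real, inner_smul_right, norm_smul, mul_pow, Real.norm_eq_abs,
      sq_abs, hy, A]
    ring
  have hqd : ∀ t, HasDerivAt q (-2 * A + 2 * t * ‖z‖ ^ 2) t := fun t => by
    rw [show q = fun t => r ^ 2 - 2 * t * A + t ^ 2 * ‖z‖ ^ 2 from funext hqe]
    have := (((hasDerivAt_id t).const_mul 2).mul_const A).const_sub (r ^ 2) |>.add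
      (((hasDerivAt_id t).pow 2).mul_const (‖z‖ ^ 2))
    refine this.congr_deriv ?_
    simp
  have hqn : ∀ t ∈ Set.Icc (0 : ℝ) 1, (r / 2) ^ 2 ≤ q t := fun t ht => by
    have h1 : ‖t • z‖ ≤ r / 2 := by
      rw [norm_smul, Real.norm_of_nonneg ht.1]
      nlinarith [norm_nonneg z, ht.2]
    have h2 := norm_sub_norm_le y (t • z)
    simp only [hq]
    gcongr
    linarith
  have hq0 : ∀ t ∈ Set.Icc (0 : ℝ) 1, 0 < q t := fun t ht =>
    lt_of_lt_of_le (by positivity) (hqn t ht)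
  have hq' : ∀ t, (-2 * A + 2 * t * ‖z‖ ^ 2) ^ 2 ≤ 4 * q t * ‖z‖ ^ 2 := fun t => by
    have h1 : -2 * A + 2 * t * ‖z‖ ^ 2 = -2 * inner ℝ (y - t • z) z := by
      rw [inner_sub_left, real_inner_smul_left, real_inner_self_eq_norm_sq]
      ring
    have h2 := abs_real_inner_le_norm (y - t • z) z
    have h3 := sq_le_sq' (by linarith [neg_abs_le (inner ℝ (y - t • z) z)]) ((le_abs_self _).trans h2)
    rw [h1]
    simp only [hq]
    nlinarith
  set M := ((n : ℝ) + 1) * (r / 2) ^ (-(n : ℝ)) * ‖z‖ ^ 2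
  set g' : ℝ → ℝ := fun t => q t ^ (-(n : ℝ) / 2) / 2 * (-2 * A + 2 * t * ‖z‖ ^ 2) with hg'
  have hM : 0 ≤ M := by positivity
  have key : ∀ t ∈ Set.Icc (0 : ℝ) 1, ‖g' t - g' 0‖ ≤ M * (t - 0) := by
    refine norm_image_sub_le_of_norm_deriv_le_segment'
      (f' := fun t => (-(n : ℝ) / 4) * q t ^ (-(n : ℝ) / 2 - 1) * (-2 * A + 2 * t * ‖z‖ ^ 2) ^ 2 +
        q t ^ (-(n : ℝ) / 2) * ‖z‖ ^ 2) (fun t ht => ?_) fun t ht => ?_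
    · have h1 := (hqd t).rpow_const (p := -(n : ℝ) / 2) (Or.inl (hq0 t ht).ne')
      have h2 : HasDerivAt (fun t : ℝ => -2 * A + 2 * t * ‖z‖ ^ 2) (2 * ‖z‖ ^ 2) t := by
        have := (((hasDerivAt_id t).const_mul 2).mul_const (‖z‖ ^ 2)).const_add (-2 * A)
        simpa using this
      have := ((h1.div_const 2).mul h2).hasDerivWithinAt (s := Set.Icc 0 1)
      refine this.congr_deriv ?_
      ring
    · have ht' : t ∈ Set.Icc (0 : ℝ) 1 := ⟨ht.1, ht.2.le⟩
      have hpos := hq0 t ht'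
      have e : q t ^ (-(n : ℝ) / 2 - 1) * q t = q t ^ (-(n : ℝ) / 2) := by
        rw [← Real.rpow_add_one hpos.ne']; congr 1; ring
      have h4 : q t ^ (-(n : ℝ) / 2) ≤ (r / 2) ^ (-(n : ℝ)) := by
        calc q t ^ (-(n : ℝ) / 2) ≤ ((r / 2) ^ 2) ^ (-(n : ℝ) / 2) :=
              Real.rpow_le_rpow_of_nonpos (by positivity) (hqn t ht')
                (by have : (0 : ℝ) ≤ n := n.cast_nonneg
                    linarith)
          _ = _ := by
            rw [← Real.rpow_natCast, ← Real.rpow_mul (by positivity)]; congr 1; push_cast; ring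
      rw [Real.norm_eq_abs]
      have h5 : 0 ≤ q t ^ (-(n : ℝ) / 2 - 1) := by positivity
      have h6 : q t ^ (-(n : ℝ) / 2 - 1) * (-2 * A + 2 * t * ‖z‖ ^ 2) ^ 2 ≤
          4 * q t ^ (-(n : ℝ) / 2) * ‖z‖ ^ 2 := by
        rw [← e]
        nlinarith [mul_le_mul_of_nonneg_left (hq' t) h5]
      have h7 : 0 ≤ q t ^ (-(n : ℝ) / 2 - 1) * (-2 * A + 2 * t * ‖z‖ ^ 2) ^ 2 := by positivity
      have h8 : q t ^ (-(n : ℝ) / 2) * ‖z‖ ^ 2 ≤ (r / 2) ^ (-(n : ℝ)) * ‖z‖ ^ 2 := by gcongr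
      have h9 : 0 ≤ q t ^ (-(n : ℝ) / 2) * ‖z‖ ^ 2 := by positivity
      have hn0 : (0 : ℝ) ≤ n := n.cast_nonneg
      have h10 := mul_le_mul_of_nonneg_left h6 hn0
      have h11 := mul_nonneg hn0 h7
      have h12 := mul_le_mul_of_nonneg_left h8 hn0
      have h13 : M = n * ((r / 2) ^ (-(n : ℝ)) * ‖z‖ ^ 2) + (r / 2) ^ (-(n : ℝ)) * ‖z‖ ^ 2 := by
        simp only [M]; ring
      have h14 := mul_nonneg hn0 h9
      rw [abs_le]
      constructor <;> nlinarith
  have fin := norm_image_sub_le_of_norm_deriv_le_segment_01'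
    (f := fun t => kap n (q t) - t * g' 0) (f' := fun t => g' t - g' 0) (C := M)
    (fun t ht => by
      have h1 := ((hasDerivAt_kap n (hq0 t ht)).comp t (hqd t)).sub
        ((hasDerivAt_id t).mul_const (g' 0))
      refine (h1.congr_deriv ?_).hasDerivWithinAt
      simp [hg'])
    (fun t ht => (key t ⟨ht.1, ht.2.le⟩).trans (by nlinarith [ht.1, ht.2]))
  have e0 : q 0 = r ^ 2 := by simp [hqe]
  rw [Real.norm_eq_abs] at fin
  convert fin using 2
  simp only [hg', e0, pot, hy]
  simp only [hq, one_smul, one_mul, zero_mul, mul_zero]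
  ring_nf

lemma pot_sub_bound (hn : 1 ≤ n) {u v : Eu n} (hu : u ≠ 0) (hv : v ≠ 0) :
    |pot n 0 u - pot n 0 v| ≤ (‖u‖ ^ (1 - (n : ℝ)) + ‖v‖ ^ (1 - (n : ℝ))) * ‖u - v‖ := by
  have hu0 : 0 < ‖u‖ := norm_pos_iff.2 hu
  have hv0 : 0 < ‖v‖ := norm_pos_iff.2 hv
  have hU : 0 ≤ ‖u‖ ^ (1 - (n : ℝ)) := by positivity
  have hV : 0 ≤ ‖v‖ ^ (1 - (n : ℝ)) := by positivity
  have h1 := norm_sub_norm_le u v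
  have h2 := norm_sub_norm_le v u
  rw [norm_sub_rev] at h2
  have hd := norm_nonneg (u - v)
  simp only [pot, sub_sub_sub_cancel_right]
  rcases le_total ‖u‖ ‖v‖ with h | h
  · have := kap_sq_diff hn 0 hu0 h
    rw [abs_sub_comm]
    refine this.trans ?_
    calc ‖u‖ ^ (1 - (n : ℝ)) * (‖v‖ - ‖u‖) ≤ ‖u‖ ^ (1 - (n : ℝ)) * ‖u - v‖ := by gcongr
      _ ≤ _ := by gcongr; linarith
  · have := kap_sq_diff hn 0 hv0 h
    refine this.trans ?_
    calc ‖v‖ ^ (1 - (n : ℝ)) * (‖u‖ - ‖v‖) ≤ ‖v‖ ^ (1 - (n : ℝ)) * ‖u - v‖ := by gcongr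
      _ ≤ _ := by gcongr; linarith

/-- Pointwise bound for the twice-subtracted Newtonian integrand. -/
lemma newt_integrand_bound (hn : 1 ≤ n) {p K : ℝ} (hp : 0 < p) (hK : 0 ≤ K) {y z : Eu n} {r c : ℝ}
    (hr : 0 < r) (hy : ‖y‖ = r) (hz0 : z ≠ 0) (hzy : z ≠ y)
    (hc : |c| ≤ K * ‖z‖ ^ (-(n + 1 + p / 2))) :
    |(pot n 0 (y - z) - pot n 0 y + (r ^ 2) ^ (-(n : ℝ) / 2) * inner ℝ y z) * c| ≤
      K * ((n + 1) * (r / 2) ^ (-(n : ℝ)) *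
          (if ‖z‖ ≤ r / 2 then ‖z‖ ^ (1 - n - p / 2) else 0) +
        (r / 2) ^ (-(n + p / 2)) * (if ‖y - z‖ ≤ r then ‖y - z‖ ^ (1 - (n : ℝ)) else 0) +
        3 * r ^ (1 - (n : ℝ)) * (if r / 2 < ‖z‖ then ‖z‖ ^ (-(n + p / 2)) else 0)) := by
  have hz : 0 < ‖z‖ := norm_pos_iff.2 hz0
  have hyz : 0 < ‖y - z‖ := norm_pos_iff.2 (sub_ne_zero.2 hzy.symm)
  have hn' : (1 : ℝ) ≤ n := by exact_mod_cast hn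
  have hi : 0 ≤ (if ‖y - z‖ ≤ r then ‖y - z‖ ^ (1 - (n : ℝ)) else 0) := by
    split_ifs <;> positivity
  rw [abs_mul]
  rcases le_or_gt ‖z‖ (r / 2) with h | h
  · rw [if_pos h, if_neg h.not_gt]
    have h1 := pot_taylor n hr hy h
    have e : ‖z‖ ^ 2 * ‖z‖ ^ (-(n + 1 + p / 2)) = ‖z‖ ^ (1 - n - p / 2) := by
      rw [← Real.rpow_natCast, ← Real.rpow_add hz]; congr 1; push_cast; ring
    calc _ ≤ ((n + 1) * (r / 2) ^ (-(n : ℝ)) * ‖z‖ ^ 2) * (K * ‖z‖ ^ (-(n + 1 + p / 2))) := by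
          gcongr
      _ = K * ((n + 1) * (r / 2) ^ (-(n : ℝ)) * (‖z‖ ^ 2 * ‖z‖ ^ (-(n + 1 + p / 2)))) := by ring
      _ ≤ _ := by
        rw [e, mul_zero, add_zero]
        gcongr
        linarith [mul_nonneg (show 0 ≤ (r / 2) ^ (-(n + p / 2)) by positivity) hi]
  · rw [if_neg h.not_ge, if_pos h]
    have hy0 : y ≠ 0 := norm_pos_iff.1 (hy ▸ hr)
    have h1 := pot_sub_bound hn (sub_ne_zero.2 hzy.symm) hy0
    rw [show y - z - y = -z by abel, norm_neg, hy] at h1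
    have h2 : |(r ^ 2) ^ (-(n : ℝ) / 2) * inner ℝ y z| ≤ r ^ (1 - (n : ℝ)) * ‖z‖ := by
      rw [abs_mul, abs_of_nonneg (by positivity)]
      have e : (r ^ 2) ^ (-(n : ℝ) / 2) * r = r ^ (1 - (n : ℝ)) := by
        rw [← Real.rpow_natCast, ← Real.rpow_mul hr.le, ← Real.rpow_add_one hr.ne']
        congr 1; push_cast; ring
      rw [← e, mul_assoc]
      have := abs_real_inner_le_norm y z
      rw [hy] at this
      gcongr
    have h3 : |pot n 0 (y - z) - pot n 0 y + (r ^ 2) ^ (-(n : ℝ) / 2) * inner ℝ y z| ≤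
        (‖y - z‖ ^ (1 - (n : ℝ)) + 2 * r ^ (1 - (n : ℝ))) * ‖z‖ := by
      refine (abs_add_le _ _).trans ?_
      linarith
    have e : ‖z‖ * ‖z‖ ^ (-(n + 1 + p / 2)) = ‖z‖ ^ (-(n + p / 2)) := by
      rw [mul_comm, ← Real.rpow_add_one hz.ne']; congr 1; ring
    have h4 : ‖y - z‖ ^ (1 - (n : ℝ)) * ‖z‖ ^ (-(n + p / 2)) ≤
        (r / 2) ^ (-(n + p / 2)) * (if ‖y - z‖ ≤ r then ‖y - z‖ ^ (1 - (n : ℝ)) else 0) +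
          r ^ (1 - (n : ℝ)) * ‖z‖ ^ (-(n + p / 2)) := by
      rcases le_or_gt ‖y - z‖ r with h5 | h5
      · rw [if_pos h5]
        have : ‖z‖ ^ (-(n + p / 2)) ≤ (r / 2) ^ (-(n + p / 2)) :=
          Real.rpow_le_rpow_of_nonpos (by positivity) h.le (by linarith)
        calc _ ≤ ‖y - z‖ ^ (1 - (n : ℝ)) * (r / 2) ^ (-(n + p / 2)) := by gcongr
          _ = (r / 2) ^ (-(n + p / 2)) * ‖y - z‖ ^ (1 - (n : ℝ)) := mul_comm _ _
          _ ≤ _ := le_add_of_nonneg_right (by positivity)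
      · rw [if_neg h5.not_ge, mul_zero, zero_add]
        gcongr ?_ * _
        exact Real.rpow_le_rpow_of_nonpos hr h5.le (by linarith)
    calc _ ≤ ((‖y - z‖ ^ (1 - (n : ℝ)) + 2 * r ^ (1 - (n : ℝ))) * ‖z‖) *
          (K * ‖z‖ ^ (-(n + 1 + p / 2))) := by gcongr
      _ = K * (‖y - z‖ ^ (1 - (n : ℝ)) * ‖z‖ ^ (-(n + p / 2)) +
          2 * r ^ (1 - (n : ℝ)) * ‖z‖ ^ (-(n + p / 2))) := by rw [← e]; ring
      _ ≤ _ := by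
        refine mul_le_mul_of_nonneg_left ?_ hK
        rw [mul_zero, zero_add]
        linarith

/-- Two vanishing moments give fast decay of the Newtonian potential. -/
lemma newt_decay (hn : 1 ≤ n) {p B K : ℝ} (hp : 0 < p) (hp2 : p < 2) (hB : 0 < B) (hK : 0 ≤ K)
    {f : Eu n → ℝ} (hfc : Continuous f)
    (hf : ∀ z, |f z| ≤ K * (‖z‖ ^ 2 + B) ^ (-((n + 1 + p / 2) / 2)))
    (h0 : ∫ z, f z = 0) (h1 : ∀ i, ∫ z : Eu n, z i * f z = 0) :
    ∃ C, 0 ≤ C ∧ ∀ y, |newt f y| ≤ C * (‖y‖ ^ 2 + B) ^ (-((n - 1 + p / 2) / 2)) := by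
  have hnt := nontrivial_Eu hn
  have hn' : (1 : ℝ) ≤ n := by exact_mod_cast hn
  have hk : (n : ℝ) + 1 < 2 * ((n + 1 + p / 2) / 2) := by linarith
  set α := ((n : ℝ) - 1 + p / 2) / 2 with hα
  have hα0 : 0 < α := by simp only [hα]; linarith
  obtain ⟨C0, hC0⟩ := newt_bound hn hB hK hk 1 hf
  have hfi : Integrable f :=
    ((integrable_add_normSq_rpow (n := n) hB (by linarith)).const_mul K).mono'
      hfc.aestronglyMeasurable (ae_of_all _ hf)
  have hfi1 : ∀ i, Integrable fun z : Eu n => z i * f z := fun i => by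
    refine ((integrable_add_normSq_rpow (n := n) (k := (n + 1 + p / 2) / 2 - 1 / 2) hB
      (by linarith)).const_mul K).mono'
      (by fun_prop) (ae_of_all _ fun z => ?_)
    rw [norm_mul]
    have hz := PiLp.norm_apply_le z i
    calc ‖z i‖ * ‖f z‖ ≤ ‖z‖ * (K * (‖z‖ ^ 2 + B) ^ (-((n + 1 + p / 2) / 2))) := by
          gcongr; exact hf z
      _ = K * (‖z‖ * (‖z‖ ^ 2 + B) ^ (-((n + 1 + p / 2) / 2))) := by ring
      _ ≤ _ := by gcongr; exact norm_mul_decay hB z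
  set A1 := (n + 1) * (2 : ℝ) ^ (n : ℝ) * (sphArea n * ((1 / 2) ^ (1 - p / 2) / (1 - p / 2)))
  set A2 := (2 : ℝ) ^ (n + p / 2) * sphArea n
  set A3 := 3 * (sphArea n * ((1 / 2) ^ (-(p / 2)) / (p / 2)))
  have hS := sphArea_nonneg n
  have hp2' : 0 < 1 - p / 2 := by linarith
  set C1 := K * (A1 + A2 + A3)
  have hC1 : 0 ≤ C1 := by positivity
  have far : ∀ y : Eu n, 1 ≤ ‖y‖ → |newt f y| ≤ C1 * ‖y‖ ^ (-(2 * α)) := by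
    intro y hy
    obtain ⟨r, hyr⟩ : ∃ r, ‖y‖ = r := ⟨_, rfl⟩
    have hr : 0 < r := by linarith
    have i1 := radial_inside hn (a := 1 - n - p / 2) (R := r / 2) (by linarith) (by positivity)
    have i2 := radial_inside hn (a := 1 - n) (R := r) (by linarith) hr
    have i3 := radial_outside hn (a := -(n + p / 2)) (R := r / 2) (by linarith) (by positivity)
    have i2' : Integrable (fun z : Eu n => if ‖y - z‖ ≤ r then ‖y - z‖ ^ (1 - (n : ℝ)) else 0) :=
      i2.1.comp_sub_left y
    have i2'' : ∫ z : Eu n, (if ‖y - z‖ ≤ r then ‖y - z‖ ^ (1 - (n : ℝ)) else 0) =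
        sphArea n * (r ^ (1 - (n : ℝ) + n) / (1 - n + n)) := by
      rw [← i2.2]
      exact integral_sub_left_eq_self (fun z : Eu n => if ‖z‖ ≤ r then ‖z‖ ^ (1 - (n : ℝ)) else 0)
        volume y
    have hI : newt f y = ∫ z, (pot n 0 (y - z) - pot n 0 y +
        (r ^ 2) ^ (-(n : ℝ) / 2) * inner ℝ y z) * f z := by
      have hin := (integrable_newt hn hB hK hk hfc hf y).comp_sub_left y
      simp only [sub_sub_cancel] at hin
      have e2 : ∫ z, (inner ℝ y z) * f z = 0 := by
        simp only [inner_eq_sum_coord, Finset.sum_mul, mul_assoc]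
        rw [integral_finsetSum _ fun i _ => (hfi1 i).const_mul _]
        refine Finset.sum_eq_zero fun i _ => ?_
        rw [integral_const_mul, h1, mul_zero]
      have hin2 : Integrable fun z => (inner ℝ y z) * f z := by
        simp only [inner_eq_sum_coord, Finset.sum_mul, mul_assoc]
        exact integrable_finsetSum _ fun i _ => (hfi1 i).const_mul _
      simp only [add_mul, sub_mul, mul_assoc]
      have hd : Integrable fun z => pot n 0 (y - z) * f z - pot n 0 y * f z :=
        hin.sub (hfi.const_mul _)
      rw [integral_add hd (hin2.const_mul _),
        integral_sub hin (hfi.const_mul _), integral_const_mul, integral_const_mul, h0, e2,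
        newt_eq_swap]
      ring
    rw [hI]
    have hb := norm_integral_le_of_norm_le (μ := volume)
      (f := fun z => (pot n 0 (y - z) - pot n 0 y +
        (r ^ 2) ^ (-(n : ℝ) / 2) * inner ℝ y z) * f z)
      (((((i1.1.const_mul ((n + 1) * (r / 2) ^ (-(n : ℝ)))).add
        (i2'.const_mul ((r / 2) ^ (-(n + p / 2))))).add
        (i3.1.const_mul (3 * r ^ (1 - (n : ℝ))))).const_mul K)) (by
        filter_upwards [compl_mem_ae_iff.2 (measure_singleton (0 : Eu n)),
          compl_mem_ae_iff.2 (measure_singleton y)] with z hz hzy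
        refine newt_integrand_bound hn hp hK hr hyr hz hzy ((hf z).trans ?_)
        have hz0 : 0 < ‖z‖ := norm_pos_iff.2 hz
        gcongr
        calc (‖z‖ ^ 2 + B) ^ (-((n + 1 + p / 2) / 2)) ≤ (‖z‖ ^ 2) ^ (-((n + 1 + p / 2) / 2)) :=
              Real.rpow_le_rpow_of_nonpos (by positivity) (by linarith) (by linarith)
          _ = _ := by
            rw [← Real.rpow_natCast, ← Real.rpow_mul hz0.le]; congr 1; push_cast; ring)
    refine hb.trans (le_of_eq ?_)
    rw [integral_const_mul]
    simp only [Pi.add_apply]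
    have hd : Integrable fun z : Eu n => (n + 1) * (r / 2) ^ (-(n : ℝ)) *
        (if ‖z‖ ≤ r / 2 then ‖z‖ ^ (1 - n - p / 2) else 0) + (r / 2) ^ (-(n + p / 2)) *
        (if ‖y - z‖ ≤ r then ‖y - z‖ ^ (1 - (n : ℝ)) else 0) :=
      (i1.1.const_mul _).add (i2'.const_mul _)
    rw [integral_add hd (i3.1.const_mul _),
      integral_add (i1.1.const_mul _) (i2'.const_mul _), integral_const_mul, integral_const_mul,
      integral_const_mul, i1.2, i2'', i3.2, hyr]
    simp only [C1]
    have hsp : ∀ a : ℝ, (r / 2) ^ a = r ^ a * (1 / 2) ^ a := fun a => by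
      rw [div_eq_mul_one_div, Real.mul_rpow hr.le (by norm_num)]
    have h2n : ∀ a : ℝ, (1 / 2 : ℝ) ^ (-a) = 2 ^ a := fun a => by
      rw [one_div, Real.inv_rpow (by norm_num), Real.rpow_neg (by norm_num), inv_inv]
    have e1 : (r / 2) ^ (-(n : ℝ)) * (r / 2) ^ (1 - n - p / 2 + (n : ℝ)) =
        2 ^ (n : ℝ) * (1 / 2) ^ (1 - p / 2) * r ^ (-(2 * α)) := by
      rw [show r ^ (-(2 * α)) = r ^ (-(n : ℝ)) * r ^ (1 - p / 2) by
          rw [← Real.rpow_add hr]; congr 1; simp only [hα]; ring,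
        show (1 - n - p / 2 + (n : ℝ)) = 1 - p / 2 by ring, hsp, hsp, h2n]
      ring
    have e2 : (r / 2) ^ (-(n + p / 2)) * r ^ (1 - (n : ℝ) + n) =
        2 ^ (n + p / 2) * r ^ (-(2 * α)) := by
      rw [show r ^ (-(2 * α)) = r ^ (-(n + p / 2)) * r ^ (1 - (n : ℝ) + n) by
          rw [← Real.rpow_add hr]; congr 1; simp only [hα]; ring, hsp, h2n]
      ring
    have e3 : r ^ (1 - (n : ℝ)) * (r / 2) ^ (-(n + p / 2) + (n : ℝ)) =
        (1 / 2) ^ (-(p / 2)) * r ^ (-(2 * α)) := by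
      rw [show r ^ (-(2 * α)) = r ^ (1 - (n : ℝ)) * r ^ (-(p / 2)) by
          rw [← Real.rpow_add hr]; congr 1; simp only [hα]; ring,
        show (-(n + p / 2) + (n : ℝ)) = -(p / 2) by ring, hsp]
      ring
    have f1 : (1 - n - p / 2 + (n : ℝ)) = 1 - p / 2 := by ring
    have f2 : (1 - (n : ℝ) + n) = 1 := by ring
    have f3 : -(-(n + p / 2) + (n : ℝ)) = p / 2 := by ring
    have t1 : (n + 1) * (r / 2) ^ (-(n : ℝ)) * (sphArea n * ((r / 2) ^ (1 - n - p / 2 + (n : ℝ)) /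
        (1 - n - p / 2 + (n : ℝ)))) = A1 * r ^ (-(2 * α)) := by
      calc _ = (n + 1) * sphArea n * ((r / 2) ^ (-(n : ℝ)) *
            (r / 2) ^ (1 - n - p / 2 + (n : ℝ))) / (1 - n - p / 2 + (n : ℝ)) := by ring
        _ = _ := by rw [e1, f1]; simp only [A1]; ring
    have t2 : (r / 2) ^ (-(n + p / 2)) * (sphArea n * (r ^ (1 - (n : ℝ) + n) / (1 - (n : ℝ) + n))) =
        A2 * r ^ (-(2 * α)) := by
      calc _ = sphArea n * ((r / 2) ^ (-(n + p / 2)) * r ^ (1 - (n : ℝ) + n)) /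
              (1 - (n : ℝ) + n) := by ring
        _ = _ := by rw [e2, f2]; simp only [A2]; ring
    have t3 : 3 * r ^ (1 - (n : ℝ)) * (sphArea n * ((r / 2) ^ (-(n + p / 2) + (n : ℝ)) /
        -(-(n + p / 2) + (n : ℝ)))) = A3 * r ^ (-(2 * α)) := by
      calc _ = 3 * sphArea n * (r ^ (1 - (n : ℝ)) * (r / 2) ^ (-(n + p / 2) + (n : ℝ))) /
            (-(-(n + p / 2) + (n : ℝ))) := by ring
        _ = _ := by rw [e3, f3]; simp only [A3]; ring
    rw [t1, t2, t3]
    ring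
  refine ⟨(|C0| + C1) * (1 + B) ^ α, by positivity, fun y => ?_⟩
  have key : ∀ t : ℝ, 0 < t → ‖y‖ ^ 2 ≤ t ^ 2 → 1 ≤ t →
      t ^ (-(2 * α)) ≤ (1 + B) ^ α * (‖y‖ ^ 2 + B) ^ (-α) := by
    intro t ht hyt ht1
    have h3 : ‖y‖ ^ 2 + B ≤ (1 + B) * t ^ 2 := by
      nlinarith [mul_nonneg hB.le (show 0 ≤ t ^ 2 - 1 by nlinarith)]
    have h4 : ((1 + B) * t ^ 2) ^ (-α) ≤ (‖y‖ ^ 2 + B) ^ (-α) :=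
      Real.rpow_le_rpow_of_nonpos (by positivity) h3 (by linarith)
    rw [Real.mul_rpow (by positivity) (by positivity), Real.rpow_neg (by positivity),
      ← Real.rpow_natCast, ← Real.rpow_mul ht.le, inv_mul_le_iff₀ (by positivity)] at h4
    rwa [show -(2 * α) = ((2 : ℕ) : ℝ) * -α by push_cast; ring]
  rw [mul_assoc]
  rcases le_total ‖y‖ 1 with h | h
  · have h5 := key 1 one_pos (by nlinarith [norm_nonneg y]) le_rfl
    rw [Real.one_rpow] at h5
    calc |newt f y| ≤ |C0| + C1 := by linarith [hC0 y h, le_abs_self C0]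
      _ = (|C0| + C1) * 1 := (mul_one _).symm
      _ ≤ _ := by gcongr
  · have h5 := key ‖y‖ (by linarith) le_rfl h
    calc |newt f y| ≤ C1 * ‖y‖ ^ (-(2 * α)) := far y h
      _ ≤ (|C0| + C1) * ‖y‖ ^ (-(2 * α)) := by gcongr; linarith [abs_nonneg C0]
      _ ≤ _ := by gcongr

end NewtonDecay

/-- Time dilation factor. -/
def th (p τ : ℝ) : ℝ := 1 + 2 * p * τ

/-- Squared length scale of the Barenblatt solution. -/
def Sc (n : ℕ) (p τ : ℝ) : ℝ := th p τ ^ ((p + n) / p)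

/-- The weight `|y|² + B S(τ)`. -/
def XX (n : ℕ) (p B τ : ℝ) (y : Eu n) : ℝ := ‖y‖ ^ 2 + B * Sc n p τ

/-- The pressure of a solution whose difference from the Barenblatt profile decays and has
vanishing zeroth and first moments initially. -/
structure Centered (n : ℕ) (p B K : ℝ) (Q : ℝ → Eu n → ℝ) : Prop where
  hn : 1 ≤ n
  hp : 0 < p
  hp2 : p < 2
  hs : 1 < (p + n) / 2
  hB : 0 < B
  hK : 0 ≤ K
  press : IsPress n ((p + n) / 2) Q
  init : ∀ y, |Q 0 y ^ (-((p + n) / 2)) - (‖y‖ ^ 2 + B) ^ (-((p + n) / 2))| ≤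
    K * (‖y‖ ^ 2 + B) ^ (-((n + 1 + p / 2) / 2))
  mass : ∫ y, (Q 0 y ^ (-((p + n) / 2)) - (‖y‖ ^ 2 + B) ^ (-((p + n) / 2))) = 0
  moment : ∀ i, ∫ y : Eu n, y i * (Q 0 y ^ (-((p + n) / 2)) - (‖y‖ ^ 2 + B) ^ (-((p + n) / 2))) = 0

section Scales

variable {n : ℕ} {p B τ : ℝ}

lemma one_le_th (hp : 0 < p) (hτ : 0 ≤ τ) : 1 ≤ th p τ := by
  unfold th; have : 0 ≤ 2 * p * τ := by positivity
  linarith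

lemma th_pos (hp : 0 < p) (hτ : 0 ≤ τ) : 0 < th p τ := one_pos.trans_le (one_le_th hp hτ)

lemma Sc_pos (hp : 0 < p) (hτ : 0 ≤ τ) : 0 < Sc n p τ := Real.rpow_pos_of_pos (th_pos hp hτ) _

lemma XX_pos (hp : 0 < p) (hB : 0 < B) (hτ : 0 ≤ τ) (y : Eu n) : 0 < XX n p B τ y := by
  have := Sc_pos (n := n) hp hτ
  unfold XX; positivity

lemma one_le_Sc (hp : 0 < p) (hτ : 0 ≤ τ) : 1 ≤ Sc n p τ :=
  Real.one_le_rpow (one_le_th hp hτ) (by positivity)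

lemma Sc_div_th (hp : 0 < p) (hτ : 0 ≤ τ) : Sc n p τ / th p τ = th p τ ^ ((n : ℝ) / p) := by
  rw [Sc, ← Real.rpow_sub_one (th_pos hp hτ).ne']
  congr 1; field_simp; ring

lemma Pr_eq_XX (hp : 0 < p) (hτ : 0 ≤ τ) (y : Eu n) :
    Pr n p B 1 τ y = XX n p B τ y / th p τ := by
  rw [XX, add_div, mul_div_assoc, Sc_div_th hp hτ]; rfl

lemma hasDerivAt_th (p τ : ℝ) : HasDerivAt (th p) (2 * p) τ := by
  have := ((hasDerivAt_id τ).const_mul (2 * p)).const_add 1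
  exact this.congr_deriv (mul_one _)

lemma hasDerivAt_th_rpow (hp : 0 < p) (hτ : 0 ≤ τ) (e : ℝ) :
    HasDerivAt (fun t => th p t ^ e) (2 * p * e * th p τ ^ e / th p τ) τ := by
  have h := th_pos hp hτ
  have := (hasDerivAt_th p τ).rpow_const (p := e) (Or.inl h.ne')
  refine this.congr_deriv ?_
  rw [Real.rpow_sub_one h.ne']
  ring

lemma hasDerivAt_Sc (hp : 0 < p) (hτ : 0 ≤ τ) :
    HasDerivAt (Sc n p) (2 * (p + n) * Sc n p τ / th p τ) τ := by
  refine (hasDerivAt_th_rpow hp hτ ((p + n) / p)).congr_deriv ?_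
  rw [Sc]
  field_simp

end Scales

section RatioBounds

variable {n : ℕ} {p B K : ℝ} {Q : ℝ → Eu n → ℝ}

lemma Pr_upper {C' τ : ℝ} (hp : 0 < p) (hB : 0 < B) (hC : 1 ≤ C') (hτ : 0 ≤ τ) (y : Eu n) :
    Pr n p (C' * B * (1 / C') ^ (-((n : ℝ) / p))) (1 / C') τ y ≤
      C' * (‖y‖ ^ 2 / th p τ) + C' * B * (1 / C') ^ (-((n : ℝ) / p)) * (Sc n p τ / th p τ) ∧
    Pr n p (C' * B * (1 / C') ^ (-((n : ℝ) / p))) (1 / C') τ y ≤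
      ‖y‖ ^ 2 / th p τ + C' * (‖y‖ ^ 2 / th p τ / th p τ) +
        C' * B * (1 / C') ^ (-((n : ℝ) / p)) * (Sc n p τ / th p τ) := by
  have hC0 : 0 < C' := by linarith
  have hθ := th_pos hp hτ
  have h1 : 1 / C' ≤ 1 := by rw [div_le_one hC0]; exact hC
  have hc0 : 0 < 1 / C' := by positivity
  have hpt : 0 ≤ 2 * p * τ := by positivity
  have h2 : 1 / C' * th p τ ≤ 1 / C' + 2 * p * τ := by
    unfold th; nlinarith
  have h3 : 1 / C' + 2 * p * τ ≤ th p τ := by unfold th; linarith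
  have h4 : 0 < 1 / C' + 2 * p * τ := by positivity
  have h5 : (1 / C' + 2 * p * τ) ^ ((n : ℝ) / p) ≤ Sc n p τ / th p τ := by
    rw [Sc_div_th hp hτ]
    exact Real.rpow_le_rpow h4.le h3 (by positivity)
  have hb : 0 ≤ C' * B * (1 / C') ^ (-((n : ℝ) / p)) := by positivity
  have h6 := mul_le_mul_of_nonneg_left h5 hb
  have h7 : 1 / (1 / C' + 2 * p * τ) ≤ C' * (1 / th p τ) := by
    rw [mul_one_div, div_le_div_iff₀ h4 hθ]
    have := mul_le_mul_of_nonneg_left h2 hC0.le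
    rw [← mul_assoc, mul_one_div, div_self hC0.ne'] at this
    linarith
  have h8 : 1 / (1 / C' + 2 * p * τ) ≤ 1 / th p τ + C' * (1 / th p τ / th p τ) := by
    have e : 1 / (1 / C' + 2 * p * τ) - 1 / th p τ =
        (1 - 1 / C') * (1 / (1 / C' + 2 * p * τ)) * (1 / th p τ) := by
      have e1 : (1 - 1 / C') = th p τ - (1 / C' + 2 * p * τ) := by unfold th; ring
      rw [e1]
      field_simp
    have : (1 - 1 / C') * (1 / (1 / C' + 2 * p * τ)) * (1 / th p τ) ≤
        1 * (C' * (1 / th p τ)) * (1 / th p τ) := by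
      gcongr
      linarith
    have e2 : 1 * (C' * (1 / th p τ)) * (1 / th p τ) = C' * (1 / th p τ / th p τ) := by ring
    linarith
  have hy : 0 ≤ ‖y‖ ^ 2 := by positivity
  have h9 := mul_le_mul_of_nonneg_left h7 hy
  have h10 := mul_le_mul_of_nonneg_left h8 hy
  constructor
  · calc _ = ‖y‖ ^ 2 * (1 / (1 / C' + 2 * p * τ)) + C' * B * (1 / C') ^ (-((n : ℝ) / p)) *
          (1 / C' + 2 * p * τ) ^ ((n : ℝ) / p) := by unfold Pr; ring
      _ ≤ _ := add_le_add h9 h6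
      _ = _ := by ring
  · calc _ = ‖y‖ ^ 2 * (1 / (1 / C' + 2 * p * τ)) + C' * B * (1 / C') ^ (-((n : ℝ) / p)) *
          (1 / C' + 2 * p * τ) ^ ((n : ℝ) / p) := by unfold Pr; ring
      _ ≤ _ := add_le_add h10 h6
      _ = _ := by ring

lemma Pr_lower {c b τ : ℝ} (hp : 0 < p) (hb : 0 < b) (hc : 1 ≤ c) (hτ : 0 ≤ τ) (y : Eu n) :
    1 / c * (‖y‖ ^ 2 / th p τ) + b * (Sc n p τ / th p τ) ≤ Pr n p b c τ y ∧
    ‖y‖ ^ 2 / th p τ - c * (‖y‖ ^ 2 / th p τ / th p τ) ≤ Pr n p b c τ y := by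
  have hC0 : 0 < c := by linarith
  have hθ := th_pos hp hτ
  have hpt : 0 ≤ 2 * p * τ := by positivity
  have h2 : c + 2 * p * τ ≤ c * th p τ := by
    unfold th; nlinarith
  have h3 : th p τ ≤ c + 2 * p * τ := by unfold th; linarith
  have h4 : 0 < c + 2 * p * τ := by positivity
  have h5 : Sc n p τ / th p τ ≤ (c + 2 * p * τ) ^ ((n : ℝ) / p) := by
    rw [Sc_div_th hp hτ]
    exact Real.rpow_le_rpow hθ.le h3 (by positivity)
  have h6 := mul_le_mul_of_nonneg_left h5 hb.le
  have h7 : 1 / c * (1 / th p τ) ≤ 1 / (c + 2 * p * τ) := by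
    rw [one_div_mul_one_div]
    exact one_div_le_one_div_of_le h4 h2
  have h8 : 1 / th p τ - c * (1 / th p τ / th p τ) ≤ 1 / (c + 2 * p * τ) := by
    have e : 1 / th p τ - 1 / (c + 2 * p * τ) =
        (c - 1) * (1 / (c + 2 * p * τ)) * (1 / th p τ) := by
      have e1 : (c - 1) = (c + 2 * p * τ) - th p τ := by unfold th; ring
      rw [e1]
      field_simp
    have : (c - 1) * (1 / (c + 2 * p * τ)) * (1 / th p τ) ≤
        c * (1 / th p τ) * (1 / th p τ) := by
      gcongr
      linarith
    have e2 : c * (1 / th p τ) * (1 / th p τ) = c * (1 / th p τ / th p τ) := by ring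
    linarith
  have hy : 0 ≤ ‖y‖ ^ 2 := by positivity
  have h9 := mul_le_mul_of_nonneg_left h7 hy
  have h10 := mul_le_mul_of_nonneg_left h8 hy
  have e : Pr n p b c τ y = ‖y‖ ^ 2 * (1 / (c + 2 * p * τ)) +
      b * (c + 2 * p * τ) ^ ((n : ℝ) / p) := by unfold Pr; ring
  have h11 : 0 ≤ b * (c + 2 * p * τ) ^ ((n : ℝ) / p) := by positivity
  constructor
  · calc _ = ‖y‖ ^ 2 * (1 / c * (1 / th p τ)) + b * (Sc n p τ / th p τ) := by ring
      _ ≤ _ := add_le_add h9 h6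
      _ = _ := e.symm
  · calc _ = ‖y‖ ^ 2 * (1 / th p τ - c * (1 / th p τ / th p τ)) := by ring
      _ ≤ _ := h10.trans (by linarith)

/-- The initial pressure is comparable to the Barenblatt pressure. -/
lemma Centered.init_ratio (h : Centered n p B K Q) : ∃ Λ, 1 ≤ Λ ∧ ∀ y,
    Q 0 y ≤ Λ * (‖y‖ ^ 2 + B) ∧ ‖y‖ ^ 2 + B ≤ Λ * Q 0 y := by
  obtain ⟨hn, hp, hp2, hs, hB, hK, press, init, -, -⟩ := h
  set s := (p + (n : ℝ)) / 2 with hsdef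
  have hQ0 : Continuous (Q 0) := by
    rw [← continuousOn_univ]
    exact press.cont.comp (f := fun z => ((0 : ℝ), z)) (by fun_prop)
      fun z _ => ⟨Set.self_mem_Ici, trivial⟩
  have hpos : ∀ y, 0 < Q 0 y := press.pos 0 le_rfl
  set g : Eu n → ℝ := fun y => Q 0 y / (‖y‖ ^ 2 + B) with hg
  have hX : ∀ y : Eu n, 0 < ‖y‖ ^ 2 + B := fun y => by positivity
  have hgc : Continuous g := hQ0.div (by fun_prop) fun y => (hX y).ne'
  have hgpos : ∀ y, 0 < g y := fun y => div_pos (hpos y) (hX y)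
  -- the ratio is close to one far away
  obtain ⟨R, hR⟩ : ∃ R : ℝ, ∀ y : Eu n, R ≤ ‖y‖ → |g y ^ (-s) - 1| ≤ 1 / 2 := by
    have ht : Tendsto (fun r : ℝ => K * (r ^ 2) ^ (-((1 - p / 2) / 2))) atTop (𝓝 (K * 0)) := by
      refine Tendsto.const_mul K ?_
      exact (tendsto_rpow_neg_atTop (by linarith)).comp (tendsto_pow_atTop two_ne_zero)
    rw [mul_zero] at ht
    obtain ⟨R, hR⟩ := (((ht.eventually (ge_mem_nhds (show (0 : ℝ) < 1 / 2 by norm_num))).and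
      (eventually_gt_atTop 0)).exists_forall_of_atTop)
    refine ⟨R, fun y hy => ?_⟩
    obtain ⟨h1, h2⟩ := hR ‖y‖ hy
    refine le_trans ?_ h1
    have e : g y ^ (-s) - 1 = (Q 0 y ^ (-s) - (‖y‖ ^ 2 + B) ^ (-s)) * (‖y‖ ^ 2 + B) ^ s := by
      simp only [hg]
      rw [Real.div_rpow (hpos y).le (hX y).le, sub_mul, ← Real.rpow_add (hX y), neg_add_cancel,
        Real.rpow_zero, Real.rpow_neg (hX y).le s, div_inv_eq_mul]
    rw [e, abs_mul, abs_of_nonneg (Real.rpow_nonneg (hX y).le s)]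
    calc _ ≤ K * (‖y‖ ^ 2 + B) ^ (-((n + 1 + p / 2) / 2)) * (‖y‖ ^ 2 + B) ^ s := by
          gcongr; exact init y
      _ = K * (‖y‖ ^ 2 + B) ^ (-((1 - p / 2) / 2)) := by
          rw [mul_assoc, ← Real.rpow_add (hX y)]; congr 2; simp only [hsdef]; ring
      _ ≤ _ := by
          refine mul_le_mul_of_nonneg_left ?_ hK
          exact Real.rpow_le_rpow_of_nonpos (by positivity) (by linarith) (by linarith)
  have hfar : ∀ y : Eu n, R ≤ ‖y‖ → g y ≤ (1 / 2) ^ (-(1 / s)) ∧ (3 / 2) ^ (-(1 / s)) ≤ g y := by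
    intro y hy
    have h1 := abs_le.1 (hR y hy)
    have e : g y = (g y ^ (-s)) ^ (-(1 / s)) := by
      rw [← Real.rpow_mul (hgpos y).le, show -s * -(1 / s) = 1 by field_simp, Real.rpow_one]
    have hs' : -(1 / s) ≤ 0 := by
      rw [neg_nonpos]; positivity
    have hgs : 0 < g y ^ (-s) := Real.rpow_pos_of_pos (hgpos y) _
    rw [e]
    exact ⟨Real.rpow_le_rpow_of_nonpos (by norm_num) (by linarith) hs',
      Real.rpow_le_rpow_of_nonpos hgs (by linarith) hs'⟩
  have hcpt : IsCompact (Metric.closedBall (0 : Eu n) R) := isCompact_closedBall _ _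
  obtain ⟨M1, hM1⟩ := hcpt.bddAbove_image hgc.continuousOn
  obtain ⟨M2, hM2⟩ := hcpt.bddAbove_image (f := fun y => (g y)⁻¹)
    (hgc.inv₀ fun y => (hgpos y).ne').continuousOn
  set a1 : ℝ := (1 / 2) ^ (-(1 / s))
  set a2 : ℝ := (3 / 2) ^ (-(1 / s))
  have ha1 : 0 < a1 := by positivity
  have ha2 : 0 < a2 := by positivity
  refine ⟨1 + |M1| + |M2| + a1 + a2⁻¹, ?_, fun y => ?_⟩
  · have : 0 < a2⁻¹ := by positivity
    linarith [abs_nonneg M1, abs_nonneg M2]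
  have hi : 0 < a2⁻¹ := by positivity
  have key : g y ≤ 1 + |M1| + |M2| + a1 + a2⁻¹ ∧ (g y)⁻¹ ≤ 1 + |M1| + |M2| + a1 + a2⁻¹ := by
    rcases le_total R ‖y‖ with hy | hy
    · obtain ⟨h1, h2⟩ := hfar y hy
      have h3 : (g y)⁻¹ ≤ a2⁻¹ := inv_anti₀ ha2 h2
      constructor <;> linarith [abs_nonneg M1, abs_nonneg M2]
    · have hy' : y ∈ Metric.closedBall (0 : Eu n) R := by simpa using hy
      have h1 := hM1 (Set.mem_image_of_mem _ hy')
      have h2 := hM2 (Set.mem_image_of_mem _ hy')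
      constructor <;> linarith [abs_nonneg M1, abs_nonneg M2, le_abs_self M1, le_abs_self M2]
  constructor
  · have := key.1
    simp only [hg] at this
    rwa [div_le_iff₀ (hX y)] at this
  · have := key.2
    simp only [hg] at this
    rwa [inv_div, div_le_iff₀ (hpos y)] at this

/-- The pressure stays comparable to the Barenblatt pressure, and is asymptotic to it far out. -/
lemma Centered.ratio (h : Centered n p B K Q) : ∃ Λ, 1 ≤ Λ ∧ ∀ τ, 0 ≤ τ → ∀ y,
    Pr n p B 1 τ y ≤ Λ * Q τ y ∧ Q τ y ≤ Λ * Pr n p B 1 τ y ∧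
    |Q τ y - Pr n p B 1 τ y| ≤ Λ * Pr n p B 1 τ y * (1 / th p τ + Sc n p τ / XX n p B τ y) := by
  obtain ⟨L, hL, hLQ⟩ := h.init_ratio
  obtain ⟨hn, hp, hp2, hs, hB, hK, press, -, -, -⟩ := h
  have hL0 : 0 < L := by linarith
  set b1 := L * B * (1 / L) ^ (-((n : ℝ) / p))
  have hb1 : 0 < b1 := by positivity
  set b2 := 1 / L * B * L ^ (-((n : ℝ) / p))
  have hb2 : 0 < b2 := by positivity
  have hup : ∀ y, Q 0 y ≤ Pr n p b1 (1 / L) 0 y := fun y => by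
    have e : Pr n p b1 (1 / L) 0 y = L * (‖y‖ ^ 2 + B) := by
      simp only [Pr, b1, mul_zero, add_zero]
      rw [mul_assoc _ ((1 / L) ^ _), ← Real.rpow_add (by positivity), neg_add_cancel,
        Real.rpow_zero]
      field_simp
    rw [e]; exact (hLQ y).1
  have hlo : ∀ y, Pr n p b2 L 0 y ≤ Q 0 y := fun y => by
    have e : Pr n p b2 L 0 y = (‖y‖ ^ 2 + B) / L := by
      simp only [Pr, b2, mul_zero, add_zero]
      rw [mul_assoc _ (L ^ _), ← Real.rpow_add (by positivity), neg_add_cancel,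
        Real.rpow_zero]
      field_simp
    rw [e, div_le_iff₀ hL0, mul_comm]; exact (hLQ y).2
  set Λ := 1 + L + b1 / B + B / b2 + b1 + B
  have hbB : 0 < b1 / B := by positivity
  have hBb : 0 < B / b2 := by positivity
  refine ⟨Λ, by simp only [Λ]; linarith, fun τ hτ y => ?_⟩
  have hθ := th_pos hp hτ
  have hX := XX_pos (n := n) hp hB hτ y
  have hS := Sc_pos (n := n) hp hτ
  have q1 := press_le_Pr hp hb1 (by positivity) hs press hup hτ y
  have q2 := Pr_le_press hp hb2 hL0 press hlo hτ y
  obtain ⟨u1, u2⟩ := Pr_upper (n := n) hp hB hL hτ y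
  obtain ⟨l1, l2⟩ := Pr_lower (n := n) hp hb2 hL hτ y
  set Y := ‖y‖ ^ 2 / th p τ with hY
  set Z := Sc n p τ / th p τ with hZ
  have hY0 : 0 ≤ Y := by positivity
  have hZ0 : 0 < Z := by positivity
  have eP : Pr n p B 1 τ y = Y + B * Z := by
    rw [Pr_eq_XX hp hτ, XX]; simp only [hY, hZ]; ring
  have e3 : Pr n p B 1 τ y * (1 / th p τ + Sc n p τ / XX n p B τ y) =
      Y / th p τ + B * Z / th p τ + Z := by
    rw [mul_add, eP]
    congr 1
    · ring
    · rw [← eP, Pr_eq_XX hp hτ]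
      simp only [hZ]
      field_simp
  have hYt : 0 ≤ Y / th p τ := by positivity
  have hZt : 0 ≤ B * Z / th p τ := by positivity
  have hQ := press.pos τ hτ y
  refine ⟨?_, ?_, ?_⟩
  · rw [eP]
    have h1 : 1 / L * Y + b2 * Z ≤ Q τ y := l1.trans q2
    have h2 : Y ≤ L * (1 / L * Y) := by field_simp; exact le_rfl
    have h3 : B * Z = B / b2 * (b2 * Z) := by field_simp
    have h4 : (L + B / b2) * (1 / L * Y + b2 * Z) ≤ (L + B / b2) * Q τ y := by gcongr
    have h5 : 0 ≤ L * (b2 * Z) := by positivity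
    have h6 : 0 ≤ B / b2 * (1 / L * Y) := by positivity
    have h7 : (L + B / b2) * Q τ y ≤ Λ * Q τ y := by
      gcongr; simp only [Λ]; linarith
    linarith
  · rw [eP]
    have h1 : Q τ y ≤ L * Y + b1 * Z := q1.trans u1
    have h3 : b1 * Z = b1 / B * (B * Z) := by field_simp
    have h4 : L * Y ≤ Λ * Y := by gcongr; simp only [Λ]; linarith
    have h5 : b1 / B * (B * Z) ≤ Λ * (B * Z) := by gcongr; simp only [Λ]; linarith
    linarith
  · rw [mul_assoc, e3, eP]
    have h1 : Q τ y ≤ Y + L * (Y / th p τ) + b1 * Z := q1.trans u2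
    have h2 : Y - L * (Y / th p τ) ≤ Q τ y := l2.trans q2
    have h4 : L * (Y / th p τ) ≤ Λ * (Y / th p τ) := by gcongr; simp only [Λ]; linarith
    have h5 : b1 * Z ≤ Λ * Z := by gcongr; simp only [Λ]; linarith
    have h6 : B * Z ≤ Λ * Z := by gcongr; simp only [Λ]; linarith
    have h7 : 0 ≤ Λ * (B * Z / th p τ) := by
      have : 0 ≤ Λ := by simp only [Λ]; linarith
      positivity
    have h8 : 0 ≤ B * Z := by positivity
    have h9 : 0 ≤ b1 * Z := by positivity
    rw [abs_le]
    constructor <;> linarith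

end RatioBounds

section PressPowers

variable {n : ℕ} {s : ℝ} {P : ℝ → Eu n → ℝ}

lemma IsPress.hasDerivAt_rpow_neg (h : IsPress n s P) (hs : s ≠ 1) {τ : ℝ} (hτ : 0 < τ)
    (y : Eu n) : HasDerivAt (fun t => P t y ^ (-s))
      (s / (s - 1) * lap n (fun x => P τ x ^ (1 - s)) y) τ := by
  have hp := h.pos τ hτ.le
  have h1 := (h.eqn τ hτ y).rpow_const (p := -s) (Or.inl (hp y).ne')
  convert h1 using 1
  rw [lap_rpow (h.slice hτ) hp]
  have e1 : P τ y ^ (1 - s - 1) = P τ y * P τ y ^ (-s - 1) := by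
    rw [show 1 - s - 1 = 1 + (-s - 1) by ring, Real.rpow_add (hp y), Real.rpow_one]
  have e2 : P τ y ^ (1 - s - 2) = P τ y ^ (-s - 1) := by congr 1; ring
  have hs' : s - 1 ≠ 0 := sub_ne_zero.2 hs
  rw [e1, e2]
  field_simp
  ring

lemma IsPress.continuousOn_rpow (h : IsPress n s P) (r : ℝ) :
    ContinuousOn (fun q : ℝ × Eu n => P q.1 q.2 ^ r) (Set.Ici 0 ×ˢ Set.univ) :=
  h.cont.rpow_const fun q hq => Or.inl (h.pos q.1 hq.1 q.2).ne'

lemma IsPress.contDiffOn_rpow (h : IsPress n s P) (r : ℝ) :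
    ContDiffOn ℝ ∞ (fun q : ℝ × Eu n => P q.1 q.2 ^ r) (Set.Ioi 0 ×ˢ Set.univ) :=
  h.smooth.rpow_const_of_ne fun q hq => (h.pos q.1 (le_of_lt hq.1) q.2).ne'

end PressPowers

section Weak

variable {n : ℕ} {φ g : Eu n → ℝ}

lemma mol_lap_right (hψ : IsTest φ) (hg : ContDiff ℝ ∞ g) (y : Eu n) :
    mol (lap n φ) g y = mol φ (lap n g) y := by
  rw [← lap_mol hψ hg.continuous, lap_eq_sum_pd]
  have h1 : ∀ i, pd n i (pd n i (mol φ g)) = mol φ (pd n i (pd n i g)) := fun i => by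
    rw [pd_mol_right hψ hg, pd_mol_right hψ (contDiff_pd hg i)]
  simp only [h1]
  unfold mol
  rw [← integral_finsetSum _ fun i _ => ?_]
  · congr 1; ext z; rw [lap_eq_sum_pd, Finset.mul_sum]
  · exact hψ.integrable_mul
      ((contDiff_pd (contDiff_pd hg i) i).continuous.comp (continuous_const.sub continuous_id))

lemma integral_eq_mol (φ g : Eu n → ℝ) : ∫ z, φ z * g z = mol (fun z => φ (0 - z)) g 0 := by
  rw [mol_eq_swap]; simp

lemma integral_lap_mul (hφ : IsTest φ) (hg : ContDiff ℝ ∞ g) :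
    ∫ z, lap n φ z * g z = ∫ z, φ z * lap n g z := by
  rw [integral_eq_mol, integral_eq_mol, ← mol_lap_right (hφ.reflect 0) hg]
  congr 1
  ext z
  have := lap_rescale (x := z) hφ.smooth 0 (-1)
  simpa using this.symm

lemma continuousOn_integral_test {s : Set ℝ} {g : ℝ → Eu n → ℝ} (hφ : IsTest φ)
    (hg : ContinuousOn (fun q : ℝ × Eu n => g q.1 q.2) (s ×ˢ Set.univ)) :
    ContinuousOn (fun τ => ∫ z, φ z * g τ z) s := by
  simp only [integral_eq_mol]
  exact (mol_continuousOn (hφ.reflect 0) hg).comp (f := fun τ : ℝ => (τ, (0 : Eu n)))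
    (by fun_prop) fun τ hτ => ⟨hτ, trivial⟩

lemma ContinuousOn.slice' {s : Set ℝ} {g : ℝ → Eu n → ℝ}
    (hg : ContinuousOn (fun q : ℝ × Eu n => g q.1 q.2) (s ×ˢ Set.univ)) {τ : ℝ} (hτ : τ ∈ s) :
    Continuous (g τ) := by
  rw [← continuousOn_univ]
  exact hg.comp (f := fun z => (τ, z)) (by fun_prop) fun z _ => ⟨hτ, trivial⟩

lemma ContDiffOn.pd {g : ℝ → Eu n → ℝ}
    (hg : ContDiffOn ℝ ∞ (fun q : ℝ × Eu n => g q.1 q.2) (Set.Ioi 0 ×ˢ Set.univ)) (i : Fin n) :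
    ContDiffOn ℝ ∞ (fun q : ℝ × Eu n => _root_.pd n i (g q.1) q.2) (Set.Ioi 0 ×ˢ Set.univ) := by
  have hU : IsOpen (Set.Ioi (0 : ℝ) ×ˢ (Set.univ : Set (Eu n))) := isOpen_Ioi.prod isOpen_univ
  have h1 := (hg.fderiv_of_isOpen (m := ∞) hU (by simp)).clm_apply
    (contDiffOn_const (c := ((0 : ℝ), stdBasis n i)))
  refine h1.congr fun q hq => ?_
  have hd : DifferentiableAt ℝ (fun q : ℝ × Eu n => g q.1 q.2) q :=
    (hg.contDiffAt (hU.mem_nhds hq)).differentiableAt (by simp)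
  have h2 := hd.hasFDerivAt.comp q.2 (f := fun x => (q.1, x))
    ((hasFDerivAt_const q.1 q.2).prodMk (hasFDerivAt_id q.2))
  have h3 : fderiv ℝ (g q.1) q.2 = _ := h2.fderiv
  unfold _root_.pd
  rw [h3]
  simp

lemma ContDiffOn.continuousOn_lap {g : ℝ → Eu n → ℝ}
    (hg : ContDiffOn ℝ ∞ (fun q : ℝ × Eu n => g q.1 q.2) (Set.Ioi 0 ×ˢ Set.univ)) :
    ContinuousOn (fun q : ℝ × Eu n => lap n (g q.1) q.2) (Set.Ioi 0 ×ˢ Set.univ) := by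
  simp only [lap_eq_sum_pd]
  exact continuousOn_finsetSum _ fun i _ => (ContDiffOn.pd
    (g := fun t => _root_.pd n i (g t)) (hg.pd i) i).continuousOn

end Weak

/-- The difference `f` of two solutions, the difference `w` of the associated powers and a
potential `D`, related by `∂_τ f = Δw`, `∂_τ D = w` and `ΔD = f` (weakly). -/
structure DSys (n : ℕ) (f w D : ℝ → Eu n → ℝ) : Prop where
  fc : ContinuousOn (fun q : ℝ × Eu n => f q.1 q.2) (Set.Ici 0 ×ˢ Set.univ)
  wc : ContinuousOn (fun q : ℝ × Eu n => w q.1 q.2) (Set.Ici 0 ×ˢ Set.univ)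
  dc : ContinuousOn (fun q : ℝ × Eu n => D q.1 q.2) (Set.Ici 0 ×ˢ Set.univ)
  fs : ContDiffOn ℝ ∞ (fun q : ℝ × Eu n => f q.1 q.2) (Set.Ioi 0 ×ˢ Set.univ)
  ws : ContDiffOn ℝ ∞ (fun q : ℝ × Eu n => w q.1 q.2) (Set.Ioi 0 ×ˢ Set.univ)
  dt : ∀ τ, 0 < τ → ∀ y, HasDerivAt (fun t => D t y) (w τ y) τ
  weak : ∀ φ, IsTest φ → ∀ τ, 0 ≤ τ → ∫ z, lap n φ z * D τ z = ∫ z, φ z * f τ z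

lemma DSys.neg {n : ℕ} {f w D : ℝ → Eu n → ℝ} (h : DSys n f w D) :
    DSys n (fun τ y => -f τ y) (fun τ y => -w τ y) (fun τ y => -D τ y) where
  fc := h.fc.neg
  wc := h.wc.neg
  dc := h.dc.neg
  fs := h.fs.neg
  ws := h.ws.neg
  dt τ hτ y := (h.dt τ hτ y).neg
  weak φ hφ τ hτ := by simp only [mul_neg, integral_neg, h.weak φ hφ τ hτ]

/-- Construction of the potential by integrating `w` in time. -/
lemma DSys.of_initial {n : ℕ} {f w : ℝ → Eu n → ℝ} {D0 : Eu n → ℝ}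
    (fc : ContinuousOn (fun q : ℝ × Eu n => f q.1 q.2) (Set.Ici 0 ×ˢ Set.univ))
    (wc : ContinuousOn (fun q : ℝ × Eu n => w q.1 q.2) (Set.Ici 0 ×ˢ Set.univ))
    (fs : ContDiffOn ℝ ∞ (fun q : ℝ × Eu n => f q.1 q.2) (Set.Ioi 0 ×ˢ Set.univ))
    (ws : ContDiffOn ℝ ∞ (fun q : ℝ × Eu n => w q.1 q.2) (Set.Ioi 0 ×ˢ Set.univ))
    (ft : ∀ τ, 0 < τ → ∀ y, HasDerivAt (fun t => f t y) (lap n (w τ) y) τ)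
    (hD0 : Continuous D0)
    (h0 : ∀ φ, IsTest φ → ∫ z, lap n φ z * D0 z = ∫ z, φ z * f 0 z) :
    DSys n f w (fun τ y => D0 y + ∫ t in (0 : ℝ)..τ, w (max t 0) y) := by
  have hwt : Continuous (fun q : ℝ × Eu n => w (max q.1 0) q.2) := by
    rw [← continuousOn_univ]
    exact wc.comp (f := fun q : ℝ × Eu n => (max q.1 0, q.2)) (by fun_prop)
      fun q _ => ⟨Set.mem_Ici.2 (le_max_right _ _), trivial⟩
  have hI : Continuous (fun q : ℝ × Eu n => ∫ t in (0 : ℝ)..q.1, w (max t 0) q.2) :=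
    intervalIntegral.continuous_parametric_intervalIntegral_of_continuous
      (f := fun (q : ℝ × Eu n) t => w (max t 0) q.2)
      (hwt.comp (g := fun q : ℝ × Eu n => w (max q.1 0) q.2)
        (f := fun z : (ℝ × Eu n) × ℝ => (z.2, z.1.2)) (by fun_prop)) continuous_fst
  have dc : ContinuousOn (fun q : ℝ × Eu n => D0 q.2 + ∫ t in (0 : ℝ)..q.1, w (max t 0) q.2)
      (Set.Ici 0 ×ˢ Set.univ) := ((hD0.comp continuous_snd).add hI).continuousOn
  have dt : ∀ τ, 0 < τ → ∀ y, HasDerivAt (fun t => D0 y + ∫ t in (0 : ℝ)..t, w (max t 0) y)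
      (w τ y) τ := fun τ hτ y => by
    have hc : Continuous fun t => w (max t 0) y := hwt.comp (f := fun t => (t, y)) (by fun_prop)
    have h1 := intervalIntegral.integral_hasDerivAt_right (hc.intervalIntegrable 0 τ)
      hc.aestronglyMeasurable.stronglyMeasurableAtFilter hc.continuousAt
    have h2 := h1.const_add (D0 y)
    rwa [max_eq_left hτ.le] at h2
  refine ⟨fc, wc, dc, fs, ws, dt, fun φ hφ τ hτ => ?_⟩
  rcases hτ.eq_or_lt with rfl | hτ
  · simpa using h0 φ hφ
  have hlap := hφ.lap
  set G : ℝ → ℝ := fun τ => (∫ z, lap n φ z * (D0 z + ∫ t in (0 : ℝ)..τ, w (max t 0) z)) -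
    ∫ z, φ z * f τ z with hG
  have hIoi : Set.Ioi (0 : ℝ) ×ˢ (Set.univ : Set (Eu n)) ⊆ Set.Ici 0 ×ˢ Set.univ :=
    Set.prod_mono Set.Ioi_subset_Ici_self subset_rfl
  have hGc : ContinuousOn G (Set.Ici 0) :=
    (continuousOn_integral_test hlap (g := fun τ z => D0 z + ∫ t in (0 : ℝ)..τ, w (max t 0) z)
      dc).sub (continuousOn_integral_test hφ fc)
  have hGd : ∀ t, 0 < t → HasDerivAt G 0 t := fun t ht => by
    have h1 := hasDerivAt_integral_test isOpen_Ioi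
      (g := fun τ z => D0 z + ∫ t in (0 : ℝ)..τ, w (max t 0) z) hlap
      (dc.mono hIoi) (wc.mono hIoi) (fun t ht y => dt t ht y) (t := t) ht
    have h2 := hasDerivAt_integral_test isOpen_Ioi (g := f) hφ
      (fc.mono hIoi) ws.continuousOn_lap (fun t ht y => ft t ht y) (t := t) ht
    refine (h1.sub h2).congr_deriv ?_
    rw [integral_lap_mul hφ (ws.slice ht), sub_self]
  obtain ⟨c, hc, hc'⟩ := exists_hasDerivAt_eq_slope G (fun _ => 0) hτ
    (hGc.mono Set.Icc_subset_Ici_self) fun t ht => hGd t ht.1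
  have hG0 : G 0 = 0 := by
    simp only [hG, intervalIntegral.integral_same, add_zero]
    rw [h0 φ hφ, sub_self]
  rw [hG0, sub_zero, sub_zero, eq_comm, div_eq_zero_iff] at hc'
  exact sub_eq_zero.1 (hc'.resolve_right hτ.ne')

/-- Difference of densities. -/
def fD (n : ℕ) (p B : ℝ) (Q : ℝ → Eu n → ℝ) (τ : ℝ) (y : Eu n) : ℝ :=
  Q τ y ^ (-((p + n) / 2)) - Pr n p B 1 τ y ^ (-((p + n) / 2))

/-- Difference of the diffused powers of the densities. -/
def wD (n : ℕ) (p B : ℝ) (Q : ℝ → Eu n → ℝ) (τ : ℝ) (y : Eu n) : ℝ :=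
  (p + n) / 2 / ((p + n) / 2 - 1) *
    (Q τ y ^ (1 - (p + n) / 2) - Pr n p B 1 τ y ^ (1 - (p + n) / 2))

/-- The difference quotient of the diffused powers. -/
def aD (n : ℕ) (p B : ℝ) (Q : ℝ → Eu n → ℝ) (τ : ℝ) (y : Eu n) : ℝ :=
  if fD n p B Q τ y = 0 then Q τ y else wD n p B Q τ y / fD n p B Q τ y

/-- Potential of the difference of densities. -/
def potD (n : ℕ) (p B : ℝ) (Q : ℝ → Eu n → ℝ) (τ : ℝ) (y : Eu n) : ℝ :=
  newt (fD n p B Q 0) y / potMass n + ∫ t in (0 : ℝ)..τ, wD n p B Q (max t 0) y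

section PowerDifference

variable {s P Q : ℝ}

/-- Concavity of the diffused power. -/
lemma pow_diff_le (hs : 1 < s) (hP : 0 < P) (hQ : 0 < Q) :
    s / (s - 1) * (Q ^ (1 - s) - P ^ (1 - s)) ≤ P * (Q ^ (-s) - P ^ (-s)) := by
  have hs0 : 0 < s := by linarith
  have hs1 : 0 < s - 1 := by linarith
  have h := rpow_tangent_of_mem (r := (s - 1) / s) (by positivity)
    (by rw [div_le_one hs0]; linarith) (Real.rpow_pos_of_pos hP (-s)) (Real.rpow_pos_of_pos hQ (-s))
  rw [← Real.rpow_mul hP.le, ← Real.rpow_mul hQ.le, ← Real.rpow_mul hP.le,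
    show -s * ((s - 1) / s) = 1 - s by field_simp; ring,
    show -s * ((s - 1) / s - 1) = 1 by field_simp; ring, Real.rpow_one] at h
  have h2 : Q ^ (1 - s) - P ^ (1 - s) ≤ (s - 1) / s * (P * (Q ^ (-s) - P ^ (-s))) := by linarith
  calc _ ≤ s / (s - 1) * ((s - 1) / s * (P * (Q ^ (-s) - P ^ (-s)))) := by gcongr
    _ = _ := by field_simp

lemma abs_sub_le_pow_diff {Λ : ℝ} (hs : 1 < s) (hP : 0 < P) (hQ : 0 < Q) (hΛ : 1 ≤ Λ)
    (h : Q ≤ Λ * P) :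
    |Q - P| ≤ Λ ^ s * P ^ s * |s / (s - 1) * (Q ^ (1 - s) - P ^ (1 - s))| := by
  have hs1 : 0 < s - 1 := by linarith
  have hPs := Real.rpow_pos_of_pos hP s
  have hQs := Real.rpow_pos_of_pos hQ s
  have hΛs : 1 ≤ Λ ^ s := Real.one_le_rpow hΛ (by linarith)
  have h1 : ∀ x y : ℝ, 0 < x → 0 < y → (x - y) ≤
      x ^ s * (s / (s - 1) * (y ^ (1 - s) - x ^ (1 - s))) / s := fun x y hx hy => by
    have h := rpow_tangent_of_nonpos (r := 1 - s) (by linarith) hx hy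
    rw [show 1 - s - 1 = -s by ring] at h
    have h2 : (s - 1) * x ^ (-s) * (x - y) ≤ y ^ (1 - s) - x ^ (1 - s) := by linarith
    have h3 : x ^ s * (s / (s - 1) * ((s - 1) * x ^ (-s) * (x - y))) / s ≤
        x ^ s * (s / (s - 1) * (y ^ (1 - s) - x ^ (1 - s))) / s := by
      gcongr
    refine le_trans (le_of_eq ?_) h3
    have := Real.rpow_pos_of_pos hx s
    rw [Real.rpow_neg hx.le]
    field_simp
  set W := s / (s - 1) * (Q ^ (1 - s) - P ^ (1 - s)) with hW
  have hs' : ∀ z : ℝ, 0 ≤ z → z / s ≤ z := fun z hz => div_le_self hz hs.le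
  rw [abs_le']
  constructor
  · have h2 := h1 Q P hQ hP
    have e : s / (s - 1) * (P ^ (1 - s) - Q ^ (1 - s)) = -W := by rw [hW]; ring
    rw [e] at h2
    calc _ ≤ Q ^ s * (-W) / s := h2
      _ ≤ Q ^ s * |W| / s := by gcongr; exact neg_le_abs W
      _ ≤ Q ^ s * |W| := hs' _ (by positivity)
      _ ≤ (Λ * P) ^ s * |W| := by gcongr
      _ = _ := by rw [Real.mul_rpow (by linarith) hP.le]
  · have h2 := h1 P Q hP hQ
    rw [← hW] at h2
    calc _ = P - Q := by ring
      _ ≤ P ^ s * W / s := h2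
      _ ≤ P ^ s * |W| / s := by gcongr; exact le_abs_self W
      _ ≤ P ^ s * |W| := hs' _ (by positivity)
      _ ≤ Λ ^ s * (P ^ s * |W|) := le_mul_of_one_le_left (by positivity) hΛs
      _ = _ := by ring

end PowerDifference

namespace Centered

variable {n : ℕ} {p B K : ℝ} {Q : ℝ → Eu n → ℝ}

lemma prPress (h : Centered n p B K Q) : IsPress n ((p + n) / 2) (Pr n p B 1) :=
  Pr_isPress h.hp h.hB one_pos

lemma pr_pos (h : Centered n p B K Q) {τ : ℝ} (hτ : 0 ≤ τ) (y : Eu n) : 0 < Pr n p B 1 τ y :=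
  h.prPress.pos τ hτ y

lemma w_le (h : Centered n p B K Q) {τ : ℝ} (hτ : 0 ≤ τ) (y : Eu n) :
    wD n p B Q τ y ≤ Pr n p B 1 τ y * fD n p B Q τ y :=
  pow_diff_le h.hs (h.pr_pos hτ y) (h.press.pos τ hτ y)

lemma le_w (h : Centered n p B K Q) {τ : ℝ} (hτ : 0 ≤ τ) (y : Eu n) :
    Q τ y * fD n p B Q τ y ≤ wD n p B Q τ y := by
  have := pow_diff_le h.hs (h.press.pos τ hτ y) (h.pr_pos hτ y)
  unfold fD wD
  linarith

lemma w_eq (h : Centered n p B K Q) {τ : ℝ} (hτ : 0 ≤ τ) (y : Eu n) :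
    wD n p B Q τ y = aD n p B Q τ y * fD n p B Q τ y := by
  unfold aD
  split_ifs with h0
  · have h1 := h.w_le hτ y
    have h2 := h.le_w hτ y
    rw [h0, mul_zero] at *
    exact le_antisymm h1 h2
  · field_simp

lemma a_bounds (h : Centered n p B K Q) {τ : ℝ} (hτ : 0 ≤ τ) (y : Eu n) :
    min (Q τ y) (Pr n p B 1 τ y) ≤ aD n p B Q τ y ∧
      aD n p B Q τ y ≤ max (Q τ y) (Pr n p B 1 τ y) := by
  have h1 := h.w_le hτ y
  have h2 := h.le_w hτ y
  unfold aD
  split_ifs with h0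
  · exact ⟨min_le_left _ _, le_max_left _ _⟩
  · rcases lt_or_gt_of_ne h0 with hf | hf
    · exact ⟨(min_le_right _ _).trans (by rw [le_div_iff_of_neg hf]; exact h1),
        le_trans (by rw [div_le_iff_of_neg hf]; exact h2) (le_max_left _ _)⟩
    · exact ⟨(min_le_left _ _).trans (by rw [le_div_iff₀ hf]; exact h2),
        le_trans (by rw [div_le_iff₀ hf]; exact h1) (le_max_right _ _)⟩

lemma Pr_zero (y : Eu n) : Pr n p B 1 0 y = ‖y‖ ^ 2 + B := by simp [Pr]

lemma f_continuousOn (h : Centered n p B K Q) :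
    ContinuousOn (fun q : ℝ × Eu n => fD n p B Q q.1 q.2) (Set.Ici 0 ×ˢ Set.univ) :=
  (h.press.continuousOn_rpow _).sub (h.prPress.continuousOn_rpow _)

lemma dSys (h : Centered n p B K Q) :
    DSys n (fD n p B Q) (wD n p B Q) (potD n p B Q) := by
  have hs1 : (p + n) / 2 ≠ 1 := h.hs.ne'
  have hk : (n : ℝ) + 1 < 2 * ((n + 1 + p / 2) / 2) := by linarith [h.hp]
  have hf0 : Continuous (fD n p B Q 0) := h.f_continuousOn.slice' Set.self_mem_Ici
  have hfb : ∀ z, |fD n p B Q 0 z| ≤ K * (‖z‖ ^ 2 + B) ^ (-((n + 1 + p / 2) / 2)) := fun z => by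
    unfold fD; rw [Pr_zero]; exact h.init z
  refine DSys.of_initial h.f_continuousOn
    (continuousOn_const.mul ((h.press.continuousOn_rpow _).sub (h.prPress.continuousOn_rpow _)))
    ((h.press.contDiffOn_rpow _).sub (h.prPress.contDiffOn_rpow _))
    (contDiffOn_const.mul ((h.press.contDiffOn_rpow _).sub (h.prPress.contDiffOn_rpow _)))
    (fun τ hτ y => ?_) ((continuous_newt h.hn h.hB h.hK hk hf0 hfb).div_const _) fun φ hφ => ?_
  · have e : lap n (wD n p B Q τ) y = (p + n) / 2 / ((p + n) / 2 - 1) *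
        lap n (fun x => Q τ x ^ (1 - (p + n) / 2)) y - (p + n) / 2 / ((p + n) / 2 - 1) *
        lap n (fun x => Pr n p B 1 τ x ^ (1 - (p + n) / 2)) y := by
      unfold wD
      rw [lap_const_mul, lap_sub (contDiff_rpow (h.press.slice hτ) (h.press.pos τ hτ.le) _)
        (contDiff_rpow (h.prPress.slice hτ) (h.prPress.pos τ hτ.le) _), mul_sub]
    rw [e]
    exact (h.press.hasDerivAt_rpow_neg hs1 hτ y).sub (h.prPress.hasDerivAt_rpow_neg hs1 hτ y)
  · have := integral_lap_mul_newt h.hn h.hB h.hK hk hf0 hfb hφ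
    have hm := (potMass_pos h.hn).ne'
    simp only [← mul_div_assoc]
    rw [integral_div, this, mul_comm, mul_div_assoc, div_self hm, mul_one]

lemma D_initial (h : Centered n p B K Q) : ∃ C, 0 ≤ C ∧ ∀ y,
    |potD n p B Q 0 y| ≤ C * (‖y‖ ^ 2 + B) ^ (-((n - 1 + p / 2) / 2)) := by
  have hf0 : Continuous (fD n p B Q 0) := h.f_continuousOn.slice' Set.self_mem_Ici
  obtain ⟨C, hC, hCn⟩ := newt_decay h.hn h.hp h.hp2 h.hB h.hK hf0
    (fun z => by unfold fD; rw [Pr_zero]; exact h.init z)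
    (by simp only [fD, Pr_zero]; exact h.mass) (by simp only [fD, Pr_zero]; exact h.moment)
  have hm := potMass_pos h.hn
  refine ⟨C / potMass n, by positivity, fun y => ?_⟩
  simp only [potD, intervalIntegral.integral_same, add_zero]
  rw [abs_div, abs_of_pos hm, div_mul_eq_mul_div]
  gcongr
  exact hCn y

lemma w_far (h : Centered n p B K Q) : ∃ C, 0 ≤ C ∧ ∀ τ, 0 ≤ τ → ∀ y,
    |wD n p B Q τ y| ≤ C * Pr n p B 1 τ y ^ (1 - (p + n) / 2) := by
  obtain ⟨Λ, hΛ, hr⟩ := h.ratio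
  have hs := h.hs
  set s := (p + (n : ℝ)) / 2 with hsd
  have hs1 : 0 < s - 1 := by linarith
  have hs0 : 0 < s := by linarith
  have hΛ0 : 0 < Λ := by linarith
  refine ⟨s / (s - 1) * (Λ ^ (s - 1) + 1), by positivity, fun τ hτ y => ?_⟩
  have hP := h.pr_pos hτ y
  have hQ := h.press.pos τ hτ y
  have h1 : Q τ y ^ (1 - s) ≤ Λ ^ (s - 1) * Pr n p B 1 τ y ^ (1 - s) := by
    have : Pr n p B 1 τ y / Λ ≤ Q τ y := by
      rw [div_le_iff₀ hΛ0, mul_comm]; exact (hr τ hτ y).1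
    calc Q τ y ^ (1 - s) ≤ (Pr n p B 1 τ y / Λ) ^ (1 - s) :=
          Real.rpow_le_rpow_of_nonpos (by positivity) this (by linarith)
      _ = _ := by
          rw [Real.div_rpow hP.le hΛ0.le, show 1 - s = -(s - 1) by ring, Real.rpow_neg hΛ0.le,
            div_inv_eq_mul, mul_comm]
  have hQ' := Real.rpow_pos_of_pos hQ (1 - s)
  have hP' := Real.rpow_pos_of_pos hP (1 - s)
  unfold wD
  rw [← hsd, abs_mul, abs_of_pos (by positivity : 0 < s / (s - 1)), mul_assoc]
  gcongr
  rw [abs_le]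
  constructor <;> nlinarith

/-- The potential vanishes at infinity, locally uniformly in time. -/
lemma D_far (h : Centered n p B K Q) (T : ℝ) {σ : ℝ} (hσ : 0 < σ) :
    ∃ R, ∀ τ, 0 ≤ τ → τ ≤ T → ∀ y, R ≤ ‖y‖ → |potD n p B Q τ y| ≤ σ := by
  obtain ⟨C0, hC0, h0⟩ := h.D_initial
  obtain ⟨C1, hC1, h1⟩ := h.w_far
  have hn : (1 : ℝ) ≤ n := by exact_mod_cast h.hn
  have hB := h.hB
  have hp := h.hp
  rcases lt_or_ge T 0 with hT | hT
  · exact ⟨0, fun τ h1 h2 => by linarith⟩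
  have hθ := th_pos hp hT
  have t2 := tendsto_pow_atTop (α := ℝ) two_ne_zero
  have t3 := (tendsto_rpow_neg_atTop (y := ((n : ℝ) - 1 + p / 2) / 2) (by linarith)).comp t2
  have t4 := (tendsto_rpow_neg_atTop (y := (p + (n : ℝ)) / 2 - 1) (by linarith [h.hs])).comp
    (t2.atTop_div_const hθ)
  have ht := (t3.const_mul C0).add (t4.const_mul (T * C1))
  simp only [mul_zero, add_zero] at ht
  obtain ⟨R, hR⟩ := ((ht.eventually (ge_mem_nhds hσ)).and
    (eventually_gt_atTop 0)).exists_forall_of_atTop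
  refine ⟨R, fun τ hτ hτT y hy => ?_⟩
  obtain ⟨hR1, hR2⟩ := hR ‖y‖ hy
  refine le_trans ?_ hR1
  have hD : potD n p B Q τ y = potD n p B Q 0 y + ∫ t in (0 : ℝ)..τ, wD n p B Q (max t 0) y := by
    simp [potD]
  rw [hD]
  refine (abs_add_le _ _).trans (add_le_add ?_ ?_)
  · refine (h0 y).trans ?_
    gcongr ?_ * ?_
    exact Real.rpow_le_rpow_of_nonpos (by positivity) (by linarith)
      (by linarith)
  · have := intervalIntegral.norm_integral_le_of_norm_le_const (a := 0) (b := τ)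
      (f := fun t => wD n p B Q (max t 0) y)
      (C := C1 * (‖y‖ ^ 2 / th p T) ^ (-((p + (n : ℝ)) / 2 - 1))) (fun t ht => ?_)
    · rw [Real.norm_eq_abs, sub_zero, abs_of_nonneg hτ] at this
      refine this.trans ?_
      simp only [Function.comp]
      have : 0 ≤ C1 * (‖y‖ ^ 2 / th p T) ^ (-((p + (n : ℝ)) / 2 - 1)) := by positivity
      nlinarith
    · rw [Set.uIoc_of_le hτ] at ht
      rw [max_eq_left ht.1.le, Real.norm_eq_abs]
      refine (h1 t ht.1.le y).trans ?_
      gcongr ?_ * ?_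
      rw [show 1 - (p + (n : ℝ)) / 2 = -((p + (n : ℝ)) / 2 - 1) by ring]
      refine Real.rpow_le_rpow_of_nonpos (by positivity) ?_ (by linarith [h.hs])
      rw [Pr_eq_XX hp ht.1.le]
      have hθt := th_pos hp ht.1.le
      have hSc := Sc_pos (n := n) hp ht.1.le
      have h5 : th p t ≤ th p T := by unfold th; nlinarith [ht.2]
      calc ‖y‖ ^ 2 / th p T ≤ ‖y‖ ^ 2 / th p t := by gcongr
        _ ≤ _ := by
          gcongr; unfold XX
          have : 0 < B * Sc n p t := by positivity
          linarith

end Centered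

section Barrier

variable {n : ℕ} {f w D : ℝ → Eu n → ℝ}

lemma DSys.lap_mol_potential (h : DSys n f w D) {ψ : Eu n → ℝ} (hψ : IsTest ψ) {τ : ℝ}
    (hτ : 0 ≤ τ) : lap n (mol ψ (D τ)) = mol ψ (f τ) := by
  ext y
  rw [lap_mol hψ (h.dc.slice' hτ), mol_eq_swap, mol_eq_swap, ← h.weak _ (hψ.reflect y) τ hτ]
  congr 1
  ext z
  have := lap_rescale (x := z) hψ.smooth y (-1)
  simp only [neg_one_smul, ← sub_eq_add_neg] at this
  rw [this]; norm_num

lemma DSys.mol_hasDerivAt_potential (h : DSys n f w D) {ψ : Eu n → ℝ} (hψ : IsTest ψ) {τ : ℝ}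
    (hτ : 0 < τ) (y : Eu n) : HasDerivAt (fun t => mol ψ (D t) y) (mol ψ (w τ) y) τ := by
  have hIoi : Set.Ioi (0 : ℝ) ×ˢ (Set.univ : Set (Eu n)) ⊆ Set.Ici 0 ×ˢ Set.univ :=
    Set.prod_mono Set.Ioi_subset_Ici_self subset_rfl
  exact mol_hasDerivAt isOpen_Ioi hψ (h.dc.mono hIoi) (h.wc.mono hIoi)
    (fun t ht y => h.dt t ht y) hτ y

/-- Comparison of the potential with a barrier that can be touched from above by
smooth supersolutions. -/
lemma DSys.le_barrier (h : DSys n f w D) {a b : ℝ → Eu n → ℝ} {t0 T : ℝ} (ht0 : 0 ≤ t0)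
    (hb : ContinuousOn (fun q : ℝ × Eu n => b q.1 q.2) (Set.Icc t0 T ×ˢ Set.univ))
    (h0 : ∀ y, D t0 y ≤ b t0 y)
    (hinf : ∀ σ, 0 < σ → ∃ R, ∀ τ ∈ Set.Icc t0 T, ∀ y, R ≤ ‖y‖ → D τ y ≤ b τ y + σ)
    (hw : ∀ τ ∈ Set.Icc t0 T, ∀ y, w τ y = a τ y * f τ y)
    (ha : ∀ τ ∈ Set.Icc t0 T, ∀ y, 0 ≤ a τ y)
    (hab : ∀ R, ∃ A, ∀ τ ∈ Set.Icc t0 T, ∀ y, ‖y‖ ≤ R → a τ y ≤ A)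
    (htouch : ∀ τ, t0 < τ → τ ≤ T → ∀ y, ∃ (F : ℝ → Eu n → ℝ) (F' : ℝ), F τ y = b τ y ∧
      (∀ᶠ x in 𝓝 y, b τ x ≤ F τ x) ∧ (∀ᶠ t in 𝓝 τ, b t y ≤ F t y) ∧ ContDiff ℝ ∞ (F τ) ∧
      HasDerivAt (fun t => F t y) F' τ ∧ a τ y * lap n (F τ) y ≤ F') :
    ∀ τ ∈ Set.Icc t0 T, ∀ y, D τ y ≤ b τ y := by
  intro τ1 hτ1 y1
  by_contra! hlt
  set d := D τ1 y1 - b τ1 y1 with hd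
  have hd0 : 0 < d := by linarith
  have hT : 0 < 1 + T - t0 := by linarith [hτ1.1, hτ1.2]
  set η := d / (4 * (1 + T - t0)) with hη
  have hη0 : 0 < η := by positivity
  have hηT : η * (1 + T - t0) = d / 4 := by rw [hη]; field_simp
  obtain ⟨R0, hR0⟩ := hinf (η / 2) (by positivity)
  set R := max R0 ‖y1‖ with hR
  obtain ⟨A, hA⟩ := hab R
  set σ := min (η / (2 * (|A| + 2))) (d / 4) with hσ
  have hσ0 : 0 < σ := by positivity
  have hσA : (|A| + 2) * σ ≤ η / 2 := by
    have : σ ≤ η / (2 * (|A| + 2)) := min_le_left _ _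
    rw [le_div_iff₀ (by positivity)] at this
    linarith
  have hσd : σ ≤ d / 4 := min_le_right _ _
  have hση : σ ≤ η / 2 := by
    have : 0 ≤ (|A| + 1) * σ := by positivity
    linarith
  have hIcc : Set.Icc t0 T ×ˢ (Set.univ : Set (Eu n)) ⊆ Set.Ici 0 ×ˢ Set.univ :=
    Set.prod_mono (fun t ht => ht0.trans ht.1) subset_rfl
  obtain ⟨ψ, hψ, -, hap⟩ := exists_bump_approx (t0 := t0) (T := T) (R := R) hσ0
    (G := fun j : Fin 3 => if j = 0 then D else if j = 1 then f else w) (fun j => by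
      fin_cases j
      · exact h.dc.mono hIcc
      · exact h.fc.mono hIcc
      · exact h.wc.mono hIcc)
  have hapD : ∀ t ∈ Set.Icc t0 T, ∀ y : Eu n, ‖y‖ ≤ R → |mol ψ (D t) y - D t y| ≤ σ := hap 0
  have hapf : ∀ t ∈ Set.Icc t0 T, ∀ y : Eu n, ‖y‖ ≤ R → |mol ψ (f t) y - f t y| ≤ σ := hap 1
  have hapw : ∀ t ∈ Set.Icc t0 T, ∀ y : Eu n, ‖y‖ ≤ R → |mol ψ (w t) y - w t y| ≤ σ := hap 2
  obtain ⟨t, y, htt, htT, hyR, -, hmt, hmx⟩ := parabolic_max (t0 := t0) (T := T) (R := R) (k := 0)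
    (x0 := (0 : Eu n)) (u := fun t y => mol ψ (D t) y - b t y - η * (1 + t - t0))
    (by
      refine ContinuousOn.mono (s := Set.Icc t0 T ×ˢ Set.univ) ?_
        (Set.prod_mono subset_rfl (Set.subset_univ _))
      exact ((mol_continuousOn hψ (h.dc.mono hIcc)).sub hb).sub (by fun_prop))
    (fun x hx => by
      have hx' : ‖x‖ ≤ R := by simpa using hx
      have := (abs_le.1 (hapD t0 ⟨le_rfl, by linarith [hτ1.1, hτ1.2]⟩ x hx')).2
      have := h0 x
      simp only [add_sub_cancel_right, mul_one]
      linarith)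
    (fun t ht x hx => by
      have hx' : ‖x‖ = R := by simpa using hx
      have := (abs_le.1 (hapD t ht x hx'.le)).2
      have := hR0 t ht x (by rw [hx']; exact le_max_left _ _)
      have : 0 ≤ η * (t - t0) := mul_nonneg hη0.le (by linarith [ht.1])
      linarith)
    ⟨τ1, hτ1, y1, by simp [hR], by
      have := (abs_le.1 (hapD τ1 hτ1 y1 (le_max_right _ _))).1
      have : η * (1 + τ1 - t0) ≤ η * (1 + T - t0) := by
        have := hτ1.2
        gcongr
      linarith⟩
  have htm : t ∈ Set.Icc t0 T := ⟨htt.le, htT⟩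
  have ht0' : 0 < t := ht0.trans_lt htt
  have hyR' : ‖y‖ ≤ R := by simpa using hyR.le
  obtain ⟨F, F', hF0, hFx, hFt, hFs, hFd, hFa⟩ := htouch t htt htT y
  have hDs := contDiff_mol hψ (h.dc.slice' (s := Set.Ici 0) (τ := t) ht0'.le)
  have hlap : lap n (fun x => mol ψ (D t) x - F t x) y ≤ 0 := by
    refine lap_nonpos_of_isLocalMax (hDs.sub hFs) ?_
    filter_upwards [hmx, hFx] with x h1 h2
    linarith
  rw [lap_sub hDs hFs, h.lap_mol_potential hψ ht0'.le] at hlap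
  have hder : 0 ≤ mol ψ (w t) y - F' - η := by
    obtain ⟨ε, hε, hball⟩ := Metric.eventually_nhds_iff.1 hFt
    refine deriv_nonneg_of_max_left (u := fun t => mol ψ (D t) y - F t y - η * (1 + t - t0))
      (t0 := max t0 (t - ε / 2)) (t := t) ?_ (max_lt htt (by linarith)) fun r hr => ?_
    · refine ((h.mol_hasDerivAt_potential hψ ht0' y).sub hFd).sub ?_
      exact ((((hasDerivAt_id t).const_add 1).sub_const t0).const_mul η).congr_deriv (mul_one _)
    · have hr1 : t0 ≤ r := (le_max_left _ _).trans hr.1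
      have hr2 : t - ε / 2 ≤ r := (le_max_right _ _).trans hr.1
      have h1 := hmt r ⟨hr1, hr.2⟩
      have h2 := hball (y := r) (by rw [Real.dist_eq, abs_lt]; constructor <;> linarith [hr.2])
      linarith
  have e1 := (abs_le.1 (hapf t htm y hyR')).1
  have e2 := (abs_le.1 (hapw t htm y hyR')).2
  have e3 : w t y ≤ a t y * lap n (F t) y + a t y * σ := by
    rw [hw t htm y, ← mul_add]
    exact mul_le_mul_of_nonneg_left (by linarith) (ha t htm y)
  have e4 : a t y * σ ≤ |A| * σ := by
    gcongr
    exact (hA t htm y hyR').trans (le_abs_self A)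
  linarith

end Barrier

section Blocks

variable {n : ℕ} {p b τ : ℝ}

lemma contDiff_XX (hp : 0 < p) (hb : 0 < b) (hτ : 0 ≤ τ) (κ : ℝ) :
    ContDiff ℝ ∞ (fun y : Eu n => XX n p b τ y ^ (-κ)) :=
  contDiff_rpow (contDiff_normSq.add contDiff_const) (fun y => XX_pos hp hb hτ y) _

lemma continuousAt_XX (hp : 0 < p) (hb : 0 < b) {q : ℝ × Eu n} (hτ : 0 ≤ q.1) (κ : ℝ) :
    ContinuousAt (fun q : ℝ × Eu n => XX n p b q.1 q.2 ^ (-κ)) q := by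
  refine ContinuousAt.rpow_const ?_ (Or.inl (XX_pos hp hb hτ q.2).ne')
  refine ContinuousAt.add (by fun_prop) (continuousAt_const.mul ?_)
  exact (hasDerivAt_Sc (n := n) hp hτ).continuousAt.comp (f := fun q : ℝ × Eu n => q.1)
    continuousAt_fst

/-- Time derivative of a barrier block. -/
lemma block_hasDerivAt (hp : 0 < p) (hb : 0 < b) (hτ : 0 ≤ τ) {g : ℝ → ℝ} {G : ℝ}
    (hg : HasDerivAt g (g τ * G / th p τ) τ) (κ : ℝ) (y : Eu n) :
    HasDerivAt (fun t => g t * XX n p b t y ^ (-κ))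
      (g τ * XX n p b τ y ^ (-κ) / th p τ *
        (G - 2 * κ * (p + n) * (b * Sc n p τ / XX n p b τ y))) τ := by
  have hX := XX_pos hp hb hτ y
  have h1 : HasDerivAt (fun t => XX n p b t y) (b * (2 * (p + n) * Sc n p τ / th p τ)) τ :=
    ((hasDerivAt_Sc (n := n) hp hτ).const_mul b).const_add (‖y‖ ^ 2)
  refine (hg.mul (h1.rpow_const (p := -κ) (Or.inl hX.ne'))).congr_deriv ?_
  rw [Real.rpow_sub_one hX.ne']
  field_simp
  ring

/-- Laplacian of a barrier block. -/
lemma block_lap (hp : 0 < p) (hb : 0 < b) (hτ : 0 ≤ τ) (c κ : ℝ) (y : Eu n) :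
    lap n (fun x => c * XX n p b τ x ^ (-κ)) y =
      c * XX n p b τ y ^ (-κ) / XX n p b τ y *
        (2 * κ * (2 * κ + 2 - n) - 4 * κ * (κ + 1) * (b * Sc n p τ / XX n p b τ y)) := by
  have hX := XX_pos hp hb hτ y
  have hs : ContDiff ℝ ∞ (fun y : Eu n => XX n p b τ y) := contDiff_normSq.add contDiff_const
  have e1 : lap n (fun y : Eu n => XX n p b τ y) y = 2 * n := by
    unfold XX
    rw [lap_add contDiff_normSq contDiff_const, lap_normSq, lap_const, add_zero]
  have e2 : ∀ i, pd n i (fun y : Eu n => XX n p b τ y) y = 2 * y i := fun i => by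
    unfold XX
    rw [pd_add contDiff_normSq contDiff_const, pd_normSq, pd_const]
    simp
  rw [lap_const_mul, lap_rpow hs (fun y => XX_pos hp hb hτ y), e1]
  simp only [e2, mul_pow, ← Finset.mul_sum, sum_coord_sq]
  have e3 : ‖y‖ ^ 2 = XX n p b τ y - b * Sc n p τ := by unfold XX; ring
  have e4 : XX n p b τ y ^ (-κ - 1) = XX n p b τ y ^ (-κ) / XX n p b τ y :=
    Real.rpow_sub_one hX.ne' _
  have e5 : XX n p b τ y ^ (-κ - 2) = XX n p b τ y ^ (-κ) / XX n p b τ y / XX n p b τ y := by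
    rw [show -κ - 2 = -κ - 1 - 1 by ring, Real.rpow_sub_one hX.ne', e4]
  rw [e3, e4, e5]
  field_simp
  ring

lemma block_super (hp : 0 < p) (hb : 0 < b) (hτ : 0 ≤ τ) {g : ℝ → ℝ} {G a κ : ℝ} (y : Eu n)
    (hg : 0 ≤ g τ)
    (h : a * th p τ / XX n p b τ y *
      (2 * κ * (2 * κ + 2 - n) - 4 * κ * (κ + 1) * (b * Sc n p τ / XX n p b τ y)) ≤
        G - 2 * κ * (p + n) * (b * Sc n p τ / XX n p b τ y)) :
    a * lap n (fun x => g τ * XX n p b τ x ^ (-κ)) y ≤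
      g τ * XX n p b τ y ^ (-κ) / th p τ *
        (G - 2 * κ * (p + n) * (b * Sc n p τ / XX n p b τ y)) := by
  have hX := XX_pos hp hb hτ y
  have hθ := th_pos hp hτ
  rw [block_lap hp hb hτ]
  have hc : 0 ≤ g τ * XX n p b τ y ^ (-κ) / th p τ := by positivity
  refine le_trans (le_of_eq ?_) (mul_le_mul_of_nonneg_left h hc)
  field_simp

lemma zfrac_mem (hp : 0 < p) (hb : 0 < b) (hτ : 0 ≤ τ) (y : Eu n) :
    0 < b * Sc n p τ / XX n p b τ y ∧ b * Sc n p τ / XX n p b τ y ≤ 1 := by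
  have hX := XX_pos hp hb hτ y
  have hS := Sc_pos (n := n) hp hτ
  refine ⟨by positivity, ?_⟩
  rw [div_le_one hX]; unfold XX
  have : 0 ≤ ‖y‖ ^ 2 := by positivity
  linarith

lemma hasDerivAt_pow_block (hp : 0 < p) (hτ : 0 ≤ τ) (c e : ℝ) :
    HasDerivAt (fun t => c * th p t ^ e) (c * th p τ ^ e * (2 * p * e) / th p τ) τ := by
  refine ((hasDerivAt_th_rpow hp hτ e).const_mul c).congr_deriv ?_
  ring

end Blocks

namespace Centered

variable {n : ℕ} {p B K : ℝ} {Q : ℝ → Eu n → ℝ}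

lemma a_nonneg (h : Centered n p B K Q) {τ : ℝ} (hτ : 0 ≤ τ) (y : Eu n) :
    0 ≤ aD n p B Q τ y :=
  le_trans (le_min (h.press.pos τ hτ y).le (h.pr_pos hτ y).le) (h.a_bounds hτ y).1

/-- Two-sided barrier bound for the potential. -/
lemma abs_le_barrier (h : Centered n p B K Q) {b : ℝ → Eu n → ℝ} {t0 : ℝ} (ht0 : 0 ≤ t0)
    (hb : ∀ τ, t0 ≤ τ → ∀ y, ContinuousAt (fun q : ℝ × Eu n => b q.1 q.2) (τ, y))
    (hb0 : ∀ τ, t0 ≤ τ → ∀ y, 0 ≤ b τ y)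
    (h0 : ∀ y, |potD n p B Q t0 y| ≤ b t0 y)
    (htouch : ∀ τ, t0 < τ → ∀ y, ∃ (F : ℝ → Eu n → ℝ) (F' : ℝ), F τ y = b τ y ∧
      (∀ᶠ x in 𝓝 y, b τ x ≤ F τ x) ∧ (∀ᶠ t in 𝓝 τ, b t y ≤ F t y) ∧ ContDiff ℝ ∞ (F τ) ∧
      HasDerivAt (fun t => F t y) F' τ ∧ aD n p B Q τ y * lap n (F τ) y ≤ F')
    {τ : ℝ} (hτ : t0 ≤ τ) (y : Eu n) : |potD n p B Q τ y| ≤ b τ y := by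
  have hbc : ContinuousOn (fun q : ℝ × Eu n => b q.1 q.2) (Set.Icc t0 τ ×ˢ Set.univ) :=
    fun q hq => (hb q.1 hq.1.1 q.2).continuousWithinAt
  have hinf : ∀ σ, 0 < σ → ∃ R, ∀ t ∈ Set.Icc t0 τ, ∀ y, R ≤ ‖y‖ →
      |potD n p B Q t y| ≤ b t y + σ := fun σ hσ => by
    obtain ⟨R, hR⟩ := h.D_far τ hσ
    exact ⟨R, fun t ht y hy => by
      linarith [hR t (ht0.trans ht.1) ht.2 y hy, hb0 t ht.1 y]⟩
  have ha : ∀ t ∈ Set.Icc t0 τ, ∀ y, 0 ≤ aD n p B Q t y := fun t ht y =>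
    h.a_nonneg (ht0.trans ht.1) y
  have hab : ∀ R, ∃ A, ∀ t ∈ Set.Icc t0 τ, ∀ y, ‖y‖ ≤ R → aD n p B Q t y ≤ A := fun R => by
    have hc : IsCompact (Set.Icc t0 τ ×ˢ Metric.closedBall (0 : Eu n) R) :=
      isCompact_Icc.prod (isCompact_closedBall _ _)
    obtain ⟨A, hA⟩ := hc.bddAbove_image (f := fun q => max (Q q.1 q.2) (Pr n p B 1 q.1 q.2))
      ((h.press.cont.sup h.prPress.cont).mono
        (Set.prod_mono (fun t ht => ht0.trans ht.1) (Set.subset_univ _)))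
    exact ⟨A, fun t ht y hy => ((h.a_bounds (ht0.trans ht.1) y).2).trans
      (hA ⟨(t, y), ⟨ht, by simpa using hy⟩, rfl⟩)⟩
  rw [abs_le']
  constructor
  · refine h.dSys.le_barrier ht0 hbc (fun y => (le_abs_self _).trans (h0 y)) (fun σ hσ => ?_)
      (fun t ht y => h.w_eq (ht0.trans ht.1) y) ha hab (fun t ht _ y => htouch t ht y) τ
      ⟨hτ, le_rfl⟩ y
    obtain ⟨R, hR⟩ := hinf σ hσ
    exact ⟨R, fun t ht y hy => (le_abs_self _).trans (hR t ht y hy)⟩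
  · refine h.dSys.neg.le_barrier ht0 hbc (fun y => (neg_le_abs _).trans (h0 y)) (fun σ hσ => ?_)
      (fun t ht y => ?_) ha hab (fun t ht _ y => htouch t ht y) τ ⟨hτ, le_rfl⟩ y
    · obtain ⟨R, hR⟩ := hinf σ hσ
      exact ⟨R, fun t ht y hy => (neg_le_abs _).trans (hR t ht y hy)⟩
    · rw [h.w_eq (ht0.trans ht.1) y, mul_neg]

/-- Barriers consisting of a single block. -/
lemma abs_le_block (h : Centered n p B K Q) {t0 κ b : ℝ} (ht0 : 0 ≤ t0) (hb : 0 < b)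
    {g G : ℝ → ℝ}
    (hg0 : ∀ τ, t0 ≤ τ → 0 ≤ g τ)
    (hg : ∀ τ, t0 ≤ τ → HasDerivAt g (g τ * G τ / th p τ) τ)
    (h0 : ∀ y, |potD n p B Q t0 y| ≤ g t0 * XX n p b t0 y ^ (-κ))
    (hsup : ∀ τ, t0 < τ → ∀ y, aD n p B Q τ y * th p τ / XX n p b τ y *
      (2 * κ * (2 * κ + 2 - n) - 4 * κ * (κ + 1) * (b * Sc n p τ / XX n p b τ y)) ≤
        G τ - 2 * κ * (p + n) * (b * Sc n p τ / XX n p b τ y))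
    {τ : ℝ} (hτ : t0 ≤ τ) (y : Eu n) :
    |potD n p B Q τ y| ≤ g τ * XX n p b τ y ^ (-κ) := by
  refine h.abs_le_barrier (b := fun τ y => g τ * XX n p b τ y ^ (-κ)) ht0 (fun τ hτ y => ?_)
    (fun τ hτ y => ?_) h0 (fun τ hτ y => ?_) hτ y
  · exact ((hg τ hτ).continuousAt.comp (f := fun q : ℝ × Eu n => q.1)
      continuousAt_fst).mul (continuousAt_XX h.hp hb (q := (τ, y)) (ht0.trans hτ) κ)
  · have := XX_pos h.hp hb (ht0.trans hτ) y
    have := hg0 τ hτ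
    positivity
  · have hτ0 := ht0.trans hτ.le
    exact ⟨fun τ y => g τ * XX n p b τ y ^ (-κ), _, rfl, Eventually.of_forall fun _ => le_rfl,
      Eventually.of_forall fun _ => le_rfl, contDiff_const.mul (contDiff_XX h.hp hb hτ0 κ),
      block_hasDerivAt h.hp hb hτ0 (hg τ hτ.le) κ y,
      block_super h.hp hb hτ0 y (hg0 τ hτ.le) (hsup τ hτ y)⟩

/-- The diffusion coefficient compared with the Barenblatt one. -/
lemma a_ratio (h : Centered n p B K Q) : ∃ Λ, 1 ≤ Λ ∧ ∀ τ, 0 ≤ τ → ∀ y,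
    1 / Λ ≤ aD n p B Q τ y * th p τ / XX n p B τ y ∧
    aD n p B Q τ y * th p τ / XX n p B τ y ≤ Λ ∧
    aD n p B Q τ y * th p τ / XX n p B τ y ≤
      1 + Λ * (1 / th p τ + Sc n p τ / XX n p B τ y) := by
  obtain ⟨Λ, hΛ, hr⟩ := h.ratio
  refine ⟨Λ, hΛ, fun τ hτ y => ?_⟩
  have hΛ0 : 0 < Λ := by linarith
  have hθ := th_pos h.hp hτ
  have hX := XX_pos (n := n) h.hp h.hB hτ y
  have hS := Sc_pos (n := n) h.hp hτ
  obtain ⟨h1, h2, h3⟩ := hr τ hτ y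
  obtain ⟨h4, h5⟩ := h.a_bounds hτ y
  have hP := h.pr_pos hτ y
  have e : XX n p B τ y = Pr n p B 1 τ y * th p τ := by
    rw [Pr_eq_XX h.hp hτ]; field_simp
  rw [e, mul_div_mul_right _ _ hθ.ne']
  refine ⟨?_, ?_, ?_⟩
  · rw [div_le_div_iff₀ hΛ0 hP]
    have : Pr n p B 1 τ y ≤ Λ * min (Q τ y) (Pr n p B 1 τ y) := by
      rw [mul_min_of_nonneg _ _ hΛ0.le]
      exact le_min h1 (le_mul_of_one_le_left hP.le hΛ)
    nlinarith
  · rw [div_le_iff₀ hP]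
    exact h5.trans (max_le h2 (le_mul_of_one_le_left hP.le hΛ))
  · rw [div_le_iff₀ hP, ← e]
    refine h5.trans (max_le ?_ ?_)
    · have := (abs_le.1 h3).2
      linarith
    · have : 0 ≤ Λ * (1 / th p τ + Sc n p τ / XX n p B τ y) * Pr n p B 1 τ y := by positivity
      linarith

lemma exists_lt_of_n (h : Centered n p B K Q) : 0 < ((n : ℝ) - 1 + p / 2) / 2 := by
  have hn : (1 : ℝ) ≤ n := by exact_mod_cast h.hn
  linarith [h.hp]

lemma XX_zero (y : Eu n) : XX n p B 0 y = ‖y‖ ^ 2 + B := by simp [XX, Sc, th]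

/-- A rough decay bound for the potential, with a growing constant. -/
lemma D_rough (h : Centered n p B K Q) : ∃ C E : ℝ, 0 ≤ C ∧ 0 ≤ E ∧ ∀ τ, 0 ≤ τ → ∀ y,
    |potD n p B Q τ y| ≤ C * th p τ ^ E * XX n p B τ y ^ (-(((n : ℝ) - 1 + p / 2) / 2)) := by
  obtain ⟨C, hC, h0⟩ := h.D_initial
  obtain ⟨Λ, hΛ, hr⟩ := h.a_ratio
  have hα := h.exists_lt_of_n
  have hp := h.hp
  set α := ((n : ℝ) - 1 + p / 2) / 2 with hαd
  have e1 : 2 * α + 2 - n = 1 + p / 2 := by rw [hαd]; ring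
  set E := (Λ * (2 * α * (1 + p / 2)) + 2 * α * (p + n)) / (2 * p) with hE
  have hE' : 2 * p * E = Λ * (2 * α * (1 + p / 2)) + 2 * α * (p + n) := by rw [hE]; field_simp
  refine ⟨C, E, hC, by positivity, fun τ hτ y => ?_⟩
  refine h.abs_le_block (t0 := 0) (g := fun τ => C * th p τ ^ E) (G := fun _ => 2 * p * E) le_rfl
    h.hB (fun τ hτ => ?_) (fun τ hτ => hasDerivAt_pow_block hp hτ C E) (fun y => ?_)
    (fun τ hτ y => ?_) hτ y
  · have := th_pos hp hτ
    positivity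
  · rw [XX_zero]
    simpa [th] using h0 y
  · obtain ⟨r1, r2, -⟩ := hr τ hτ.le y
    obtain ⟨z1, z2⟩ := zfrac_mem (n := n) hp h.hB hτ.le y
    set ζ := aD n p B Q τ y * th p τ / XX n p B τ y
    set z := B * Sc n p τ / XX n p B τ y
    have hζ : 0 ≤ ζ := le_trans (by positivity) r1
    rw [e1, hE']
    have i1 : ζ * (2 * α * (1 + p / 2)) ≤ Λ * (2 * α * (1 + p / 2)) := by gcongr
    have i2 : 2 * α * (p + n) * z ≤ 2 * α * (p + n) * 1 := by gcongr
    have i3 : 0 ≤ ζ * (4 * α * (α + 1) * z) := by positivity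
    linarith

end Centered

section Numeric

lemma XX_rpow_neg_le {n : ℕ} {p b τ κ : ℝ} (hp : 0 < p) (hb : 0 < b) (hτ : 0 ≤ τ) (hκ : 0 ≤ κ)
    (y : Eu n) : XX n p b τ y ^ (-κ) ≤ b ^ (-κ) * Sc n p τ ^ (-κ) := by
  have hS := Sc_pos (n := n) hp hτ
  rw [← Real.mul_rpow hb.le hS.le]
  refine Real.rpow_le_rpow_of_nonpos (by positivity) ?_ (by linarith)
  unfold XX
  have : 0 ≤ ‖y‖ ^ 2 := by positivity
  linarith

lemma XX_rpow_neg_le' {n : ℕ} {p b τ κ : ℝ} (hp : 0 < p) (hb : 0 < b) (hτ : 0 ≤ τ) (hκ : 0 ≤ κ)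
    (y : Eu n) : XX n p b τ y ^ (-κ) ≤ b ^ (-κ) := by
  refine (XX_rpow_neg_le hp hb hτ hκ y).trans (mul_le_of_le_one_right (by positivity) ?_)
  exact Real.rpow_le_one_of_one_le_of_nonpos (one_le_Sc hp hτ) (by linarith)

lemma Sc_rpow {n : ℕ} {p τ : ℝ} (hp : 0 < p) (hτ : 0 ≤ τ) (κ : ℝ) :
    Sc n p τ ^ κ = th p τ ^ (κ * (p + n) / p) := by
  rw [Sc, ← Real.rpow_mul (th_pos hp hτ).le]
  congr 1; ring

/-- The supersolution inequality in the inner region. -/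
lemma inner_super {n κ p σ c ρ₁ μ Λ B ρ ζ : ℝ} (hn : 0 < n) (hκ : 0 < κ) (hp : 0 < p)
    (hσ : 0 < σ) (hc : 0 < c) (hρ₁ : 0 < ρ₁) (hμ : 0 < μ) (hΛ : 0 < Λ) (hB : 0 < B) (hρ : 0 ≤ ρ)
    (hζ : (ρ + B) / Λ ≤ ζ) (h1 : ρ₁ * (2 * Λ * (p + n + 1)) ≤ n * B) (h2 : σ ≤ ρ₁)
    (h3 : 2 * σ * ρ₁ ^ (-κ) ≤ c * ρ₁) (h4 : 2 * p * μ * ρ₁ ≤ κ * σ)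
    (h5 : 2 * p * μ * ρ₁ ^ (-κ) ≤ κ * (p + n) * c) :
    -(ζ * ((ρ + σ) ^ (-κ) / (ρ + σ)) * (2 * κ * n * (σ / (ρ + σ)))) ≤
      (ρ + σ) ^ (-κ) * (-(2 * p * μ) - 2 * κ * (p + n) * (σ / (ρ + σ))) +
        c * (2 * p * μ + 2 * κ * (p + n)) := by
  have hA : 0 < ρ + σ := by positivity
  have hζ0 : 0 ≤ ζ := le_trans (by positivity) hζ
  set M := (ρ + σ) ^ (-κ) with hM
  have hM0 : 0 < M := Real.rpow_pos_of_pos hA _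
  have hc1 : 0 ≤ c * (2 * p * μ) := by positivity
  have hc2 : 0 ≤ c * (2 * κ * (p + n)) := by positivity
  rcases le_or_gt ρ ρ₁ with hle | hgt
  · have k1 : p + n + 1 ≤ ζ * n / (ρ + σ) := by
      rw [le_div_iff₀ hA]
      have : B / Λ ≤ ζ := le_trans (by gcongr; linarith) hζ
      rw [div_le_iff₀ hΛ] at this
      have e1 : (p + n + 1) * (ρ + σ) ≤ (p + n + 1) * (2 * ρ₁) := by gcongr; linarith
      have e2 : (p + n + 1) * (2 * ρ₁) * Λ ≤ ζ * n * Λ := by nlinarith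
      exact e1.trans (le_of_mul_le_mul_right e2 hΛ)
    have k2 : 2 * p * μ ≤ 2 * κ * (σ / (ρ + σ)) := by
      rw [← mul_div_assoc, le_div_iff₀ hA]
      have : 2 * p * μ * (ρ + σ) ≤ 2 * p * μ * (2 * ρ₁) := by gcongr; linarith
      linarith
    have e : ζ * (M / (ρ + σ)) * (2 * κ * n * (σ / (ρ + σ))) =
        M * (2 * κ * (σ / (ρ + σ))) * (ζ * n / (ρ + σ)) := by field_simp
    rw [e]
    have hz : 0 ≤ M * (2 * κ * (σ / (ρ + σ))) := by positivity
    have i1 := mul_le_mul_of_nonneg_left k1 hz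
    have i2 := mul_le_mul_of_nonneg_left k2 hM0.le
    nlinarith
  · have hMle : M ≤ ρ₁ ^ (-κ) :=
      Real.rpow_le_rpow_of_nonpos hρ₁ (by linarith) (by linarith)
    have k1 : M * (2 * p * μ) ≤ κ * (p + n) * c := by
      refine le_trans ?_ h5
      rw [mul_comm]; gcongr
    have k2 : M * (2 * (σ / (ρ + σ))) ≤ c := by
      rw [← mul_div_assoc, ← mul_div_assoc, div_le_iff₀ hA]
      have : M * (2 * σ) ≤ ρ₁ ^ (-κ) * (2 * σ) := by gcongr
      have : c * ρ₁ ≤ c * (ρ + σ) := by gcongr; linarith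
      linarith
    have k3 : κ * (p + n) * (M * (2 * (σ / (ρ + σ)))) ≤ κ * (p + n) * c := by gcongr
    have k4 : 0 ≤ ζ * (M / (ρ + σ)) * (2 * κ * n * (σ / (ρ + σ))) := by positivity
    nlinarith

/-- The supersolution inequality in the outer region. -/
lemma outer_super {n p σ W μ Λ B ρ ζ t : ℝ} (hn : 1 ≤ n) (hp : 0 < p) (hσ : 0 < σ) (hB : 0 < B)
    (hΛ : 0 < Λ) (hσ1 : σ ≤ 1) (hWρ : W ≤ ρ) (hW1 : 8 * n * Λ ≤ W)
    (hW2 : 8 * n * B ≤ W) (hW3 : 4 * n * (p + n) ≤ W) (ht : 8 * n * Λ ≤ t)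
    (hμ : 2 * p * μ ≤ 1 / 4) (hζ0 : 0 ≤ ζ) (hζ : ζ ≤ 1 + Λ * (1 / t + 1 / (ρ + B))) :
    ζ * ((ρ + B) / (ρ + σ)) * ((n - 1) - (n - 1) * (n + 1) * (σ / (ρ + σ))) ≤
      (-(2 * p * μ) + (p + n)) - (n - 1) * (p + n) * (σ / (ρ + σ)) := by
  have hW : 0 < W := lt_of_lt_of_le (by positivity) hW1
  have hρ : 0 < ρ := by linarith
  have hn0 : 0 < n := by linarith
  have ht0 : 0 < t := lt_of_lt_of_le (by positivity) ht
  have hn1 : 0 ≤ n - 1 := by linarith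
  have a1 : Λ * (1 / t) ≤ 1 / (8 * n) := by
    rw [mul_one_div, div_le_div_iff₀ ht0 (by positivity)]; linarith
  have a2 : Λ * (1 / (ρ + B)) ≤ 1 / (8 * n) := by
    rw [mul_one_div, div_le_div_iff₀ (by positivity) (by positivity)]; linarith
  have a3 : (ρ + B) / (ρ + σ) ≤ 1 + 1 / (8 * n) := by
    rw [div_le_iff₀ (by positivity)]
    have : B ≤ 1 / (8 * n) * ρ := by
      rw [one_div, ← div_eq_inv_mul, le_div_iff₀ (by positivity)]; linarith
    have : 0 ≤ 1 / (8 * n) * σ := by positivity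
    nlinarith
  have a4 : (n - 1) * (p + n) * (σ / (ρ + σ)) ≤ 1 / 4 := by
    rw [← mul_div_assoc, div_le_iff₀ (by positivity)]
    have : (n - 1) * (p + n) * σ ≤ n * (p + n) * 1 := by gcongr; linarith
    linarith
  have a5 : 0 ≤ (n - 1) * (n + 1) * (σ / (ρ + σ)) := by positivity
  have hq : 0 ≤ (ρ + B) / (ρ + σ) := by positivity
  have a6 : ζ * ((ρ + B) / (ρ + σ)) ≤ (1 + 2 * (1 / (8 * n))) * (1 + 1 / (8 * n)) := by
    gcongr; linarith
  have a7 : (1 + 2 * (1 / (8 * n))) * (1 + 1 / (8 * n)) * (n - 1) ≤ n - 1 + 1 / 2 := by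
    set x := 1 / (8 * n) with hx
    have hx1 : x * (8 * n) = 1 := by rw [hx]; field_simp
    have hx0 : 0 < x := by positivity
    have : x ≤ 1 / 8 := by nlinarith
    have : (1 + 2 * x) * (1 + x) ≤ 1 + 4 * x := by nlinarith
    have := mul_le_mul_of_nonneg_right this hn1
    nlinarith
  calc _ ≤ ζ * ((ρ + B) / (ρ + σ)) * (n - 1) :=
        mul_le_mul_of_nonneg_left (by linarith) (by positivity)
    _ ≤ (1 + 2 * (1 / (8 * n))) * (1 + 1 / (8 * n)) * (n - 1) := by gcongr
    _ ≤ _ := by linarith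

end Numeric

namespace Centered

variable {n : ℕ} {p B K : ℝ} {Q : ℝ → Eu n → ℝ}

lemma D_decay_one (h : Centered n p B K Q) (hn : n = 1) : ∃ μ C : ℝ, 0 < μ ∧ 0 ≤ C ∧
    ∀ τ, 0 ≤ τ → ∀ y, |potD n p B Q τ y| ≤ C * th p τ ^ (-μ) * Sc n p τ ^ (1 - (n : ℝ) / 2) := by
  obtain ⟨C, hC, h0⟩ := h.D_initial
  have hp := h.hp
  have hα := h.exists_lt_of_n
  refine ⟨(p + n) / (2 * p), C * B ^ (-(((n : ℝ) - 1 + p / 2) / 2)), by positivity,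
    mul_nonneg hC (Real.rpow_nonneg h.hB.le _), fun τ hτ y => ?_⟩
  have hθ := th_pos hp hτ
  have e : th p τ ^ (-((p + n) / (2 * p))) * Sc n p τ ^ (1 - (n : ℝ) / 2) = 1 := by
    rw [Sc_rpow hp hτ, ← Real.rpow_add hθ, hn]
    convert Real.rpow_zero _ using 2
    field_simp; push_cast; ring
  rw [mul_assoc, e, mul_one]
  have := h.abs_le_block (t0 := 0) (κ := 0)
    (g := fun _ => C * B ^ (-(((n : ℝ) - 1 + p / 2) / 2))) (G := fun _ => 0) le_rfl
    h.hB (fun τ hτ => mul_nonneg hC (Real.rpow_nonneg h.hB.le _))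
    (fun τ hτ => by simpa using hasDerivAt_const τ _) (fun y => ?_)
    (fun τ hτ y => by simp) hτ y
  · simpa using this
  · rw [neg_zero, Real.rpow_zero, mul_one]
    refine (h0 y).trans (mul_le_mul_of_nonneg_left ?_ hC)
    rw [← XX_zero (p := p)]
    exact XX_rpow_neg_le' hp h.hB le_rfl hα.le y

lemma D_decay_two (h : Centered n p B K Q) (hn : n = 2) : ∃ μ C : ℝ, 0 < μ ∧ 0 ≤ C ∧
    ∀ τ, 0 ≤ τ → ∀ y, |potD n p B Q τ y| ≤ C * th p τ ^ (-μ) * Sc n p τ ^ (1 - (n : ℝ) / 2) := by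
  obtain ⟨C, hC, h0⟩ := h.D_initial
  obtain ⟨Λ, hΛ, hr⟩ := h.a_ratio
  have hp := h.hp
  have hB := h.hB
  have hα := h.exists_lt_of_n
  set α := ((n : ℝ) - 1 + p / 2) / 2 with hαd
  set κ := min α (1 / (2 * Λ)) with hκd
  have hΛ0 : 0 < Λ := by linarith
  have hκ : 0 < κ := lt_min hα (by positivity)
  have hκΛ : 2 * Λ * κ ≤ 1 := by
    have := min_le_right α (1 / (2 * Λ))
    rw [← hκd, le_div_iff₀ (by positivity)] at this
    linarith
  have hn2 : (n : ℝ) = 2 := by exact_mod_cast hn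
  set μ := κ / Λ / p with hμ
  set e := -μ + κ * (p + n) / p with he
  have hpe : 2 * p * e = -(2 * (κ / Λ)) + 2 * κ * (p + n) := by rw [he, hμ]; field_simp
  refine ⟨μ, C * B ^ (κ - α) * B ^ (-κ), by positivity, by positivity, fun τ hτ y => ?_⟩
  have hθ := th_pos hp hτ
  have key := h.abs_le_block (t0 := 0) (κ := κ)
    (g := fun τ => C * B ^ (κ - α) * th p τ ^ e) (G := fun _ => 2 * p * e) le_rfl
    h.hB (fun τ hτ => ?_) (fun τ hτ => hasDerivAt_pow_block hp hτ _ e) (fun y => ?_)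
    (fun τ hτ y => ?_) hτ y
  · refine key.trans ?_
    have i := XX_rpow_neg_le hp hB hτ hκ.le y
    calc _ ≤ C * B ^ (κ - α) * th p τ ^ e * (B ^ (-κ) * Sc n p τ ^ (-κ)) := by gcongr
      _ = C * B ^ (κ - α) * B ^ (-κ) * (th p τ ^ e * Sc n p τ ^ (-κ)) := by ring
      _ = _ := by
        rw [Sc_rpow hp hτ, ← Real.rpow_add hθ, hn2]
        rw [show (1 : ℝ) - 2 / 2 = 0 by norm_num, Real.rpow_zero, mul_one]
        congr 2
        rw [he, hn2]; ring
  · have := th_pos hp hτ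
    positivity
  · rw [XX_zero]
    have hX : 0 < ‖y‖ ^ 2 + B := by positivity
    refine (h0 y).trans ?_
    simp only [th, mul_zero, add_zero, Real.one_rpow, mul_one, mul_assoc]
    refine mul_le_mul_of_nonneg_left ?_ hC
    rw [show -α = (κ - α) + -κ by ring, Real.rpow_add hX]
    refine mul_le_mul_of_nonneg_right ?_ (by positivity)
    refine Real.rpow_le_rpow_of_nonpos hB ?_ ?_
    · have : 0 ≤ ‖y‖ ^ 2 := by positivity
      linarith
    · linarith [min_le_left α (1 / (2 * Λ))]
  · obtain ⟨r1, r2, -⟩ := hr τ hτ.le y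
    obtain ⟨z1, z2⟩ := zfrac_mem (n := n) hp h.hB hτ.le y
    set ζ := aD n p B Q τ y * th p τ / XX n p B τ y
    set z := B * Sc n p τ / XX n p B τ y
    rw [hpe, hn2]
    have i1 : κ * (1 / Λ) ≤ κ * ζ := by gcongr
    have i2 : κ * (κ * ζ) ≤ κ * (κ * Λ) := by gcongr
    have i3 : κ * (2 * Λ * κ) ≤ κ * 1 := by gcongr
    have i4 : κ / Λ ≤ κ := div_le_self hκ.le hΛ
    have i5 : 0 ≤ κ * p := by positivity
    have j0 : 4 * (κ * (κ * ζ)) ≤ -(2 * (κ / Λ)) + 2 * κ * (p + 2) := by nlinarith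
    have j1 : -(4 * (κ * ζ)) ≤ -(2 * (κ / Λ)) := by
      have : κ * (1 / Λ) = κ / Λ := by ring
      have : 0 < κ / Λ := by positivity
      linarith
    have k0 := mul_le_mul_of_nonneg_left j0 (sub_nonneg.2 z2)
    have k1 := mul_le_mul_of_nonneg_left j1 z1.le
    nlinarith

end Centered

section TwoBlocks

variable {n : ℕ} {p σ W c μ : ℝ}

/-- Inner part of the two-block barrier. -/
def innerB (n : ℕ) (p σ c μ τ : ℝ) (y : Eu n) : ℝ :=
  th p τ ^ (-μ) * XX n p σ τ y ^ (-(((n : ℝ) - 2) / 2)) -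
    c * th p τ ^ (-μ - ((n : ℝ) - 2) / 2 * (p + n) / p)

/-- Outer part of the two-block barrier. -/
def outerB (n : ℕ) (p σ W μ τ : ℝ) (y : Eu n) : ℝ :=
  √(W + σ) * th p τ ^ (-μ + (p + n) / (2 * p)) * XX n p σ τ y ^ (-(((n : ℝ) - 1) / 2))

open Classical in
/-- The two-block barrier. -/
def twoB (n : ℕ) (p σ W c μ τ : ℝ) (y : Eu n) : ℝ :=
  if ‖y‖ ^ 2 < 4 * W * Sc n p τ then min (innerB n p σ c μ τ y) (outerB n p σ W μ τ y)
  else outerB n p σ W μ τ y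

lemma innerB_eq (hp : 0 < p) (hσ : 0 < σ) {τ : ℝ} (hτ : 0 ≤ τ) (y : Eu n) :
    innerB n p σ c μ τ y = th p τ ^ (-μ) * Sc n p τ ^ (-(((n : ℝ) - 2) / 2)) *
      ((‖y‖ ^ 2 / Sc n p τ + σ) ^ (-(((n : ℝ) - 2) / 2)) - c) := by
  have hS := Sc_pos (n := n) hp hτ
  have hX : XX n p σ τ y = Sc n p τ * (‖y‖ ^ 2 / Sc n p τ + σ) := by unfold XX; field_simp
  rw [innerB, hX, Real.mul_rpow hS.le (by positivity), sub_eq_add_neg (-μ),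
    Real.rpow_add (th_pos hp hτ), Sc_rpow hp hτ]
  rw [show -(((n : ℝ) - 2) / 2) * (p + n) / p = -(((n : ℝ) - 2) / 2 * (p + n) / p) by ring]
  ring

lemma outerB_eq (hp : 0 < p) (hσ : 0 < σ) {τ : ℝ} (hτ : 0 ≤ τ) (y : Eu n) :
    outerB n p σ W μ τ y = th p τ ^ (-μ) * Sc n p τ ^ (-(((n : ℝ) - 2) / 2)) *
      (√(W + σ) * (‖y‖ ^ 2 / Sc n p τ + σ) ^ (-(((n : ℝ) - 1) / 2))) := by
  have hS := Sc_pos (n := n) hp hτ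
  have hX : XX n p σ τ y = Sc n p τ * (‖y‖ ^ 2 / Sc n p τ + σ) := by unfold XX; field_simp
  have e : th p τ ^ ((p + n) / (2 * p)) * Sc n p τ ^ (-(((n : ℝ) - 1) / 2)) =
      Sc n p τ ^ (-(((n : ℝ) - 2) / 2)) := by
    rw [Sc_rpow hp hτ, Sc_rpow hp hτ, ← Real.rpow_add (th_pos hp hτ)]
    congr 1; field_simp; ring
  rw [outerB, hX, Real.mul_rpow hS.le (by positivity), Real.rpow_add (th_pos hp hτ), ← e]
  ring

lemma outerB_pos (hp : 0 < p) (hσ : 0 < σ) (hW : 0 < W) {τ : ℝ} (hτ : 0 ≤ τ) (y : Eu n) :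
    0 < outerB n p σ W μ τ y := by
  have := th_pos hp hτ
  have := XX_pos (n := n) hp hσ hτ y
  unfold outerB; positivity

lemma twoB_le_outerB (τ : ℝ) (y : Eu n) : twoB n p σ W c μ τ y ≤ outerB n p σ W μ τ y := by
  unfold twoB; split_ifs
  · exact min_le_right _ _
  · exact le_rfl

lemma split_rpow {A : ℝ} (hA : 0 < A) :
    A ^ (-(((n : ℝ) - 1) / 2)) = A ^ (-(((n : ℝ) - 2) / 2)) / √A := by
  rw [Real.sqrt_eq_rpow, ← Real.rpow_sub hA]; congr 1; ring

/-- In the inner region the inner block is the smaller one. -/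
lemma inner_lt_outer (hp : 0 < p) (hσ : 0 < σ) (hc : 0 < c) {τ : ℝ} (hτ : 0 ≤ τ) {y : Eu n}
    (hy : ‖y‖ ^ 2 ≤ W * Sc n p τ) : innerB n p σ c μ τ y < outerB n p σ W μ τ y := by
  have hS := Sc_pos (n := n) hp hτ
  have hθ := th_pos hp hτ
  rw [innerB_eq hp hσ hτ, outerB_eq hp hσ hτ]
  refine mul_lt_mul_of_pos_left ?_ (by positivity)
  have hA : 0 < ‖y‖ ^ 2 / Sc n p τ + σ := by positivity
  have hAW : ‖y‖ ^ 2 / Sc n p τ + σ ≤ W + σ := by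
    gcongr; rwa [div_le_iff₀ hS]
  set A := ‖y‖ ^ 2 / Sc n p τ + σ
  rw [split_rpow hA]
  have hM : 0 < A ^ (-(((n : ℝ) - 2) / 2)) := by positivity
  have h1 : 1 ≤ √(W + σ) / √A := by
    rw [one_le_div (Real.sqrt_pos.2 hA)]; exact Real.sqrt_le_sqrt hAW
  have := mul_le_mul_of_nonneg_left h1 hM.le
  calc _ < A ^ (-(((n : ℝ) - 2) / 2)) * 1 := by linarith
    _ ≤ _ := this
    _ = _ := by ring

/-- On the interface the outer block is the smaller one. -/
lemma outer_lt_inner (hp : 0 < p) (hσ : 0 < σ) (hW : 0 < W) (hσW : 2 * σ ≤ W) (hn : 3 ≤ n)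
    (hc : c = (5 * W) ^ (-(((n : ℝ) - 2) / 2)) / 4) {τ : ℝ} (hτ : 0 ≤ τ) {y : Eu n}
    (hy : ‖y‖ ^ 2 = 4 * W * Sc n p τ) : outerB n p σ W μ τ y < innerB n p σ c μ τ y := by
  have hS := Sc_pos (n := n) hp hτ
  have hθ := th_pos hp hτ
  have hn' : (3 : ℝ) ≤ n := by exact_mod_cast hn
  rw [innerB_eq hp hσ hτ, outerB_eq hp hσ hτ]
  refine mul_lt_mul_of_pos_left ?_ (by positivity)
  rw [hy, mul_div_cancel_right₀ _ hS.ne', split_rpow (by positivity)]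
  have hA : 0 < 4 * W + σ := by positivity
  have h1 : √(W + σ) / √(4 * W + σ) ≤ 5 / 8 := by
    rw [div_le_iff₀ (Real.sqrt_pos.2 hA)]
    refine Real.sqrt_le_iff.2 ⟨by positivity, ?_⟩
    rw [mul_pow, Real.sq_sqrt hA.le]; linarith
  have h2 : (5 * W) ^ (-(((n : ℝ) - 2) / 2)) ≤ (4 * W + σ) ^ (-(((n : ℝ) - 2) / 2)) :=
    Real.rpow_le_rpow_of_nonpos hA (by linarith) (by linarith)
  have h3 : 0 < (5 * W) ^ (-(((n : ℝ) - 2) / 2)) := by positivity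
  have h4 := mul_le_mul_of_nonneg_right h1 (h3.le.trans h2)
  calc _ = √(W + σ) / √(4 * W + σ) * (4 * W + σ) ^ (-(((n : ℝ) - 2) / 2)) := by ring
    _ ≤ _ := h4
    _ < _ := by rw [hc]; linarith

lemma inner_lower (hp : 0 < p) (hσ : 0 < σ) (hσW : 2 * σ ≤ W) (hn : 3 ≤ n)
    (hc : c = (5 * W) ^ (-(((n : ℝ) - 2) / 2)) / 4) {τ : ℝ} (hτ : 0 ≤ τ) {y : Eu n}
    (hy : ‖y‖ ^ 2 < 4 * W * Sc n p τ) :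
    3 * c * (th p τ ^ (-μ) * Sc n p τ ^ (-(((n : ℝ) - 2) / 2))) ≤ innerB n p σ c μ τ y := by
  have hS := Sc_pos (n := n) hp hτ
  have hθ := th_pos hp hτ
  have hn' : (3 : ℝ) ≤ n := by exact_mod_cast hn
  rw [innerB_eq hp hσ hτ, mul_comm]
  refine mul_le_mul_of_nonneg_left ?_ (by positivity)
  have hA : ‖y‖ ^ 2 / Sc n p τ < 4 * W := by rwa [div_lt_iff₀ hS]
  have h2 : (5 * W) ^ (-(((n : ℝ) - 2) / 2)) ≤
      (‖y‖ ^ 2 / Sc n p τ + σ) ^ (-(((n : ℝ) - 2) / 2)) :=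
    Real.rpow_le_rpow_of_nonpos (by positivity) (by linarith) (by linarith)
  rw [hc] at *; linarith

lemma continuousAt_th_rpow (hp : 0 < p) {q : ℝ × Eu n} (hτ : 0 ≤ q.1) (e : ℝ) :
    ContinuousAt (fun q : ℝ × Eu n => th p q.1 ^ e) q :=
  (hasDerivAt_th_rpow hp hτ e).continuousAt.comp (f := fun q : ℝ × Eu n => q.1) continuousAt_fst

lemma continuousAt_innerB (hp : 0 < p) (hσ : 0 < σ) {q : ℝ × Eu n} (hτ : 0 ≤ q.1) :
    ContinuousAt (fun q : ℝ × Eu n => innerB n p σ c μ q.1 q.2) q :=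
  ((continuousAt_th_rpow hp hτ _).mul (continuousAt_XX hp hσ hτ _)).sub
    (continuousAt_const.mul (continuousAt_th_rpow hp hτ _))

lemma continuousAt_outerB (hp : 0 < p) (hσ : 0 < σ) {q : ℝ × Eu n} (hτ : 0 ≤ q.1) :
    ContinuousAt (fun q : ℝ × Eu n => outerB n p σ W μ q.1 q.2) q :=
  (continuousAt_const.mul (continuousAt_th_rpow hp hτ _)).mul (continuousAt_XX hp hσ hτ _)

lemma continuousAt_region (hp : 0 < p) {q : ℝ × Eu n} (hτ : 0 ≤ q.1) :
    ContinuousAt (fun q : ℝ × Eu n => 4 * W * Sc n p q.1 - ‖q.2‖ ^ 2) q := by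
  refine ContinuousAt.sub (continuousAt_const.mul ?_) (by fun_prop)
  exact (hasDerivAt_Sc (n := n) hp hτ).continuousAt.comp (f := fun q : ℝ × Eu n => q.1)
    continuousAt_fst

lemma continuousAt_twoB (hp : 0 < p) (hσ : 0 < σ) (hW : 0 < W) (hσW : 2 * σ ≤ W) (hn : 3 ≤ n)
    (hc : c = (5 * W) ^ (-(((n : ℝ) - 2) / 2)) / 4) {q : ℝ × Eu n} (hτ : 0 ≤ q.1) :
    ContinuousAt (fun q : ℝ × Eu n => twoB n p σ W c μ q.1 q.2) q := by
  have hi := continuousAt_innerB (c := c) (μ := μ) hp hσ hτ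
  have ho := continuousAt_outerB (W := W) (μ := μ) hp hσ hτ
  have hr := continuousAt_region (W := W) hp hτ
  by_cases hy : ‖q.2‖ ^ 2 < 4 * W * Sc n p q.1
  · have hm : ContinuousAt (fun q : ℝ × Eu n =>
        min (innerB n p σ c μ q.1 q.2) (outerB n p σ W μ q.1 q.2)) q := hi.min ho
    refine hm.congr ?_
    filter_upwards [hr.eventually (lt_mem_nhds (sub_pos.2 hy))] with x hx
    simp [twoB, sub_pos.1 hx]
  · refine ho.congr ?_
    have hE : ∀ᶠ x in 𝓝 q, ‖x.2‖ ^ 2 < 4 * W * Sc n p x.1 →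
        outerB n p σ W μ x.1 x.2 ≤ innerB n p σ c μ x.1 x.2 := by
      rcases (not_lt.1 hy).lt_or_eq with h1 | h1
      · filter_upwards [hr.eventually (gt_mem_nhds (sub_neg.2 h1))] with x hx hx'
        exact absurd (sub_neg.1 hx) (not_lt.2 hx'.le)
      · have := outer_lt_inner (μ := μ) hp hσ hW hσW hn hc hτ h1.symm
        filter_upwards [(ho.prodMk hi).eventually (isOpen_lt continuous_fst continuous_snd
          |>.mem_nhds this)] with x hx _
        exact le_of_lt hx
    filter_upwards [hE] with x hx
    unfold twoB
    split_ifs with h2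
    · rw [min_eq_right (hx h2)]
    · rfl

end TwoBlocks

section TwoBlocks

variable {n : ℕ} {p σ W c μ : ℝ}

lemma hasDerivAt_pow_block' {τ : ℝ} (hp : 0 < p) (hτ : 0 ≤ τ) (e : ℝ) :
    HasDerivAt (fun t => th p t ^ e) (th p τ ^ e * (2 * p * e) / th p τ) τ := by
  simpa using hasDerivAt_pow_block hp hτ 1 e

lemma contDiff_innerB (hp : 0 < p) (hσ : 0 < σ) {τ : ℝ} (hτ : 0 ≤ τ) :
    ContDiff ℝ ∞ (innerB n p σ c μ τ) :=
  (contDiff_const.mul (contDiff_XX hp hσ hτ _)).sub contDiff_const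

lemma contDiff_outerB (hp : 0 < p) (hσ : 0 < σ) {τ : ℝ} (hτ : 0 ≤ τ) :
    ContDiff ℝ ∞ (outerB n p σ W μ τ) :=
  contDiff_const.mul (contDiff_XX hp hσ hτ _)

lemma innerB_super (hn : 3 ≤ n) (hp : 0 < p) (hσ : 0 < σ) (hc : 0 < c) {ρ₁ Λ B a τ : ℝ}
    (hρ₁ : 0 < ρ₁) (hμ : 0 < μ) (hΛ : 0 < Λ) (hB : 0 < B) (hτ : 0 ≤ τ) (y : Eu n)
    (ha : 1 / Λ ≤ a * th p τ / XX n p B τ y)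
    (h1 : ρ₁ * (2 * Λ * (p + n + 1)) ≤ n * B) (h2 : σ ≤ ρ₁)
    (h3 : 2 * σ * ρ₁ ^ (-(((n : ℝ) - 2) / 2)) ≤ c * ρ₁)
    (h4 : 2 * p * μ * ρ₁ ≤ ((n : ℝ) - 2) / 2 * σ)
    (h5 : 2 * p * μ * ρ₁ ^ (-(((n : ℝ) - 2) / 2)) ≤ ((n : ℝ) - 2) / 2 * (p + n) * c) :
    ∃ F', HasDerivAt (fun t => innerB n p σ c μ t y) F' τ ∧
      a * lap n (innerB n p σ c μ τ) y ≤ F' := by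
  have hn' : (3 : ℝ) ≤ n := by exact_mod_cast hn
  set κ := ((n : ℝ) - 2) / 2 with hκ
  have hκ0 : 0 < κ := by rw [hκ]; linarith
  have hθ := th_pos hp hτ
  have hS := Sc_pos (n := n) hp hτ
  have hX := XX_pos (n := n) hp hσ hτ y
  have hXB := XX_pos (n := n) hp hB hτ y
  have d1 := block_hasDerivAt hp hσ hτ (hasDerivAt_pow_block' hp hτ (-μ)) κ y
  have d2 := (hasDerivAt_pow_block' hp hτ (-μ - κ * (p + n) / p)).const_mul c
  refine ⟨_, d1.sub d2, ?_⟩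
  have hl : lap n (innerB n p σ c μ τ) y = lap n (fun x => th p τ ^ (-μ) *
      XX n p σ τ x ^ (-κ)) y := by
    unfold innerB
    rw [lap_sub (contDiff_const.mul (contDiff_XX hp hσ hτ _)) contDiff_const, lap_const, sub_zero]
  rw [hl, block_lap hp hσ hτ]
  have hζ : (‖y‖ ^ 2 / Sc n p τ + B) / Λ ≤ a * th p τ / Sc n p τ := by
    have e : ‖y‖ ^ 2 / Sc n p τ + B = XX n p B τ y / Sc n p τ := by unfold XX; field_simp
    rw [e]
    rw [div_le_div_iff₀ hΛ hXB] at ha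
    rw [div_div, div_le_div_iff₀ (by positivity) hS]
    nlinarith
  have key := inner_super (n := (n : ℝ)) (by linarith) hκ0 hp hσ hc hρ₁ hμ hΛ hB
    (div_nonneg (sq_nonneg ‖y‖) hS.le) hζ h1 h2 h3 h4 h5
  have eX : XX n p σ τ y = Sc n p τ * (‖y‖ ^ 2 / Sc n p τ + σ) := by unfold XX; field_simp
  have eS : th p τ ^ (-μ - κ * (p + n) / p) = th p τ ^ (-μ) * Sc n p τ ^ (-κ) := by
    rw [sub_eq_add_neg, Real.rpow_add hθ, Sc_rpow hp hτ]
    congr 2; ring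
  have hA : 0 < ‖y‖ ^ 2 / Sc n p τ + σ := by positivity
  rw [eX, Real.mul_rpow hS.le hA.le, eS]
  set A := ‖y‖ ^ 2 / Sc n p τ + σ
  have e2 : 2 * κ + 2 - n = 0 := by rw [hκ]; ring
  have e3 : (n : ℝ) = 2 * κ + 2 := by linarith
  have hpe : 2 * p * (-μ - κ * (p + n) / p) = -(2 * p * μ + 2 * κ * (p + n)) := by
    field_simp; ring
  rw [e2, hpe]
  have hc0 : 0 ≤ th p τ ^ (-μ) * Sc n p τ ^ (-κ) / th p τ := by positivity
  have := mul_le_mul_of_nonneg_left key hc0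
  refine (le_of_eq ?_).trans (this.trans (le_of_eq ?_))
  · rw [e3]; field_simp; ring
  · field_simp; ring

lemma outerB_super (hn : 3 ≤ n) (hp : 0 < p) (hσ : 0 < σ) {Λ B a τ : ℝ}
    (hΛ : 0 < Λ) (hB : 0 < B) (hτ : 0 ≤ τ) {y : Eu n} (hσ1 : σ ≤ 1)
    (hWρ : W * Sc n p τ ≤ ‖y‖ ^ 2) (hW1 : 8 * n * Λ ≤ W) (hW2 : 8 * n * B ≤ W)
    (hW3 : 4 * n * (p + n) ≤ W) (ht : 8 * n * Λ ≤ th p τ) (hμ : 2 * p * μ ≤ 1 / 4)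
    (ha0 : 0 ≤ a)
    (ha : a * th p τ / XX n p B τ y ≤ 1 + Λ * (1 / th p τ + Sc n p τ / XX n p B τ y)) :
    ∃ F', HasDerivAt (fun t => outerB n p σ W μ t y) F' τ ∧
      a * lap n (outerB n p σ W μ τ) y ≤ F' := by
  have hn' : (3 : ℝ) ≤ n := by exact_mod_cast hn
  have hθ := th_pos hp hτ
  have hS := Sc_pos (n := n) hp hτ
  have hX := XX_pos (n := n) hp hσ hτ y
  have hXB := XX_pos (n := n) hp hB hτ y
  have d1 := block_hasDerivAt hp hσ hτ (hasDerivAt_pow_block hp hτ √(W + σ)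
    (-μ + (p + n) / (2 * p))) (((n : ℝ) - 1) / 2) y
  refine ⟨_, d1, ?_⟩
  refine block_super hp hσ hτ (g := fun t => √(W + σ) * th p t ^ (-μ + (p + n) / (2 * p))) y
    (by positivity) ?_
  have eX : XX n p σ τ y = Sc n p τ * (‖y‖ ^ 2 / Sc n p τ + σ) := by unfold XX; field_simp
  have eXB : XX n p B τ y = Sc n p τ * (‖y‖ ^ 2 / Sc n p τ + B) := by unfold XX; field_simp
  have hρ : W ≤ ‖y‖ ^ 2 / Sc n p τ := by rwa [le_div_iff₀ hS]
  have hρ0 : 0 ≤ ‖y‖ ^ 2 / Sc n p τ := by positivity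
  have e1 : Sc n p τ / XX n p B τ y = 1 / (‖y‖ ^ 2 / Sc n p τ + B) := by
    rw [eXB]; field_simp
  rw [e1] at ha
  have key := outer_super (n := (n : ℝ)) (by linarith) hp hσ hB hΛ hσ1 hρ hW1 hW2 hW3 ht hμ
    (by positivity) ha
  have e2 : a * th p τ / XX n p σ τ y = a * th p τ / XX n p B τ y *
      ((‖y‖ ^ 2 / Sc n p τ + B) / (‖y‖ ^ 2 / Sc n p τ + σ)) := by
    have h1 : ‖y‖ ^ 2 / Sc n p τ + B ≠ 0 := by positivity
    have h2 : ‖y‖ ^ 2 / Sc n p τ + σ ≠ 0 := by positivity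
    rw [eX, eXB]
    generalize ‖y‖ ^ 2 / Sc n p τ = r at *
    field_simp
  have e3 : σ * Sc n p τ / XX n p σ τ y = σ / (‖y‖ ^ 2 / Sc n p τ + σ) := by
    rw [eX]
    have h2 : ‖y‖ ^ 2 / Sc n p τ + σ ≠ 0 := by positivity
    generalize ‖y‖ ^ 2 / Sc n p τ = r at *
    field_simp
  rw [e2, e3]
  refine (le_of_eq ?_).trans (key.trans (le_of_eq ?_))
  · ring
  · field_simp

end TwoBlocks

namespace Centered

variable {n : ℕ} {p B K : ℝ} {Q : ℝ → Eu n → ℝ}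

lemma D_decay_three (h : Centered n p B K Q) (hn : 3 ≤ n) : ∃ μ C : ℝ, 0 < μ ∧ 0 ≤ C ∧
    ∀ τ, 0 ≤ τ → ∀ y, |potD n p B Q τ y| ≤ C * th p τ ^ (-μ) * Sc n p τ ^ (1 - (n : ℝ) / 2) := by
  obtain ⟨C₁, E, hC₁, hE, hD⟩ := h.D_rough
  obtain ⟨Λ, hΛ1, hr⟩ := h.a_ratio
  have hp := h.hp
  have hB := h.hB
  have hα := h.exists_lt_of_n
  have hn' : (3 : ℝ) ≤ n := by exact_mod_cast hn
  have hΛ : 0 < Λ := by linarith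
  set α := ((n : ℝ) - 1 + p / 2) / 2 with hαd
  set κ := ((n : ℝ) - 2) / 2 with hκd
  have hκ : 0 < κ := by rw [hκd]; linarith
  set W := 8 * n * Λ + 8 * n * B + 4 * n * (p + n) with hWd
  have hW : 0 < W := by positivity
  set ρ₁ := n * B / (2 * Λ * (p + n + 1)) with hρ₁d
  have hρ₁ : 0 < ρ₁ := by positivity
  set c := (5 * W) ^ (-κ) / 4 with hcd
  have hc : 0 < c := by positivity
  set σ := min (min 1 B) (min (W / 2) (min ρ₁ (c * ρ₁ / (2 * ρ₁ ^ (-κ))))) with hσd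
  have hσ : 0 < σ := by
    rw [hσd]
    refine lt_min (lt_min one_pos hB) (lt_min (by positivity) (lt_min hρ₁ (by positivity)))
  have hσ1 : σ ≤ 1 := (min_le_left _ _).trans (min_le_left _ _)
  have hσB : σ ≤ B := (min_le_left _ _).trans (min_le_right _ _)
  have hσW : 2 * σ ≤ W := by
    have : σ ≤ W / 2 := (min_le_right _ _).trans (min_le_left _ _)
    linarith
  have hσρ : σ ≤ ρ₁ := (min_le_right _ _).trans ((min_le_right _ _).trans (min_le_left _ _))
  have hσc : 2 * σ * ρ₁ ^ (-κ) ≤ c * ρ₁ := by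
    have : σ ≤ c * ρ₁ / (2 * ρ₁ ^ (-κ)) :=
      (min_le_right _ _).trans ((min_le_right _ _).trans (min_le_right _ _))
    rw [le_div_iff₀ (by positivity)] at this
    linarith
  set μ := min (1 / (8 * p)) (min (κ * σ / (2 * p * ρ₁)) (κ * (p + n) * c / (2 * p * ρ₁ ^ (-κ))))
    with hμd
  have hμ : 0 < μ := lt_min (by positivity) (lt_min (by positivity) (by positivity))
  have hμ1 : 2 * p * μ ≤ 1 / 4 := by
    have : μ ≤ 1 / (8 * p) := min_le_left _ _
    rw [le_div_iff₀ (by positivity)] at this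
    linarith
  have hμ2 : 2 * p * μ * ρ₁ ≤ κ * σ := by
    have : μ ≤ κ * σ / (2 * p * ρ₁) := (min_le_right _ _).trans (min_le_left _ _)
    rw [le_div_iff₀ (by positivity)] at this
    linarith
  have hμ3 : 2 * p * μ * ρ₁ ^ (-κ) ≤ κ * (p + n) * c := by
    have : μ ≤ κ * (p + n) * c / (2 * p * ρ₁ ^ (-κ)) := (min_le_right _ _).trans (min_le_right _ _)
    rw [le_div_iff₀ (by positivity)] at this
    linarith
  have hρeq : ρ₁ * (2 * Λ * (p + n + 1)) ≤ n * B := by rw [hρ₁d]; field_simp; rfl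
  have hκe : (1 : ℝ) - n / 2 = -κ := by rw [hκd]; ring
  rw [hκe]
  set t₀ := 8 * n * Λ / (2 * p) with ht₀d
  have ht₀ : 0 ≤ t₀ := by positivity
  have hth : ∀ τ, t₀ ≤ τ → 8 * n * Λ ≤ th p τ := fun τ hτ => by
    rw [ht₀d, div_le_iff₀ (by positivity)] at hτ
    unfold th; linarith
  have hθ₀ := th_pos hp ht₀
  have hS₀ := Sc_pos (n := n) hp ht₀
  set N := th p t₀ ^ (-μ) * Sc n p t₀ ^ (-κ) with hNd
  have hN : 0 < N := by positivity
  set M := √(W + σ) * th p t₀ ^ (-μ + (p + n) / (2 * p)) with hMd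
  have hM : 0 < M := by positivity
  set Ci := C₁ * th p t₀ ^ E * B ^ (-α) with hCi
  set Co := C₁ * th p t₀ ^ E * B ^ (-(p / 4)) with hCo
  have hCi0 : 0 ≤ Ci := by positivity
  have hCo0 : 0 ≤ Co := by positivity
  set C₂ := Ci / (3 * c * N) + Co / M with hC₂
  have hC₂0 : 0 ≤ C₂ := by positivity
  have hlate : ∀ τ, t₀ ≤ τ → ∀ y, |potD n p B Q τ y| ≤ C₂ * twoB n p σ W c μ τ y := by
    intro τ hτ y
    refine h.abs_le_barrier (b := fun τ y => C₂ * twoB n p σ W c μ τ y) ht₀ (fun τ hτ y => ?_)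
      (fun τ hτ y => ?_) (fun y => ?_) (fun τ hτ y => ?_) hτ y
    · exact continuousAt_const.mul
        (continuousAt_twoB hp hσ hW hσW hn hcd (q := (τ, y)) (ht₀.trans hτ))
    · refine mul_nonneg hC₂0 ?_
      have hτ0 := ht₀.trans hτ
      have ho := outerB_pos (n := n) (μ := μ) hp hσ hW hτ0 y
      have := th_pos hp hτ0
      have := Sc_pos (n := n) hp hτ0
      unfold twoB
      split_ifs with h1
      · refine le_min (le_trans ?_ (inner_lower hp hσ hσW hn hcd hτ0 h1)) ho.le
        positivity
      · exact ho.le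
    · have hX := XX_pos (n := n) hp hB ht₀ y
      have hXσ := XX_pos (n := n) hp hσ ht₀ y
      have hD0 := hD t₀ ht₀ y
      have hXi : XX n p B t₀ y ^ (-α) ≤ B ^ (-α) := XX_rpow_neg_le' hp hB ht₀ hα.le y
      have hi : |potD n p B Q t₀ y| ≤ Ci := hD0.trans (mul_le_mul_of_nonneg_left hXi (by positivity))
      have ho : |potD n p B Q t₀ y| ≤ C₂ * outerB n p σ W μ t₀ y := by
        have e1 : XX n p B t₀ y ^ (-α) ≤
            B ^ (-(p / 4)) * XX n p σ t₀ y ^ (-(((n : ℝ) - 1) / 2)) := by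
          rw [show -α = -(p / 4) + -(((n : ℝ) - 1) / 2) by rw [hαd]; ring, Real.rpow_add hX]
          refine mul_le_mul (XX_rpow_neg_le' hp hB ht₀ (by positivity) y) ?_ (by positivity)
            (by positivity)
          refine Real.rpow_le_rpow_of_nonpos hXσ ?_ (by linarith)
          unfold XX; gcongr
        calc _ ≤ C₁ * th p t₀ ^ E *
              (B ^ (-(p / 4)) * XX n p σ t₀ y ^ (-(((n : ℝ) - 1) / 2))) :=
              hD0.trans (by gcongr)
          _ = Co / M * (M * XX n p σ t₀ y ^ (-(((n : ℝ) - 1) / 2))) := by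
              rw [hCo]; field_simp
          _ ≤ C₂ * (M * XX n p σ t₀ y ^ (-(((n : ℝ) - 1) / 2))) := by
              gcongr
              rw [hC₂]
              have : 0 ≤ Ci / (3 * c * N) := by positivity
              linarith
      unfold twoB
      split_ifs with h1
      · rcases min_choice (innerB n p σ c μ t₀ y) (outerB n p σ W μ t₀ y) with h2 | h2 <;> rw [h2]
        · refine hi.trans ?_
          have h3 := inner_lower (μ := μ) hp hσ hσW hn hcd ht₀ h1
          calc Ci = Ci / (3 * c * N) * (3 * c * N) := by field_simp
            _ ≤ C₂ * innerB n p σ c μ t₀ y := by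
              refine mul_le_mul ?_ h3 (by positivity) hC₂0
              rw [hC₂]
              have : 0 ≤ Co / M := by positivity
              linarith
        · exact ho
      · exact ho
    · have hτ0 : 0 ≤ τ := ht₀.trans hτ.le
      obtain ⟨r1, r2, r3⟩ := hr τ hτ0 y
      have ha := h.a_nonneg hτ0 y
      by_cases hin : ‖y‖ ^ 2 < 4 * W * Sc n p τ ∧ innerB n p σ c μ τ y ≤ outerB n p σ W μ τ y
      · obtain ⟨F', d, hs⟩ := innerB_super (μ := μ) hn hp hσ hc hρ₁ hμ hΛ hB hτ0 y r1 hρeq hσρ hσc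
          hμ2 hμ3
        have hreg := (continuousAt_region (W := W) hp (q := (τ, y)) hτ0).eventually
          (lt_mem_nhds (sub_pos.2 hin.1))
        have hle : ∀ᶠ q : ℝ × Eu n in 𝓝 (τ, y),
            C₂ * twoB n p σ W c μ q.1 q.2 ≤ C₂ * innerB n p σ c μ q.1 q.2 := by
          filter_upwards [hreg] with q hq
          refine mul_le_mul_of_nonneg_left ?_ hC₂0
          rw [twoB, if_pos (sub_pos.1 hq)]
          exact min_le_left _ _
        refine ⟨fun τ y => C₂ * innerB n p σ c μ τ y, C₂ * F', ?_, ?_, ?_,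
          contDiff_const.mul (contDiff_innerB hp hσ hτ0), d.const_mul C₂, ?_⟩
        · simp only [twoB, if_pos hin.1, min_eq_left hin.2]
        · exact (Continuous.prodMk_right τ).continuousAt.eventually hle
        · exact (Continuous.prodMk_left y).continuousAt.eventually hle
        · rw [lap_const_mul]
          calc _ = C₂ * (aD n p B Q τ y * lap n (innerB n p σ c μ τ) y) := by ring
            _ ≤ _ := mul_le_mul_of_nonneg_left hs hC₂0
      · have hWS : W * Sc n p τ ≤ ‖y‖ ^ 2 := by
          by_contra hlt
          rw [not_le] at hlt
          have hS := Sc_pos (n := n) hp hτ0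
          have hWS := mul_pos hW hS
          exact hin ⟨by linarith, (inner_lt_outer hp hσ hc hτ0 hlt.le).le⟩
        have q1 : 0 ≤ 8 * n * Λ := by positivity
        have q2 : 0 ≤ 8 * n * B := by positivity
        have q3 : 0 ≤ 4 * n * (p + n) := by positivity
        obtain ⟨F', d, hs⟩ := outerB_super (W := W) (μ := μ) hn hp hσ hΛ hB hτ0 hσ1 hWS
          (by linarith) (by linarith) (by linarith) (hth τ hτ.le) hμ1 ha r3
        refine ⟨fun τ y => C₂ * outerB n p σ W μ τ y, C₂ * F', ?_,
          Eventually.of_forall fun x => mul_le_mul_of_nonneg_left (twoB_le_outerB _ _) hC₂0,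
          Eventually.of_forall fun x => mul_le_mul_of_nonneg_left (twoB_le_outerB _ _) hC₂0,
          contDiff_const.mul (contDiff_outerB hp hσ hτ0), d.const_mul C₂, ?_⟩
        · simp only [twoB]
          split_ifs with h1
          · rw [min_eq_right]
            by_contra hlt
            exact hin ⟨h1, (not_le.1 hlt).le⟩
          · rfl
        · rw [lap_const_mul]
          calc _ = C₂ * (aD n p B Q τ y * lap n (outerB n p σ W μ τ) y) := by ring
            _ ≤ _ := mul_le_mul_of_nonneg_left hs hC₂0
  refine ⟨μ, C₂ * (√(W + σ) * σ ^ (-(((n : ℝ) - 1) / 2))) + Ci / N, hμ, by positivity,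
    fun τ hτ y => ?_⟩
  have hθ := th_pos hp hτ
  have hS := Sc_pos (n := n) hp hτ
  have hN' : 0 < th p τ ^ (-μ) * Sc n p τ ^ (-κ) := by positivity
  rw [mul_assoc, add_mul]
  rcases le_total t₀ τ with hle | hle
  · refine (hlate τ hle y).trans (le_trans ?_ (le_add_of_nonneg_right (by positivity)))
    rw [mul_assoc]
    refine mul_le_mul_of_nonneg_left ((twoB_le_outerB τ y).trans ?_) hC₂0
    rw [outerB_eq hp hσ hτ, mul_comm]
    refine mul_le_mul_of_nonneg_right (mul_le_mul_of_nonneg_left ?_ (by positivity)) hN'.le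
    refine Real.rpow_le_rpow_of_nonpos hσ ?_ (by linarith)
    have : 0 ≤ ‖y‖ ^ 2 / Sc n p τ := by positivity
    linarith
  · refine le_trans ?_ (le_add_of_nonneg_left (by positivity))
    have hmono : th p τ ≤ th p t₀ := by unfold th; gcongr
    have hNN : N ≤ th p τ ^ (-μ) * Sc n p τ ^ (-κ) := by
      refine mul_le_mul ?_ ?_ (by positivity) (by positivity)
      · exact Real.rpow_le_rpow_of_nonpos hθ hmono (by linarith)
      · refine Real.rpow_le_rpow_of_nonpos hS ?_ (by linarith)
        exact Real.rpow_le_rpow hθ.le hmono (by positivity)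
    calc _ ≤ Ci := (hD τ hτ y).trans (by
            have i1 := XX_rpow_neg_le' hp hB hτ hα.le y
            have i2 : th p τ ^ E ≤ th p t₀ ^ E := Real.rpow_le_rpow hθ.le hmono hE
            exact mul_le_mul (mul_le_mul_of_nonneg_left i2 hC₁) i1 (Real.rpow_nonneg
              (XX_pos hp hB hτ y).le _) (by positivity))
      _ = Ci / N * N := by field_simp
      _ ≤ _ := by gcongr

/-- Decay of the potential faster than the natural scale. -/
lemma D_decay (h : Centered n p B K Q) : ∃ μ C : ℝ, 0 < μ ∧ 0 ≤ C ∧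
    ∀ τ, 0 ≤ τ → ∀ y, |potD n p B Q τ y| ≤ C * th p τ ^ (-μ) * Sc n p τ ^ (1 - (n : ℝ) / 2) := by
  have := h.hn
  rcases show n = 1 ∨ n = 2 ∨ 3 ≤ n by omega with h1 | h1 | h1
  · exact h.D_decay_one h1
  · exact h.D_decay_two h1
  · exact h.D_decay_three h1

end Centered

section Bernstein

variable {n : ℕ}

lemma pd_comm {f : Eu n → ℝ} (hf : ContDiff ℝ ∞ f) (i j : Fin n) :
    pd n i (pd n j f) = pd n j (pd n i f) := by
  ext x
  have hd : DifferentiableAt ℝ (fderiv ℝ f) x :=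
    ((hf.fderiv_right (m := ∞) (by simp)).differentiable (by simp)) x
  have key : ∀ i j : Fin n, pd n i (pd n j f) x =
      fderiv ℝ (fderiv ℝ f) x (stdBasis n i) (stdBasis n j) := fun i j => by
    unfold pd
    rw [fderiv_clm_apply hd (differentiableAt_const _)]
    simp
  rw [key, key]
  exact (hf.contDiffAt.isSymmSndFDerivAt (by simp; exact WithTop.coe_le_coe.2 (le_top : (2 : ℕ∞) ≤ ⊤))) _ _

lemma lap_pd {f : Eu n → ℝ} (hf : ContDiff ℝ ∞ f) (i : Fin n) :
    lap n (pd n i f) = pd n i (lap n f) := by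
  ext x
  have e : lap n f = fun x => ∑ j, pd n j (pd n j f) x := rfl
  rw [e, pd_sum _ fun j => contDiff_pd (contDiff_pd hf j) j, lap_eq_sum_pd]
  refine Finset.sum_congr rfl fun j _ => ?_
  rw [pd_comm hf j i, pd_comm (contDiff_pd hf j) j i]

/-- Square of the standard cutoff on the unit ball. -/
def cut (n : ℕ) (z : Eu n) : ℝ := (1 - ‖z‖ ^ 2) ^ 2

lemma contDiff_cut : ContDiff ℝ ∞ (cut n) := (contDiff_const.sub contDiff_normSq).pow 2

lemma cut_pd (i : Fin n) : pd n i (cut n) = fun z => (1 - ‖z‖ ^ 2) * (-4 * z i) := by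
  have h := pd_sq (n := n) (i := i) (contDiff_const (c := (1 : ℝ)).sub contDiff_normSq)
  rw [show cut n = fun z => (1 - ‖z‖ ^ 2) ^ 2 from rfl, h,
    pd_sub contDiff_const contDiff_normSq, pd_const, pd_normSq]
  ext z; ring

lemma cut_lap_ge (z : Eu n) : -(4 * n) ≤ lap n (cut n) z := by
  have h := lap_sq (n := n) (x := z) (contDiff_const (c := (1 : ℝ)).sub contDiff_normSq)
  rw [show cut n = fun z => (1 - ‖z‖ ^ 2) ^ 2 from rfl, h,
    lap_sub contDiff_const contDiff_normSq, lap_const, lap_normSq]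
  have h1 : 0 ≤ ∑ i, pd n i (fun y : Eu n => 1 - ‖y‖ ^ 2) z ^ 2 :=
    Finset.sum_nonneg fun i _ => sq_nonneg _
  have h2 : ‖z‖ ^ 2 * (n : ℝ) ≥ 0 := by positivity
  nlinarith

lemma cut_mem {z : Eu n} (hz : ‖z‖ ≤ 1) : 0 ≤ cut n z ∧ cut n z ≤ 1 := by
  have : ‖z‖ ^ 2 ≤ 1 := pow_le_one₀ (norm_nonneg _) hz
  have : 0 ≤ ‖z‖ ^ 2 := by positivity
  unfold cut
  exact ⟨sq_nonneg _, by nlinarith⟩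

/-- Evolution of the cut-off square of the solution. -/
lemma bernstein_zeroth {Λ A G s : ℝ} {w : ℝ → Eu n → ℝ} {z : Eu n} (hz : ‖z‖ ≤ 1) (hs0 : 0 ≤ s)
    (hs1 : s ≤ 1) (hA0 : 0 ≤ A) (hA : A ≤ Λ) (hw : ContDiff ℝ ∞ (w s))
    (hG : |G| ≤ Λ * |w s z|) (hd : HasDerivAt (fun s => w s z) (A * lap n (w s) z + G) s) :
    ∃ U', HasDerivAt (fun s => s ^ 2 * (cut n z ^ 2 * w s z ^ 2)) U' s ∧
      U' - A * (s ^ 2 * lap n (fun z => cut n z ^ 2 * w s z ^ 2) z) ≤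
        (2 + (98 + 8 * n) * Λ) * (s * cut n z * w s z ^ 2) := by
  refine ⟨_, ((hasDerivAt_pow 2 s).mul ((hd.pow 2).const_mul (cut n z ^ 2))), ?_⟩
  have hc := contDiff_cut (n := n)
  obtain ⟨c0, c1⟩ := cut_mem hz
  have hl := cut_lap_ge z
  rw [lap_mul (hc.pow 2) (hw.pow 2), lap_sq hc, lap_sq hw]
  simp only [pd_sq hc, pd_sq hw]
  have hΛ : 0 ≤ Λ := hA0.trans hA
  have hgrad : ∑ i, pd n i (cut n) z ^ 2 ≤ 16 * cut n z := by
    have : ∀ i, pd n i (cut n) z ^ 2 = 16 * cut n z * z i ^ 2 := fun i => by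
      rw [cut_pd]; unfold cut; ring
    simp only [this, ← Finset.mul_sum, sum_coord_sq]
    exact mul_le_of_le_one_right (by positivity) (pow_le_one₀ (norm_nonneg _) hz)
  have hsum : -(6 * w s z ^ 2 * ∑ i, pd n i (cut n) z ^ 2) ≤
      2 * cut n z ^ 2 * ∑ i, pd n i (w s) z ^ 2 + 2 * w s z ^ 2 * ∑ i, pd n i (cut n) z ^ 2 +
      2 * ∑ i, 2 * cut n z * pd n i (cut n) z * (2 * w s z * pd n i (w s) z) := by
    simp only [Finset.mul_sum, ← Finset.sum_add_distrib, ← Finset.sum_neg_distrib]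
    refine Finset.sum_le_sum fun i _ => ?_
    nlinarith [sq_nonneg (cut n z * pd n i (w s) z + 2 * (w s z * pd n i (cut n) z))]
  have hG' : w s z * G ≤ Λ * w s z ^ 2 := by
    calc _ ≤ |w s z| * |G| := by rw [← abs_mul]; exact le_abs_self _
      _ ≤ |w s z| * (Λ * |w s z|) := by gcongr
      _ = _ := by rw [← sq_abs]; ring
  set Ψ := cut n z
  set L := lap n (cut n) z
  set g := ∑ i, pd n i (cut n) z ^ 2
  set X := ∑ i, 2 * Ψ * pd n i (cut n) z * (2 * w s z * pd n i (w s) z)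
  set Y := ∑ i, pd n i (w s) z ^ 2
  set u := w s z
  have hu : 0 ≤ u ^ 2 := sq_nonneg _
  have hN : 0 ≤ s * Ψ * u ^ 2 := by positivity
  have t1 : s * Ψ ^ 2 * u ^ 2 ≤ s * Ψ * u ^ 2 := by
    have : Ψ ^ 2 ≤ Ψ := by nlinarith
    gcongr
  have ht : s ^ 2 * Ψ * u ^ 2 ≤ s * Ψ * u ^ 2 := by
    have : s ^ 2 ≤ s := by nlinarith
    gcongr
  have t2 : s ^ 2 * Ψ ^ 2 * (u * G) ≤ Λ * (s * Ψ * u ^ 2) := by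
    have hΨ2 : Ψ ^ 2 ≤ Ψ := by nlinarith
    calc _ ≤ s ^ 2 * Ψ ^ 2 * (Λ * u ^ 2) := by gcongr
      _ ≤ s ^ 2 * Ψ * (Λ * u ^ 2) := by gcongr
      _ = Λ * (s ^ 2 * Ψ * u ^ 2) := by ring
      _ ≤ _ := by gcongr
  have t3 : -(A * s ^ 2 * (2 * Ψ ^ 2 * Y + 2 * u ^ 2 * g + 2 * X)) ≤
      96 * Λ * (s * Ψ * u ^ 2) := by
    have h1 : 6 * u ^ 2 * g ≤ 6 * u ^ 2 * (16 * Ψ) := by gcongr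
    calc _ ≤ A * s ^ 2 * (6 * u ^ 2 * (16 * Ψ)) := by
          have hAs : 0 ≤ A * s ^ 2 := by positivity
          nlinarith
      _ = 96 * A * (s ^ 2 * Ψ * u ^ 2) := by ring
      _ ≤ _ := by gcongr
  have t4 : -(A * s ^ 2 * (u ^ 2 * (2 * Ψ * L))) ≤ 8 * n * Λ * (s * Ψ * u ^ 2) := by
    calc _ = A * (2 * (s ^ 2 * Ψ * u ^ 2)) * (-L) := by ring
      _ ≤ A * (2 * (s ^ 2 * Ψ * u ^ 2)) * (4 * n) := by gcongr; linarith
      _ = 8 * n * A * (s ^ 2 * Ψ * u ^ 2) := by ring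
      _ ≤ _ := by gcongr
  simp only [Nat.cast_ofNat, Nat.add_one_sub_one, pow_one]
  linarith

/-- Evolution of the cut-off gradient energy. -/
lemma bernstein_first (hn : 1 ≤ n) {Λ σ A s w : ℝ} {D : ℝ → Eu n → ℝ} {z : Eu n} {H : Fin n → ℝ}
    (hz : ‖z‖ ≤ 1) (hs0 : 0 ≤ s) (hs1 : s ≤ 1) (hΛ : 1 ≤ Λ) (hA0 : 1 / Λ ≤ A) (hA : A ≤ Λ)
    (hD : ContDiff ℝ ∞ (D s)) (hH : ∀ i, |H i| ≤ Λ * |w| + σ)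
    (hw : |w| ≤ Λ * |lap n (D s) z| + σ)
    (hd : ∀ i, HasDerivAt (fun s => pd n i (D s) z) (A * pd n i (lap n (D s)) z + H i) s) :
    ∃ V', HasDerivAt (fun s => s * ∑ i, cut n z * pd n i (D s) z ^ 2) V' s ∧
      V' - A * (s * lap n (fun z => ∑ i, cut n z * pd n i (D s) z ^ 2) z) ≤
        (1 + 64 * Λ + 4 * n * Λ + 8 * n ^ 2 * Λ ^ 5) * ∑ i, pd n i (D s) z ^ 2 -
          1 / (4 * n * Λ ^ 3) * (s * cut n z * w ^ 2) + 2 * σ ^ 2 := by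
  have hsum := HasDerivAt.fun_sum (u := Finset.univ) fun i (_ : i ∈ Finset.univ) =>
    (((hd i).pow 2).const_mul (cut n z))
  refine ⟨_, (hasDerivAt_id s).mul hsum, ?_⟩
  have hc := contDiff_cut (n := n)
  obtain ⟨c0, c1⟩ := cut_mem hz
  have hl := cut_lap_ge z
  have hn' : (1 : ℝ) ≤ n := by exact_mod_cast hn
  have hn0 : (0 : ℝ) < n := by linarith
  have hΛ0 : 0 < Λ := by linarith
  have hA' : 0 ≤ A := le_trans (by positivity) hA0
  rw [lap_sum _ fun i => hc.mul ((contDiff_pd hD i).pow 2)]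
  have hlap : ∀ i, lap n (fun z => cut n z * pd n i (D s) z ^ 2) z =
      cut n z * (2 * pd n i (D s) z * pd n i (lap n (D s)) z +
        2 * ∑ j, pd n j (pd n i (D s)) z ^ 2) + pd n i (D s) z ^ 2 * lap n (cut n) z +
      2 * ∑ j, pd n j (cut n) z * (2 * pd n i (D s) z * pd n j (pd n i (D s)) z) := fun i => by
    rw [lap_mul hc ((contDiff_pd hD i).pow 2), lap_sq (contDiff_pd hD i), lap_pd hD]
    simp only [pd_sq (contDiff_pd hD i)]
  have hcross : ∀ i, cut n z * ∑ j, pd n j (pd n i (D s)) z ^ 2 - 64 * pd n i (D s) z ^ 2 ≤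
      cut n z * (2 * ∑ j, pd n j (pd n i (D s)) z ^ 2) +
      2 * ∑ j, pd n j (cut n) z * (2 * pd n i (D s) z * pd n j (pd n i (D s)) z) := fun i => by
    have h1 : ∑ j, 64 * pd n i (D s) z ^ 2 * z j ^ 2 ≤ 64 * pd n i (D s) z ^ 2 := by
      rw [← Finset.mul_sum, sum_coord_sq]
      exact mul_le_of_le_one_right (by positivity) (pow_le_one₀ (norm_nonneg _) hz)
    have h2 : ∑ j, (cut n z * pd n j (pd n i (D s)) z ^ 2 - 64 * pd n i (D s) z ^ 2 * z j ^ 2) ≤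
        ∑ j, (cut n z * (2 * pd n j (pd n i (D s)) z ^ 2) +
          2 * (pd n j (cut n) z * (2 * pd n i (D s) z * pd n j (pd n i (D s)) z))) := by
      refine Finset.sum_le_sum fun j _ => ?_
      rw [cut_pd]
      unfold cut
      nlinarith [sq_nonneg ((1 - ‖z‖ ^ 2) * pd n j (pd n i (D s)) z - 8 * pd n i (D s) z * z j)]
    simp only [Finset.sum_sub_distrib, Finset.sum_add_distrib, ← Finset.mul_sum] at h2 h1 ⊢
    linarith
  have hHi : ∀ i, 2 * (pd n i (D s) z * H i) ≤ 8 * n ^ 2 * Λ ^ 5 * pd n i (D s) z ^ 2 +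
      1 / (8 * n ^ 2 * Λ ^ 5) * (2 * Λ ^ 2 * w ^ 2 + 2 * σ ^ 2) := fun i => by
    have h1 : H i ^ 2 ≤ 2 * Λ ^ 2 * w ^ 2 + 2 * σ ^ 2 := by
      have := pow_le_pow_left₀ (abs_nonneg _) (hH i) 2
      rw [sq_abs] at this
      nlinarith [sq_nonneg (Λ * |w| - σ), sq_abs w]
    have hE : 0 < 8 * (n : ℝ) ^ 2 * Λ ^ 5 := by positivity
    generalize 8 * (n : ℝ) ^ 2 * Λ ^ 5 = E at *
    have h2 : 2 * (pd n i (D s) z * H i) ≤ E * pd n i (D s) z ^ 2 + 1 / E * H i ^ 2 := by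
      have : 0 ≤ (E * pd n i (D s) z - H i) ^ 2 / E := by positivity
      have e : (E * pd n i (D s) z - H i) ^ 2 / E =
        E * pd n i (D s) z ^ 2 + 1 / E * H i ^ 2 - 2 * (pd n i (D s) z * H i) := by
        field_simp; ring
      linarith
    have h3 : 1 / E * H i ^ 2 ≤ 1 / E * (2 * Λ ^ 2 * w ^ 2 + 2 * σ ^ 2) := by gcongr
    linarith
  have hHess : (w ^ 2 - 2 * σ ^ 2) / (2 * n * Λ ^ 2) ≤ ∑ i, ∑ j, pd n j (pd n i (D s)) z ^ 2 := by
    have h1 : lap n (D s) z ^ 2 ≤ n * ∑ i, pd n i (pd n i (D s)) z ^ 2 := by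
      rw [lap_eq_sum_pd]
      simpa using sq_sum_le_card_mul_sum_sq (s := (Finset.univ : Finset (Fin n)))
        (f := fun i => pd n i (pd n i (D s)) z)
    have h2 : ∑ i, pd n i (pd n i (D s)) z ^ 2 ≤ ∑ i, ∑ j, pd n j (pd n i (D s)) z ^ 2 :=
      Finset.sum_le_sum fun i _ => Finset.single_le_sum
        (f := fun j => pd n j (pd n i (D s)) z ^ 2) (fun j _ => sq_nonneg _) (Finset.mem_univ i)
    have h3 : w ^ 2 ≤ 2 * Λ ^ 2 * lap n (D s) z ^ 2 + 2 * σ ^ 2 := by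
      have := pow_le_pow_left₀ (abs_nonneg _) hw 2
      rw [sq_abs] at this
      nlinarith [sq_nonneg (Λ * |lap n (D s) z| - σ), sq_abs (lap n (D s) z)]
    rw [div_le_iff₀ (by positivity)]
    have h4 : Λ ^ 2 * lap n (D s) z ^ 2 ≤ Λ ^ 2 * (n * ∑ i, ∑ j, pd n j (pd n i (D s)) z ^ 2) := by
      gcongr; exact h1.trans (by gcongr)
    linarith
  set Ψ := cut n z
  set L := lap n (cut n) z
  have step : ∀ i, Ψ * pd n i (D s) z ^ 2 +
      s * (Ψ * (2 * pd n i (D s) z * (A * pd n i (lap n (D s)) z + H i))) -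
      A * (s * lap n (fun z => cut n z * pd n i (D s) z ^ 2) z) ≤
      (1 + 64 * Λ + 4 * n * Λ + 8 * n ^ 2 * Λ ^ 5) * pd n i (D s) z ^ 2 +
        s * Ψ * (1 / (8 * n ^ 2 * Λ ^ 5) * (2 * Λ ^ 2 * w ^ 2 + 2 * σ ^ 2)) -
        1 / Λ * (s * Ψ) * ∑ j, pd n j (pd n i (D s)) z ^ 2 := by
    intro i
    rw [hlap]
    have hg := sq_nonneg (pd n i (D s) z)
    have hS : 0 ≤ ∑ j, pd n j (pd n i (D s)) z ^ 2 := Finset.sum_nonneg fun j _ => sq_nonneg _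
    have k1 := mul_le_mul_of_nonneg_left (hcross i) (mul_nonneg hA' hs0)
    have k2 := mul_le_mul_of_nonneg_left (hHi i) (mul_nonneg hs0 c0)
    set g := pd n i (D s) z
    set S := ∑ j, pd n j (pd n i (D s)) z ^ 2
    set X := ∑ j, pd n j (cut n) z * (2 * g * pd n j (pd n i (D s)) z)
    have hsΨ : s * Ψ ≤ 1 := mul_le_one₀ hs1 c0 c1
    have hAs : A * s ≤ Λ := (mul_le_of_le_one_right hA' hs1).trans hA
    have m1 : Ψ * g ^ 2 ≤ g ^ 2 := mul_le_of_le_one_left hg c1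
    have m2 : s * Ψ * (8 * n ^ 2 * Λ ^ 5 * g ^ 2) ≤ 8 * n ^ 2 * Λ ^ 5 * g ^ 2 :=
      mul_le_of_le_one_left (by positivity) hsΨ
    have m3 : A * s * (64 * g ^ 2) ≤ Λ * (64 * g ^ 2) := by gcongr
    have m4 : A * s * g ^ 2 * (-L) ≤ Λ * g ^ 2 * (4 * n) := by
      refine (mul_le_mul_of_nonneg_left (show -L ≤ 4 * n by linarith) (by positivity)).trans ?_
      gcongr
    have m5 : 1 / Λ * (s * Ψ) * S ≤ A * (s * Ψ) * S := by gcongr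
    linarith
  have hfin := Finset.sum_le_sum fun i (_ : i ∈ Finset.univ) => step i
  simp only [Finset.sum_sub_distrib, Finset.sum_add_distrib, ← Finset.mul_sum, Finset.sum_const,
    Finset.card_univ, Fintype.card_fin, nsmul_eq_mul] at hfin
  simp only [Nat.cast_ofNat, Nat.add_one_sub_one, pow_one, id, one_mul, ← Finset.mul_sum]
  refine hfin.trans ?_
  have hsΨ0 : 0 ≤ s * Ψ := by positivity
  have hsΨ : s * Ψ ≤ 1 := mul_le_one₀ hs1 c0 c1
  have k3 := mul_le_mul_of_nonneg_left hHess (show 0 ≤ 1 / Λ * (s * Ψ) by positivity)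
  have e1 : n * (s * Ψ * (1 / (8 * n ^ 2 * Λ ^ 5) * (2 * Λ ^ 2 * w ^ 2 + 2 * σ ^ 2))) =
      1 / (4 * n * Λ ^ 3) * (s * Ψ * w ^ 2) + s * Ψ * (1 / (4 * n * Λ ^ 5) * σ ^ 2) := by
    field_simp; ring
  have e2 : 1 / Λ * (s * Ψ) * ((w ^ 2 - 2 * σ ^ 2) / (2 * n * Λ ^ 2)) =
      2 * (1 / (4 * n * Λ ^ 3) * (s * Ψ * w ^ 2)) - s * Ψ * (1 / (n * Λ ^ 3) * σ ^ 2) := by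
    field_simp; ring
  have o : ∀ k : ℕ, 1 / (n * Λ ^ k) ≤ 1 := fun k => by
    rw [div_le_one (by positivity)]
    exact one_le_mul_of_one_le_of_one_le hn' (one_le_pow₀ hΛ)
  have f1 : s * Ψ * (1 / (4 * n * Λ ^ 5) * σ ^ 2) ≤ σ ^ 2 := by
    have : 1 / (4 * n * Λ ^ 5) ≤ 1 := by
      have := o 5
      rw [div_le_one (by positivity)] at this ⊢
      linarith
    exact (mul_le_of_le_one_left (by positivity) hsΨ).trans
      (mul_le_of_le_one_left (by positivity) this)
  have f2 : s * Ψ * (1 / (n * Λ ^ 3) * σ ^ 2) ≤ σ ^ 2 :=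
    (mul_le_of_le_one_left (by positivity) hsΨ).trans
      (mul_le_of_le_one_left (by positivity) (o 3))
  linarith

lemma bernstein_potential {Λ σ A E M s : ℝ} {D : ℝ → Eu n → ℝ} {z : Eu n}
    (hA0 : 1 / Λ ≤ A) (hD : ContDiff ℝ ∞ (D s)) (hσ : 0 ≤ σ) (hE : -σ ≤ E) (hM : |D s z| ≤ M)
    (hd : HasDerivAt (fun s => D s z) (A * lap n (D s) z + E) s) :
    ∃ W', HasDerivAt (fun s => (M - D s z) ^ 2) W' s ∧
      W' - A * lap n (fun z => (M - D s z) ^ 2) z ≤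
        4 * M * σ - 2 / Λ * ∑ i, pd n i (D s) z ^ 2 := by
  refine ⟨_, (hd.const_sub M).pow 2, ?_⟩
  rw [lap_sq (contDiff_const.sub hD), lap_sub contDiff_const hD, lap_const]
  simp only [pd_sub contDiff_const hD, pd_const, zero_sub, neg_sq]
  have h := abs_le.1 hM
  have hS : 0 ≤ ∑ i, pd n i (D s) z ^ 2 := Finset.sum_nonneg fun j _ => sq_nonneg _
  have k1 : 1 / Λ * ∑ i, pd n i (D s) z ^ 2 ≤ A * ∑ i, pd n i (D s) z ^ 2 := by gcongr
  have k2 : -((M - D s z) * E) ≤ 2 * M * σ := by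
    have : (M - D s z) * (-E) ≤ (M - D s z) * σ :=
      mul_le_mul_of_nonneg_left (by linarith) (by linarith [h.2])
    have : (M - D s z) * σ ≤ 2 * M * σ := by gcongr; linarith [h.1]
    linarith
  have e : 2 / Λ * ∑ i, pd n i (D s) z ^ 2 = 2 * (1 / Λ * ∑ i, pd n i (D s) z ^ 2) := by ring
  rw [e]
  simp only [Nat.cast_ofNat, Nat.add_one_sub_one, pow_one]
  nlinarith

end Bernstein

section Bernstein

variable {n : ℕ}

/-- Hypotheses, on the unit parabolic cylinder, for the interior estimate of a solution `w` in terms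
of its potential `D`. -/
structure UnitCyl (n : ℕ) (Λ σ M : ℝ) (w D A : ℝ → Eu n → ℝ) : Prop where
  smooth_w : ∀ s ∈ Set.Ioc (0 : ℝ) 1, ContDiff ℝ ∞ (w s)
  smooth_D : ∀ s ∈ Set.Ioc (0 : ℝ) 1, ContDiff ℝ ∞ (D s)
  cont_w : ContinuousOn (fun q : ℝ × Eu n => w q.1 q.2) (Set.Icc 0 1 ×ˢ Metric.closedBall 0 1)
  cont_D : ContinuousOn (fun q : ℝ × Eu n => D q.1 q.2) (Set.Icc 0 1 ×ˢ Metric.closedBall 0 1)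
  cont_pd : ∀ i, ContinuousOn (fun q : ℝ × Eu n => pd n i (D q.1) q.2)
    (Set.Icc 0 1 ×ˢ Metric.closedBall 0 1)
  A_ge : ∀ s ∈ Set.Ioc (0 : ℝ) 1, ∀ z, ‖z‖ ≤ 1 → 1 / Λ ≤ A s z
  A_le : ∀ s ∈ Set.Ioc (0 : ℝ) 1, ∀ z, ‖z‖ ≤ 1 → A s z ≤ Λ
  D_le : ∀ s ∈ Set.Icc (0 : ℝ) 1, ∀ z, ‖z‖ ≤ 1 → |D s z| ≤ M
  w_le : ∀ s ∈ Set.Ioc (0 : ℝ) 1, ∀ z, ‖z‖ ≤ 1 → |w s z| ≤ Λ * |lap n (D s) z| + σ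
  eq_w : ∀ s ∈ Set.Ioc (0 : ℝ) 1, ∀ z, ‖z‖ ≤ 1 → ∃ G, |G| ≤ Λ * |w s z| ∧
    HasDerivAt (fun s => w s z) (A s z * lap n (w s) z + G) s
  eq_D : ∀ s ∈ Set.Ioc (0 : ℝ) 1, ∀ z, ‖z‖ ≤ 1 → ∃ E, -σ ≤ E ∧
    HasDerivAt (fun s => D s z) (A s z * lap n (D s) z + E) s
  eq_pd : ∀ s ∈ Set.Ioc (0 : ℝ) 1, ∀ z, ‖z‖ ≤ 1 → ∀ i, ∃ H, |H| ≤ Λ * |w s z| + σ ∧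
    HasDerivAt (fun s => pd n i (D s) z) (A s z * pd n i (lap n (D s)) z + H) s

/-- Interior estimate: `w` at the centre of the top of the cylinder is controlled by its
potential. -/
theorem UnitCyl.interior_bound (hn : 1 ≤ n) {Λ : ℝ} (hΛ : 1 ≤ Λ) :
    ∃ C : ℝ, 0 ≤ C ∧ ∀ (σ M : ℝ) (w D A : ℝ → Eu n → ℝ), 0 ≤ σ → 0 ≤ M → UnitCyl n Λ σ M w D A →
      w 1 0 ^ 2 ≤ C * (M ^ 2 + σ ^ 2 + M * σ) := by
  have hn' : (1 : ℝ) ≤ n := mod_cast hn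
  have hΛ0 : 0 < Λ := by linarith
  set C1 := 2 + (98 + 8 * n) * Λ with hC1
  set C3 := 1 + 64 * Λ + 4 * n * Λ + 8 * n ^ 2 * Λ ^ 5 with hC3
  set K := C1 * (4 * n * Λ ^ 3) with hK
  set K2 := Λ * K * C3 / 2 with hK2
  have hC1p : 0 ≤ C1 := by positivity
  have hC3p : 0 ≤ C3 := by positivity
  have hKp : 0 ≤ K := by positivity
  have hK2p : 0 ≤ K2 := by positivity
  refine ⟨4 * K2 + 2 * K, by positivity, fun σ M w D A hσ hM h => ?_⟩
  set N := 2 * K * σ ^ 2 + 4 * K2 * M * σ with hN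
  have main : ∀ ε > 0, w 1 0 ^ 2 ≤ 4 * K2 * M ^ 2 + N + ε := by
    intro ε hε
    by_contra hcon
    push Not at hcon
    set U0 : ℝ → Eu n → ℝ := fun s z => s ^ 2 * (cut n z ^ 2 * w s z ^ 2) with hU0
    set U1 : ℝ → Eu n → ℝ := fun s z => s * ∑ i, cut n z * pd n i (D s) z ^ 2 with hU1
    set U2 : ℝ → Eu n → ℝ := fun s z => (M - D s z) ^ 2 with hU2
    have hcutc : Continuous (cut n) := contDiff_cut.continuous
    have hcc : ContinuousOn (fun q : ℝ × Eu n => cut n q.2)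
        (Set.Icc 0 1 ×ˢ Metric.closedBall 0 1) := (hcutc.comp continuous_snd).continuousOn
    have hW2 : ∀ s ∈ Set.Icc (0 : ℝ) 1, ∀ z, ‖z‖ ≤ 1 → U2 s z ≤ 4 * M ^ 2 := by
      intro s hs z hz
      have := abs_le.1 (h.D_le s hs z hz)
      simp only [hU2]
      nlinarith
    obtain ⟨t, z, ht0, ht1, hz, -, hmax, hloc⟩ := parabolic_max
      (u := fun s z => U0 s z + K * U1 s z + K2 * U2 s z - (N + ε) * s) (t0 := 0) (T := 1)
      (R := 1) (k := 4 * K2 * M ^ 2) (x0 := (0 : Eu n))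
      (by
        refine ContinuousOn.sub (ContinuousOn.add (ContinuousOn.add ?_ ?_) ?_) ?_
        · exact (continuous_fst.continuousOn.pow 2).mul ((hcc.pow 2).mul (h.cont_w.pow 2))
        · exact continuousOn_const.mul (continuous_fst.continuousOn.mul
            (continuousOn_finsetSum _ fun i _ => hcc.mul ((h.cont_pd i).pow 2)))
        · exact continuousOn_const.mul ((continuousOn_const.sub h.cont_D).pow 2)
        · exact continuousOn_const.mul continuous_fst.continuousOn)
      (by
        intro x hx
        have := hW2 0 ⟨le_rfl, zero_le_one⟩ x (by simpa using hx)
        simp only [hU0, hU1]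
        nlinarith)
      (by
        intro s hs x hx
        have hx' : ‖x‖ = 1 := by simpa using hx
        have := hW2 s hs x hx'.le
        have hc0 : cut n x = 0 := by simp [cut, hx']
        simp only [hU0, hU1, hc0]
        have : 0 ≤ (N + ε) * s := mul_nonneg (by positivity) hs.1
        simp only [zero_mul, Finset.sum_const_zero]
        nlinarith)
      (by
        refine ⟨1, ⟨zero_le_one, le_rfl⟩, 0, by simp, ?_⟩
        have hc1 : cut n 0 = 1 := by simp [cut]
        have h1 : 0 ≤ U1 1 0 := by
          simp only [hU1, hc1, one_mul]
          exact Finset.sum_nonneg fun i _ => sq_nonneg _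
        have h2 : 0 ≤ U2 1 0 := sq_nonneg _
        have h0 : U0 1 0 = w 1 0 ^ 2 := by simp [hU0, hc1]
        have := mul_nonneg hKp h1
        have := mul_nonneg hK2p h2
        simp only [h0]
        linarith)
    have ht : t ∈ Set.Ioc (0 : ℝ) 1 := ⟨ht0, ht1⟩
    have hz' : ‖z‖ ≤ 1 := by simpa using hz.le
    have hws := h.smooth_w t ht
    have hDs := h.smooth_D t ht
    have hAg := h.A_ge t ht z hz'
    have hAl := h.A_le t ht z hz'
    have hA0 : 0 ≤ A t z := le_trans (by positivity) hAg
    obtain ⟨G, hG, hdw⟩ := h.eq_w t ht z hz'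
    obtain ⟨E, hE, hdD⟩ := h.eq_D t ht z hz'
    choose H hH hdp using h.eq_pd t ht z hz'
    obtain ⟨D0, hd0, hi0⟩ := bernstein_zeroth hz' ht0.le ht1 hA0 hAl hws hG hdw
    obtain ⟨D1, hd1, hi1⟩ := bernstein_first hn hz' ht0.le ht1 hΛ hAg hAl hDs hH
      (h.w_le t ht z hz') hdp
    obtain ⟨D2, hd2, hi2⟩ := bernstein_potential hAg hDs hσ hE
      (h.D_le t ⟨ht0.le, ht1⟩ z hz') hdD
    have hdu := (((hd0.add (hd1.const_mul K)).add (hd2.const_mul K2)).sub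
      ((hasDerivAt_id t).const_mul (N + ε)))
    have hder := deriv_nonneg_of_max_left hdu ht0 hmax
    have hc := contDiff_cut (n := n)
    have s0 : ContDiff ℝ ∞ (fun z => cut n z ^ 2 * w t z ^ 2) := (hc.pow 2).mul (hws.pow 2)
    have s1 : ContDiff ℝ ∞ (fun z => ∑ i, cut n z * pd n i (D t) z ^ 2) :=
      ContDiff.sum fun i _ => hc.mul ((contDiff_pd hDs i).pow 2)
    have s2 : ContDiff ℝ ∞ (fun z => (M - D t z) ^ 2) := (contDiff_const.sub hDs).pow 2
    have S0 : ContDiff ℝ ∞ (U0 t) := contDiff_const.mul s0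
    have S1 : ContDiff ℝ ∞ (fun z => K * U1 t z) := contDiff_const.mul (contDiff_const.mul s1)
    have S2 : ContDiff ℝ ∞ (fun z => K2 * U2 t z) := contDiff_const.mul s2
    have hlap := lap_nonpos_of_isLocalMax (((S0.add S1).add S2).sub contDiff_const) hloc
    rw [lap_sub ((S0.add S1).add S2) contDiff_const, lap_add (S0.add S1) S2, lap_add S0 S1,
      lap_const, lap_const_mul, lap_const_mul, lap_const_mul, lap_const_mul] at hlap
    have hAl := mul_nonneg hA0 (neg_nonneg.2 hlap)
    have e1 : K * (1 / (4 * n * Λ ^ 3)) = C1 := by rw [hK]; field_simp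
    have e2 : K2 * (2 / Λ) = K * C3 := by rw [hK2]; field_simp
    have j1 := mul_le_mul_of_nonneg_left hi1 hKp
    have j2 := mul_le_mul_of_nonneg_left hi2 hK2p
    have j1' : K * (D1 - A t z * (t * lap n (fun z => ∑ i, cut n z * pd n i (D t) z ^ 2) z)) ≤
        K * C3 * (∑ i, pd n i (D t) z ^ 2) - C1 * (t * cut n z * w t z ^ 2) + 2 * K * σ ^ 2 := by
      rw [← e1]; refine j1.trans (le_of_eq ?_); ring
    have j2' : K2 * (D2 - A t z * lap n (fun z => (M - D t z) ^ 2) z) ≤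
        4 * K2 * M * σ - K * C3 * ∑ i, pd n i (D t) z ^ 2 := by
      rw [← e2]; refine j2.trans (le_of_eq ?_); ring
    simp only [mul_one] at hder
    rw [← hC1] at hi0
    clear_value N K2 K C1 C3
    generalize lap n (fun z => cut n z ^ 2 * w t z ^ 2) z = L0 at *
    generalize lap n (fun z => ∑ i, cut n z * pd n i (D t) z ^ 2) z = L1 at *
    generalize lap n (fun z => (M - D t z) ^ 2) z = L2 at *
    generalize t * cut n z * w t z ^ 2 = c at *
    generalize ∑ i, pd n i (D t) z ^ 2 = b at *
    generalize A t z = a at *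
    clear * - hder hAl j1' j2' hi0 hN hε
    linarith
  have := le_of_forall_pos_le_add main
  refine this.trans ?_
  have := mul_nonneg hM hσ
  have := mul_nonneg hK2p (sq_nonneg σ)
  have := mul_nonneg hKp (sq_nonneg M)
  have := mul_nonneg hKp (mul_nonneg hM hσ)
  nlinarith

end Bernstein

section WeightedEquations

variable {n : ℕ} {p B K : ℝ} {Q : ℝ → Eu n → ℝ}

lemma hasDerivAt_Pr (hp : 0 < p) (hB : 0 < B) {τ : ℝ} (hτ : 0 < τ) (y : Eu n) :
    ∃ P', |P'| ≤ 2 * (p + n) * Pr n p B 1 τ y / th p τ ∧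
      HasDerivAt (fun t => Pr n p B 1 t y) P' τ := by
  have ht := th_pos hp hτ.le
  have hX := XX_pos (n := n) hp hB hτ.le y
  have hS := Sc_pos (n := n) hp hτ.le
  have hX' : HasDerivAt (fun t => XX n p B t y) (B * (2 * (p + n) * Sc n p τ / th p τ)) τ :=
    ((hasDerivAt_Sc hp hτ.le).const_mul B).const_add (‖y‖ ^ 2)
  have h1 := hX'.div (hasDerivAt_th p τ) ht.ne'
  refine ⟨_, ?_, h1.congr_of_eventuallyEq ?_⟩
  · rw [Pr_eq_XX hp hτ.le]
    have e : B * (2 * (p + n) * Sc n p τ / th p τ) * th p τ - XX n p B τ y * (2 * p) =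
        2 * (p + n) * (B * Sc n p τ) - 2 * p * XX n p B τ y := by field_simp
    rw [e, abs_div, abs_of_pos (pow_pos ht 2), mul_div_assoc', div_div, ← pow_two]
    have hBS : 0 ≤ B * Sc n p τ := by positivity
    have hle : B * Sc n p τ ≤ XX n p B τ y := by unfold XX; nlinarith [sq_nonneg ‖y‖]
    have hn : (0 : ℝ) ≤ n := n.cast_nonneg
    gcongr
    rw [abs_le]
    constructor
    · have := mul_nonneg hn hX.le
      have : 0 ≤ (p + n) * (B * Sc n p τ) := by positivity
      nlinarith
    · have : (p + n) * (B * Sc n p τ) ≤ (p + n) * XX n p B τ y := by gcongr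
      have : 0 ≤ p * XX n p B τ y := by positivity
      nlinarith
  · filter_upwards [lt_mem_nhds hτ] with t ht
    exact Pr_eq_XX hp ht.le y

lemma pd_Pr_rpow_neg (hp : 0 < p) (hB : 0 < B) {s : ℝ} {τ : ℝ} (hτ : 0 < τ) (y : Eu n)
    (i : Fin n) : pd n i (fun y => Pr n p B 1 τ y ^ (-s)) y =
      -(2 * s * y i / XX n p B τ y) * Pr n p B 1 τ y ^ (-s) := by
  have hP := Pr_isPress (n := n) hp hB one_pos
  have ht := th_pos hp hτ.le
  have hX := XX_pos (n := n) hp hB hτ.le y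
  have hpos := hP.pos τ hτ.le y
  rw [pd_rpow (hP.slice hτ) (hP.pos τ hτ.le)]
  have e : pd n i (Pr n p B 1 τ) y = 2 * y i / th p τ := by
    have := pd_Pr_aux (n := n) (1 + 2 * p * τ) (B * (1 + 2 * p * τ) ^ ((n : ℝ) / p)) i
    exact congrFun this y
  simp only [e]
  rw [Real.rpow_sub_one hpos.ne']
  rw [show ∀ u : ℝ, -s * (u / Pr n p B 1 τ y) * (2 * y i / th p τ) =
    -s * (2 * y i) * (u / (Pr n p B 1 τ y * th p τ)) from fun u => by field_simp]
  rw [show Pr n p B 1 τ y * th p τ = XX n p B τ y by rw [Pr_eq_XX hp hτ.le]; field_simp]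
  ring

namespace Centered

/-- The diffused difference solves a linear equation with a lower order term. -/
lemma wD_hasDerivAt (h : Centered n p B K Q) {Λ : ℝ} (hΛ : 1 ≤ Λ) {τ : ℝ} (hτ : 0 < τ) (y : Eu n)
    (hQ : Q τ y ≤ Λ * Pr n p B 1 τ y) :
    ∃ G, |G| ≤ (p + n) ^ 2 * Λ ^ ((p + n) / 2) * |wD n p B Q τ y| / th p τ ∧
      HasDerivAt (fun t => wD n p B Q t y) (Q τ y * lap n (wD n p B Q τ) y + G) τ := by
  set s := (p + (n : ℝ)) / 2 with hs
  have hs1 : s ≠ 1 := h.hs.ne'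
  have hs0 : 0 < s := by linarith [h.hs]
  have hPp := h.pr_pos hτ.le y
  have ht := th_pos h.hp hτ.le
  have hd := ((h.press.hasDerivAt_rpow hτ y).sub (h.prPress.hasDerivAt_rpow hτ y)).const_mul
    (s / (s - 1))
  have e : lap n (wD n p B Q τ) y = s / (s - 1) *
      lap n (fun x => Q τ x ^ (1 - s)) y - s / (s - 1) *
      lap n (fun x => Pr n p B 1 τ x ^ (1 - s)) y := by
    unfold wD
    rw [← hs, lap_const_mul, lap_sub (contDiff_rpow (h.press.slice hτ) (h.press.pos τ hτ.le) _)
      (contDiff_rpow (h.prPress.slice hτ) (h.prPress.pos τ hτ.le) _), mul_sub]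
  refine ⟨(Q τ y - Pr n p B 1 τ y) *
    (s / (s - 1) * lap n (fun x => Pr n p B 1 τ x ^ (1 - s)) y), ?_, ?_⟩
  · obtain ⟨P', hP', hdP⟩ := hasDerivAt_Pr h.hp h.hB hτ y
    have h1 := hdP.rpow_const (p := -s) (Or.inl hPp.ne')
    rw [(h.prPress.hasDerivAt_rpow_neg hs1 hτ y).unique h1, abs_mul]
    have h2 := abs_sub_le_pow_diff h.hs hPp (h.press.pos τ hτ.le y) hΛ hQ
    rw [← hs] at h2
    change |Q τ y - Pr n p B 1 τ y| ≤ Λ ^ s * Pr n p B 1 τ y ^ s * |wD n p B Q τ y| at h2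
    have hpow := Real.rpow_pos_of_pos hPp
    rw [abs_mul, abs_mul, abs_neg, abs_of_pos hs0, abs_of_pos (hpow _)]
    have hΛs : 0 ≤ Λ ^ s := by positivity
    have h3 : |P'| * s * Pr n p B 1 τ y ^ (-s - 1) ≤
        (p + n) ^ 2 / th p τ * Pr n p B 1 τ y ^ (-s) := by
      have e2 : Pr n p B 1 τ y ^ (-s) = Pr n p B 1 τ y * Pr n p B 1 τ y ^ (-s - 1) := by
        rw [← Real.rpow_one_add' hPp.le (by linarith)]; congr 1; ring
      calc |P'| * s * Pr n p B 1 τ y ^ (-s - 1)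
          ≤ (2 * (p + n) * Pr n p B 1 τ y / th p τ) * s * Pr n p B 1 τ y ^ (-s - 1) := by
            have := (hpow (-s - 1)).le
            gcongr
        _ = _ := by rw [e2, hs]; ring
    calc _ ≤ Λ ^ s * Pr n p B 1 τ y ^ s * |wD n p B Q τ y| *
          ((p + n) ^ 2 / th p τ * Pr n p B 1 τ y ^ (-s)) := by
            have := (hpow (-s - 1)).le
            have := (hpow s).le
            exact mul_le_mul h2 h3 (by positivity) (by positivity)
      _ = (p + n) ^ 2 * Λ ^ s * |wD n p B Q τ y| / th p τ *
          (Pr n p B 1 τ y ^ s * Pr n p B 1 τ y ^ (-s)) := by ring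
      _ = _ := by rw [← Real.rpow_add hPp, add_neg_cancel, Real.rpow_zero, mul_one]
  · refine hd.congr_deriv ?_
    rw [e]; ring

lemma pd_wD (h : Centered n p B K Q) {Λ : ℝ} (hΛ : 1 ≤ Λ) {τ : ℝ} (hτ : 0 < τ) (y : Eu n)
    (hQ : Q τ y ≤ Λ * Pr n p B 1 τ y) (i : Fin n) :
    |pd n i (wD n p B Q τ) y - Q τ y * pd n i (fD n p B Q τ) y| ≤
      (p + n) * Λ ^ ((p + n) / 2) * |wD n p B Q τ y| / √(XX n p B τ y) := by
  set s := (p + (n : ℝ)) / 2 with hs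
  have hs1 : s - 1 ≠ 0 := sub_ne_zero.2 h.hs.ne'
  have hs0 : 0 < s := by linarith [h.hs]
  have hPp := h.pr_pos hτ.le y
  have hQp := h.press.pos τ hτ.le y
  have hX := XX_pos (n := n) h.hp h.hB hτ.le y
  have sQ := h.press.slice hτ
  have sP := h.prPress.slice hτ
  have pQ := h.press.pos τ hτ.le
  have pP := h.prPress.pos τ hτ.le
  have e : pd n i (wD n p B Q τ) y - Q τ y * pd n i (fD n p B Q τ) y =
      (Q τ y - Pr n p B 1 τ y) * pd n i (fun y => Pr n p B 1 τ y ^ (-s)) y := by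
    have aux : ∀ {P : Eu n → ℝ}, ContDiff ℝ ∞ P → (∀ y, 0 < P y) →
        s / (s - 1) * pd n i (fun y => P y ^ (1 - s)) y = P y * pd n i (fun y => P y ^ (-s)) y := by
      intro P hP hpos
      rw [pd_rpow hP hpos, pd_rpow hP hpos]
      simp only []
      rw [show (1 : ℝ) - s - 1 = -s by ring, Real.rpow_sub_one (hpos y).ne']
      have := (hpos y).ne'
      field_simp
      ring
    have e1 : pd n i (wD n p B Q τ) y = s / (s - 1) * pd n i (fun y => Q τ y ^ (1 - s)) y -
        s / (s - 1) * pd n i (fun y => Pr n p B 1 τ y ^ (1 - s)) y := by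
      unfold wD
      rw [← hs, pd_const_mul, pd_sub (contDiff_rpow sQ pQ _) (contDiff_rpow sP pP _)]
      ring
    have e2 : pd n i (fD n p B Q τ) y = pd n i (fun y => Q τ y ^ (-s)) y -
        pd n i (fun y => Pr n p B 1 τ y ^ (-s)) y := by
      unfold fD
      rw [← hs, pd_sub (contDiff_rpow sQ pQ _) (contDiff_rpow sP pP _)]
    rw [e1, e2, aux sQ pQ, aux sP pP]
    ring
  rw [e, pd_Pr_rpow_neg h.hp h.hB hτ, abs_mul, abs_mul, abs_neg,
    abs_of_pos (Real.rpow_pos_of_pos hPp _)]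
  have h2 := abs_sub_le_pow_diff h.hs hPp hQp hΛ hQ
  rw [← hs] at h2
  change |Q τ y - Pr n p B 1 τ y| ≤ Λ ^ s * Pr n p B 1 τ y ^ s * |wD n p B Q τ y| at h2
  have hsX := Real.sqrt_pos.2 hX
  have hy : |y i| ≤ √(XX n p B τ y) := by
    have h1 : |y i| ≤ ‖y‖ := by simpa using PiLp.norm_apply_le y i
    refine h1.trans (Real.le_sqrt_of_sq_le ?_)
    have := Sc_pos (n := n) h.hp hτ.le
    have := h.hB
    unfold XX
    have : 0 ≤ B * Sc n p τ := by positivity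
    linarith
  have h3 : |2 * s * y i / XX n p B τ y| ≤ (p + n) / √(XX n p B τ y) := by
    rw [abs_div, abs_mul, abs_of_pos hX, abs_of_pos (by positivity : 0 < 2 * s),
      div_le_div_iff₀ hX hsX]
    have e3 : XX n p B τ y = √(XX n p B τ y) * √(XX n p B τ y) := (Real.mul_self_sqrt hX.le).symm
    rw [e3, Real.sqrt_mul_self hsX.le, ← mul_assoc, show 2 * s = p + n by rw [hs]; ring]
    have : 0 < p + (n : ℝ) := by linarith
    gcongr
  have hpow := Real.rpow_pos_of_pos hPp
  calc _ ≤ Λ ^ s * Pr n p B 1 τ y ^ s * |wD n p B Q τ y| *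
        ((p + n) / √(XX n p B τ y) * Pr n p B 1 τ y ^ (-s)) := by
          have := (hpow (-s)).le
          have := (hpow s).le
          exact mul_le_mul h2 (by gcongr) (by positivity) (by positivity)
    _ = (p + n) * Λ ^ s * |wD n p B Q τ y| / √(XX n p B τ y) *
        (Pr n p B 1 τ y ^ s * Pr n p B 1 τ y ^ (-s)) := by ring
    _ = _ := by rw [← Real.rpow_add hPp, add_neg_cancel, Real.rpow_zero, mul_one]

end Centered

end WeightedEquations

section CylinderGeometry

variable {n : ℕ} {p B : ℝ}

lemma th_half (hp : 0 < p) {τ1 τ : ℝ} (h1 : τ1 / 2 ≤ τ) (h2 : τ ≤ τ1) :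
    th p τ1 / 2 ≤ th p τ ∧ th p τ ≤ th p τ1 := by
  unfold th
  constructor <;> nlinarith

lemma Sc_half (hp : 0 < p) {τ1 τ : ℝ} (hτ1 : 1 ≤ τ1) (h1 : τ1 / 2 ≤ τ) (h2 : τ ≤ τ1) :
    (1 / 2) ^ ((p + n) / p) * Sc n p τ1 ≤ Sc n p τ ∧ Sc n p τ ≤ Sc n p τ1 := by
  obtain ⟨t1, t2⟩ := th_half hp h1 h2
  have ht := th_pos hp (by linarith : (0 : ℝ) ≤ τ)
  have ht1 := th_pos hp (by linarith : (0 : ℝ) ≤ τ1)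
  have he : 0 ≤ (p + n) / p := by positivity
  unfold Sc
  rw [← Real.mul_rpow (by norm_num) ht1.le]
  exact ⟨Real.rpow_le_rpow (by positivity) (by linarith) he, Real.rpow_le_rpow ht.le t2 he⟩

/-- Comparability constant of the weight on parabolic cylinders. -/
def cylConst (n : ℕ) (p : ℝ) : ℝ := (1 / 2) ^ ((p + n) / p) / 16

lemma cylConst_pos : 0 < cylConst n p := by unfold cylConst; positivity

lemma XX_cyl (hp : 0 < p) (hB : 0 < B) {τ1 τ : ℝ} (hτ1 : 1 ≤ τ1) (h1 : τ1 / 2 ≤ τ) (h2 : τ ≤ τ1)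
    {y1 y : Eu n} (hy : ‖y - y1‖ ≤ √(XX n p B τ1 y1) / 2) :
    cylConst n p * XX n p B τ1 y1 ≤ XX n p B τ y ∧ XX n p B τ y ≤ 4 * XX n p B τ1 y1 := by
  obtain ⟨s1, s2⟩ := Sc_half (n := n) hp hτ1 h1 h2
  have hX := XX_pos (n := n) hp hB (by linarith : (0 : ℝ) ≤ τ1) y1
  have hS := Sc_pos (n := n) hp (by linarith : (0 : ℝ) ≤ τ)
  have hS1 := Sc_pos (n := n) hp (by linarith : (0 : ℝ) ≤ τ1)
  have hk1 : (1 / 2 : ℝ) ^ ((p + n) / p) ≤ 1 :=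
    Real.rpow_le_one (by norm_num) (by norm_num) (by positivity)
  have hk0 : 0 < (1 / 2 : ℝ) ^ ((p + n) / p) := by positivity
  set r := √(XX n p B τ1 y1) with hr
  have hr0 : 0 < r := Real.sqrt_pos.2 hX
  have hr2 : XX n p B τ1 y1 = r ^ 2 := (Real.sq_sqrt hX.le).symm
  have ha : ‖y‖ ≤ ‖y1‖ + r / 2 := by
    have := norm_le_norm_add_norm_sub' y y1; linarith
  have hb : ‖y1‖ - r / 2 ≤ ‖y‖ := by
    have := norm_le_norm_add_norm_sub y y1; linarith
  have hy1 : ‖y1‖ ^ 2 + B * Sc n p τ1 = r ^ 2 := by rw [← hr2]; rfl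
  have hBS : B * Sc n p τ ≤ B * Sc n p τ1 := by gcongr
  have hBS' : (1 / 2 : ℝ) ^ ((p + n) / p) * (B * Sc n p τ1) ≤ B * Sc n p τ := by
    have := mul_le_mul_of_nonneg_left s1 hB.le
    linarith
  have hy10 := norm_nonneg y1
  have hy0 := norm_nonneg y
  have hBSp : 0 < B * Sc n p τ1 := by positivity
  have hBSp' : 0 < B * Sc n p τ := by positivity
  rw [hr2]
  unfold cylConst XX
  constructor
  · rcases le_or_gt (3 / 4 * r) ‖y1‖ with hc | hc
    · have : r / 4 ≤ ‖y‖ := by linarith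
      nlinarith
    · have : 7 / 16 * r ^ 2 ≤ B * Sc n p τ1 := by nlinarith
      have := mul_le_mul_of_nonneg_left this hk0.le
      nlinarith [sq_nonneg ‖y‖, mul_pos hk0 (pow_pos hr0 2)]
  · have : ‖y‖ ^ 2 ≤ (‖y1‖ + r / 2) ^ 2 := by gcongr
    nlinarith [sq_nonneg (‖y1‖ - r / 2)]

end CylinderGeometry

namespace Centered

variable {n : ℕ} {p B K : ℝ} {Q : ℝ → Eu n → ℝ}

set_option maxHeartbeats 2000000 in
/-- Rescaling a parabolic cylinder below a point, and mollifying the potential, gives a solution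
on the unit cylinder with uniform constants. -/
lemma exists_unitCyl (h : Centered n p B K Q) {Λ0 : ℝ} (hΛ0 : 1 ≤ Λ0)
    (hr : ∀ τ, 0 ≤ τ → ∀ y, Pr n p B 1 τ y ≤ Λ0 * Q τ y ∧ Q τ y ≤ Λ0 * Pr n p B 1 τ y) :
    ∃ Λ : ℝ, 1 ≤ Λ ∧ ∀ τ1, 1 ≤ τ1 → ∀ y1 : Eu n, ∀ M : ℝ,
      (∀ τ, τ1 / 2 ≤ τ → τ ≤ τ1 → ∀ y, cylConst n p * XX n p B τ1 y1 ≤ XX n p B τ y →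
        XX n p B τ y ≤ 4 * XX n p B τ1 y1 → |potD n p B Q τ y| ≤ M) →
      ∀ σ > 0, ∃ w D A : ℝ → Eu n → ℝ, UnitCyl n Λ σ (M + σ) w D A ∧
        w 1 0 = τ1 / 2 * wD n p B Q τ1 y1 := by
  have hp := h.hp
  have hB := h.hB
  have hk := cylConst_pos (n := n) (p := p)
  set k := cylConst n p with hkd
  set c1 := (p + n) ^ 2 * Λ0 ^ ((p + n) / 2) with hc1
  set c2 := (p + n) * Λ0 ^ ((p + n) / 2) with hc2
  have hc1p : 0 ≤ c1 := by positivity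
  have hc2p : 0 ≤ c2 := by positivity
  have hl1 : 0 ≤ 8 * Λ0 / p := by positivity
  have hl2 : 0 ≤ Λ0 * (1 + 2 * p) / (2 * k) := by positivity
  have hl3 : 0 ≤ c1 / (2 * p) := by positivity
  have hl4 : 0 ≤ c2 / √k := by positivity
  set Λ := 1 + 8 * Λ0 / p + Λ0 * (1 + 2 * p) / (2 * k) + c1 / (2 * p) + c2 / √k with hΛd
  have hΛ1 : 8 * Λ0 / p ≤ Λ := by rw [hΛd]; linarith
  have hΛ2 : Λ0 * (1 + 2 * p) / (2 * k) ≤ Λ := by rw [hΛd]; linarith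
  have hΛ3 : c1 / (2 * p) ≤ Λ := by rw [hΛd]; linarith
  have hΛ4 : c2 / √k ≤ Λ := by rw [hΛd]; linarith
  have hΛ : 1 ≤ Λ := by rw [hΛd]; linarith
  refine ⟨Λ, hΛ, fun τ1 hτ1 y1 M hM σ hσ => ?_⟩
  clear_value Λ
  have hτ10 : 0 < τ1 := by linarith
  have hX1 := XX_pos (n := n) hp hB hτ10.le y1
  set X1 := XX n p B τ1 y1 with hX1d
  have ht1 := th_pos hp hτ10.le
  set R := √X1 / 2 with hR
  have hsX : 0 < √X1 := Real.sqrt_pos.2 hX1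
  have hR0 : 0 < R := by positivity
  have hR2 : R ^ 2 = X1 / 4 := by rw [hR, div_pow, Real.sq_sqrt hX1.le]; norm_num
  set a := τ1 / 2 with ha
  have ha0 : 0 < a := by positivity
  set q := 8 * Λ0 * X1 / th p τ1 with hq
  have hq0 : 0 < q := by positivity
  set σ0 := σ / ((1 + a) * (1 + R) * (1 + q)) with hσ0d
  have hσ0 : 0 < σ0 := by positivity
  have hσe : σ0 * ((1 + a) * (1 + R) * (1 + q)) = σ := by rw [hσ0d]; field_simp
  have b1 : 0 < a * R := by positivity
  have b2 : 0 < a * q := by positivity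
  have b3 : 0 < R * q := by positivity
  have b4 : 0 < a * R * q := by positivity
  have hexp : (1 + a) * (1 + R) * (1 + q) =
    1 + a + R + q + a * R + a * q + R * q + a * R * q := by ring
  have hσ1 : a * (1 + q) * σ0 ≤ σ := by
    rw [← hσe, mul_comm σ0]
    exact mul_le_mul_of_nonneg_right (by rw [hexp]; linarith) hσ0.le
  have hσ2 : a * R * (1 + q) * σ0 ≤ σ := by
    rw [← hσe, mul_comm σ0]
    exact mul_le_mul_of_nonneg_right (by rw [hexp]; linarith) hσ0.le
  have hσ3 : σ0 ≤ σ := by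
    rw [← hσe]
    exact le_mul_of_one_le_right hσ0.le (by rw [hexp]; linarith)
  have hS := h.dSys
  have hpos : ∀ τ ∈ Set.Icc a τ1, 0 < τ := fun τ hτ => ha0.trans_le hτ.1
  have hsubI : Set.Icc a τ1 ×ˢ (Set.univ : Set (Eu n)) ⊆ Set.Ioi 0 ×ˢ Set.univ :=
    Set.prod_mono (fun τ hτ => hpos τ hτ) subset_rfl
  have hsubc : Set.Icc a τ1 ×ˢ (Set.univ : Set (Eu n)) ⊆ Set.Ici 0 ×ˢ Set.univ :=
    Set.prod_mono (fun τ hτ => (hpos τ hτ).le) subset_rfl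
  set f := fD n p B Q with hf
  set w := wD n p B Q with hw
  set D := potD n p B Q with hD
  obtain ⟨η, hη, hη0, happ⟩ := exists_bump_approx (n := n) (t0 := a) (T := τ1) (R := ‖y1‖ + R) hσ0
    (G := Sum.elim ![w, f, D] (Sum.elim (fun (i : Fin n) τ => pd n i (w τ))
      (fun (i : Fin n) τ => pd n i (f τ)))) (by
        rintro (j | j | j)
        · fin_cases j
          · exact hS.wc.mono hsubc
          · exact hS.fc.mono hsubc
          · exact hS.dc.mono hsubc
        · exact (hS.ws.pd j).continuousOn.mono hsubI
        · exact (hS.fs.pd j).continuousOn.mono hsubI)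
  have happw := happ (Sum.inl 0)
  have happf := happ (Sum.inl 1)
  have happD := happ (Sum.inl 2)
  have happpw := fun i => happ (Sum.inr (Sum.inl i))
  have happpf := fun i => happ (Sum.inr (Sum.inr i))
  simp only [Sum.elim_inl, Sum.elim_inr, Matrix.cons_val] at happw happf happD happpw happpf
  clear happ
  have hT : ∀ s ∈ Set.Icc (0 : ℝ) 1, a + a * s ∈ Set.Icc a τ1 := fun s hs => by
    have : a * s ≤ a * 1 := by gcongr; exact hs.2
    have := mul_nonneg ha0.le hs.1
    exact ⟨by linarith, by rw [ha] at *; linarith⟩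
  have hIoc : ∀ s ∈ Set.Ioc (0 : ℝ) 1, s ∈ Set.Icc (0 : ℝ) 1 := fun s hs => ⟨hs.1.le, hs.2⟩
  have hY : ∀ z : Eu n, ‖z‖ ≤ 1 → ‖y1 + R • z - y1‖ ≤ √X1 / 2 := fun z hz => by
    rw [add_sub_cancel_left, norm_smul, Real.norm_of_nonneg hR0.le]
    exact mul_le_of_le_one_right hR0.le hz
  have hYn : ∀ z : Eu n, ‖z‖ ≤ 1 → ‖y1 + R • z‖ ≤ ‖y1‖ + R := fun z hz => by
    refine (norm_add_le _ _).trans ?_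
    rw [norm_smul, Real.norm_of_nonneg hR0.le]
    exact add_le_add le_rfl (mul_le_of_le_one_right hR0.le hz)
  have hcyl : ∀ s ∈ Set.Icc (0 : ℝ) 1, ∀ z : Eu n, ‖z‖ ≤ 1 →
      k * X1 ≤ XX n p B (a + a * s) (y1 + R • z) ∧
        XX n p B (a + a * s) (y1 + R • z) ≤ 4 * X1 := fun s hs z hz =>
    XX_cyl hp hB hτ1 (hT s hs).1 (hT s hs).2 (hY z hz)
  have hth : ∀ s ∈ Set.Icc (0 : ℝ) 1, th p τ1 / 2 ≤ th p (a + a * s) ∧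
      th p (a + a * s) ≤ th p τ1 := fun s hs => th_half hp (hT s hs).1 (hT s hs).2
  have hPb : ∀ s ∈ Set.Icc (0 : ℝ) 1, ∀ z : Eu n, ‖z‖ ≤ 1 →
      k * X1 / th p τ1 ≤ Pr n p B 1 (a + a * s) (y1 + R • z) ∧
        Λ0 * Pr n p B 1 (a + a * s) (y1 + R • z) ≤ q := fun s hs z hz => by
    obtain ⟨x1, x2⟩ := hcyl s hs z hz
    obtain ⟨t1, t2⟩ := hth s hs
    have h0 := (hpos _ (hT s hs)).le
    have := th_pos hp h0
    rw [Pr_eq_XX hp h0]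
    constructor
    · gcongr
      exact (mul_pos hk hX1).le.trans x1
    · calc Λ0 * (XX n p B (a + a * s) (y1 + R • z) / th p (a + a * s))
          ≤ Λ0 * (4 * X1 / (th p τ1 / 2)) := by gcongr
        _ = q := by rw [hq]; field_simp; norm_num
  have hQb : ∀ s ∈ Set.Icc (0 : ℝ) 1, ∀ z : Eu n, ‖z‖ ≤ 1 →
      k * X1 / th p τ1 / Λ0 ≤ Q (a + a * s) (y1 + R • z) ∧
        Q (a + a * s) (y1 + R • z) ≤ q := fun s hs z hz => by
    obtain ⟨x1, x2⟩ := hPb s hs z hz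
    obtain ⟨r1, r2⟩ := hr _ (hpos _ (hT s hs)).le (y1 + R • z)
    refine ⟨?_, r2.trans x2⟩
    rw [div_le_iff₀ (by positivity)]
    linarith
  have hta : τ1 / th p τ1 ≤ 1 / (2 * p) := by
    rw [div_le_div_iff₀ ht1 (by positivity)]
    unfold th; linarith
  have hta' : 1 / (1 + 2 * p) ≤ τ1 / th p τ1 := by
    rw [div_le_div_iff₀ (by positivity) ht1]
    unfold th; linarith
  have hqb : a * q / R ^ 2 ≤ 8 * Λ0 / p := by
    calc a * q / R ^ 2 = 16 * Λ0 * (τ1 / th p τ1) := by rw [hR2, hq, ha]; field_simp; norm_num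
      _ ≤ 16 * Λ0 * (1 / (2 * p)) := by gcongr
      _ = 8 * Λ0 / p := by field_simp; norm_num
  have hin : ∀ s : ℝ, HasDerivAt (fun s => a + a * s) a s := fun s =>
    (((hasDerivAt_id s).const_mul a).const_add a).congr_deriv (mul_one a)
  have hcomp : ∀ {F : ℝ → ℝ} {F' : ℝ} (s : ℝ), HasDerivAt F F' (a + a * s) →
      HasDerivAt (fun s => F (a + a * s)) (F' * a) s := fun s hF => hF.comp s (hin s)
  have hmc : ∀ s ∈ Set.Icc (0 : ℝ) 1, ContDiff ℝ ∞ (mol η (D (a + a * s))) := fun s hs =>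
    contDiff_mol hη (hS.dc.slice' (hpos _ (hT s hs)).le)
  have hDpd : ∀ s ∈ Set.Icc (0 : ℝ) 1, ∀ i, pd n i (fun z => mol η (D (a + a * s)) (y1 + R • z)) =
      fun z => R * mol (pd n i η) (D (a + a * s)) (y1 + R • z) := fun s hs i => by
    rw [pd_rescale (hmc s hs), pd_mol hη (hS.dc.slice' (hpos _ (hT s hs)).le)]
  have hDlap : ∀ s ∈ Set.Icc (0 : ℝ) 1, lap n (fun z => mol η (D (a + a * s)) (y1 + R • z)) =
      fun z => R ^ 2 * mol η (f (a + a * s)) (y1 + R • z) := fun s hs => by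
    ext z
    rw [lap_rescale (hmc s hs), hS.lap_mol_potential hη (hpos _ (hT s hs)).le]
  have hfc : ∀ s ∈ Set.Icc (0 : ℝ) 1, ContDiff ℝ ∞ (f (a + a * s)) := fun s hs =>
    hS.fs.slice (hpos _ (hT s hs))
  have hwc : ∀ s ∈ Set.Icc (0 : ℝ) 1, ContDiff ℝ ∞ (w (a + a * s)) := fun s hs =>
    hS.ws.slice (hpos _ (hT s hs))
  have hmaps : Set.MapsTo (fun q : ℝ × Eu n => (a + a * q.1, y1 + R • q.2))
      (Set.Icc 0 1 ×ˢ Metric.closedBall 0 1) (Set.Ici 0 ×ˢ Set.univ) := fun q hq =>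
    ⟨(hpos _ (hT q.1 hq.1)).le, trivial⟩
  have hmapc : ContinuousOn (fun q : ℝ × Eu n => (a + a * q.1, y1 + R • q.2))
      (Set.Icc 0 1 ×ˢ Metric.closedBall 0 1) := by fun_prop
  have hcont : ∀ g : ℝ → Eu n → ℝ,
      ContinuousOn (fun q : ℝ × Eu n => g q.1 q.2) (Set.Ici 0 ×ˢ Set.univ) →
      ContinuousOn (fun q : ℝ × Eu n => g (a + a * q.1) (y1 + R • q.2))
        (Set.Icc 0 1 ×ˢ Metric.closedBall 0 1) := fun g hg => hg.comp hmapc hmaps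
  refine ⟨fun s z => a * w (a + a * s) (y1 + R • z),
    fun s z => mol η (D (a + a * s)) (y1 + R • z),
    fun s z => a * Q (a + a * s) (y1 + R • z) / R ^ 2, ?_, ?_⟩
  · refine ⟨?_, ?_, ?_, ?_, ?_, ?_, ?_, ?_, ?_, ?_, ?_, ?_⟩
    · exact fun s hs => contDiff_const.mul (contDiff_rescale (hwc s (hIoc s hs)) y1 R)
    · exact fun s hs => contDiff_rescale (hmc s (hIoc s hs)) y1 R
    · exact continuousOn_const.mul (hcont w hS.wc)
    · exact hcont (fun t => mol η (D t)) (mol_continuousOn hη hS.dc)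
    · intro i
      have hc : ContinuousOn (fun q : ℝ × Eu n =>
          R * mol (pd n i η) (D (a + a * q.1)) (y1 + R • q.2))
          (Set.Icc 0 1 ×ˢ Metric.closedBall 0 1) :=
        continuousOn_const.mul (hcont (fun t => mol (pd n i η) (D t))
          (mol_continuousOn (hη.pd i) hS.dc))
      exact hc.congr fun q hq => congrFun (hDpd q.1 hq.1 i) q.2
    · intro s hs z hz
      obtain ⟨q1, -⟩ := hQb s (hIoc s hs) z hz
      have hΛinv : 1 / Λ ≤ 2 * k / (Λ0 * (1 + 2 * p)) := by
        rw [div_le_div_iff₀ (by positivity) (by positivity)]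
        rw [div_le_iff₀ (by positivity)] at hΛ2
        linarith
      refine hΛinv.trans ?_
      calc 2 * k / (Λ0 * (1 + 2 * p)) = 2 * k / Λ0 * (1 / (1 + 2 * p)) := by field_simp
        _ ≤ 2 * k / Λ0 * (τ1 / th p τ1) := by gcongr
        _ = a * (k * X1 / th p τ1 / Λ0) / R ^ 2 := by rw [hR2, ha]; field_simp; norm_num
        _ ≤ _ := by gcongr
    · intro s hs z hz
      obtain ⟨-, q1⟩ := hQb s (hIoc s hs) z hz
      refine le_trans ?_ (hqb.trans hΛ1)
      gcongr
    · intro s hs z hz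
      obtain ⟨x1, x2⟩ := hcyl s hs z hz
      have h1 := hM _ (hT s hs).1 (hT s hs).2 _ x1 x2
      have h2 := happD _ (hT s hs) _ (hYn z hz)
      have h3 := abs_sub_abs_le_abs_sub (mol η (D (a + a * s)) (y1 + R • z))
        (D (a + a * s) (y1 + R • z))
      linarith
    · intro s hs z hz
      have hs' := hIoc s hs
      rw [hDlap s hs']
      have h0 := (hpos _ (hT s hs')).le
      have h1 := happf _ (hT s hs') _ (hYn z hz)
      have h3 := abs_sub_abs_le_abs_sub (f (a + a * s) (y1 + R • z))
        (mol η (f (a + a * s)) (y1 + R • z))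
      rw [abs_sub_comm] at h3
      obtain ⟨a1, a2⟩ := h.a_bounds h0 (y1 + R • z)
      obtain ⟨-, x2⟩ := hPb s hs' z hz
      obtain ⟨-, q2⟩ := hQb s hs' z hz
      have hPp := h.pr_pos h0 (y1 + R • z)
      have haq : aD n p B Q (a + a * s) (y1 + R • z) ≤ q := by
        refine a2.trans (max_le q2 ((le_mul_of_one_le_left hPp.le hΛ0).trans x2))
      have ha0' := h.a_nonneg h0 (y1 + R • z)
      have he : w (a + a * s) (y1 + R • z) = _ := h.w_eq h0 (y1 + R • z)
      have hq' : a * q ≤ Λ * R ^ 2 := by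
        have := hqb.trans hΛ1
        rwa [div_le_iff₀ (by positivity)] at this
      set fm := mol η (f (a + a * s)) (y1 + R • z)
      simp only [he]
      rw [abs_mul, abs_mul, abs_of_pos ha0, abs_of_nonneg ha0', abs_mul,
        abs_of_pos (pow_pos hR0 2)]
      calc a * (aD n p B Q (a + a * s) (y1 + R • z) * |f (a + a * s) (y1 + R • z)|)
          ≤ a * (q * (|fm| + σ0)) := by
            have : |f (a + a * s) (y1 + R • z)| ≤ |fm| + σ0 := by linarith
            gcongr
        _ = a * q * |fm| + a * q * σ0 := by ring
        _ ≤ Λ * R ^ 2 * |fm| + a * (1 + q) * σ0 := by gcongr; linarith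
        _ ≤ _ := by linarith
    · intro s hs z hz
      have hs' := hIoc s hs
      have h0 := hpos _ (hT s hs')
      have hQΛ := (hr _ h0.le (y1 + R • z)).2
      obtain ⟨G, hG, hd⟩ := h.wD_hasDerivAt hΛ0 h0 (y1 + R • z) hQΛ
      refine ⟨a * (G * a), ?_, ?_⟩
      · rw [abs_mul, abs_mul, abs_mul, abs_of_pos ha0]
        have hths := th_pos hp h0.le
        have h1 : a / th p (a + a * s) ≤ 1 / (2 * p) := by
          rw [div_le_div_iff₀ hths (by positivity)]
          have := mul_nonneg hp.le (mul_nonneg ha0.le hs.1.le)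
          unfold th
          linarith
        calc a * (|G| * a) ≤ a * (c1 * |w (a + a * s) (y1 + R • z)| / th p (a + a * s) * a) := by
              gcongr
          _ = c1 * (a / th p (a + a * s)) * (a * |w (a + a * s) (y1 + R • z)|) := by ring
          _ ≤ c1 * (1 / (2 * p)) * (a * |w (a + a * s) (y1 + R • z)|) := by gcongr
          _ ≤ _ := by
            rw [mul_one_div]; gcongr
      · refine ((hcomp s hd).const_mul a).congr_deriv ?_
        rw [lap_const_mul, lap_rescale (hwc s hs')]
        field_simp
        rfl
    · intro s hs z hz
      have hs' := hIoc s hs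
      have h0 := hpos _ (hT s hs')
      have hd := hcomp s (hS.mol_hasDerivAt_potential hη h0 (y1 + R • z))
      rw [hDlap s hs']
      obtain ⟨-, q2⟩ := hQb s hs' z hz
      have hQp := h.press.pos _ h0.le (y1 + R • z)
      refine ⟨a * (mol η (w (a + a * s)) (y1 + R • z) - Q (a + a * s) (y1 + R • z) *
        mol η (f (a + a * s)) (y1 + R • z)), ?_, hd.congr_deriv ?_⟩
      · have h1 := abs_le.1 (happw _ (hT s hs') _ (hYn z hz))
        have h2 := abs_le.1 (happf _ (hT s hs') _ (hYn z hz))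
        have h3 := h.le_w h0.le (y1 + R • z)
        have h4 : Q (a + a * s) (y1 + R • z) * mol η (f (a + a * s)) (y1 + R • z) ≤
            Q (a + a * s) (y1 + R • z) * (f (a + a * s) (y1 + R • z) + σ0) := by
          gcongr; linarith [h2.2]
        have h5 : Q (a + a * s) (y1 + R • z) * σ0 ≤ q * σ0 := by gcongr
        have h6 : -((1 + q) * σ0) ≤ mol η (w (a + a * s)) (y1 + R • z) -
            Q (a + a * s) (y1 + R • z) * mol η (f (a + a * s)) (y1 + R • z) := by
          change Q (a + a * s) (y1 + R • z) * f (a + a * s) (y1 + R • z) ≤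
            w (a + a * s) (y1 + R • z) at h3
          linarith [h1.1]
        have := mul_le_mul_of_nonneg_left h6 ha0.le
        linarith
      · field_simp
        ring
    · intro s hs z hz i
      have hs' := hIoc s hs
      have h0 := hpos _ (hT s hs')
      have hQΛ := (hr _ h0.le (y1 + R • z)).2
      obtain ⟨x1, x2⟩ := hcyl s hs' z hz
      have hXp := XX_pos (n := n) hp hB h0.le (y1 + R • z)
      obtain ⟨-, q2⟩ := hQb s hs' z hz
      have hQp := h.press.pos _ h0.le (y1 + R • z)
      have hd := (hcomp s (hS.mol_hasDerivAt_potential (hη.pd i) h0 (y1 + R • z))).const_mul R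
      rw [← pd_mol hη (hS.wc.slice' h0.le), pd_mol_right hη (hwc s hs')] at hd
      have hpe : pd n i (lap n (fun z => mol η (D (a + a * s)) (y1 + R • z))) z =
          R ^ 3 * mol η (pd n i (f (a + a * s))) (y1 + R • z) := by
        rw [hDlap s hs', pd_const_mul, pd_rescale (contDiff_mol hη (hfc s hs').continuous),
          pd_mol_right hη (hfc s hs')]
        simp only []
        ring
      refine ⟨a * R * (mol η (pd n i (w (a + a * s))) (y1 + R • z) - Q (a + a * s) (y1 + R • z) *
        mol η (pd n i (f (a + a * s))) (y1 + R • z)), ?_, ?_⟩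
      · have h1 := happpw i _ (hT s hs') _ (hYn z hz)
        have h2 := happpf i _ (hT s hs') _ (hYn z hz)
        have h3 := h.pd_wD hΛ0 h0 (y1 + R • z) hQΛ i
        set mw := mol η (pd n i (w (a + a * s))) (y1 + R • z)
        set mf := mol η (pd n i (f (a + a * s))) (y1 + R • z)
        set W := pd n i (w (a + a * s)) (y1 + R • z)
        set F := pd n i (f (a + a * s)) (y1 + R • z)
        set Qv := Q (a + a * s) (y1 + R • z)
        set wv := w (a + a * s) (y1 + R • z)
        have h4 : |mw - Qv * mf| ≤
            c2 * |wv| / √(XX n p B (a + a * s) (y1 + R • z)) + (1 + q) * σ0 := by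
          rw [show mw - Qv * mf = (mw - W) - Qv * (mf - F) + (W - Qv * F) by ring]
          refine (abs_add_le _ _).trans ?_
          have h5 : |(mw - W) - Qv * (mf - F)| ≤ σ0 + q * σ0 := by
            refine (abs_sub _ _).trans ?_
            rw [abs_mul, abs_of_pos hQp]
            gcongr
          have h6 : |W - Qv * F| ≤ c2 * |wv| / √(XX n p B (a + a * s) (y1 + R • z)) := h3
          linarith
        have h7 : R / √(XX n p B (a + a * s) (y1 + R • z)) ≤ 1 / √k := by
          have hs1 : √k * √X1 ≤ √(XX n p B (a + a * s) (y1 + R • z)) := by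
            rw [← Real.sqrt_mul hk.le]; exact Real.sqrt_le_sqrt x1
          have hsk := Real.sqrt_pos.2 hk
          rw [div_le_div_iff₀ (Real.sqrt_pos.2 hXp) hsk, hR]
          linarith [mul_pos hsk hsX]
        rw [abs_mul, abs_of_pos b1, abs_mul, abs_of_pos ha0]
        calc a * R * |mw - Qv * mf|
            ≤ a * R * (c2 * |wv| / √(XX n p B (a + a * s) (y1 + R • z)) + (1 + q) * σ0) := by
              gcongr
          _ = c2 * (R / √(XX n p B (a + a * s) (y1 + R • z))) * (a * |wv|) +
              a * R * (1 + q) * σ0 := by ring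
          _ ≤ c2 * (1 / √k) * (a * |wv|) + σ := by gcongr
          _ ≤ _ := by rw [mul_one_div]; gcongr
      · have hmem : ∀ᶠ t in 𝓝 s, 0 < a + a * t := by
          have : ContinuousAt (fun t : ℝ => a + a * t) s := by fun_prop
          exact this.eventually (lt_mem_nhds h0)
        refine (hd.congr_of_eventuallyEq ?_).congr_deriv ?_
        · filter_upwards [hmem] with t ht
          rw [pd_rescale (contDiff_mol hη (hS.dc.slice' ht.le)), pd_mol hη (hS.dc.slice' ht.le)]
        · rw [hpe]
          field_simp
          ring
  · simp only [mul_one, smul_zero, add_zero]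
    rw [show a + a = τ1 by rw [ha]; ring]

/-- Interior estimate for the diffused difference in terms of the potential. -/
theorem interior_bound (h : Centered n p B K Q) :
    ∃ C : ℝ, 0 ≤ C ∧ ∀ τ1, 1 ≤ τ1 → ∀ y1 : Eu n, ∀ M : ℝ, 0 ≤ M →
      (∀ τ, τ1 / 2 ≤ τ → τ ≤ τ1 → ∀ y, cylConst n p * XX n p B τ1 y1 ≤ XX n p B τ y →
        XX n p B τ y ≤ 4 * XX n p B τ1 y1 → |potD n p B Q τ y| ≤ M) →
      τ1 * |wD n p B Q τ1 y1| ≤ C * M := by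
  obtain ⟨Λ0, hΛ0, hr⟩ := h.ratio
  obtain ⟨Λ, hΛ, hcyl⟩ := h.exists_unitCyl hΛ0 fun τ hτ y => ⟨(hr τ hτ y).1, (hr τ hτ y).2.1⟩
  obtain ⟨C, hC, hb⟩ := UnitCyl.interior_bound h.hn hΛ
  refine ⟨2 * √C, by positivity, fun τ1 hτ1 y1 M hM hD => ?_⟩
  have key : ∀ σ > 0, (τ1 / 2 * wD n p B Q τ1 y1) ^ 2 ≤
      C * ((M + σ) ^ 2 + σ ^ 2 + (M + σ) * σ) := fun σ hσ => by
    obtain ⟨w, D, A, hU, he⟩ := hcyl τ1 hτ1 y1 M hD σ hσ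
    rw [← he]
    exact hb σ (M + σ) w D A hσ.le (by positivity) hU
  have hlim : Tendsto (fun σ : ℝ => C * ((M + σ) ^ 2 + σ ^ 2 + (M + σ) * σ)) (𝓝[>] 0)
      (𝓝 (C * M ^ 2)) := by
    have hc : Continuous (fun σ : ℝ => C * ((M + σ) ^ 2 + σ ^ 2 + (M + σ) * σ)) := by fun_prop
    have := hc.tendsto 0
    simp only [add_zero, mul_zero, ne_eq, OfNat.ofNat_ne_zero, not_false_eq_true, zero_pow] at this
    exact this.mono_left nhdsWithin_le_nhds
  have h1 : (τ1 / 2 * wD n p B Q τ1 y1) ^ 2 ≤ C * M ^ 2 :=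
    ge_of_tendsto hlim (by filter_upwards [self_mem_nhdsWithin] with σ hσ using key σ hσ)
  have h2 := Real.abs_le_sqrt h1
  rw [Real.sqrt_mul hC, Real.sqrt_sq hM, abs_mul, abs_of_pos (by linarith : 0 < τ1 / 2)] at h2
  linarith

end Centered

lemma rpow_le_of_comparable {x y c : ℝ} (e : ℝ) (hx : 0 < x) (hy : 0 < y) (hc : 1 ≤ c)
    (h1 : x ≤ c * y) (h2 : y ≤ c * x) : x ^ e ≤ c ^ |e| * y ^ e := by
  have hc0 : 0 < c := by linarith
  rcases le_total 0 e with he | he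
  · rw [abs_of_nonneg he, ← Real.mul_rpow hc0.le hy.le]
    exact Real.rpow_le_rpow hx.le h1 he
  · rw [abs_of_nonpos he, Real.rpow_neg hc0.le, ← Real.inv_rpow hc0.le,
      ← Real.mul_rpow (by positivity) hy.le]
    refine Real.rpow_le_rpow_of_nonpos (by positivity) ?_ he
    rw [inv_mul_le_iff₀ hc0]
    exact h2

namespace Centered

variable {n : ℕ} {p B K : ℝ} {Q : ℝ → Eu n → ℝ}

/-- A bound on the potential yields one on the diffused difference. -/
lemma w_bound_of_potential (h : Centered n p B K Q) {e r κ C₀ : ℝ} (hC₀ : 0 ≤ C₀)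
    (hD : ∀ τ, 0 ≤ τ → ∀ y, |potD n p B Q τ y| ≤
      C₀ * (th p τ ^ e * Sc n p τ ^ r * XX n p B τ y ^ κ)) :
    ∃ C, 0 ≤ C ∧ ∀ τ, 1 ≤ τ → ∀ y, th p τ * |wD n p B Q τ y| ≤
      C * (th p τ ^ e * Sc n p τ ^ r * XX n p B τ y ^ κ) := by
  obtain ⟨C, hC, hI⟩ := h.interior_bound
  have hp := h.hp
  have hcc := cylConst_pos (n := n) (p := p)
  set c := (4 : ℝ) + 1 / cylConst n p with hc
  have hcinv : 0 < 1 / cylConst n p := by positivity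
  have hc1 : 1 ≤ c := by linarith
  set c' := (2 : ℝ) ^ ((p + n) / p) with hc'
  have hc'1 : 1 ≤ c' := Real.one_le_rpow (by norm_num) (by positivity)
  refine ⟨(1 + 2 * p) * (C * (C₀ * (2 ^ |e| * c' ^ |r| * c ^ |κ|))), by positivity,
    fun τ hτ y => ?_⟩
  have hτ0 : 0 ≤ τ := by linarith
  have hθ := th_pos hp hτ0
  have hS := Sc_pos (n := n) hp hτ0
  have hX := XX_pos (n := n) hp h.hB hτ0 y
  have key := hI τ hτ y (C₀ * (2 ^ |e| * c' ^ |r| * c ^ |κ| *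
    (th p τ ^ e * Sc n p τ ^ r * XX n p B τ y ^ κ))) (by positivity) (fun t h1 h2 x h3 h4 => ?_)
  · have h5 : th p τ ≤ (1 + 2 * p) * τ := by unfold th; linarith
    calc _ ≤ (1 + 2 * p) * τ * |wD n p B Q τ y| := by gcongr
      _ = (1 + 2 * p) * (τ * |wD n p B Q τ y|) := by ring
      _ ≤ _ := mul_le_mul_of_nonneg_left key (by positivity)
      _ = _ := by ring
  · have ht0 : 0 ≤ t := by linarith
    have hθ' := th_pos hp ht0
    have hS' := Sc_pos (n := n) hp ht0
    have hX' := XX_pos (n := n) hp h.hB ht0 x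
    obtain ⟨t1, t2⟩ := th_half hp h1 h2
    obtain ⟨s1, s2⟩ := Sc_half (n := n) hp hτ h1 h2
    have a1 : th p t ^ e ≤ 2 ^ |e| * th p τ ^ e :=
      rpow_le_of_comparable e hθ' hθ (by norm_num) (by linarith) (by linarith)
    have a2 : Sc n p t ^ r ≤ c' ^ |r| * Sc n p τ ^ r := by
      refine rpow_le_of_comparable r hS' hS hc'1
        (s2.trans (le_mul_of_one_le_left hS.le hc'1)) ?_
      rw [one_div, Real.inv_rpow (by norm_num), ← hc', inv_mul_le_iff₀ (by linarith)] at s1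
      exact s1
    have a3 : XX n p B t x ^ κ ≤ c ^ |κ| * XX n p B τ y ^ κ := by
      refine rpow_le_of_comparable κ hX' hX hc1 ?_ ?_
      · have := mul_pos hcinv hX
        rw [hc, add_mul]; linarith
      · have := mul_le_mul_of_nonneg_left h3 hcinv.le
        rw [← mul_assoc, one_div_mul_cancel hcc.ne', one_mul] at this
        rw [hc, add_mul]; linarith
    refine (hD t ht0 x).trans (mul_le_mul_of_nonneg_left ?_ hC₀)
    calc _ ≤ (2 ^ |e| * th p τ ^ e) * (c' ^ |r| * Sc n p τ ^ r) * (c ^ |κ| * XX n p B τ y ^ κ) :=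
          mul_le_mul (mul_le_mul a1 a2 (by positivity) (by positivity)) a3 (by positivity)
            (by positivity)
      _ = _ := by ring

/-- Uniform algebraic convergence of the pressure ratio. -/
lemma ratio_decay (h : Centered n p B K Q) : ∃ μ C : ℝ, 0 < μ ∧ 0 ≤ C ∧
    ∀ τ, 0 ≤ τ → ∀ y, |Q τ y - Pr n p B 1 τ y| ≤ C * th p τ ^ (-μ) * Pr n p B 1 τ y := by
  obtain ⟨μ, C₀, hμ, hC₀, hD⟩ := h.D_decay
  obtain ⟨C, hC, hw⟩ := h.w_bound_of_potential (e := -μ) (r := 1 - (n : ℝ) / 2) (κ := 0) hC₀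
    (fun τ hτ y => by rw [Real.rpow_zero, mul_one, ← mul_assoc]; exact hD τ hτ y)
  obtain ⟨Λ, hΛ, hr⟩ := h.ratio
  have hp := h.hp
  have hB := h.hB
  set s := (p + n) / 2 with hs
  have hs1 : 1 < s := h.hs
  set ν := min (μ / s) 1 with hν
  have hν0 : 0 < ν := by rw [hν]; positivity
  have hν1 : ν ≤ 1 := min_le_right _ _
  have hνs : ν * s ≤ μ := by
    rw [← le_div_iff₀ (by linarith)]; exact min_le_left _ _
  refine ⟨ν, Λ ^ s * C + 2 * Λ + Λ * (1 + 1 / B) * (1 + 2 * p) ^ ν, hν0, by positivity,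
    fun τ hτ y => ?_⟩
  have hP := h.pr_pos hτ y
  have hθ1 := one_le_th hp hτ
  have hθ := th_pos hp hτ
  have hS := Sc_pos (n := n) hp hτ
  have hX := XX_pos (n := n) hp hB hτ y
  obtain ⟨-, h2, h3⟩ := hr τ hτ y
  have hpos1 : 0 ≤ Λ ^ s * C * th p τ ^ (-ν) := by positivity
  have hpos2 : 0 ≤ 2 * Λ * th p τ ^ (-ν) := by positivity
  have hpos3 : 0 ≤ Λ * (1 + 1 / B) * (1 + 2 * p) ^ ν * th p τ ^ (-ν) := by positivity
  suffices hsuff : ∃ A, |Q τ y - Pr n p B 1 τ y| ≤ A * Pr n p B 1 τ y ∧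
      (A ≤ Λ ^ s * C * th p τ ^ (-ν) ∨ A ≤ 2 * Λ * th p τ ^ (-ν) ∨
        A ≤ Λ * (1 + 1 / B) * (1 + 2 * p) ^ ν * th p τ ^ (-ν)) by
    obtain ⟨A, hA, hA'⟩ := hsuff
    refine hA.trans (mul_le_mul_of_nonneg_right ?_ hP.le)
    rw [add_mul, add_mul]
    rcases hA' with h | h | h <;> linarith
  have hinv : 1 / th p τ ≤ th p τ ^ (-ν) := by
    rw [one_div, ← Real.rpow_neg_one]
    exact Real.rpow_le_rpow_of_exponent_le hθ1 (by linarith)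
  rcases le_total τ 1 with hle | hle
  · refine ⟨Λ * (1 / th p τ + Sc n p τ / XX n p B τ y), by linarith, Or.inr (Or.inr ?_)⟩
    have i1 : 1 / th p τ ≤ 1 := by rw [div_le_one hθ]; exact hθ1
    have i2 : Sc n p τ / XX n p B τ y ≤ 1 / B := by
      rw [div_le_div_iff₀ hX hB]
      have : 0 ≤ ‖y‖ ^ 2 := by positivity
      unfold XX; linarith
    have i3 : 1 ≤ (1 + 2 * p) ^ ν * th p τ ^ (-ν) := by
      rw [Real.rpow_neg hθ.le, ← div_eq_mul_inv, one_le_div (by positivity)]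
      refine Real.rpow_le_rpow hθ.le ?_ hν0.le
      unfold th
      have : 2 * p * τ ≤ 2 * p * 1 := by gcongr
      linarith
    calc _ ≤ Λ * (1 + 1 / B) := by gcongr
      _ ≤ Λ * (1 + 1 / B) * ((1 + 2 * p) ^ ν * th p τ ^ (-ν)) :=
        le_mul_of_one_le_right (by positivity) i3
      _ = _ := by ring
  · set z := XX n p B τ y / Sc n p τ with hz
    have hz0 : 0 < z := by positivity
    rcases le_total z (th p τ ^ ν) with hzle | hzle
    · have j1 := abs_sub_le_pow_diff hs1 hP (h.press.pos τ hτ y) hΛ h2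
      have j2 := hw τ hle y
      rw [Real.rpow_zero, mul_one] at j2
      have j3 : |s / (s - 1) * (Q τ y ^ (1 - s) - Pr n p B 1 τ y ^ (1 - s))| ≤
          C * (th p τ ^ (-μ) * Sc n p τ ^ (1 - (n : ℝ) / 2)) / th p τ := by
        rw [le_div_iff₀ hθ, mul_comm]; exact j2
      refine ⟨Λ ^ s * Pr n p B 1 τ y ^ (s - 1) *
        (C * (th p τ ^ (-μ) * Sc n p τ ^ (1 - (n : ℝ) / 2)) / th p τ), ?_, Or.inl ?_⟩
      · refine (j1.trans (mul_le_mul_of_nonneg_left j3 (by positivity))).trans (le_of_eq ?_)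
        rw [show Pr n p B 1 τ y ^ s = Pr n p B 1 τ y ^ (s - 1) * Pr n p B 1 τ y by
          rw [← Real.rpow_add_one hP.ne']; ring_nf]
        ring
      · have k1 : Pr n p B 1 τ y ^ (s - 1) = z ^ (s - 1) * Sc n p τ ^ (s - 1) * th p τ ^ (1 - s) := by
          rw [Pr_eq_XX hp hτ, Real.div_rpow hX.le hθ.le, hz, Real.div_rpow hX.le hS.le,
            show 1 - s = -(s - 1) by ring, Real.rpow_neg hθ.le]
          field_simp
        have k2 : Sc n p τ ^ (s - 1) * Sc n p τ ^ (1 - (n : ℝ) / 2) = th p τ ^ s := by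
          rw [← Real.rpow_add hS, Sc, ← Real.rpow_mul hθ.le]
          congr 1
          rw [hs]; field_simp; ring
        have k3 : th p τ ^ s * th p τ ^ (1 - s) = th p τ := by
          rw [← Real.rpow_add hθ]; simp
        have k4 : z ^ (s - 1) ≤ th p τ ^ (ν * (s - 1)) := by
          rw [Real.rpow_mul hθ.le]
          exact Real.rpow_le_rpow hz0.le hzle (by linarith)
        have k5 : th p τ ^ (ν * (s - 1)) * th p τ ^ (-μ) ≤ th p τ ^ (-ν) := by
          rw [← Real.rpow_add hθ]
          exact Real.rpow_le_rpow_of_exponent_le hθ1 (by linarith)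
        calc _ = Λ ^ s * C * (z ^ (s - 1) * th p τ ^ (-μ)) * (Sc n p τ ^ (s - 1) *
              Sc n p τ ^ (1 - (n : ℝ) / 2) * th p τ ^ (1 - s)) / th p τ := by rw [k1]; ring
          _ = Λ ^ s * C * (z ^ (s - 1) * th p τ ^ (-μ)) := by rw [k2, k3]; field_simp
          _ ≤ Λ ^ s * C * th p τ ^ (-ν) := by
            refine mul_le_mul_of_nonneg_left (le_trans ?_ k5) (by positivity)
            exact mul_le_mul_of_nonneg_right k4 (by positivity)
    · refine ⟨Λ * (1 / th p τ + Sc n p τ / XX n p B τ y), by linarith, Or.inr (Or.inl ?_)⟩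
      have i2 : Sc n p τ / XX n p B τ y ≤ th p τ ^ (-ν) := by
        rw [Real.rpow_neg hθ.le, show Sc n p τ / XX n p B τ y = z⁻¹ by rw [hz, inv_div]]
        exact inv_anti₀ (by positivity) hzle
      calc _ ≤ Λ * (th p τ ^ (-ν) + th p τ ^ (-ν)) := by gcongr
        _ = _ := by ring

/-- The diffusion coefficient converges to the Barenblatt one at an algebraic rate. -/
lemma a_decay (h : Centered n p B K Q) : ∃ μ C : ℝ, 0 < μ ∧ 0 ≤ C ∧
    ∀ τ, 0 ≤ τ → ∀ y, |aD n p B Q τ y * th p τ / XX n p B τ y - 1| ≤ C * th p τ ^ (-μ) := by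
  obtain ⟨μ, C, hμ, hC, hr⟩ := h.ratio_decay
  refine ⟨μ, C, hμ, hC, fun τ hτ y => ?_⟩
  have hθ := th_pos h.hp hτ
  have hP := h.pr_pos hτ y
  have h1 := abs_le.1 (hr τ hτ y)
  obtain ⟨h4, h5⟩ := h.a_bounds hτ y
  have e : XX n p B τ y = Pr n p B 1 τ y * th p τ := by
    rw [Pr_eq_XX h.hp hτ]; field_simp
  have h0 : 0 ≤ C * th p τ ^ (-μ) * Pr n p B 1 τ y := by positivity
  rw [e, mul_div_mul_right _ _ hθ.ne', div_sub_one hP.ne', abs_div, abs_of_pos hP, div_le_iff₀ hP,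
    abs_le]
  constructor
  · rcases min_choice (Q τ y) (Pr n p B 1 τ y) with hm | hm <;> rw [hm] at h4 <;> linarith
  · rcases max_choice (Q τ y) (Pr n p B 1 τ y) with hm | hm <;> rw [hm] at h5 <;> linarith

/-- The optimal weighted decay of the potential. -/
lemma D_sharp (h : Centered n p B K Q) : ∃ C, 0 ≤ C ∧ ∀ τ, 0 ≤ τ → ∀ y,
    |potD n p B Q τ y| ≤ C * th p τ ^ ((p + 2) * (p + 2 * n - 2) / (8 * p)) *
      XX n p B τ y ^ (-(((n : ℝ) - 1 + p / 2) / 2)) := by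
  obtain ⟨C, hC, h0⟩ := h.D_initial
  obtain ⟨μ, C₂, hμ, hC₂, hr⟩ := h.a_decay
  have hα := h.exists_lt_of_n
  have hp := h.hp
  set e := (p + 2) * (p + 2 * n - 2) / (8 * p) with he
  set α := ((n : ℝ) - 1 + p / 2) / 2 with hαd
  have e1 : 2 * α + 2 - n = 1 + p / 2 := by rw [hαd]; ring
  have e2 : 2 * p * e = 2 * α * (1 + p / 2) := by rw [he, hαd]; field_simp; ring
  have e3 : 2 * α * (p + n) ≤ 4 * α * (α + 1) := by
    have : p + n ≤ 2 * (α + 1) := by rw [hαd]; linarith [h.hp2]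
    calc _ ≤ 2 * α * (2 * (α + 1)) := mul_le_mul_of_nonneg_left this (by positivity)
      _ = _ := by ring
  set M := C₂ * (2 * α * (1 + p / 2) + 4 * α * (α + 1)) with hM
  set L := M / (2 * p * μ) with hL
  have hL' : 2 * p * μ * L = M := by rw [hL]; field_simp
  have hL0 : 0 ≤ L := by positivity
  refine ⟨C * Real.exp L, by positivity, fun τ hτ y => ?_⟩
  have key := h.abs_le_block (t0 := 0) (κ := α) (b := B)
    (g := fun τ => C * Real.exp L * (Real.exp (-(L * th p τ ^ (-μ))) * th p τ ^ e))
    (G := fun τ => 2 * p * e + M * th p τ ^ (-μ)) le_rfl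
    h.hB (fun τ hτ => ?_) (fun τ hτ => ?_) (fun y => ?_) (fun τ hτ y => ?_) hτ y
  · have hθ := th_pos hp hτ
    have hX := XX_pos (n := n) hp h.hB hτ y
    refine key.trans ?_
    refine mul_le_mul_of_nonneg_right (mul_le_mul_of_nonneg_left ?_ (by positivity))
      (by positivity)
    refine mul_le_of_le_one_left (by positivity) (Real.exp_le_one_iff.2 ?_)
    have : 0 ≤ L * th p τ ^ (-μ) := by positivity
    linarith
  · have := th_pos hp hτ
    positivity
  · have d1 := ((hasDerivAt_th_rpow hp hτ (-μ)).const_mul L).fun_neg.exp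
    have d2 := (d1.fun_mul (hasDerivAt_th_rpow hp hτ e)).const_mul (C * Real.exp L)
    refine d2.congr_deriv ?_
    rw [← hL']
    ring
  · rw [XX_zero]
    have : C * Real.exp L * (Real.exp (-(L * th p 0 ^ (-μ))) * th p 0 ^ e) = C := by
      simp only [th, mul_zero, add_zero, Real.one_rpow, mul_one]
      rw [mul_assoc, ← Real.exp_add]; simp
    simp only [this]
    exact h0 y
  · have hr := hr τ hτ.le y
    obtain ⟨z1, z2⟩ := zfrac_mem (n := n) hp h.hB hτ.le y
    have hE : 0 ≤ th p τ ^ (-μ) := by have := th_pos hp hτ.le; positivity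
    generalize th p τ ^ (-μ) = E at *
    generalize aD n p B Q τ y * th p τ / XX n p B τ y = ζ at *
    generalize B * Sc n p τ / XX n p B τ y = z at *
    rw [e1, e2]
    generalize hA : 2 * α * (1 + p / 2) = A at *
    have hA0 : 0 ≤ A := by rw [← hA]; positivity
    have hA1 : 0 ≤ 4 * α * (α + 1) := by positivity
    generalize 4 * α * (α + 1) = A' at *
    have i1 : (ζ - 1) * (A - A' * z) ≤ C₂ * E * (A + A') := by
      refine (le_abs_self _).trans ?_
      rw [abs_mul]
      refine mul_le_mul hr ?_ (abs_nonneg _) (by positivity)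
      have q1 : A' * z ≤ A' * 1 := mul_le_mul_of_nonneg_left z2 hA1
      have q2 : 0 ≤ A' * z := by positivity
      rw [abs_le]; constructor <;> linarith
    have i2 := mul_le_mul_of_nonneg_right e3 z1.le
    rw [hM]
    linarith

/-- The optimal weighted decay of the relative error in the centered case. -/
theorem relative_error (h : Centered n p B K Q) : ∃ C, 0 ≤ C ∧ ∀ τ, 1 ≤ τ → ∀ y,
    th p τ ^ ((p / 2 + 1) ^ 2 / (2 * p)) *
      (XX n p B τ y / Sc n p τ) ^ ((1 - p / 2) / 2) *
      (Pr n p B 1 τ y ^ ((p + n) / 2) * |fD n p B Q τ y|) ≤ C := by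
  obtain ⟨C₀, hC₀, hD⟩ := h.D_sharp
  obtain ⟨C, hC, hw⟩ := h.w_bound_of_potential (r := 0)
    (e := (p + 2) * (p + 2 * n - 2) / (8 * p)) (κ := -(((n : ℝ) - 1 + p / 2) / 2)) hC₀
    (fun τ hτ y => by rw [Real.rpow_zero, mul_one, ← mul_assoc]; exact hD τ hτ y)
  obtain ⟨Λ, hΛ, hr⟩ := h.a_ratio
  have hp := h.hp
  refine ⟨Λ * C, by positivity, fun τ hτ1 y => ?_⟩
  have hτ : 0 ≤ τ := by linarith
  have hθ := th_pos hp hτ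
  have hS := Sc_pos (n := n) hp hτ
  have hX := XX_pos (n := n) hp h.hB hτ y
  have hΛ0 : 0 < Λ := by linarith
  obtain ⟨r1, -, -⟩ := hr τ hτ y
  have hw := hw τ hτ1 y
  rw [Real.rpow_zero, mul_one, h.w_eq hτ y, abs_mul, abs_of_nonneg (h.a_nonneg hτ y)] at hw
  rw [div_le_div_iff₀ hΛ0 hX] at r1
  have hf : XX n p B τ y * |fD n p B Q τ y| ≤ Λ * C * (th p τ ^ ((p + 2) * (p + 2 * n - 2) / (8 * p)) *
      XX n p B τ y ^ (-(((n : ℝ) - 1 + p / 2) / 2))) := by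
    have i1 := mul_le_mul_of_nonneg_right r1 (abs_nonneg (fD n p B Q τ y))
    have i2 := mul_le_mul_of_nonneg_left hw hΛ0.le
    linarith
  have e1 : Pr n p B 1 τ y ^ ((p + n) / 2) =
      XX n p B τ y ^ ((p + n) / 2 - 1) * XX n p B τ y * th p τ ^ (-((p + n) / 2)) := by
    rw [Pr_eq_XX hp hτ, Real.div_rpow hX.le hθ.le, Real.rpow_neg hθ.le, ← Real.rpow_add_one hX.ne',
      sub_add_cancel, div_eq_mul_inv]
  have e2 : (XX n p B τ y / Sc n p τ) ^ ((1 - p / 2) / 2) =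
      XX n p B τ y ^ ((1 - p / 2) / 2) * th p τ ^ (-((p + n) / p * ((1 - p / 2) / 2))) := by
    rw [Real.div_rpow hX.le hS.le, Sc, ← Real.rpow_mul hθ.le, Real.rpow_neg hθ.le, div_eq_mul_inv]
  have e3 : XX n p B τ y ^ ((1 - p / 2) / 2) * XX n p B τ y ^ ((p + n) / 2 - 1) *
      XX n p B τ y ^ (-(((n : ℝ) - 1 + p / 2) / 2)) = 1 := by
    rw [← Real.rpow_add hX, ← Real.rpow_add hX]
    refine Eq.trans ?_ (Real.rpow_zero (XX n p B τ y))
    congr 1; ring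
  have e4 : th p τ ^ ((p / 2 + 1) ^ 2 / (2 * p)) * th p τ ^ (-((p + n) / p * ((1 - p / 2) / 2))) *
      th p τ ^ (-((p + n) / 2)) * th p τ ^ ((p + 2) * (p + 2 * n - 2) / (8 * p)) = 1 := by
    rw [← Real.rpow_add hθ, ← Real.rpow_add hθ, ← Real.rpow_add hθ]
    refine Eq.trans ?_ (Real.rpow_zero (th p τ))
    congr 1; field_simp; ring
  rw [e1, e2]
  calc _ = th p τ ^ ((p / 2 + 1) ^ 2 / (2 * p)) * th p τ ^ (-((p + n) / p * ((1 - p / 2) / 2))) *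
      th p τ ^ (-((p + n) / 2)) * (XX n p B τ y ^ ((1 - p / 2) / 2) *
        XX n p B τ y ^ ((p + n) / 2 - 1)) * (XX n p B τ y * |fD n p B Q τ y|) := by ring
    _ ≤ th p τ ^ ((p / 2 + 1) ^ 2 / (2 * p)) * th p τ ^ (-((p + n) / p * ((1 - p / 2) / 2))) *
      th p τ ^ (-((p + n) / 2)) * (XX n p B τ y ^ ((1 - p / 2) / 2) *
        XX n p B τ y ^ ((p + n) / 2 - 1)) * (Λ * C * (th p τ ^ ((p + 2) * (p + 2 * n - 2) / (8 * p)) *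
      XX n p B τ y ^ (-(((n : ℝ) - 1 + p / 2) / 2)))) :=
        mul_le_mul_of_nonneg_left hf (by positivity)
    _ = Λ * C * (th p τ ^ ((p / 2 + 1) ^ 2 / (2 * p)) *
        th p τ ^ (-((p + n) / p * ((1 - p / 2) / 2))) * th p τ ^ (-((p + n) / 2)) *
        th p τ ^ ((p + 2) * (p + 2 * n - 2) / (8 * p))) * (XX n p B τ y ^ ((1 - p / 2) / 2) *
        XX n p B τ y ^ ((p + n) / 2 - 1) * XX n p B τ y ^ (-(((n : ℝ) - 1 + p / 2) / 2))) := by ring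
    _ ≤ _ := by rw [e3, e4]; simp

end Centered

section Parameters

variable {n : ℕ} {m : ℝ}

/-- The parameter range of the theorem in terms of `p`. -/
lemma pPar_facts (hcase : (2 ≤ n ∧ ((n : ℝ) - 2) / n < m ∧ m < (n : ℝ) / (n + 2)) ∨
    (n = 1 ∧ 0 < m ∧ m < 1 / 3)) :
    1 ≤ n ∧ 0 < m ∧ m < 1 ∧ 0 < pPar n m ∧ pPar n m < 2 ∧ (n = 1 → 1 < pPar n m) := by
  rcases hcase with ⟨hn, h1, h2⟩ | ⟨rfl, h1, h2⟩
  · have hn' : (2 : ℝ) ≤ n := by exact_mod_cast hn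
    have hm0 : 0 < m := lt_of_le_of_lt (div_nonneg (by linarith) (by linarith)) h1
    rw [div_lt_iff₀ (by linarith)] at h1
    rw [lt_div_iff₀ (by linarith)] at h2
    have hm1 : m < 1 := by nlinarith
    have h3 : 0 < 1 - m := by linarith
    refine ⟨by omega, hm0, hm1, ?_, ?_, fun h => by omega⟩
    · unfold pPar
      rw [sub_pos, lt_div_iff₀ h3]; linarith
    · unfold pPar
      rw [sub_lt_iff_lt_add, div_lt_iff₀ h3]; linarith
  · have h3 : 0 < 1 - m := by linarith
    have h4 : 2 < 2 / (1 - m) := by rw [lt_div_iff₀ h3]; linarith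
    have h5 : 2 / (1 - m) < 3 := by rw [div_lt_iff₀ h3]; linarith
    unfold pPar
    rw [Nat.cast_one]
    exact ⟨le_rfl, h1, by linarith, by linarith, by linarith, fun _ => by linarith⟩

lemma one_div_one_sub (m : ℝ) : 1 / (1 - m) = (pPar n m + n) / 2 := by
  unfold pPar; ring

/-- The Barenblatt solution as a power of its pressure. -/
lemma rhoB_eq {B τ : ℝ} (hp : 0 < pPar n m) (hB : 0 < B) (hτ : 0 ≤ τ) (y : Eu n) :
    rhoB n m B τ y = Pr n (pPar n m) B 1 τ y ^ (-((pPar n m + n) / 2)) := by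
  have hθ := th_pos hp hτ
  have hX := XX_pos (n := n) hp hB hτ y
  rw [Pr_eq_XX hp hτ, rhoB, uB, one_div_one_sub (n := n), betaPar, norm_smul, Real.norm_eq_abs]
  change th _ τ ^ _ * (B + (|th _ τ ^ _| * _) ^ 2) ^ _ = _
  generalize pPar n m = p at *
  have e1 : B + (|th p τ ^ (-((1 + (n : ℝ) / p) / 2))| * ‖y‖) ^ 2 =
      XX n p B τ y * th p τ ^ (-((p + n) / p)) := by
    rw [abs_of_pos (by positivity), mul_pow, ← Real.rpow_natCast, ← Real.rpow_mul hθ.le, XX, Sc,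
      add_mul, mul_assoc, ← Real.rpow_add hθ, add_neg_cancel, Real.rpow_zero]
    rw [show -((1 + (n : ℝ) / p) / 2) * ((2 : ℕ) : ℝ) = -((p + n) / p) by
      push_cast; field_simp]
    ring
  rw [e1, Real.mul_rpow hX.le (by positivity), ← Real.rpow_mul hθ.le,
    Real.div_rpow hX.le hθ.le, mul_left_comm, ← Real.rpow_add hθ,
    eq_div_iff (Real.rpow_pos_of_pos hθ _).ne', mul_assoc, ← Real.rpow_add hθ]
  refine mul_eq_left₀ (Real.rpow_pos_of_pos hX _).ne' |>.2 (Eq.trans ?_ (Real.rpow_zero (th p τ)))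
  congr 1
  field_simp
  ring

/-- The pressure of a solution of the fast diffusion equation. -/
lemma IsFDESol.isPress {ρ : ℝ → Eu n → ℝ} (hρ : IsFDESol n m ρ) (hm0 : 0 < m) (hm1 : m < 1)
    (a : Eu n) : IsPress n (1 / (1 - m)) (fun τ y => ρ τ (y + a) ^ (m - 1)) := by
  obtain ⟨hpos, hcont, hsm, heq⟩ := hρ
  have hmap : ∀ I : Set ℝ, Set.MapsTo (fun q : ℝ × Eu n => (q.1, q.2 + a)) (I ×ˢ Set.univ)
      (I ×ˢ Set.univ) := fun I q hq => ⟨hq.1, trivial⟩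
  refine ⟨fun τ hτ y => Real.rpow_pos_of_pos (hpos τ hτ _) _, ?_, ?_, fun τ hτ y => ?_⟩
  · have h1 : ContinuousOn (fun q : ℝ × Eu n => ρ q.1 (q.2 + a)) (Set.Ici 0 ×ˢ Set.univ) :=
      hcont.comp (f := fun q : ℝ × Eu n => (q.1, q.2 + a)) (by fun_prop) (hmap _)
    exact h1.rpow_const fun q hq => Or.inl (hpos q.1 hq.1 _).ne'
  · have h1 : ContDiffOn ℝ ∞ (fun q : ℝ × Eu n => ρ q.1 (q.2 + a)) (Set.Ioi 0 ×ˢ Set.univ) :=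
      hsm.comp (f := fun q : ℝ × Eu n => (q.1, q.2 + a)) (by fun_prop) (hmap _)
    exact h1.rpow_const_of_ne fun q hq => (hpos q.1 (Set.mem_Ioi.1 hq.1).le _).ne'
  · have hpos' := hpos τ hτ.le
    have hs : ContDiff ℝ ∞ (ρ τ) := ContDiffOn.slice hsm hτ
    have hd : HasDerivAt (fun t => ρ t (y + a)) (1 / m * lap n (fun x => ρ τ x ^ m) (y + a)) τ := by
      rw [← heq τ hτ]
      refine DifferentiableAt.hasDerivAt ?_
      have h1 := hsm.contDiffAt (x := (τ, y + a))
        ((isOpen_Ioi.prod isOpen_univ).mem_nhds ⟨hτ, trivial⟩)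
      exact (h1.differentiableAt (by simp)).comp τ (f := fun t : ℝ => (t, y + a))
        (by fun_prop)
    refine (hd.rpow_const (p := m - 1) (Or.inl (hpos' _).ne')).congr_deriv ?_
    rw [lap_translate (fun y => ρ τ y ^ (m - 1)) a]
    simp only [pd_translate (fun y => ρ τ y ^ (m - 1)) a]
    rw [lap_rpow hs hpos', lap_rpow hs hpos']
    simp only [pd_rpow hs hpos', mul_pow, ← Finset.mul_sum]
    generalize ∑ i, pd n i (ρ τ) (y + a) ^ 2 = G
    generalize lap n (ρ τ) (y + a) = L
    have hr := hpos' (y + a)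
    generalize ρ τ (y + a) = r at *
    have h1m : 1 - m ≠ 0 := by linarith
    have e1 : r ^ (m - 2) = r ^ (m - 1) / r := by
      rw [← Real.rpow_sub_one hr.ne']; ring_nf
    have e2 : r ^ (m - 1 - 1) = r ^ (m - 1) / r := Real.rpow_sub_one hr.ne' _
    have e3 : r ^ (m - 1 - 2) = r ^ (m - 1) / r / r := by
      rw [show m - 1 - 2 = m - 1 - 1 - 1 by ring, Real.rpow_sub_one hr.ne', e2]
    rw [e1, e2, e3]
    field_simp
    ring

end Parameters

section Shift

lemma abs_rpow_sub_one_le {s a c : ℝ} (hs : 1 < s) (ha : 0 < a) (hc : 1 ≤ c) (hac : a ≤ c) :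
    |a ^ s - 1| ≤ s * c ^ s * |a - 1| := by
  have hcs : 1 ≤ c ^ s := Real.one_le_rpow hc (by linarith)
  have h0 : 0 ≤ s * |a - 1| := mul_nonneg (by linarith) (abs_nonneg _)
  have bern : ∀ x : ℝ, 0 < x → 1 + s * (x - 1) ≤ x ^ s := fun x hx => by
    have := one_add_mul_self_le_rpow_one_add (s := x - 1) (by linarith) hs.le
    rwa [add_sub_cancel] at this
  rw [abs_le]
  constructor
  · have h1 := bern a ha
    have h2 : -(s * |a - 1|) ≤ s * (a - 1) := by
      rw [← mul_neg]; exact mul_le_mul_of_nonneg_left (neg_abs_le _) (by linarith)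
    have h3 : s * |a - 1| ≤ s * |a - 1| * c ^ s := le_mul_of_one_le_right h0 hcs
    linarith
  · have h1 := mul_le_mul_of_nonneg_left (bern a⁻¹ (by positivity)) (Real.rpow_nonneg ha.le s)
    rw [Real.inv_rpow ha.le, mul_inv_cancel₀ (Real.rpow_pos_of_pos ha s).ne'] at h1
    have h2 : a ^ s * (1 + s * (a⁻¹ - 1)) = a ^ s - s * (a ^ (s - 1) * (a - 1)) := by
      rw [Real.rpow_sub_one ha.ne']; field_simp; ring
    have h3 : a ^ (s - 1) ≤ c ^ s := by
      calc _ ≤ c ^ (s - 1) := Real.rpow_le_rpow ha.le hac (by linarith)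
        _ ≤ c ^ s := Real.rpow_le_rpow_of_exponent_le hc (by linarith)
    have h4 : a ^ (s - 1) * (a - 1) ≤ c ^ s * |a - 1| :=
      calc _ ≤ a ^ (s - 1) * |a - 1| := by gcongr; exact le_abs_self _
        _ ≤ _ := by gcongr
    have h5 := mul_le_mul_of_nonneg_left h4 (by linarith : 0 ≤ s)
    linarith

lemma normSq_shift_le {n : ℕ} {B b : ℝ} (hB : 0 < B) (hb : B ≤ b) (y a : Eu n) :
    ‖y + a‖ ^ 2 + b ≤ (2 + 2 * ‖a‖ ^ 2 / B) * (‖y‖ ^ 2 + b) := by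
  have h1 : ‖y + a‖ ^ 2 ≤ (‖y‖ + ‖a‖) ^ 2 := by gcongr; exact norm_add_le _ _
  have h2 : 2 * ‖a‖ ^ 2 / B * B = 2 * ‖a‖ ^ 2 := by field_simp
  have h3 : 2 * ‖a‖ ^ 2 / B * B ≤ 2 * ‖a‖ ^ 2 / B * (‖y‖ ^ 2 + b) := by
    gcongr; nlinarith [sq_nonneg ‖y‖]
  nlinarith [sq_nonneg (‖y‖ - ‖a‖), sq_nonneg ‖y‖]

/-- Effect of a translation on a power of `|y|² + b`. -/
lemma shift_rpow {n : ℕ} {s B : ℝ} (hs : 1 < s) (hB : 0 < B) (a : Eu n) :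
    ∃ C, 0 ≤ C ∧ ∀ b, B ≤ b → ∀ y : Eu n,
      |((‖y‖ ^ 2 + b) / (‖y + a‖ ^ 2 + b)) ^ s - 1| ≤ C * ‖a‖ / √(‖y‖ ^ 2 + b) := by
  set c := 2 + 2 * ‖a‖ ^ 2 / B with hc
  have hc2 : 2 ≤ c := by rw [hc]; have : 0 ≤ 2 * ‖a‖ ^ 2 / B := by positivity
                         linarith
  refine ⟨s * c ^ s * ((1 + √c) * c), by positivity, fun b hb y => ?_⟩
  have hb0 : 0 < b := hB.trans_le hb
  set X := ‖y‖ ^ 2 + b with hX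
  set X' := ‖y + a‖ ^ 2 + b with hX'
  have hX0 : 0 < X := by positivity
  have hX'0 : 0 < X' := by positivity
  have h1 : X' ≤ c * X := normSq_shift_le hB hb y a
  have h2 : X ≤ c * X' := by
    have := normSq_shift_le hB hb (y + a) (-a)
    rwa [add_neg_cancel_right, norm_neg] at this
  have h3 : |X - X'| ≤ ‖a‖ * ((1 + √c) * √X) := by
    have e : X - X' = (‖y‖ - ‖y + a‖) * (‖y‖ + ‖y + a‖) := by rw [hX, hX']; ring
    rw [e, abs_mul]
    refine mul_le_mul ?_ ?_ (abs_nonneg _) (norm_nonneg _)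
    · have := abs_norm_sub_norm_le y (y + a)
      rwa [sub_add_cancel_left, norm_neg] at this
    · rw [abs_of_nonneg (by positivity), add_mul, one_mul, ← Real.sqrt_mul (by linarith)]
      refine add_le_add (Real.le_sqrt_of_sq_le (by linarith)) (Real.le_sqrt_of_sq_le ?_)
      linarith
  have h4 : |X / X' - 1| ≤ (1 + √c) * c * ‖a‖ / √X := by
    rw [div_sub_one hX'0.ne', abs_div, abs_of_pos hX'0, div_le_div_iff₀ hX'0 (by positivity)]
    calc |X - X'| * √X ≤ ‖a‖ * ((1 + √c) * √X) * √X := by gcongr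
      _ = ‖a‖ * (1 + √c) * X := by rw [← Real.mul_self_sqrt hX0.le, Real.sqrt_mul_self (by positivity)]; ring
      _ ≤ ‖a‖ * (1 + √c) * (c * X') := by gcongr
      _ = _ := by ring
  calc _ ≤ s * c ^ s * |X / X' - 1| :=
        abs_rpow_sub_one_le hs (by positivity) (by linarith) (by rw [div_le_iff₀ hX'0]; exact h2)
    _ ≤ s * c ^ s * ((1 + √c) * c * ‖a‖ / √X) := by gcongr
    _ = _ := by ring

end Shift

section Clip

/-- Truncation of a real number to `[-k, k]`. -/
def clip (k x : ℝ) : ℝ := max (-k) (min k x)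

lemma continuous_clip (k : ℝ) : Continuous (clip k) :=
  continuous_const.max (continuous_const.min continuous_id)

lemma abs_clip_sub_le (k x y : ℝ) : |clip k x - clip k y| ≤ |x - y| :=
  (abs_max_sub_max_le_max _ _ _ _).trans (by
    rw [sub_self, abs_zero, max_eq_right (abs_nonneg _)]
    refine (abs_min_sub_min_le_max _ _ _ _).trans ?_
    rw [sub_self, abs_zero, max_eq_right (abs_nonneg _)])

lemma clip_of_abs_le {k x : ℝ} (h : |x| ≤ k) : clip k x = x := by
  rw [clip, min_eq_right (abs_le.1 h).2, max_eq_right (abs_le.1 h).1]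

lemma abs_clip_le {k : ℝ} (hk : 0 ≤ k) (x : ℝ) : |clip k x| ≤ k :=
  abs_le.2 ⟨le_max_left _ _, max_le (by linarith) (min_le_left _ _)⟩

lemma abs_clip_le_abs {k : ℝ} (hk : 0 ≤ k) (x : ℝ) : |clip k x| ≤ |x| := by
  simpa [clip_of_abs_le (k := k) (x := 0) (by simpa using hk)] using abs_clip_sub_le k x 0

lemma tendsto_clip (x : ℝ) : Tendsto (fun k : ℕ => clip k x) atTop (𝓝 x) := by
  obtain ⟨N, hN⟩ := exists_nat_ge |x|
  refine tendsto_const_nhds.congr' (EventuallyEq.symm ?_)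
  filter_upwards [eventually_ge_atTop N] with k hk
  exact clip_of_abs_le (hN.trans (by exact_mod_cast hk))

end Clip

section Moments

variable {n : ℕ} {s B : ℝ}

lemma abs_coord_le (y : Eu n) (i : Fin n) : |y i| ≤ ‖y‖ := PiLp.norm_apply_le y i

lemma norm_le_sqrt (hB : 0 < B) (y : Eu n) : ‖y‖ ≤ √(‖y‖ ^ 2 + B) :=
  Real.le_sqrt_of_sq_le (by linarith)

lemma norm_mul_weight_le {k : ℝ} (hB : 0 < B) (y : Eu n) :
    ‖y‖ * (‖y‖ ^ 2 + B) ^ (-k) ≤ (‖y‖ ^ 2 + B) ^ (-(k - 1 / 2)) := by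
  have hX : 0 < ‖y‖ ^ 2 + B := by positivity
  calc _ ≤ √(‖y‖ ^ 2 + B) * (‖y‖ ^ 2 + B) ^ (-k) := by
        gcongr; exact norm_le_sqrt hB y
    _ = _ := by rw [Real.sqrt_eq_rpow, ← Real.rpow_add hX]; ring_nf

lemma integrable_norm_mul {E : Type*} [NormedAddCommGroup E] {f : Eu n → ℝ} {F : Eu n → E}
    {k K : ℝ} (hB : 0 < B) (hK : 0 ≤ K)
    (hk : (n : ℝ) + 1 < 2 * k) (hF : AEStronglyMeasurable F)
    (hfF : ∀ y, ‖F y‖ ≤ ‖y‖ * |f y|)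
    (hb : ∀ y, |f y| ≤ K * (‖y‖ ^ 2 + B) ^ (-k)) : Integrable F := by
  refine ((integrable_add_normSq_rpow (n := n) (k := k - 1 / 2) hB (by linarith)).const_mul
    K).mono' hF (ae_of_all _ fun y => (hfF y).trans ?_)
  calc _ ≤ ‖y‖ * (K * (‖y‖ ^ 2 + B) ^ (-k)) := mul_le_mul_of_nonneg_left (hb y) (norm_nonneg _)
    _ = K * (‖y‖ * (‖y‖ ^ 2 + B) ^ (-k)) := by ring
    _ ≤ _ := mul_le_mul_of_nonneg_left (norm_mul_weight_le hB y) hK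

lemma integrable_coord_mul {f : Eu n → ℝ} {k K : ℝ} (hB : 0 < B) (hK : 0 ≤ K)
    (hk : (n : ℝ) + 1 < 2 * k) (hf : Continuous f)
    (hb : ∀ y, |f y| ≤ K * (‖y‖ ^ 2 + B) ^ (-k)) (i : Fin n) : Integrable fun y => y i * f y :=
  integrable_norm_mul hB hK hk (by fun_prop) (fun y => by
    rw [norm_mul]
    exact mul_le_mul_of_nonneg_right (abs_coord_le y i) (norm_nonneg _)) hb

lemma continuous_weight (hB : 0 < B) (k : ℝ) :
    Continuous fun y : Eu n => (‖y‖ ^ 2 + B) ^ (-k) :=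
  Continuous.rpow_const (by fun_prop) fun y => Or.inl (by positivity)

lemma shift_weight (hs : 1 < s) (hB : 0 < B) (a : Eu n) : ∃ C, 0 ≤ C ∧ ∀ y : Eu n,
    |(‖y + a‖ ^ 2 + B) ^ (-s) - (‖y‖ ^ 2 + B) ^ (-s)| ≤ C * (‖y‖ ^ 2 + B) ^ (-(s + 1 / 2)) := by
  obtain ⟨C, hC, h⟩ := shift_rpow hs hB a
  refine ⟨C * ‖a‖, by positivity, fun y => ?_⟩
  have hX : 0 < ‖y‖ ^ 2 + B := by positivity
  have hX' : 0 < ‖y + a‖ ^ 2 + B := by positivity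
  have h := mul_le_mul_of_nonneg_left (h B le_rfl y) (Real.rpow_nonneg hX.le (-s))
  rw [← abs_of_pos (Real.rpow_pos_of_pos hX (-s)), ← abs_mul,
    abs_of_pos (Real.rpow_pos_of_pos hX (-s)), Real.div_rpow hX.le hX'.le] at h
  refine (le_of_eq ?_).trans (h.trans (le_of_eq ?_))
  · rw [Real.rpow_neg hX'.le, Real.rpow_neg hX.le]
    have := Real.rpow_pos_of_pos hX s
    have := Real.rpow_pos_of_pos hX' s
    congr 1; field_simp
  · rw [neg_add, Real.rpow_add hX, Real.rpow_neg hX.le (1 / 2), ← Real.sqrt_eq_rpow]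
    ring

lemma shift_moment (hs : 1 < s) (hns : (n : ℝ) < 2 * s) (hB : 0 < B) (a : Eu n) (i : Fin n) :
    Integrable (fun y : Eu n => y i * ((‖y + a‖ ^ 2 + B) ^ (-s) - (‖y‖ ^ 2 + B) ^ (-s))) ∧
    ∫ y : Eu n, y i * ((‖y + a‖ ^ 2 + B) ^ (-s) - (‖y‖ ^ 2 + B) ^ (-s)) =
      -a i * ∫ y : Eu n, (‖y‖ ^ 2 + B) ^ (-s) := by
  obtain ⟨C, hC, hb⟩ := shift_weight hs hB a
  have hUc : Continuous fun y : Eu n => (‖y‖ ^ 2 + B) ^ (-s) := continuous_weight hB s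
  have hUi : Integrable fun y : Eu n => (‖y‖ ^ 2 + B) ^ (-s) := integrable_add_normSq_rpow hB hns
  have hU0 : ∀ y : Eu n, 0 ≤ (‖y‖ ^ 2 + B) ^ (-s) := fun y => by positivity
  have hVc : Continuous fun y : Eu n => (‖y + a‖ ^ 2 + B) ^ (-s) :=
    hUc.comp (continuous_add_const a)
  have hVi : Integrable fun y : Eu n => (‖y + a‖ ^ 2 + B) ^ (-s) := hUi.comp_add_right a
  have hI := integrable_coord_mul hB hC (by linarith) (hVc.sub hUc) hb i
  refine ⟨hI, ?_⟩
  generalize hU : (fun y : Eu n => (‖y‖ ^ 2 + B) ^ (-s)) = U at *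
  have hUy : ∀ y : Eu n, (‖y‖ ^ 2 + B) ^ (-s) = U y := fun y => congrFun hU y
  simp only [hUy] at *
  have hcc : ∀ k : ℝ, Continuous fun y : Eu n => clip k (y i) := fun k =>
    (continuous_clip k).comp (by fun_prop)
  have t1 : Tendsto (fun k : ℕ => ∫ y, clip k (y i) * (U (y + a) - U y)) atTop
      (𝓝 (∫ y, y i * (U (y + a) - U y))) := by
    refine tendsto_integral_of_dominated_convergence _
      (fun k => ((hcc k).mul (hVc.sub hUc)).aestronglyMeasurable) hI.norm
      (fun k => ae_of_all _ fun y => ?_)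
      (ae_of_all _ fun y => (tendsto_clip (y i)).mul_const _)
    rw [norm_mul, norm_mul]
    exact mul_le_mul_of_nonneg_right (abs_clip_le_abs k.cast_nonneg _) (norm_nonneg _)
  have t2 : Tendsto (fun k : ℕ => ∫ y, (clip k (y i - a i) - clip k (y i)) * U y) atTop
      (𝓝 (∫ y, -a i * U y)) := by
    refine tendsto_integral_of_dominated_convergence (fun y => |a i| * U y)
      (fun k => ((((continuous_clip k).comp (by fun_prop)).sub (hcc k)).mul
        hUc).aestronglyMeasurable) (hUi.const_mul _)
      (fun k => ae_of_all _ fun y => ?_) (ae_of_all _ fun y => ?_)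
    · rw [norm_mul, Real.norm_of_nonneg (hU0 y)]
      refine mul_le_mul_of_nonneg_right ((abs_clip_sub_le _ _ _).trans ?_) (hU0 y)
      rw [sub_sub_cancel_left, abs_neg]
    · have := ((tendsto_clip (y i - a i)).sub (tendsto_clip (y i))).mul_const (U y)
      rwa [sub_sub_cancel_left] at this
  have hbd : ∀ {V : Eu n → ℝ} (k : ℕ), Integrable V → Integrable fun y => clip k (y i) * V y :=
    fun k hV => hV.bdd_mul (c := k) (hcc k).aestronglyMeasurable
      (ae_of_all _ fun y => abs_clip_le k.cast_nonneg _)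
  have e : ∀ k : ℕ, ∫ y, clip k (y i) * (U (y + a) - U y) =
      ∫ y, (clip k (y i - a i) - clip k (y i)) * U y := fun k => by
    have e1 : ∫ y, clip k (y i) * U (y + a) = ∫ y, clip k (y i - a i) * U y := by
      rw [← integral_add_right_eq_self (fun y => clip k (y i - a i) * U y) a]
      simp
    simp only [mul_sub, sub_mul]
    rw [integral_sub (hbd k hVi) (hbd k hUi), e1, integral_sub _ (hbd k hUi)]
    refine hUi.bdd_mul (c := k) ?_ (ae_of_all _ fun y => abs_clip_le k.cast_nonneg _)
    exact ((continuous_clip k).comp (by fun_prop)).aestronglyMeasurable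
  simp only [e] at t1
  rw [tendsto_nhds_unique t1 t2, integral_const_mul]

/-- Translation of an initial density so that its difference from the Barenblatt profile has
vanishing mass and centre of mass. -/
lemma exists_centering {p K : ℝ} {g : Eu n → ℝ} (hn : 1 ≤ n) (hp : 0 < p) (hs : 1 < (p + n) / 2)
    (hB : 0 < B) (hK : 0 ≤ K) (hp1 : n = 1 → 1 < p) (hg : Continuous g)
    (hb : ∀ y, |g y - (‖y‖ ^ 2 + B) ^ (-((p + n) / 2))| ≤
      K * (‖y‖ ^ 2 + B) ^ (-((n + 1 + p / 2) / 2)))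
    (hmass : ∫ y, g y = 1) (hBmass : ∫ y : Eu n, (‖y‖ ^ 2 + B) ^ (-((p + n) / 2)) = 1)
    (hctr : n = 1 → ∫ y, g y • y = 0) (hp2 : p < 2) :
    ∃ (a : Eu n) (K' : ℝ), 0 ≤ K' ∧ (n = 1 → a = 0) ∧
      (∀ y, |g (y + a) - (‖y‖ ^ 2 + B) ^ (-((p + n) / 2))| ≤
        K' * (‖y‖ ^ 2 + B) ^ (-((n + 1 + p / 2) / 2))) ∧
      ∫ y, (g (y + a) - (‖y‖ ^ 2 + B) ^ (-((p + n) / 2))) = 0 ∧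
      ∀ i, ∫ y : Eu n, y i * (g (y + a) - (‖y‖ ^ 2 + B) ^ (-((p + n) / 2))) = 0 := by
  set s := (p + n) / 2 with hsd
  set k := ((n : ℝ) + 1 + p / 2) / 2 with hkd
  have hns : (n : ℝ) < 2 * s := by rw [hsd]; linarith
  have hUi : Integrable fun y : Eu n => (‖y‖ ^ 2 + B) ^ (-s) := integrable_add_normSq_rpow hB hns
  have hUc : Continuous fun y : Eu n => (‖y‖ ^ 2 + B) ^ (-s) := continuous_weight hB s
  have hgi : Integrable g := by
    by_contra hni
    rw [integral_undef hni] at hmass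
    exact zero_ne_one hmass
  have hf := fun i => integrable_coord_mul hB hK (by rw [hkd]; linarith) (hg.sub hUc) hb i
  have hf0 : ∫ y, (g y - (‖y‖ ^ 2 + B) ^ (-s)) = 0 := by
    rw [integral_sub hgi hUi, hmass, hBmass, sub_self]
  set a : Eu n := WithLp.toLp 2 fun i => ∫ y : Eu n, y i * (g y - (‖y‖ ^ 2 + B) ^ (-s)) with ha
  have hai : ∀ i, a i = ∫ y : Eu n, y i * (g y - (‖y‖ ^ 2 + B) ^ (-s)) := fun i => rfl
  clear_value a
  obtain ⟨C, hC, hsh⟩ := shift_weight hs hB a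
  have hsplit : ∀ y, g (y + a) - (‖y‖ ^ 2 + B) ^ (-s) = (g (y + a) - (‖y + a‖ ^ 2 + B) ^ (-s)) +
      ((‖y + a‖ ^ 2 + B) ^ (-s) - (‖y‖ ^ 2 + B) ^ (-s)) := fun y => by ring
  have hkp : 0 < k := by rw [hkd]; positivity
  set c := 2 + 2 * ‖a‖ ^ 2 / B with hc
  have hc0 : 0 < c := by rw [hc]; positivity
  refine ⟨a, K * c ^ k + C * B ^ (-(s + 1 / 2 - k)), by positivity, fun h1 => ?_, fun y => ?_, ?_,
    fun i => ?_⟩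
  · have hn1 : (n : ℝ) = 1 := by rw [h1, Nat.cast_one]
    have hs2 : (n : ℝ) + 1 < 2 * s := by rw [hsd]; linarith [hp1 h1]
    have hUm : ∀ i, Integrable fun y : Eu n => y i * (‖y‖ ^ 2 + B) ^ (-s) := fun i =>
      integrable_coord_mul hB zero_le_one hs2 hUc (fun y => by
        rw [one_mul, abs_of_nonneg (by positivity)]) i
    have hgm : Integrable fun y : Eu n => g y • y := by
      have h2 : Integrable fun y : Eu n => (g y - (‖y‖ ^ 2 + B) ^ (-s)) • y :=
        integrable_norm_mul hB hK (k := k) (by rw [hkd]; linarith)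
          ((hg.sub hUc).smul continuous_id).aestronglyMeasurable
          (fun y => by rw [norm_smul, mul_comm]; rfl) hb
      have h3 : Integrable fun y : Eu n => ((‖y‖ ^ 2 + B) ^ (-s)) • y :=
        integrable_norm_mul (f := fun y => (‖y‖ ^ 2 + B) ^ (-s)) (k := s) hB zero_le_one hs2
          (hUc.smul continuous_id).aestronglyMeasurable
          (fun y => by rw [norm_smul, mul_comm]; rfl)
          (fun y => by rw [one_mul, abs_of_nonneg (by positivity)])
      refine (h2.add h3).congr (ae_of_all _ fun y => ?_)
      simp only [Pi.add_apply, ← add_smul, sub_add_cancel]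
    ext i
    have h4 := (EuclideanSpace.proj (𝕜 := ℝ) i).integral_comp_comm hgm
    rw [hctr h1, map_zero] at h4
    have h4' : ∫ y : Eu n, y i * g y = 0 := by
      rw [← h4]
      refine integral_congr_ae (ae_of_all _ fun y => ?_)
      simp [mul_comm]
    have h5 : ∫ y : Eu n, y i * (‖y‖ ^ 2 + B) ^ (-s) = 0 := by
      have := integral_neg_eq_self (fun y : Eu n => y i * (‖y‖ ^ 2 + B) ^ (-s)) volume
      simp only [PiLp.neg_apply, norm_neg, neg_mul] at this
      rw [integral_neg] at this
      linarith
    have h6 : Integrable fun y : Eu n => y i * g y :=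
      ((hf i).add (hUm i)).congr (ae_of_all _ fun y => by simp only [Pi.add_apply, Pi.sub_apply]; ring)
    rw [hai]
    simp only [mul_sub]
    rw [integral_sub h6 (hUm i), h4', h5]
    simp
  · have hX : 0 < ‖y‖ ^ 2 + B := by positivity
    have hX' : 0 < ‖y + a‖ ^ 2 + B := by positivity
    rw [hsplit, add_mul]
    refine (abs_add_le _ _).trans (add_le_add ((hb _).trans ?_) ((hsh y).trans ?_))
    · rw [mul_assoc]
      refine mul_le_mul_of_nonneg_left ?_ hK
      have h2 : ‖y‖ ^ 2 + B ≤ c * (‖y + a‖ ^ 2 + B) := by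
        have := normSq_shift_le hB le_rfl (y + a) (-a)
        rwa [add_neg_cancel_right, norm_neg] at this
      rw [Real.rpow_neg hX'.le, Real.rpow_neg hX.le, ← div_eq_mul_inv, ← one_div,
        div_le_div_iff₀ (by positivity) (by positivity), one_mul, ← Real.mul_rpow hc0.le hX'.le]
      exact Real.rpow_le_rpow hX.le h2 hkp.le
    · rw [mul_assoc]
      refine mul_le_mul_of_nonneg_left ?_ hC
      rw [show -(s + 1 / 2) = -(s + 1 / 2 - k) + -k by ring, Real.rpow_add hX]
      refine mul_le_mul_of_nonneg_right ?_ (by positivity)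
      refine Real.rpow_le_rpow_of_nonpos hB (by linarith [sq_nonneg ‖y‖]) ?_
      rw [hsd, hkd]; linarith
  · rw [integral_sub (hgi.comp_add_right a) hUi, integral_add_right_eq_self (μ := volume) g a, hmass, hBmass,
      sub_self]
  · obtain ⟨m1, m2⟩ := shift_moment hs hns hB a i
    have m3 : Integrable fun y : Eu n => y i * (g (y + a) - (‖y + a‖ ^ 2 + B) ^ (-s)) := by
      have h2 : Integrable fun y : Eu n => (y i - a i) * (g y - (‖y‖ ^ 2 + B) ^ (-s)) := by
        simp only [sub_mul]
        exact (hf i).sub ((hgi.sub hUi).const_mul _)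
      refine (h2.comp_add_right a).congr (ae_of_all _ fun y => ?_)
      simp
    have m4 : ∫ y : Eu n, y i * (g (y + a) - (‖y + a‖ ^ 2 + B) ^ (-s)) = a i := by
      have h2 := integral_add_right_eq_self (μ := volume)
        (fun y : Eu n => (y i - a i) * (g y - (‖y‖ ^ 2 + B) ^ (-s))) a
      simp only [PiLp.add_apply, add_sub_cancel_right] at h2
      rw [h2]
      simp only [sub_mul]
      have h3 : Integrable fun y : Eu n => a i * (g y - (‖y‖ ^ 2 + B) ^ (-s)) :=
        (hgi.sub hUi).const_mul _
      have h4 : Integrable fun y : Eu n => y i * (g y - (‖y‖ ^ 2 + B) ^ (-s)) := hf i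
      rw [integral_sub h4 h3, integral_const_mul, hf0, ← hai, mul_zero,
        sub_zero]
    simp only [hsplit, mul_add]
    rw [integral_add m3 m1, m4, m2, hBmass]
    ring

end Moments

section Main

variable {n : ℕ} {m B : ℝ}

/-- The weight of the theorem in terms of `|y|² + B S(τ)`. -/
lemma rhoB_ratio_rpow {τ : ℝ} (hp : 0 < pPar n m) (hB : 0 < B) (hτ : 0 ≤ τ) (y : Eu n) :
    (rhoB n m B τ y / rhoB n m B τ 0) ^ ((pPar n m / 2 - 1) / (pPar n m + n)) =
      B ^ (-((1 - pPar n m / 2) / 2)) *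
        (XX n (pPar n m) B τ y / Sc n (pPar n m) τ) ^ ((1 - pPar n m / 2) / 2) := by
  have hθ := th_pos hp hτ
  have hX := XX_pos (n := n) hp hB hτ y
  have hS := Sc_pos (n := n) hp hτ
  have hX0 : XX n (pPar n m) B τ 0 = B * Sc n (pPar n m) τ := by simp [XX]
  rw [rhoB_eq hp hB hτ, rhoB_eq hp hB hτ, Pr_eq_XX hp hτ, Pr_eq_XX hp hτ, hX0,
    ← Real.div_rpow (by positivity) (by positivity), ← Real.rpow_mul (by positivity),
    Real.rpow_neg hB.le, ← Real.inv_rpow hB.le, ← Real.mul_rpow (by positivity) (by positivity)]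
  congr 1
  · field_simp
  · have : pPar n m + n ≠ 0 := by positivity
    field_simp
    ring

/-- The hypothesis on the initial datum as a decay estimate. -/
lemma initial_decay {K : ℝ} {g : Eu n → ℝ} (hp : 0 < pPar n m) (hB : 0 < B)
    (h : ∀ y, rhoB n m B 0 y ^ ((pPar n m / 2 - 1) / (pPar n m + (n : ℝ))) *
      |1 - g y / rhoB n m B 0 y| ≤ K) (y : Eu n) :
    |g y - (‖y‖ ^ 2 + B) ^ (-((pPar n m + n) / 2))| ≤
      K * (‖y‖ ^ 2 + B) ^ (-((n + 1 + pPar n m / 2) / 2)) := by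
  have hX : 0 < ‖y‖ ^ 2 + B := by positivity
  have h := h y
  rw [rhoB_eq hp hB le_rfl, Centered.Pr_zero] at h
  have hpn : pPar n m + n ≠ 0 := by positivity
  set U := (‖y‖ ^ 2 + B) ^ (-((pPar n m + n) / 2)) with hU
  have hU0 : 0 < U := Real.rpow_pos_of_pos hX _
  have e1 : (‖y‖ ^ 2 + B) ^ (-((n + 1 + pPar n m / 2) / 2)) * U ^ ((pPar n m / 2 - 1) /
      (pPar n m + (n : ℝ))) = U := by
    rw [hU, ← Real.rpow_mul hX.le, ← Real.rpow_add hX]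
    congr 1
    field_simp
    ring
  have e2 : |1 - g y / U| = |g y - U| / U := by
    rw [one_sub_div hU0.ne', abs_div, abs_of_pos hU0, abs_sub_comm]
  rw [e2] at h
  have h2 := mul_le_mul_of_nonneg_left h
    (Real.rpow_nonneg hX.le (-((n + 1 + pPar n m / 2) / 2)))
  rw [← mul_assoc, e1, mul_div_cancel₀ _ hU0.ne'] at h2
  linarith

/-- Transfer of the weighted relative error estimate under a translation. -/
lemma relative_error_translate {p C : ℝ} {ρ : ℝ → Eu n → ℝ} {a : Eu n} (hp : 0 < p) (hp2 : p < 2)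
    (hs : 1 < (p + n) / 2) (hB : 0 < B) (hC : 0 ≤ C) (hn : 2 ≤ n ∨ a = 0)
    (h : ∀ τ, 1 ≤ τ → ∀ y, th p τ ^ ((p / 2 + 1) ^ 2 / (2 * p)) *
      (XX n p B τ y / Sc n p τ) ^ ((1 - p / 2) / 2) *
      |ρ τ (y + a) * Pr n p B 1 τ y ^ ((p + n) / 2) - 1| ≤ C) :
    ∃ C', 0 ≤ C' ∧ ∀ τ, 1 ≤ τ → ∀ y, th p τ ^ ((p / 2 + 1) ^ 2 / (2 * p)) *
      (XX n p B τ y / Sc n p τ) ^ ((1 - p / 2) / 2) *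
      |ρ τ y * Pr n p B 1 τ y ^ ((p + n) / 2) - 1| ≤ C' := by
  obtain ⟨C₁, hC₁, hsh⟩ := shift_rpow hs hB (-a)
  set s := (p + n) / 2 with hsd
  set γ := (p / 2 + 1) ^ 2 / (2 * p) with hγ
  set q := (1 - p / 2) / 2 with hq
  have hq0 : 0 < q := by rw [hq]; linarith
  set c := 2 + 2 * ‖-a‖ ^ 2 / B with hc
  have hc0 : 0 < c := by rw [hc]; positivity
  refine ⟨c ^ q * c ^ s * C + C₁ * ‖-a‖ * B ^ (-(p / 4)), by positivity, fun τ hτ1 y => ?_⟩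
  have hτ : 0 ≤ τ := by linarith
  have hθ := th_pos hp hτ
  have hS := Sc_pos (n := n) hp hτ
  have hS1 := one_le_Sc (n := n) hp hτ
  have hX := XX_pos (n := n) hp hB hτ y
  have hX' := XX_pos (n := n) hp hB hτ (y + -a)
  have hb : B ≤ B * Sc n p τ := le_mul_of_one_le_right hB.le hS1
  have h1 := h τ hτ1 (y + -a)
  rw [neg_add_cancel_right] at h1
  have h2 : |(XX n p B τ y / XX n p B τ (y + -a)) ^ s - 1| ≤ C₁ * ‖-a‖ / √(XX n p B τ y) :=
    hsh _ hb y
  have h3 : XX n p B τ y ≤ c * XX n p B τ (y + -a) := by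
    have := normSq_shift_le hB hb (y + -a) (- -a)
    rwa [add_neg_cancel_right, norm_neg] at this
  have hY : B ≤ XX n p B τ y / Sc n p τ := by
    rw [le_div_iff₀ hS]; unfold XX; linarith [sq_nonneg ‖y‖]
  rw [Pr_eq_XX hp hτ] at h1 ⊢
  set X := XX n p B τ y
  set X' := XX n p B τ (y + -a)
  set r := (X / X') ^ s with hr
  have hr0 : 0 < r := by positivity
  have hrc : r ≤ c ^ s := Real.rpow_le_rpow (by positivity) (by rwa [div_le_iff₀ hX'])
    (by linarith)
  have e1 : (X / th p τ) ^ s = r * (X' / th p τ) ^ s := by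
    rw [hr, ← Real.mul_rpow (by positivity) (by positivity)]
    congr 1; field_simp
  have e2 : ρ τ y * (X / th p τ) ^ s - 1 = r * (ρ τ y * (X' / th p τ) ^ s - 1) + (r - 1) := by
    rw [e1]; ring
  set v := ρ τ y * (X' / th p τ) ^ s - 1
  have h4 : (X / Sc n p τ) ^ q ≤ c ^ q * (X' / Sc n p τ) ^ q := by
    rw [← Real.mul_rpow hc0.le (by positivity)]
    refine Real.rpow_le_rpow (by positivity) ?_ hq0.le
    rw [← mul_div_assoc]
    gcongr
  have hw : 0 ≤ th p τ ^ γ * (X / Sc n p τ) ^ q := by positivity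
  have i1 : th p τ ^ γ * (X / Sc n p τ) ^ q * (r * |v|) ≤ c ^ q * c ^ s * C := by
    calc _ ≤ th p τ ^ γ * (c ^ q * (X' / Sc n p τ) ^ q) * (c ^ s * |v|) := by gcongr
      _ = c ^ q * c ^ s * (th p τ ^ γ * (X' / Sc n p τ) ^ q * |v|) := by ring
      _ ≤ _ := mul_le_mul_of_nonneg_left h1 (by positivity)
  have i2 : th p τ ^ γ * (X / Sc n p τ) ^ q * |r - 1| ≤ C₁ * ‖-a‖ * B ^ (-(p / 4)) := by
    refine (mul_le_mul_of_nonneg_left h2 hw).trans ?_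
    rcases hn with hn | ha
    · have hn' : (2 : ℝ) ≤ n := by exact_mod_cast hn
      have hγβ : γ ≤ (p + n) / p * (1 / 2) := by
        rw [hγ, div_le_iff₀ (by positivity)]
        have : (p + n) / p * (1 / 2) * (2 * p) = p + n := by field_simp
        rw [this]
        nlinarith
      have k1 : √X = (X / Sc n p τ) ^ (1 / 2 : ℝ) * th p τ ^ ((p + n) / p * (1 / 2)) := by
        rw [Real.rpow_mul hθ.le]
        change √X = _ * Sc n p τ ^ _
        rw [← Real.mul_rpow (by positivity) hS.le, div_mul_cancel₀ _ hS.ne', Real.sqrt_eq_rpow]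
      have k2 : (X / Sc n p τ) ^ q = (X / Sc n p τ) ^ (-(p / 4)) * (X / Sc n p τ) ^ (1 / 2 : ℝ) := by
        rw [← Real.rpow_add (by positivity)]
        congr 1; rw [hq]; ring
      have k3 : (X / Sc n p τ) ^ (-(p / 4)) ≤ B ^ (-(p / 4)) :=
        Real.rpow_le_rpow_of_nonpos hB hY (by linarith)
      have k4 : th p τ ^ γ ≤ th p τ ^ ((p + n) / p * (1 / 2)) :=
        Real.rpow_le_rpow_of_exponent_le (one_le_th hp hτ) hγβ
      have hpos1 : 0 < (X / Sc n p τ) ^ (1 / 2 : ℝ) := by positivity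
      have hpos2 : 0 < th p τ ^ ((p + n) / p * (1 / 2)) := by positivity
      rw [← mul_div_assoc, div_le_iff₀ (by positivity), k1, k2]
      calc _ = th p τ ^ γ * (X / Sc n p τ) ^ (-(p / 4)) *
            ((X / Sc n p τ) ^ (1 / 2 : ℝ) * (C₁ * ‖-a‖)) := by ring
        _ ≤ th p τ ^ ((p + n) / p * (1 / 2)) * B ^ (-(p / 4)) *
            ((X / Sc n p τ) ^ (1 / 2 : ℝ) * (C₁ * ‖-a‖)) := by
          refine mul_le_mul_of_nonneg_right ?_ (by positivity)
          exact mul_le_mul k4 k3 (by positivity) hpos2.le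
        _ = _ := by ring
    · simp [ha]
  calc _ ≤ th p τ ^ γ * (X / Sc n p τ) ^ q * (r * |v| + |r - 1|) := by
        rw [e2]
        refine mul_le_mul_of_nonneg_left ((abs_add_le _ _).trans ?_) hw
        rw [abs_mul, abs_of_pos hr0]
    _ ≤ _ := by rw [mul_add]; exact add_le_add i1 i2

/-- The sharp weighted decay of the relative error. -/
theorem relative_error_bound
    (hcase : (2 ≤ n ∧ ((n : ℝ) - 2) / n < m ∧ m < (n : ℝ) / (n + 2)) ∨
             (n = 1 ∧ 0 < m ∧ m < 1 / 3)) (hB : 0 < B)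
    {ρ : ℝ → Eu n → ℝ} (hρ : IsFDESol n m ρ) (hmass : ∫ y, ρ 0 y = 1)
    (hctr : n = 1 → ∫ y, ρ 0 y • y = 0) (hBmass : ∫ y, uB n m B y = 1)
    {K : ℝ} (hinit : ∀ y, rhoB n m B 0 y ^ ((pPar n m / 2 - 1) / (pPar n m + (n : ℝ))) *
        |1 - ρ 0 y / rhoB n m B 0 y| ≤ K) :
    ∃ C, ∀ τ, 1 ≤ τ → ∀ y, τ ^ ((pPar n m / 2 + 1) ^ 2 / (2 * pPar n m)) *
        (rhoB n m B τ y / rhoB n m B τ 0) ^ ((pPar n m / 2 - 1) / (pPar n m + (n : ℝ))) *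
        |ρ τ y / rhoB n m B τ y - 1| ≤ C := by
  obtain ⟨hn, hm0, hm1, hp, hp2, hp1⟩ := pPar_facts hcase
  have hs1m := one_div_one_sub (n := n) m
  have hs : 1 < (pPar n m + n) / 2 := by
    rw [← hs1m, one_lt_div (by linarith)]; linarith
  have hdec := initial_decay (n := n) (m := m) hp hB hinit
  have hK : 0 ≤ K := (mul_nonneg (Real.rpow_nonneg (by
    rw [rhoB_eq hp hB le_rfl, Centered.Pr_zero]; positivity) _) (abs_nonneg _)).trans (hinit 0)
  have hBmass' : ∫ y : Eu n, (‖y‖ ^ 2 + B) ^ (-((pPar n m + n) / 2)) = 1 := by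
    rw [← hBmass]
    simp only [uB, hs1m, add_comm]
  have hcont : Continuous (ρ 0) := hρ.2.1.slice' Set.self_mem_Ici
  have hb0 : ∀ τ : ℝ, 0 ≤ τ → ∀ y, 0 < ρ τ y := hρ.1
  obtain ⟨a, K', hK', ha, i1, i2, i3⟩ := exists_centering hn hp hs hB hK hp1 hcont hdec hmass
    hBmass' hctr hp2
  have hpr := hρ.isPress hm0 hm1 a
  rw [hs1m] at hpr
  have hpow : ∀ τ, 0 ≤ τ → ∀ y, (ρ τ (y + a) ^ (m - 1)) ^ (-((pPar n m + n) / 2)) = ρ τ (y + a) :=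
    fun τ hτ y => by
      rw [← Real.rpow_mul (hb0 τ hτ _).le, ← hs1m]
      have : (1 - m) ≠ 0 := by linarith
      rw [show (m - 1) * -(1 / (1 - m)) = 1 by field_simp; ring, Real.rpow_one]
  have hcen : Centered n (pPar n m) B K' (fun τ y => ρ τ (y + a) ^ (m - 1)) := by
    refine ⟨hn, hp, hp2, hs, hB, hK', hpr, fun y => ?_, ?_, fun i => ?_⟩
    · rw [hpow 0 le_rfl]; exact i1 y
    · simp only [hpow 0 le_rfl]; exact i2
    · simp only [hpow 0 le_rfl]; exact i3 i
  obtain ⟨C, hC, hrel⟩ := hcen.relative_error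
  obtain ⟨C', hC', h⟩ := relative_error_translate (ρ := ρ) (a := a) hp hp2 hs hB hC
    (by rcases show n = 1 ∨ 2 ≤ n by omega with h | h
        · exact Or.inr (ha h)
        · exact Or.inl h) (fun τ hτ1 y => by
      have hτ : 0 ≤ τ := by linarith
      have hP := hcen.pr_pos hτ y
      refine (le_of_eq ?_).trans (hrel τ hτ1 y)
      congr 1
      rw [fD, hpow τ hτ, Real.rpow_neg hP.le]
      have hPs := Real.rpow_pos_of_pos hP ((pPar n m + n) / 2)
      nth_rw 2 [← abs_of_pos hPs]
      rw [← abs_mul]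
      congr 1
      field_simp)
  have hθpow : ∀ τ : ℝ, 1 ≤ τ → τ ^ ((pPar n m / 2 + 1) ^ 2 / (2 * pPar n m)) ≤
      (2 * pPar n m) ^ (-((pPar n m / 2 + 1) ^ 2 / (2 * pPar n m))) *
        th (pPar n m) τ ^ ((pPar n m / 2 + 1) ^ 2 / (2 * pPar n m)) := fun τ hτ1 => by
    have hθ := th_pos hp (by linarith : 0 ≤ τ)
    rw [Real.rpow_neg (by positivity), ← Real.inv_rpow (by positivity),
      ← Real.mul_rpow (by positivity) hθ.le]
    refine Real.rpow_le_rpow (by linarith) ?_ (by positivity)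
    rw [le_inv_mul_iff₀ (by positivity)]
    unfold th; linarith
  refine ⟨(2 * pPar n m) ^ (-((pPar n m / 2 + 1) ^ 2 / (2 * pPar n m))) *
    B ^ (-((1 - pPar n m / 2) / 2)) * C', fun τ hτ1 y => ?_⟩
  have hτ : 0 ≤ τ := by linarith
  have hX := XX_pos (n := n) hp hB hτ y
  have hS := Sc_pos (n := n) hp hτ
  have hP := hcen.pr_pos hτ y
  have e1 : ρ τ y / rhoB n m B τ y = ρ τ y * Pr n (pPar n m) B 1 τ y ^ ((pPar n m + n) / 2) := by
    rw [rhoB_eq hp hB hτ, Real.rpow_neg hP.le, div_inv_eq_mul]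
  rw [rhoB_ratio_rpow hp hB hτ, e1]
  have h := h τ hτ1 y
  have hpos := XX_pos (n := n) hp hB hτ y
  set γ := (pPar n m / 2 + 1) ^ 2 / (2 * pPar n m)
  set q := (1 - pPar n m / 2) / 2
  set v := |ρ τ y * Pr n (pPar n m) B 1 τ y ^ ((pPar n m + n) / 2) - 1| with hv
  set θ := th (pPar n m) τ
  set Y := XX n (pPar n m) B τ y / Sc n (pPar n m) τ with hYd
  have hY : 0 < Y := div_pos hX hS
  have hv0 : 0 ≤ v := abs_nonneg _
  have hYq := (Real.rpow_pos_of_pos hY q).le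
  calc τ ^ γ * (B ^ (-q) * Y ^ q) * v
      ≤ (2 * pPar n m) ^ (-γ) * θ ^ γ * (B ^ (-q) * Y ^ q) * v := by
        refine mul_le_mul_of_nonneg_right (mul_le_mul_of_nonneg_right (hθpow τ hτ1) ?_) hv0
        positivity
    _ = (2 * pPar n m) ^ (-γ) * B ^ (-q) * (θ ^ γ * Y ^ q * v) := by ring
    _ ≤ _ := mul_le_mul_of_nonneg_left h (by positivity)

end Main

/-- **Fine asymptotics for `m < m₂ = n/(n+2)` with restricted initial data**
(Theorem fine:p<2).  Here `δ = (p/2-1)/(p+n) < 0` and `γ = (p/2+1)²/(2p)`. -/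
theorem statement4
    (n : ℕ) (m : ℝ)
    (hcase : (2 ≤ n ∧ ((n : ℝ) - 2) / n < m ∧ m < (n : ℝ) / (n + 2)) ∨
             (n = 1 ∧ 0 < m ∧ m < 1 / 3))
    (B : ℝ) (hB : 0 < B)
    (ρ : ℝ → EuclideanSpace ℝ (Fin n) → ℝ) (hρ : IsFDESol n m ρ)
    (hmass : ∫ y : EuclideanSpace ℝ (Fin n), ρ 0 y = 1)
    (hctr : n = 1 → ∫ y : EuclideanSpace ℝ (Fin n), ρ 0 y • y = 0)
    (hBmass : ∫ y : EuclideanSpace ℝ (Fin n), uB n m B y = 1)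
    (hinit : ∃ K : ℝ, ∀ y,
      rhoB n m B 0 y ^ ((pPar n m / 2 - 1) / (pPar n m + (n : ℝ))) *
        |1 - ρ 0 y / rhoB n m B 0 y| ≤ K) :
    (∀ ε > (0 : ℝ), ∃ C : ℝ, ∀ᶠ τ in atTop, ∀ y,
      τ ^ ((pPar n m / 2 + 1) ^ 2 / (2 * pPar n m) - ε) *
        (rhoB n m B τ y / rhoB n m B τ 0) ^
          ((pPar n m / 2 - 1) / (pPar n m + (n : ℝ))) *
        |ρ τ y / rhoB n m B τ y - 1| ≤ C) ∧
    (Integrable (fun y : EuclideanSpace ℝ (Fin n) =>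
        (rhoB n m B 0 y ^ ((pPar n m / 2 - 1) / (pPar n m + (n : ℝ))) *
            |1 - ρ 0 y / rhoB n m B 0 y|) ^ 2 * (1 + ‖y‖ ^ 2) ^ (-(n : ℝ) / 2)) →
      ∃ C : ℝ, ∀ᶠ τ in atTop, ∀ y,
        τ ^ ((pPar n m / 2 + 1) ^ 2 / (2 * pPar n m)) *
          (rhoB n m B τ y / rhoB n m B τ 0) ^
            ((pPar n m / 2 - 1) / (pPar n m + (n : ℝ))) *
          |ρ τ y / rhoB n m B τ y - 1| ≤ C) := by
  obtain ⟨K, hK⟩ := hinit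
  obtain ⟨C, hC⟩ := relative_error_bound hcase hB hρ hmass hctr hBmass hK
  refine ⟨fun ε hε => ⟨C, ?_⟩, fun _ => ⟨C, (eventually_ge_atTop 1).mono fun τ hτ y => hC τ hτ y⟩⟩
  refine (eventually_ge_atTop 1).mono fun τ hτ y => le_trans ?_ (hC τ hτ y)
  obtain ⟨-, -, -, hp, -, -⟩ := pPar_facts hcase
  have hτ0 : 0 ≤ τ := zero_le_one.trans hτ
  have hX := XX_pos (n := n) hp hB hτ0 y
  have hS := Sc_pos (n := n) hp hτ0
  rw [rhoB_ratio_rpow hp hB hτ0]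
  gcongr
  linarith
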